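/- If G ∈ Apex(k) and tw(G) > w(r,k) := 24r − 11 + k, then G contains the hexagonal grid H_r as a minor. -/

import Mathlib

open SimpleGraph

/-- `A` is a subdivision of `H`: branch vertices given by an injective map `f`, and each
edge of `H` is replaced by a path in `A`; the paths are internally disjoint, internal
vertices avoid branch vertices, and every vertex and edge of `A` is used. -/
def IsSubdivisionOf {U W : Type*} (A : SimpleGraph U) (H : SimpleGraph W) : Prop :=
  ∃ (f : W → U) (p : ∀ ⦃a b⦄, H.Adj a b → A.Walk (f a) (f b)),
    Function.Injective f ∧
    (∀ ⦃a b⦄ (h : H.Adj a b), (p h).IsPath) ∧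
    (∀ ⦃a b⦄ (h : H.Adj a b) (w : W), f w ∈ (p h).support → w = a ∨ w = b) ∧
    (∀ ⦃a b⦄ (h : H.Adj a b) ⦃c d⦄ (h' : H.Adj c d), s(a, b) ≠ s(c, d) →
      ∀ u, u ∈ (p h).support → u ∈ (p h').support →
        (u = f a ∨ u = f b) ∧ (u = f c ∨ u = f d)) ∧
    (∀ u : U, u ∈ Set.range f ∨ ∃ (a b : W) (h : H.Adj a b), u ∈ (p h).support) ∧
    (∀ e ∈ A.edgeSet, ∃ (a b : W) (h : H.Adj a b), e ∈ (p h).edges)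

/-- `G` contains a subdivision of `H` as a subgraph (i.e. `H` is a topological minor). -/
def ContainsSubdivisionOf {V W : Type*} (G : SimpleGraph V) (H : SimpleGraph W) : Prop :=
  ∃ A : G.Subgraph, IsSubdivisionOf A.coe H

/-- Planarity, via Kuratowski's characterization. -/
def IsPlanar {V : Type*} (G : SimpleGraph V) : Prop :=
  ¬ ContainsSubdivisionOf G (completeGraph (Fin 5)) ∧
  ¬ ContainsSubdivisionOf G (completeBipartiteGraph (Fin 3) (Fin 3))

/-- `G ∈ Apex(k)`: some set of at most `k` vertices can be deleted to leave a planar graph. -/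
def Apex {V : Type*} (k : ℕ) (G : SimpleGraph V) : Prop :=
  ∃ X : Finset V, X.card ≤ k ∧ IsPlanar (G.induce ((X : Set V)ᶜ))

/-- `H` is a minor of `G`, via branch sets. -/
def HasMinor {V W : Type*} (G : SimpleGraph V) (H : SimpleGraph W) : Prop :=
  ∃ f : W → Set V,
    (∀ w, (f w).Nonempty) ∧
    (∀ w, (G.induce (f w)).Connected) ∧
    (∀ w w', w ≠ w' → Disjoint (f w) (f w')) ∧
    (∀ ⦃w w'⦄, H.Adj w w' → ∃ a ∈ f w, ∃ b ∈ f w', G.Adj a b)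

/-- `G` has a tree decomposition of width at most `w`. -/
def HasTreeDecompositionOfWidth {V : Type*} (G : SimpleGraph V) (w : ℕ) : Prop :=
  ∃ (ι : Type) (T : SimpleGraph ι) (B : ι → Finset V),
    T.IsAcyclic ∧ T.Connected ∧
    (∀ v : V, ∃ t, v ∈ B t) ∧
    (∀ ⦃u v⦄, G.Adj u v → ∃ t, u ∈ B t ∧ v ∈ B t) ∧
    (∀ v : V, (T.induce {t | v ∈ B t}).Connected) ∧
    (∀ t, (B t).card ≤ w + 1)

/-- The treewidth of `G`. -/
noncomputable def treewidth {V : Type*} (G : SimpleGraph V) : ℕ :=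
  sInf {w | HasTreeDecompositionOfWidth G w}

/-- The vertex set of the hexagonal grid of radius `r` (brick-wall model in `ℤ × ℤ`). -/
def hexVertexSet (r : ℕ) : Set (ℤ × ℤ) :=
  {p | ∃ b : ℤ, |b| ≤ (r : ℤ) - 1 ∧ (p.2 = b ∨ p.2 = b + 1) ∧ |p.1| ≤ 2 * (r : ℤ) - 1 - |b|}

/-- The hexagonal grid `H_r` of radius `r` (brick-wall model). -/
def hexGrid (r : ℕ) : SimpleGraph (hexVertexSet r) :=
  SimpleGraph.fromRel fun p q =>
    (p.val.2 = q.val.2 ∧ p.val.1 + 1 = q.val.1) ∨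
    (p.val.1 = q.val.1 ∧ p.val.2 + 1 = q.val.2 ∧ Odd (p.val.1 + p.val.2))

/-- The `g × g` grid graph. -/
def gridGraph (g : ℕ) : SimpleGraph (Fin g × Fin g) :=
  SimpleGraph.fromRel fun p q =>
    (p.1 = q.1 ∧ (p.2 : ℕ) + 1 = (q.2 : ℕ)) ∨ (p.2 = q.2 ∧ (p.1 : ℕ) + 1 = (q.1 : ℕ))

noncomputable section
open scoped Classical
namespace PG
local notation "ω" => (by omega)
set_option linter.unusedSectionVars false
set_option linter.unusedVariables false
set_option linter.style.longLine false

/-- the spanning subgraph of edges inside `S` -/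
def ins {V : Type*} (G : SimpleGraph V) (S : Set V) : SimpleGraph V where
  Adj a b := G.Adj a b ∧ a ∈ S ∧ b ∈ S
  symm := ⟨fun _ _ h => ⟨h.1.symm, h.2.2, h.2.1⟩⟩
  loopless := ⟨fun _ h => G.loopless.irrefl _ h.1⟩

/-- `S` is nonempty and connected in `G` -/
def Cn {V : Type*} (G : SimpleGraph V) (S : Set V) : Prop :=
  S.Nonempty ∧ ∀ u ∈ S, ∀ v ∈ S, (ins G S).Reachable u v

section basic
variable {V W : Type*} {G : SimpleGraph V}

theorem ins_mono {S T : Set V} {G' : SimpleGraph V} (hG : G ≤ G') (h : S ⊆ T) :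
    ins G S ≤ ins G' T := fun _ _ hh => ⟨hG hh.1, h hh.2.1, h hh.2.2⟩

theorem ins_le (S : Set V) : ins G S ≤ G := fun _ _ hh => hh.1

theorem reach_ins_mem {S : Set V} {u v : V} (h : (ins G S).Reachable u v) (hu : u ∈ S) : v ∈ S := by
  obtain ⟨p⟩ := h
  induction p with
  | nil => exact hu
  | cons hh _ ih => exact ih hh.2.2

theorem Cn.single (v : V) : Cn G {v} := by
  refine ⟨⟨v, rfl⟩, ?_⟩
  rintro u rfl w rfl
  exact Reachable.refl _

theorem Cn.union {S T : Set V} (hS : Cn G S) (hT : Cn G T)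
    (h : (S ∩ T).Nonempty ∨ ∃ a ∈ S, ∃ b ∈ T, G.Adj a b) : Cn G (S ∪ T) := by
  have hs : ∀ u ∈ S, ∀ v ∈ S, (ins G (S ∪ T)).Reachable u v := fun u hu v hv =>
    (hS.2 u hu v hv).mono (ins_mono le_rfl Set.subset_union_left)
  have ht : ∀ u ∈ T, ∀ v ∈ T, (ins G (S ∪ T)).Reachable u v := fun u hu v hv =>
    (hT.2 u hu v hv).mono (ins_mono le_rfl Set.subset_union_right)
  have hst : ∀ u ∈ S, ∀ v ∈ T, (ins G (S ∪ T)).Reachable u v := by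
    intro u hu v hv
    rcases h with ⟨x, hx⟩ | ⟨a, ha, b, hb, hab⟩
    · exact (hs u hu x hx.1).trans (ht x hx.2 v hv)
    · refine (hs u hu a ha).trans (Reachable.trans (Adj.reachable ?_) (ht b hb v hv))
      exact ⟨hab, Or.inl ha, Or.inr hb⟩
  refine ⟨hS.1.mono Set.subset_union_left, ?_⟩
  rintro u (hu | hu) v (hv | hv)
  · exact hs u hu v hv
  · exact hst u hu v hv
  · exact (hst v hv u hu).symm
  · exact ht u hu v hv

theorem Cn.mono_graph {S : Set V} {G' : SimpleGraph V} (h : Cn G S) (hG : G ≤ G') : Cn G' S :=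
  ⟨h.1, fun u hu v hv => (h.2 u hu v hv).mono (ins_mono hG le_rfl)⟩

theorem Cn.ins_iff {S T : Set V} (hST : S ⊆ T) : Cn (ins G T) S ↔ Cn G S := by
  have : ins (ins G T) S = ins G S := by
    ext a b
    constructor
    · rintro ⟨h, ha, hb⟩; exact ⟨h.1, ha, hb⟩
    · rintro ⟨h, ha, hb⟩; exact ⟨⟨h, hST ha, hST hb⟩, ha, hb⟩
  unfold Cn
  rw [this]

theorem Cn.insert {S : Set V} {a b : V} (hS : Cn G S) (ha : a ∈ S) (hab : G.Adj a b) :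
    Cn G (insert b S) := by
  have := hS.union (Cn.single (G := G) b) (Or.inr ⟨a, ha, b, rfl, hab⟩)
  rwa [Set.union_singleton] at this

/-- induction principle on connected-sets: closed subset is everything -/
theorem Cn.closed {S : Set V} (hS : Cn G S) (P : V -> Prop) {u : V} (hu : u ∈ S) (hP : P u)
    (h : ∀ a ∈ S, ∀ b ∈ S, G.Adj a b -> P a -> P b) : ∀ v ∈ S, P v := by
  intro v hv
  obtain ⟨p⟩ := hS.2 u hu v hv
  induction p with
  | nil => exact hP
  | cons hh _ ih => exact ih hh.2.2 (h _ hh.2.1 _ hh.2.2 hh.1 hP) hv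

theorem reach_closed {K : SimpleGraph V} (P : V -> Prop) {u v : V} (hr : K.Reachable u v) (hP : P u)
    (h : ∀ a b, K.Adj a b -> P a -> P b) : P v := by
  obtain ⟨p⟩ := hr
  induction p with
  | nil => exact hP
  | cons hh _ ih => exact ih (h _ _ hh hP)

/-- if every proper nonempty cut is crossed then connected -/
theorem Cn.of_cut {S : Set V} (hne : S.Nonempty)
    (h : ∀ A ⊆ S, A.Nonempty -> (∀ a ∈ A, ∀ b ∈ S, G.Adj a b -> b ∈ A) -> A = S) : Cn G S := by
  refine ⟨hne, fun u hu v hv => ?_⟩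
  have := h {x | x ∈ S ∧ (ins G S).Reachable u x} (fun x hx => hx.1) ⟨u, hu, Reachable.refl _⟩
    (fun a ha b hb hab => ⟨hb, ha.2.trans (Adj.reachable ⟨hab, ha.1, hb⟩)⟩)
  have hv' : v ∈ {x | x ∈ S ∧ (ins G S).Reachable u x} := by rw [this]; exact hv
  exact hv'.2

theorem Cn.walk {K : SimpleGraph V} (hK : K ≤ G) {u v : V} (p : K.Walk u v) :
    Cn G {x | x ∈ p.support} := by
  induction p with
  | nil => simpa using Cn.single _
  | @cons u v w h p ih =>
    have := ih.insert (a := v) (b := u) (by simp) (hK h).symm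
    convert this using 1
    ext x; simp

theorem cn_iff_induce (S : Set V) : Cn G S ↔ (G.induce S).Connected := by
  constructor
  · rintro ⟨⟨x, hx⟩, h⟩
    have : Nonempty S := ⟨⟨x, hx⟩⟩
    refine Connected.mk ?_
    rintro ⟨u, hu⟩ ⟨v, hv⟩
    obtain ⟨p⟩ := h u hu v hv
    induction p with
    | nil => exact Reachable.refl _
    | cons hh _ ih => exact (Adj.reachable (G := G.induce S) (u := ⟨_, hu⟩) (v := ⟨_, hh.2.2⟩) hh.1).trans (ih hh.2.2 hv)
  · intro h
    obtain ⟨x, hx⟩ := h.nonempty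
    refine ⟨⟨x, hx⟩, fun u hu v hv => ?_⟩
    obtain ⟨p⟩ := h.preconnected ⟨u, hu⟩ ⟨v, hv⟩
    have : ∀ (a b : S) (p : (G.induce S).Walk a b), (ins G S).Reachable a.1 b.1 := by
      intro a b p
      induction p with
      | nil => exact Reachable.refl _
      | @cons a b c hh _ ih =>
        have h0 : (ins G S).Adj a.1 b.1 := ⟨hh, a.2, b.2⟩
        exact h0.reachable.trans ih
    exact this _ _ p

theorem hasMinor_iff {H : SimpleGraph W} : HasMinor G H ↔ ∃ f : W -> Set V,
    (∀ w, Cn G (f w)) ∧ (∀ w w', w ≠ w' -> Disjoint (f w) (f w')) ∧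
    (∀ ⦃w w'⦄, H.Adj w w' -> ∃ a ∈ f w, ∃ b ∈ f w', G.Adj a b) := by
  constructor
  · rintro ⟨f, _, h2, h3, h4⟩
    exact ⟨f, fun w => (cn_iff_induce _).2 (h2 w), h3, h4⟩
  · rintro ⟨f, h2, h3, h4⟩
    exact ⟨f, fun w => (h2 w).1, fun w => (cn_iff_induce _).1 (h2 w), h3, h4⟩

theorem HasMinor.mono {G' : SimpleGraph V} {H : SimpleGraph W} (h : HasMinor G H) (hG : G ≤ G') :
    HasMinor G' H := by
  rw [hasMinor_iff] at h ⊢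
  obtain ⟨f, h1, h2, h3⟩ := h
  exact ⟨f, fun w => (h1 w).mono_graph hG, h2, fun w w' hh => by
    obtain ⟨a, ha, b, hb, hab⟩ := h3 hh
    exact ⟨a, ha, b, hb, hG hab⟩⟩

theorem HasMinor.trans {U : Type*} {H : SimpleGraph W} {K : SimpleGraph U}
    (h : HasMinor G H) (h' : HasMinor H K) : HasMinor G K := by
  rw [hasMinor_iff] at h h' ⊢
  obtain ⟨f, h1, h2, h3⟩ := h
  obtain ⟨g, g1, g2, g3⟩ := h'
  refine ⟨fun u => ⋃ w ∈ g u, f w, fun u => ?_, fun u u' hne => ?_, fun u u' hh => ?_⟩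
  · obtain ⟨w0, hw0⟩ := (g1 u).1
    have key : ∀ w ∈ g u, ∀ x ∈ f w0, ∀ y ∈ f w, (ins G (⋃ w ∈ g u, f w)).Reachable x y := by
      have hin : ∀ w ∈ g u, ∀ x ∈ f w, ∀ y ∈ f w, (ins G (⋃ w ∈ g u, f w)).Reachable x y :=
        fun w hw x hx y hy => ((h1 w).2 x hx y hy).mono
          (ins_mono le_rfl (Set.subset_biUnion_of_mem (u := fun w => f w) hw))
      refine (g1 u).closed _ hw0 (fun x hx y hy => hin w0 hw0 x hx y hy) ?_
      intro a ha b hb hab ih x hx y hy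
      obtain ⟨p, hp, q, hq, hpq⟩ := h3 hab
      refine (ih x hx p hp).trans ((Adj.reachable ?_).trans (hin b hb q hq y hy))
      exact ⟨hpq, Set.mem_biUnion ha hp, Set.mem_biUnion hb hq⟩
    obtain ⟨x0, hx0⟩ := (h1 w0).1
    refine ⟨⟨x0, Set.mem_biUnion hw0 hx0⟩, ?_⟩
    intro p hp q hq
    simp only [Set.mem_iUnion] at hp hq
    obtain ⟨w, hw, hp⟩ := hp
    obtain ⟨w', hw', hq⟩ := hq
    exact (key w hw x0 hx0 p hp).symm.trans (key w' hw' x0 hx0 q hq)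
  · rw [Set.disjoint_left]
    intro x hx hx'
    simp only [Set.mem_iUnion] at hx hx'
    obtain ⟨w, hw, hp⟩ := hx
    obtain ⟨w', hw', hq⟩ := hx'
    by_cases e : w = w'
    · subst e
      exact Set.disjoint_left.1 (g2 u u' hne) hw hw'
    · exact Set.disjoint_left.1 (h2 w w' e) hp hq
  · obtain ⟨w, hw, w', hw', hh⟩ := g3 hh
    obtain ⟨a, ha, b, hb, hab⟩ := h3 hh
    exact ⟨a, Set.mem_biUnion hw ha, b, Set.mem_biUnion hw' hb, hab⟩

end basic

section chains
variable {V : Type*} [Fintype V]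

theorem z2 (x : ZMod 2) : x + x = 0 := CharTwo.add_self_eq_zero x

theorem z2cases (x : ZMod 2) : x = 0 ∨ x = 1 := by
  revert x; decide

theorem z2ne {x : ZMod 2} (h : x ≠ 0) : x = 1 := (z2cases x).resolve_left h

theorem z2eq {x y : ZMod 2} : x + y = 0 ↔ x = y := by
  revert x y; decide

/-- boundary of a mod 2 chain -/
def bd : (Sym2 V -> ZMod 2) →ₗ[ZMod 2] (V -> ZMod 2) where
  toFun c v := ∑ u, c s(v, u)
  map_add' c d := by ext v; simp [Finset.sum_add_distrib]
  map_smul' a c := by ext v; simp [Finset.mul_sum]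

theorem bd_apply (c : Sym2 V -> ZMod 2) (v : V) : bd c v = ∑ u, c s(v, u) := rfl

/-- single edge chain -/
abbrev sg (e : Sym2 V) : Sym2 V -> ZMod 2 := Pi.single e 1
/-- single vertex -/
abbrev sv (v : V) : V -> ZMod 2 := Pi.single v 1

theorem bd_sg {u v : V} (h : u ≠ v) : bd (sg s(u, v)) = sv u + sv v := by
  ext w
  rw [bd_apply]
  simp only [Pi.add_apply, Pi.single_apply, Sym2.eq_iff]
  by_cases hu : w = u
  · subst hu
    simp [h]
  · by_cases hv : w = v
    · subst hv
      simp [h.symm]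
    · simp [hu, hv]

/-- chain supported on a set -/
def Sup (E : Set (Sym2 V)) (c : Sym2 V -> ZMod 2) : Prop := ∀ e, e ∉ E -> c e = 0

theorem Sup.add {E : Set (Sym2 V)} {c d : Sym2 V -> ZMod 2} (hc : Sup E c) (hd : Sup E d) : Sup E (c + d) :=
  fun e he => by simp [hc e he, hd e he]
theorem Sup.smul {E : Set (Sym2 V)} {c : Sym2 V -> ZMod 2} (a : ZMod 2) (hc : Sup E c) : Sup E (a • c) :=
  fun e he => by simp [hc e he]
theorem Sup.sum {ι : Type*} {E : Set (Sym2 V)} (s : Finset ι) (c : ι -> Sym2 V -> ZMod 2)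
    (h : ∀ i ∈ s, Sup E (c i)) : Sup E (∑ i ∈ s, c i) := fun e he => by
  rw [Finset.sum_apply]
  exact Finset.sum_eq_zero fun i hi => h i hi e he
theorem Sup.mono {E E' : Set (Sym2 V)} {c : Sym2 V -> ZMod 2} (hc : Sup E c) (h : E ⊆ E') : Sup E' c :=
  fun e he => hc e fun hh => he (h hh)
theorem Sup.sg {E : Set (Sym2 V)} {e : Sym2 V} (h : e ∈ E) : Sup E (sg e) := fun e' he' => by
  rw [PG.sg, Pi.single_apply, if_neg]; rintro rfl; exact he' h

theorem chain_eq_sum (c : Sym2 V -> ZMod 2) : c = ∑ e, c e • sg e := by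
  ext e
  simp [Finset.sum_apply, Pi.single_apply]

theorem reach_chain {K : SimpleGraph V} {u v : V} (h : K.Reachable u v) :
    ∃ k, Sup K.edgeSet k ∧ bd k = sv u + sv v := by
  obtain ⟨p⟩ := h
  induction p with
  | nil => exact ⟨0, fun _ _ => rfl, by ext w; simp [z2]⟩
  | @cons a b c h p ih =>
    obtain ⟨k, hk, hb⟩ := ih
    refine ⟨sg s(a, b) + k, (Sup.sg h).add hk, ?_⟩
    rw [map_add, bd_sg h.ne, hb]
    ext w
    simp only [Pi.add_apply]
    have := z2 (sv b w)
    linear_combination this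

theorem tjoin {K : SimpleGraph V} {x0 : V} (p : V -> ZMod 2) (hp : ∑ v, p v = 0)
    (h : ∀ v, p v ≠ 0 -> K.Reachable x0 v) : ∃ k, Sup K.edgeSet k ∧ bd k = p := by
  have hk : ∀ v, ∃ k, Sup K.edgeSet k ∧ (p v ≠ 0 -> bd k = sv x0 + sv v) := fun v => by
    by_cases hv : p v = 0
    · exact ⟨0, fun _ _ => rfl, fun h => (h hv).elim⟩
    · obtain ⟨k, h1, h2⟩ := reach_chain (h v hv)
      exact ⟨k, h1, fun _ => h2⟩
  choose k hk1 hk2 using hk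
  refine ⟨∑ v, p v • k v, Sup.sum _ _ fun v _ => (hk1 v).smul _, ?_⟩
  rw [map_sum]
  have : ∀ v, bd (p v • k v) = p v • (sv x0 + sv v) := fun v => by
    rw [map_smul]
    by_cases hv : p v = 0
    · simp [hv]
    · rw [hk2 v hv]
  simp only [this, smul_add, Finset.sum_add_distrib, ← Finset.sum_smul, hp, zero_smul, zero_add]
  ext w
  simp [Finset.sum_apply, Pi.single_apply]

theorem Sup.bd_zero {K : SimpleGraph V} {c : Sym2 V -> ZMod 2} (hc : Sup K.edgeSet c) {v : V}
    (h : ∀ u, ¬ K.Adj v u) : bd c v = 0 := by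
  rw [bd_apply]
  exact Finset.sum_eq_zero fun u _ => hc _ (h u)

theorem sum_ind (S : Set V) (a b : V) : ∑ v, (if v ∈ S then (sv a + sv b) v else 0) =
    (if a ∈ S then (1 : ZMod 2) else 0) + (if b ∈ S then 1 else 0) := by
  have e1 : ∀ v, (if v ∈ S then (sv a + sv b) v else 0) = (if v = a then (if v ∈ S then (1 : ZMod 2) else 0) else 0)
     + (if v = b then (if v ∈ S then 1 else 0) else 0) := by
    intro v
    simp only [Pi.add_apply, Pi.single_apply]
    by_cases h3 : v ∈ S <;> simp [h3]
  simp only [e1, Finset.sum_add_distrib, Finset.sum_ite_eq', Finset.mem_univ, if_true]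

theorem sum_bd (c : Sym2 V -> ZMod 2) {K : SimpleGraph V} (hc : Sup K.edgeSet c) (S : Set V)
    (h : ∀ a b, K.Adj a b -> c s(a, b) ≠ 0 -> a ∈ S -> b ∈ S) : ∑ v, (if v ∈ S then bd c v else 0) = 0 := by
  have : ∀ v, (if v ∈ S then bd c v else 0) =
      ∑ e : Sym2 V, c e * (if v ∈ S then bd (sg e) v else 0) := by
    intro v
    conv_lhs => rw [chain_eq_sum c]
    split_ifs
    · simp only [map_sum, map_smul, Finset.sum_apply, Pi.smul_apply, smul_eq_mul]
    · simp
  simp only [this]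
  rw [Finset.sum_comm]
  refine Finset.sum_eq_zero fun e _ => ?_
  rw [← Finset.mul_sum]
  by_cases he : c e = 0
  · simp [he]
  induction e with
  | h a b =>
  have hab : K.Adj a b := by
    by_contra hh
    exact he (hc _ hh)
  rw [bd_sg hab.ne]
  rw [sum_ind]
  have : a ∈ S ↔ b ∈ S := ⟨h a b hab he, h b a hab.symm (by rwa [Sym2.eq_swap])⟩
  simp [this, z2]

/-! representations -/

variable {F : Type*}

/-- coboundary of a face function -/
def dl (G : SimpleGraph V) (l r : Sym2 V -> F) (a : F -> ZMod 2) : Sym2 V -> ZMod 2 :=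
  fun e => if e ∈ G.edgeSet then a (l e) + a (r e) else 0

structure IsRep (G : SimpleGraph V) (l r : Sym2 V -> F) : Prop where
  even : ∀ a, bd (dl G l r a) = 0
  full : ∀ c, Sup G.edgeSet c -> bd c = 0 -> ∃ a, c = dl G l r a

theorem dl_sup (G : SimpleGraph V) (l r : Sym2 V -> F) (a : F -> ZMod 2) : Sup G.edgeSet (dl G l r a) :=
  fun e he => by simp [dl, he]

theorem dl_edge {G : SimpleGraph V} (l r : Sym2 V -> F) (a : F -> ZMod 2) {e : Sym2 V} (h : e ∈ G.edgeSet) :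
    dl G l r a e = a (l e) + a (r e) := by simp [dl, h]

theorem dl_add (G : SimpleGraph V) (l r : Sym2 V -> F) (a b : F -> ZMod 2) :
    dl G l r (a + b) = dl G l r a + dl G l r b := by
  ext e
  simp only [dl, Pi.add_apply]
  split_ifs
  · ring
  · simp

/-- planarity, algebraically -/
def PL (G : SimpleGraph V) : Prop := ∃ (F : Type) (l r : Sym2 V -> F), IsRep G l r

end chains

section minor
variable {V : Type*} [Fintype V] {W : Type*} [Fintype W] {F : Type}

/-- Minor closure with explicit data. -/
theorem IsRep.minor_strong {G : SimpleGraph V} {l r : Sym2 V -> F} (h : IsRep G l r) (H : SimpleGraph W)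
    (f : W -> Set V) (hf : ∀ w, f w = ∅ ∨ Cn G (f w)) (hd : ∀ w w', w ≠ w' -> Disjoint (f w) (f w'))
    (ψ : Sym2 W -> Sym2 V)
    (hψ : ∀ w w', H.Adj w w' -> ∃ a ∈ f w, ∃ b ∈ f w', G.Adj a b ∧ ψ s(w, w') = s(a, b)) :
    ∃ (F' : Type) (q : F -> F'), IsRep H (fun e => q (l (ψ e))) (fun e => q (r (ψ e))) ∧
      ∀ e ∈ G.edgeSet, e ∉ ψ '' H.edgeSet -> (¬ ∃ w, ∀ x ∈ e, x ∈ f w) -> q (l e) = q (r e) := by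
  let inside : Set (Sym2 V) := {e | ∃ w, ∀ x ∈ e, x ∈ f w}
  let R : F -> F -> Prop := fun x y => ∃ e ∈ G.edgeSet, e ∉ ψ '' H.edgeSet ∧ e ∉ inside ∧ x = l e ∧ y = r e
  have uniq : ∀ {w w' x}, x ∈ f w -> x ∈ f w' -> w = w' := fun {w w' x} hx hx' => by
    by_contra hne
    exact Set.disjoint_left.1 (hd _ _ hne) hx hx'
  have ψG : ∀ e ∈ H.edgeSet, ψ e ∈ G.edgeSet := by
    intro e
    induction e with
    | h w w' =>
    intro he
    obtain ⟨a, ha, b, hb, hab, h1⟩ := hψ w w' he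
    rw [h1]; exact hab
  have ψin : ∀ e ∈ H.edgeSet, ψ e ∉ inside := by
    intro e
    induction e with
    | h w w' =>
    rintro he ⟨u, hu⟩
    obtain ⟨a, ha, b, hb, hab, h1⟩ := hψ w w' he
    rw [h1] at hu
    have e1 := uniq ha (hu a (by simp))
    have e2 := uniq hb (hu b (by simp))
    exact he.ne (e1.trans e2.symm)
  have ψinj : ∀ e ∈ H.edgeSet, ∀ e' ∈ H.edgeSet, ψ e = ψ e' -> e = e' := by
    intro e
    induction e with
    | h w w' =>
    intro he e'
    induction e' with
    | h u u' =>
    intro he' heq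
    obtain ⟨a, ha, b, hb, hab, h1⟩ := hψ w w' he
    obtain ⟨a', ha', b', hb', hab', h1'⟩ := hψ u u' he'
    rw [h1, h1', Sym2.eq_iff] at heq
    rcases heq with ⟨rfl, rfl⟩ | ⟨rfl, rfl⟩
    · rw [uniq ha ha', uniq hb hb']
    · rw [uniq ha hb', uniq hb ha', Sym2.eq_swap]
  -- sum over a branch set
  let sm : W -> (Sym2 V -> ZMod 2) -> ZMod 2 := fun w c => ∑ v, if v ∈ f w then bd c v else 0
  have smadd : ∀ w c d, sm w (c + d) = sm w c + sm w d := by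
    intro w c d
    simp only [sm, map_add, Pi.add_apply, ← Finset.sum_add_distrib]
    refine Finset.sum_congr rfl fun v _ => ?_
    split_ifs <;> simp
  have smsmul : ∀ w (x : ZMod 2) c, sm w (x • c) = x * sm w c := by
    intro w x c
    simp only [sm, map_smul, Pi.smul_apply, Finset.mul_sum]
    refine Finset.sum_congr rfl fun v _ => ?_
    split_ifs <;> simp
  have smsum : ∀ w (c : Sym2 W -> Sym2 V -> ZMod 2), sm w (∑ e, c e) = ∑ e, sm w (c e) := by
    intro w c
    simp only [sm, map_sum, Finset.sum_apply]
    rw [Finset.sum_comm]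
    refine Finset.sum_congr rfl fun v _ => ?_
    split_ifs <;> simp
  have sminside : ∀ w c, Sup (G.edgeSet ∩ inside) c -> sm w c = 0 := by
    intro w c hc
    refine sum_bd c (K := G) (hc.mono Set.inter_subset_left) (f w) ?_
    intro a b hab hne ha
    by_contra hb
    refine hne (hc _ ?_)
    rintro ⟨_, u, hu⟩
    have := uniq ha (hu a (by simp))
    subst this
    exact hb (hu b (by simp))
  have smψ : ∀ w, ∀ e ∈ H.edgeSet, sm w (sg (ψ e)) = bd (sg e) w := by
    intro w e
    induction e with
    | h u u' =>
    intro he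
    obtain ⟨a, ha, b, hb, hab, h1⟩ := hψ u u' he
    rw [h1, bd_sg (H.ne_of_adj he)]
    simp only [sm, bd_sg hab.ne]
    rw [sum_ind]
    have hu : a ∈ f w ↔ w = u := ⟨fun h => uniq h ha, fun h => h ▸ ha⟩
    have hu' : b ∈ f w ↔ w = u' := ⟨fun h => uniq h hb, fun h => h ▸ hb⟩
    simp [Pi.single_apply, hu, hu']
  refine ⟨Quot R, Quot.mk R, ⟨?_, ?_⟩, fun e he hE hi => Quot.sound ⟨e, he, hE, hi, rfl, rfl⟩⟩
  · intro a'
    let a : F -> ZMod 2 := fun x => a' (Quot.mk R x)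
    let c := dl G l r a
    let c' := dl H (fun e => Quot.mk R (l (ψ e))) (fun e => Quot.mk R (r (ψ e))) a'
    let c0 : Sym2 V -> ZMod 2 := ∑ e, c' e • sg (ψ e)
    have hc' : Sup H.edgeSet c' := dl_sup _ _ _ _
    have hcc : ∀ e ∈ H.edgeSet, c' e = c (ψ e) := by
      intro e he
      simp only [c, c', dl_edge _ _ _ he, dl_edge _ _ _ (ψG e he)]
      rfl
    have hk : Sup (G.edgeSet ∩ inside) (c + c0) := by
      intro e he
      by_cases hG : e ∈ G.edgeSet
      · have hi : e ∉ inside := fun h => he ⟨hG, h⟩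
        by_cases hE : e ∈ ψ '' H.edgeSet
        · obtain ⟨e', he', rfl⟩ := hE
          have : c0 (ψ e') = c' e' := by
            simp only [c0, Finset.sum_apply, Pi.smul_apply, Pi.single_apply, smul_eq_mul]
            rw [Finset.sum_eq_single e']
            · simp
            · intro e'' _ hne
              by_cases h'' : e'' ∈ H.edgeSet
              · rw [if_neg, mul_zero]
                intro hh; exact hne (ψinj _ h'' _ he' hh.symm)
              · rw [hc' _ h'', zero_mul]
            · simp
          rw [Pi.add_apply, this, hcc e' he', z2]
        · have h1 : c e = 0 := by
            simp only [c, dl_edge _ _ _ hG, a]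
            rw [Quot.sound (r := R) (a := l e) (b := r e) ⟨e, hG, hE, hi, rfl, rfl⟩, z2]
          have h2 : c0 e = 0 := by
            simp only [c0, Finset.sum_apply, Pi.smul_apply, Pi.single_apply, smul_eq_mul]
            refine Finset.sum_eq_zero fun e' _ => ?_
            by_cases h'' : e' ∈ H.edgeSet
            · rw [if_neg, mul_zero]
              rintro rfl
              exact hE ⟨e', h'', rfl⟩
            · rw [hc' _ h'', zero_mul]
          simp [h1, h2]
      · have h2 : c0 e = 0 := by
          simp only [c0, Finset.sum_apply, Pi.smul_apply, Pi.single_apply, smul_eq_mul]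
          refine Finset.sum_eq_zero fun e' _ => ?_
          by_cases h'' : e' ∈ H.edgeSet
          · rw [if_neg, mul_zero]
            rintro rfl
            exact hG (ψG _ h'')
          · rw [hc' _ h'', zero_mul]
        simp [h2, c, dl_sup _ _ _ _ _ hG]
    have hc0 : ∀ w, sm w c0 = bd c' w := by
      intro w
      simp only [c0]
      rw [smsum]
      conv_rhs => rw [chain_eq_sum c']
      rw [map_sum, Finset.sum_apply]
      refine Finset.sum_congr rfl fun e _ => ?_
      rw [smsmul, map_smul, Pi.smul_apply, smul_eq_mul]
      by_cases he : e ∈ H.edgeSet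
      · rw [smψ _ _ he]
      · have : c' e = 0 := dl_sup _ _ _ _ _ he
        rw [this]; simp
    ext w
    have h1 := sminside w _ hk
    rw [smadd, hc0] at h1
    have h2 : sm w c = 0 := by
      simp only [sm, c, h.even a]; simp
    rw [h2, zero_add] at h1
    exact h1
  · intro c' hc' hb
    let c0 : Sym2 V -> ZMod 2 := ∑ e, c' e • sg (ψ e)
    have hc0 : ∀ w, sm w c0 = 0 := by
      intro w
      have : sm w c0 = bd c' w := by
        simp only [c0]
        rw [smsum]
        conv_rhs => rw [chain_eq_sum c']
        rw [map_sum, Finset.sum_apply]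
        refine Finset.sum_congr rfl fun e _ => ?_
        rw [smsmul, map_smul, Pi.smul_apply, smul_eq_mul]
        by_cases he : e ∈ H.edgeSet
        · rw [smψ _ _ he]
        · rw [hc' _ he]; simp
      rw [this, hb]; rfl
    have hk : ∀ w, ∃ k, Sup (ins G (f w)).edgeSet k ∧ bd k = fun v => if v ∈ f w then bd c0 v else 0 := by
      intro w
      rcases hf w with hw | hfw
      · refine ⟨0, fun _ _ => rfl, ?_⟩
        ext v
        simp [hw]
      obtain ⟨x0, hx0⟩ := hfw.1
      refine tjoin (x0 := x0) _ (hc0 w) ?_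
      intro v hv
      have : v ∈ f w := by by_contra hh; simp [hh] at hv
      exact hfw.2 _ hx0 _ this
    choose k hk1 hk2 using hk
    have kin : ∀ w, Sup (G.edgeSet ∩ inside) (k w) := by
      intro w
      refine (hk1 w).mono ?_
      intro e
      induction e with
      | h x y =>
      intro he
      refine ⟨he.1, w, ?_⟩
      intro z hz
      rcases Sym2.mem_iff.1 hz with rfl | rfl
      · exact he.2.1
      · exact he.2.2
    have c0out : ∀ v, (∀ w, v ∉ f w) -> bd c0 v = 0 := by
      intro v hv
      simp only [c0, map_sum, map_smul, Finset.sum_apply, Pi.smul_apply, smul_eq_mul]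
      refine Finset.sum_eq_zero fun e _ => ?_
      by_cases he : e ∈ H.edgeSet
      · induction e with
        | h w w' =>
        obtain ⟨a, ha, b, hb, hab, h1⟩ := hψ w w' he
        rw [h1, bd_sg hab.ne]
        have h2 : v ≠ a := by rintro rfl; exact hv _ ha
        have h3 : v ≠ b := by rintro rfl; exact hv _ hb
        simp [Pi.single_apply, h2, h3]
      · rw [hc' _ he, zero_mul]
    have hc0G : Sup G.edgeSet c0 := by
      refine Sup.sum _ _ fun e _ => ?_
      by_cases he : e ∈ H.edgeSet
      · exact (Sup.sg (ψG e he)).smul _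
      · rw [hc' _ he, zero_smul]; exact fun _ _ => rfl
    let c := c0 + ∑ w, k w
    have hcG : Sup G.edgeSet c := hc0G.add (Sup.sum _ _ fun w _ => (kin w).mono Set.inter_subset_left)
    have hcb : bd c = 0 := by
      ext v
      simp only [c, map_add, map_sum, Pi.add_apply, Finset.sum_apply, hk2]
      by_cases hv : ∃ w, v ∈ f w
      · obtain ⟨w, hw⟩ := hv
        rw [Finset.sum_eq_single w]
        · simp [hw, z2]
        · intro w' _ hne
          rw [if_neg]
          intro hh; exact hne (uniq hh hw)
        · simp
      · push Not at hv
        rw [c0out v hv]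
        simp [hv]
    obtain ⟨a, ha⟩ := h.full c hcG hcb
    have kz : ∀ e ∉ inside, (∑ w, k w) e = 0 := fun e he => by
      rw [Finset.sum_apply]
      exact Finset.sum_eq_zero fun w _ => kin w e fun hh => he hh.2
    have hR : ∀ x y, R x y -> a x = a y := by
      rintro x y ⟨e, hG, hE, hi, rfl, rfl⟩
      have h1 : c e = 0 := by
        simp only [c, Pi.add_apply, kz e hi, add_zero]
        simp only [c0, Finset.sum_apply, Pi.smul_apply, Pi.single_apply, smul_eq_mul]
        refine Finset.sum_eq_zero fun e' _ => ?_
        by_cases h'' : e' ∈ H.edgeSet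
        · rw [if_neg, mul_zero]
          rintro rfl
          exact hE ⟨e', h'', rfl⟩
        · rw [hc' _ h'', zero_mul]
      rw [ha, dl_edge _ _ _ hG] at h1
      exact z2eq.1 h1
    refine ⟨fun x => Quot.lift a hR x, ?_⟩
    ext e
    by_cases he : e ∈ H.edgeSet
    · rw [dl_edge _ _ _ he]
      change c' e = a (l (ψ e)) + a (r (ψ e))
      rw [← dl_edge _ _ _ (ψG e he), ← ha]
      simp only [c, Pi.add_apply, kz _ (ψin e he), add_zero]
      simp only [c0, Finset.sum_apply, Pi.smul_apply, Pi.single_apply, smul_eq_mul]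
      rw [Finset.sum_eq_single e]
      · simp
      · intro e'' _ hne
        by_cases h'' : e'' ∈ H.edgeSet
        · rw [if_neg, mul_zero]
          intro hh; exact hne (ψinj _ h'' _ he hh.symm)
        · rw [hc' _ h'', zero_mul]
      · simp
    · rw [hc' e he, dl_sup _ _ _ _ _ he]

theorem IsRep.minor {G : SimpleGraph V} {l r : Sym2 V -> F} (h : IsRep G l r) (H : SimpleGraph W)
    (f : W -> Set V) (hf : ∀ w, Cn G (f w)) (hd : ∀ w w', w ≠ w' -> Disjoint (f w) (f w'))
    (ψ : Sym2 W -> Sym2 V)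
    (hψ : ∀ w w', H.Adj w w' -> ∃ a ∈ f w, ∃ b ∈ f w', G.Adj a b ∧ ψ s(w, w') = s(a, b)) :
    ∃ (F' : Type) (q : F -> F'), IsRep H (fun e => q (l (ψ e))) (fun e => q (r (ψ e))) := by
  obtain ⟨F', q, h, _⟩ := h.minor_strong H f (fun w => Or.inr (hf w)) hd ψ hψ
  exact ⟨F', q, h⟩

theorem PL.minor {G : SimpleGraph V} (h : PL G) {H : SimpleGraph W} (hm : HasMinor G H) : PL H := by
  obtain ⟨F, l, r, h⟩ := h
  obtain ⟨f, h1, h2, h3⟩ := hasMinor_iff.1 hm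
  have : ∀ e : Sym2 W, ∃ e' : Sym2 V, ∀ w w', e = s(w, w') -> H.Adj w w' →
      ∃ a ∈ f w, ∃ b ∈ f w', G.Adj a b ∧ e' = s(a, b) := by
    intro e
    induction e with
    | h w w' =>
    by_cases hh : H.Adj w w'
    · obtain ⟨a, ha, b, hb, hab⟩ := h3 hh
      refine ⟨s(a, b), fun u u' he hu => ?_⟩
      rcases Sym2.eq_iff.1 he with ⟨rfl, rfl⟩ | ⟨rfl, rfl⟩
      · exact ⟨a, ha, b, hb, hab, rfl⟩
      · exact ⟨b, hb, a, ha, hab.symm, Sym2.eq_swap⟩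
    · obtain ⟨x, _⟩ := (h1 w).1
      refine ⟨s(x, x), fun u u' he hu => (hh ?_).elim⟩
      rcases Sym2.eq_iff.1 he with ⟨rfl, rfl⟩ | ⟨rfl, rfl⟩
      · exact hu
      · exact hu.symm
  choose ψ hψ using this
  obtain ⟨F', q, h'⟩ := h.minor H f h1 h2 ψ (fun w w' hh => hψ _ w w' rfl hh)
  exact ⟨F', _, _, h'⟩

end minor

section ops
variable {V : Type*} [Fintype V] {F : Type}

theorem IsRep.congr {G : SimpleGraph V} {l r l' r' : Sym2 V -> F} (h : IsRep G l r)
    (hh : ∀ e ∈ G.edgeSet, (l' e = l e ∧ r' e = r e) ∨ (l' e = r e ∧ r' e = l e)) : IsRep G l' r' := by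
  have : ∀ a, dl G l' r' a = dl G l r a := fun a => by
    ext e
    by_cases he : e ∈ G.edgeSet
    · rw [dl_edge _ _ _ he, dl_edge _ _ _ he]
      rcases hh e he with ⟨h1, h2⟩ | ⟨h1, h2⟩
      · rw [h1, h2]
      · rw [h1, h2, add_comm]
    · rw [dl_sup _ _ _ _ _ he, dl_sup _ _ _ _ _ he]
  exact ⟨fun a => by rw [this]; exact h.even a, fun c hc hb => by
    obtain ⟨a, ha⟩ := h.full c hc hb
    exact ⟨a, by rw [this]; exact ha⟩⟩

/-- put the special face to the left where present -/
theorem IsRep.left {G : SimpleGraph V} {l r : Sym2 V -> F} (h : IsRep G l r) (o : F) :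
    ∃ l' r' : Sym2 V -> F, IsRep G l' r' ∧ ∀ e, l e = o ∨ r e = o -> l' e = o := by
  refine ⟨fun e => if r e = o then r e else l e, fun e => if r e = o then l e else r e, h.congr ?_, ?_⟩
  · intro e _
    by_cases hr : r e = o
    · right; simp [hr]
    · left; simp [hr]
  · intro e he
    by_cases hr : r e = o
    · simp [hr]
    · simp [hr, he.resolve_right hr]

theorem IsRep.sub {G H : SimpleGraph V} {l r : Sym2 V -> F} (h : IsRep G l r) (hle : H ≤ G) :
    ∃ (F' : Type) (q : F -> F'), IsRep H (fun e => q (l e)) (fun e => q (r e)) :=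
  h.minor H (fun v => {v}) (fun v => Cn.single v)
    (fun w w' hne => by simpa using hne) id
    (fun w w' hh => ⟨w, rfl, w', rfl, hle hh, rfl⟩)

theorem PL.sub {G H : SimpleGraph V} (h : PL G) (hle : H ≤ G) : PL H := by
  obtain ⟨F, l, r, h⟩ := h
  obtain ⟨F', q, h⟩ := h.sub hle
  exact ⟨F', _, _, h⟩

/-- restriction of a chain -/
def rst (E : Set (Sym2 V)) (c : Sym2 V -> ZMod 2) : Sym2 V -> ZMod 2 := fun e => if e ∈ E then c e else 0

theorem glue_aux {F₁ F₂ : Type} {G₁ G₂ : SimpleGraph V} {l₁ r₁ : Sym2 V -> F₁} {l₂ r₂ : Sym2 V -> F₂}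
    (h₁ : IsRep G₁ l₁ r₁) (h₂ : IsRep G₂ l₂ r₂) (o₁ : F₁) (o₂ : F₂)
    (c₁ : ∀ e ∈ G₁.edgeSet, e ∈ G₂.edgeSet -> l₁ e = o₁)
    (c₂ : ∀ e ∈ G₁.edgeSet, e ∈ G₂.edgeSet -> l₂ e = o₂)
    (hb : ∀ c, Sup (G₁.edgeSet ∪ G₂.edgeSet) c -> bd c = 0 →
      ∃ k, Sup (G₁.edgeSet ∩ G₂.edgeSet) k ∧ bd (rst (G₁.edgeSet \ G₂.edgeSet) c) = bd k) :
    PL (G₁ ⊔ G₂) := by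
  let j : F₂ -> F₁ ⊕ F₂ := fun f => if f = o₂ then Sum.inl o₁ else Sum.inr f
  let l : Sym2 V -> F₁ ⊕ F₂ := fun e => if e ∈ G₁.edgeSet then
    (if e ∈ G₂.edgeSet then Sum.inl (r₁ e) else Sum.inl (l₁ e)) else j (l₂ e)
  let r : Sym2 V -> F₁ ⊕ F₂ := fun e => if e ∈ G₂.edgeSet then j (r₂ e) else Sum.inl (r₁ e)
  have hE : (G₁ ⊔ G₂).edgeSet = G₁.edgeSet ∪ G₂.edgeSet := edgeSet_sup _ _
  have key : ∀ a : F₁ ⊕ F₂ -> ZMod 2, dl (G₁ ⊔ G₂) l r a =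
      dl G₁ l₁ r₁ (fun f => a (Sum.inl f)) + dl G₂ l₂ r₂ (fun f => a (j f)) := by
    intro a
    ext e
    simp only [dl, hE, Set.mem_union, Pi.add_apply, l, r]
    by_cases h1 : e ∈ G₁.edgeSet
    · by_cases h2 : e ∈ G₂.edgeSet
      · simp only [h1, h2, true_or, if_true, c₁ e h1 h2, c₂ e h1 h2, j]
        have := z2 (a (Sum.inl o₁))
        linear_combination -this
      · simp [h1, h2]
    · by_cases h2 : e ∈ G₂.edgeSet
      · simp [h1, h2]
      · simp [h1, h2]
  refine ⟨F₁ ⊕ F₂, l, r, fun a => ?_, fun c hc hbc => ?_⟩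
  · rw [key, map_add, h₁.even, h₂.even, add_zero]
  · rw [hE] at hc
    obtain ⟨k, hk, hkb⟩ := hb c hc hbc
    let d₁ := rst (G₁.edgeSet \ G₂.edgeSet) c
    let d₂ := rst G₂.edgeSet c
    have hcd : c = d₁ + d₂ := by
      ext e
      simp only [d₁, d₂, rst, Pi.add_apply, Set.mem_diff]
      by_cases h2 : e ∈ G₂.edgeSet
      · simp [h2]
      · by_cases h1 : e ∈ G₁.edgeSet
        · simp [h1, h2]
        · simp [h1, h2, hc e (by simp [h1, h2])]
    have kk : bd k + bd k = 0 := by ext v; simp [z2]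
    obtain ⟨a₁, ha₁⟩ := h₁.full (d₁ + k) (Sup.add (fun e he => by simp [d₁, rst, he]) (hk.mono Set.inter_subset_left))
      (by rw [map_add, hkb, kk])
    obtain ⟨a₂, ha₂⟩ := h₂.full (d₂ + k) (Sup.add (fun e he => by simp [d₂, rst, he]) (hk.mono Set.inter_subset_right))
      (by
        have : d₂ + k = c + (d₁ + k) := by
          rw [hcd]; ext e; simp only [Pi.add_apply]
          have := z2 (d₁ e); linear_combination -this
        rw [this, map_add, hbc, map_add, hkb, kk, add_zero])
    let a : F₁ ⊕ F₂ -> ZMod 2 := Sum.elim a₁ (fun f => a₂ f + (a₁ o₁ + a₂ o₂))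
    refine ⟨a, ?_⟩
    rw [key]
    have e1 : (fun f => a (j f)) = a₂ + fun _ => (a₁ o₁ + a₂ o₂) := by
      ext f
      by_cases hf : f = o₂
      · subst hf
        simp only [a, j, if_true, Sum.elim_inl, Pi.add_apply]
        have := z2 (a₂ f); linear_combination -this
      · simp [a, j, hf]
    have e2 : dl G₂ l₂ r₂ (fun _ => (a₁ o₁ + a₂ o₂)) = 0 := by
      ext e
      simp only [dl, z2, ite_self, Pi.zero_apply]
    rw [e1, dl_add, e2, add_zero, ← ha₂]
    have e3 : (fun f => a (Sum.inl f)) = a₁ := by ext f; simp [a]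
    rw [e3, ← ha₁, hcd]
    ext e
    simp only [Pi.add_apply]
    have := z2 (k e); linear_combination -this

theorem glue {F₁ F₂ : Type} {G₁ G₂ : SimpleGraph V} {l₁ r₁ : Sym2 V -> F₁} {l₂ r₂ : Sym2 V -> F₂}
    (h₁ : IsRep G₁ l₁ r₁) (h₂ : IsRep G₂ l₂ r₂) (o₁ : F₁) (o₂ : F₂)
    (c₁ : ∀ e ∈ G₁.edgeSet, e ∈ G₂.edgeSet -> l₁ e = o₁ ∨ r₁ e = o₁)
    (c₂ : ∀ e ∈ G₁.edgeSet, e ∈ G₂.edgeSet -> l₂ e = o₂ ∨ r₂ e = o₂)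
    (hb : ∀ c, Sup (G₁.edgeSet ∪ G₂.edgeSet) c -> bd c = 0 →
      ∃ k, Sup (G₁.edgeSet ∩ G₂.edgeSet) k ∧ bd (rst (G₁.edgeSet \ G₂.edgeSet) c) = bd k) :
    PL (G₁ ⊔ G₂) := by
  obtain ⟨l₁', r₁', h₁', c₁'⟩ := h₁.left o₁
  obtain ⟨l₂', r₂', h₂', c₂'⟩ := h₂.left o₂
  exact glue_aux h₁' h₂' o₁ o₂ (fun e h h' => c₁' e (c₁ e h h')) (fun e h h' => c₂' e (c₂ e h h')) hb

/-- even nonzero chain that is minimal -/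
def Circ (c : Sym2 V -> ZMod 2) : Prop :=
  c ≠ 0 ∧ bd c = 0 ∧ ∀ d, bd d = 0 -> (∀ e, c e = 0 -> d e = 0) -> d = 0 ∨ d = c

theorem merge {G : SimpleGraph V} {l r : Sym2 V -> F} (h : IsRep G l r) (β : F -> ZMod 2)
    (hC : Circ (dl G l r β)) (h0 : ∀ e ∈ G.edgeSet, dl G l r β e = 0 -> β (l e) = 0) :
    ∃ (l' r' : Sym2 V -> Option F), IsRep G l' r' ∧
      ∀ e, dl G l r β e ≠ 0 -> l' e = none ∨ r' e = none := by
  let μ : F -> Option F := fun f => if β f = 0 then some f else none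
  have key : ∀ a : Option F -> ZMod 2, dl G (fun e => μ (l e)) (fun e => μ (r e)) a =
    dl G l r (fun f => a (μ f)) := fun a => rfl
  refine ⟨fun e => μ (l e), fun e => μ (r e), ⟨fun a => ?_, fun c hc hb => ?_⟩, ?_⟩
  · rw [key]; exact h.even _
  · obtain ⟨a, rfl⟩ := h.full c hc hb
    have h1 := hC.2.2 (dl G l r (fun f => a f * β f)) (h.even _) (by
      intro e he
      by_cases hE : e ∈ G.edgeSet
      · have hl := h0 e hE he
        rw [dl_edge _ _ _ hE] at he ⊢
        have hr : β (r e) = 0 := by rw [hl, zero_add] at he; exact he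
        rw [hl, hr]; simp
      · exact dl_sup _ _ _ _ _ hE)
    have : ∃ t : ZMod 2, ∀ e ∈ G.edgeSet, (β (l e) ≠ 0 -> a (l e) = t) ∧ (β (r e) ≠ 0 -> a (r e) = t) := by
      have main : ∀ t : ZMod 2, (∀ e ∈ G.edgeSet, dl G l r β e ≠ 0 -> dl G l r (fun f => a f * β f) e = t) →
        ∀ e ∈ G.edgeSet, (β (l e) ≠ 0 -> a (l e) = t) ∧ (β (r e) ≠ 0 -> a (r e) = t) := by
        intro t ht e he
        have h2 := ht e he
        have h3 := h0 e he
        rw [dl_edge _ _ _ he] at h2 h3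
        rw [dl_edge _ _ _ he] at h2
        rcases z2cases (β (l e)) with hl | hl <;> rcases z2cases (β (r e)) with hr | hr
        · simp [hl, hr]
        · simp [hl, hr] at h2 ⊢; exact h2
        · simp [hl, hr] at h2 ⊢; exact h2
        · rw [hl, hr] at h3; exact absurd (h3 (z2 1)) one_ne_zero
      rcases h1 with h1 | h1
      · exact ⟨0, main 0 fun e _ _ => by rw [h1]; rfl⟩
      · exact ⟨1, main 1 fun e _ hne => by rw [h1]; exact z2ne hne⟩
    obtain ⟨t, ht⟩ := this
    refine ⟨fun x => x.elim t a, ?_⟩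
    rw [key]
    ext e
    by_cases hE : e ∈ G.edgeSet
    · rw [dl_edge _ _ _ hE, dl_edge _ _ _ hE]
      obtain ⟨t1, t2⟩ := ht e hE
      congr 1
      · by_cases hz : β (l e) = 0
        · simp [μ, hz]
        · simp [μ, hz, t1 hz]
      · by_cases hz : β (r e) = 0
        · simp [μ, hz]
        · simp [μ, hz, t2 hz]
    · rw [dl_sup _ _ _ _ _ hE, dl_sup _ _ _ _ _ hE]
  · intro e he
    have hE : e ∈ G.edgeSet := by by_contra hh; exact he (dl_sup _ _ _ _ _ hh)
    rw [dl_edge _ _ _ hE] at he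
    by_cases hz : β (l e) = 0
    · right
      have : β (r e) ≠ 0 := by intro h'; exact he (by rw [hz, h', add_zero])
      simp [μ, this]
    · left; simp [μ, hz]

theorem lemmaS {G : SimpleGraph V} {l r : Sym2 V -> F} (h : IsRep G l r) (β : F -> ZMod 2)
    {c : Sym2 V -> ZMod 2} (hc : Sup G.edgeSet c) (hb : bd c = 0) (v : V)
    (hv : ∀ u, dl G l r β s(v, u) = 0) : ∑ u, c s(v, u) * β (l s(v, u)) = 0 := by
  obtain ⟨a, rfl⟩ := h.full c hc hb
  have h1 := congrFun (h.even (fun f => a f * β f)) v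
  rw [bd_apply] at h1
  rw [Pi.zero_apply] at h1
  rw [← h1]
  refine Finset.sum_congr rfl fun u _ => ?_
  by_cases hE : s(v, u) ∈ G.edgeSet
  · have h2 := hv u
    rw [dl_edge _ _ _ hE] at h2 ⊢
    rw [dl_edge _ _ _ hE, z2eq.1 h2]
    ring
  · rw [dl_sup _ _ _ _ _ hE, dl_sup _ _ _ _ _ hE, zero_mul]

/-- adding a chord in a face -/
def chL (l : Sym2 V -> F) (p q : V) (f : F) (S : Sym2 V -> ZMod 2) : Sym2 V -> Option F :=
  fun e => if e = s(p, q) then some f else if S e ≠ 0 ∧ l e = f then none else some (l e)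
def chR (r : Sym2 V -> F) (p q : V) (f : F) (S : Sym2 V -> ZMod 2) : Sym2 V -> Option F :=
  fun e => if e = s(p, q) then none else if S e ≠ 0 ∧ r e = f then none else some (r e)

theorem chord {G : SimpleGraph V} {l r : Sym2 V -> F} (h : IsRep G l r) {p q : V} (hpq : p ≠ q)
    (hE : ¬ G.Adj p q) (f : F) (S : Sym2 V -> ZMod 2) (hS : Sup G.edgeSet S) (hb : bd S = sv p + sv q)
    (hf : ∀ e, S e ≠ 0 -> (l e = f ∧ r e ≠ f) ∨ (l e ≠ f ∧ r e = f)) :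
    IsRep (G ⊔ SimpleGraph.edge p q) (chL l p q f S) (chR r p q f S) := by
  have hes : (G ⊔ SimpleGraph.edge p q).edgeSet = G.edgeSet ∪ {s(p, q)} := by
    rw [edgeSet_sup, edge_edgeSet_of_ne hpq]
  have hne : ∀ e ∈ G.edgeSet, e ≠ s(p, q) := by rintro e he rfl; exact hE he
  have key : ∀ a, dl (G ⊔ SimpleGraph.edge p q) (chL l p q f S) (chR r p q f S) a =
      dl G l r (fun x => a (some x)) + (a (some f) + a none) • (S + sg s(p, q)) := by
    intro a
    ext e
    by_cases he : e = s(p, q)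
    · subst he
      have h1 : s(p, q) ∉ G.edgeSet := hE
      simp [dl, hes, chL, chR, hS _ h1, hE]
    · simp only [dl, hes, Set.mem_union, Set.mem_singleton_iff, he, or_false, chL, chR, if_false, Pi.add_apply,
        Pi.smul_apply, Pi.single_apply, add_zero, smul_eq_mul]
      by_cases hG : e ∈ G.edgeSet
      · simp only [hG, if_true]
        by_cases hs : S e = 0
        · simp [hs]
        · rw [z2ne hs, mul_one]
          rcases hf e hs with ⟨h1, h2⟩ | ⟨h1, h2⟩
          · simp only [h1, h2, ne_eq, one_ne_zero, not_false_eq_true, and_self, if_true, and_false, if_false]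
            have := z2 (a (some f)); linear_combination -this
          · simp only [h1, h2, ne_eq, one_ne_zero, not_false_eq_true, and_self, if_true, and_false, if_false]
            have := z2 (a (some f)); linear_combination -this
      · simp [hG, hS _ hG]
  have hbb : bd (S + sg s(p, q)) = 0 := by
    rw [map_add, hb, bd_sg hpq]; ext v
    exact z2 _
  refine ⟨fun a => ?_, fun c hc hcb => ?_⟩
  · rw [key, map_add, h.even, map_smul, hbb, smul_zero, add_zero]
  · rw [hes] at hc
    obtain ⟨a, ha⟩ := h.full (c + c s(p, q) • (S + sg s(p, q))) (by
      intro e he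
      by_cases h1 : e = s(p, q)
      · subst h1
        simp [hS _ he, z2]
      · have : c e = 0 := hc e (by simp [h1, he])
        simp [this, hS _ he, Pi.single_apply, h1]) (by
      rw [map_add, hcb, map_smul, hbb, smul_zero, add_zero])
    refine ⟨fun x => x.elim (a f + c s(p, q)) a, ?_⟩
    rw [key]
    have e1 : ((fun x : Option F => x.elim (a f + c s(p, q)) a) (some f) +
      (fun x : Option F => x.elim (a f + c s(p, q)) a) none) = c s(p, q) := by
      simp only [Option.elim]
      have := z2 (a f); linear_combination this
    rw [e1]
    have e2 : (fun x => (fun x : Option F => x.elim (a f + c s(p, q)) a) (some x)) = a := rfl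
    rw [e2, ← ha]
    ext e
    simp only [Pi.add_apply]
    have := z2 ((c s(p, q) • (S + sg s(p, q))) e)
    simp only [Pi.add_apply, Pi.smul_apply] at this ⊢
    linear_combination -this

end ops

section count
variable {V : Type*} [Fintype V] {F : Type}

theorem euler {G : SimpleGraph V} {l r : Sym2 V -> F} (h : IsRep G l r) (g : ℕ) (x : V)
    (hcard : Fintype.card V ≤ G.edgeFinset.card)
    (hg : ∀ c, Sup G.edgeSet c -> bd c = 0 -> c ≠ 0 -> g ≤ (Finset.univ.filter (fun e => c e ≠ 0)).card) :
    g * (G.edgeFinset.card + 2) ≤ 2 * G.edgeFinset.card + g * Fintype.card V := by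
  let E := G.edgeFinset
  let K : Submodule (ZMod 2) (Sym2 V -> ZMod 2) :=
    { carrier := {c | Sup G.edgeSet c}
      add_mem' := fun h h' => h.add h'
      zero_mem' := fun _ _ => rfl
      smul_mem' := fun a _ h => h.smul a }
  have hKE : G.edgeFinset.card ≤ Module.finrank (ZMod 2) K := by
    have : LinearIndependent (ZMod 2) (fun e : G.edgeFinset => (⟨sg e.1, Sup.sg (mem_edgeFinset.1 e.2)⟩ : K)) := by
      refine LinearIndependent.of_comp K.subtype ?_
      have h1 := (Pi.basisFun (ZMod 2) (Sym2 V)).linearIndependent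
      have h2 := h1.comp (fun e : G.edgeFinset => e.1) Subtype.val_injective
      convert h2 using 1
      ext e e'
      simp
    have := this.fintype_card_le_finrank
    rwa [Fintype.card_coe] at this
  let B : K →ₗ[ZMod 2] (V -> ZMod 2) := bd.domRestrict K
  have hrn := B.finrank_range_add_finrank_ker
  have hran : Module.finrank (ZMod 2) (LinearMap.range B) < Fintype.card V := by
    have : Module.finrank (ZMod 2) (V -> ZMod 2) = Fintype.card V := Module.finrank_pi _
    rw [← this]
    apply Submodule.finrank_lt
    intro htop
    have hx : sv x ∈ LinearMap.range B := by rw [htop]; trivial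
    obtain ⟨⟨c, hc⟩, hcx⟩ := hx
    have h1 := sum_bd c (K := G) hc Set.univ (fun _ _ _ _ _ => trivial)
    have h2 : bd c = sv x := hcx
    simp [h2] at h1
  -- faces
  let Fs : Finset F := (G.edgeFinset.image l) ∪ (G.edgeFinset.image r)
  let d : F -> Sym2 V -> ZMod 2 := fun f => dl G l r (Pi.single f 1)
  let Fn : Finset F := Fs.filter (fun f => d f ≠ 0)
  have hspan : ∀ a, dl G l r a = ∑ f ∈ Fn, a f • d f := by
    intro a
    have h1 : ∑ f ∈ Fn, a f • d f = ∑ f ∈ Fs, a f • d f := by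
      refine Finset.sum_subset (Finset.filter_subset _ _) ?_
      intro f hf hf'
      have : d f = 0 := by
        by_contra hh; exact hf' (Finset.mem_filter.2 ⟨hf, hh⟩)
      rw [this, smul_zero]
    rw [h1]
    ext e
    by_cases hE : e ∈ G.edgeSet
    · rw [dl_edge _ _ _ hE, Finset.sum_apply]
      have hl : l e ∈ Fs := Finset.mem_union_left _ (Finset.mem_image_of_mem _ (by simpa using hE))
      have hr : r e ∈ Fs := Finset.mem_union_right _ (Finset.mem_image_of_mem _ (by simpa using hE))
      simp only [Pi.smul_apply, smul_eq_mul, d, dl_edge _ _ _ hE, Pi.single_apply, mul_add, Finset.sum_add_distrib,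
        mul_ite, mul_one, mul_zero, Finset.sum_ite_eq, hl, hr, if_true]
    · rw [dl_sup _ _ _ _ _ hE, Finset.sum_apply]
      symm
      refine Finset.sum_eq_zero fun f _ => ?_
      simp [d, dl_sup _ _ _ _ _ hE]
  have hker : Module.finrank (ZMod 2) (LinearMap.ker B) + 1 ≤ Fn.card := by
    have hkerpos : 1 ≤ Module.finrank (ZMod 2) (LinearMap.ker B) := by omega
    have hFne : Fn.Nonempty := by
      by_contra hh
      rw [Finset.not_nonempty_iff_eq_empty] at hh
      have : LinearMap.ker B = ⊥ := by
        rw [eq_bot_iff]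
        rintro ⟨c, hc⟩ hcb
        obtain ⟨a, ha⟩ := h.full c hc hcb
        rw [hspan, hh, Finset.sum_empty] at ha
        simp [ha]
      rw [this] at hkerpos
      simp at hkerpos
    obtain ⟨f0, hf0⟩ := hFne
    have h1 : (LinearMap.ker B).map K.subtype ≤ Submodule.span (ZMod 2) (((Fn.erase f0).image d : Finset (Sym2 V -> ZMod 2)) : Set (Sym2 V -> ZMod 2)) := by
      rintro c ⟨⟨c, hc⟩, hcb, rfl⟩
      obtain ⟨a, ha⟩ := h.full c hc hcb
      have h2 : dl G l r a = dl G l r (a + fun _ => a f0) := by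
        rw [dl_add]
        have : dl G l r (fun _ => a f0) = 0 := by
          ext e; simp only [dl, z2, ite_self, Pi.zero_apply]
        rw [this, add_zero]
      change c ∈ _
      rw [ha, h2, hspan]
      refine Submodule.sum_mem _ fun f hf => ?_
      by_cases hff : f = f0
      · subst hff
        simp only [Pi.add_apply, z2, zero_smul]
        exact Submodule.zero_mem _
      · refine Submodule.smul_mem _ _ (Submodule.subset_span ?_)
        exact Finset.mem_coe.2 (Finset.mem_image_of_mem _ (Finset.mem_erase.2 ⟨hff, hf⟩))
    have h2 := Submodule.finrank_mono h1
    have h3 := finrank_span_finset_le_card (R := ZMod 2) ((Fn.erase f0).image d)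
    have h4 : ((Fn.erase f0).image d).card ≤ (Fn.erase f0).card := Finset.card_image_le
    rw [Finset.card_erase_of_mem hf0] at h4
    have h5 : Module.finrank (ZMod 2) ((LinearMap.ker B).map K.subtype) = Module.finrank (ZMod 2) (LinearMap.ker B) :=
      Submodule.finrank_map_subtype_eq _ _
    have h6 : 0 < Fn.card := Finset.card_pos.2 ⟨f0, hf0⟩
    unfold Set.finrank at h3
    omega
  have hdc : ∑ f ∈ Fn, (Finset.univ.filter (fun e => d f e ≠ 0)).card ≤ 2 * G.edgeFinset.card := by
    have h1 : ∀ f ∈ Fn, (Finset.univ.filter (fun e => d f e ≠ 0)).card ≤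
        ∑ e ∈ G.edgeFinset, ((if l e = f then 1 else 0) + (if r e = f then 1 else 0)) := by
      intro f _
      rw [Finset.card_filter]
      rw [← Finset.sum_subset (Finset.subset_univ G.edgeFinset)]
      · refine Finset.sum_le_sum fun e he => ?_
        have he' : e ∈ G.edgeSet := by simpa using he
        simp only [d, dl_edge _ _ _ he', Pi.single_apply]
        by_cases h1 : l e = f <;> by_cases h2 : r e = f <;> simp [h1, h2, z2]
      · intro e _ he
        have he' : e ∉ G.edgeSet := by simpa using he
        simp [d, dl_sup _ _ _ _ _ he']
    refine (Finset.sum_le_sum h1).trans ?_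
    rw [Finset.sum_comm]
    have : ∀ e ∈ G.edgeFinset, ∑ f ∈ Fn, ((if l e = f then 1 else 0) + (if r e = f then 1 else 0)) ≤ 2 := by
      intro e _
      rw [Finset.sum_add_distrib, Finset.sum_ite_eq, Finset.sum_ite_eq]
      split_ifs <;> simp
    refine (Finset.sum_le_sum this).trans ?_
    simp [mul_comm]
  have hgl : g * Fn.card ≤ ∑ f ∈ Fn, (Finset.univ.filter (fun e => d f e ≠ 0)).card := by
    rw [mul_comm, ← smul_eq_mul]
    refine Finset.card_nsmul_le_sum _ _ _ fun f hf => ?_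
    exact hg _ (dl_sup _ _ _ _) (h.even _) (Finset.mem_filter.1 hf).2
  have hfin : G.edgeFinset.card + 2 ≤ Fn.card + Fintype.card V := by omega
  have : g * (G.edgeFinset.card + 2) ≤ g * (Fn.card + Fintype.card V) := Nat.mul_le_mul_left _ hfin
  rw [mul_add g Fn.card] at this
  omega

theorem euler' {G : SimpleGraph V} {l r : Sym2 V -> F} (h : IsRep G l r) (g n m : ℕ) (x : V)
    (hn : ∀ [Fintype G.edgeSet], G.edgeFinset.card = n) (hm : Fintype.card V = m)
    (hcard : m ≤ n)
    (hg : ∀ c, Sup G.edgeSet c -> bd c = 0 -> c ≠ 0 -> g ≤ (Finset.univ.filter (fun e => c e ≠ 0)).card) :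
    g * (n + 2) ≤ 2 * n + g * m := by
  have := euler h g x (by rw [hn, hm]; exact hcard) hg
  rwa [hn, hm] at this

theorem other_edge {c : Sym2 V -> ZMod 2} (hb : bd c = 0) {a b : V} (h : c s(a, b) ≠ 0) :
    ∃ x, x ≠ b ∧ c s(a, x) ≠ 0 := by
  by_contra hh
  push Not at hh
  have := congrFun hb a
  rw [bd_apply, Finset.sum_eq_single b (fun x _ hx => hh x hx) (by simp)] at this
  exact h this

theorem no_K5 : ¬ PL (completeGraph (Fin 5)) := by
  rintro ⟨F, l, r, h⟩
  have := euler' h 3 10 5 0 (fun {_} => by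
      have h1 := card_edgeFinset_top_eq_card_choose_two (V := Fin 5)
      have h2 : (Fintype.card (Fin 5)).choose 2 = 10 := by simp; rfl
      rw [h2] at h1
      rw [← h1]
      congr!) (by simp) (by norm_num) (by
    intro c hc hb hne
    obtain ⟨e, he⟩ := Function.ne_iff.1 hne
    induction e with
    | h a b =>
    have hab : a ≠ b := by
      rintro rfl; exact he (hc _ (by simp))
    obtain ⟨x, hx, hcx⟩ := other_edge hb he
    obtain ⟨y, hy, hcy⟩ := other_edge hb (a := b) (b := a) (by rwa [Sym2.eq_swap])
    have : ({s(a, b), s(a, x), s(b, y)} : Finset (Sym2 (Fin 5))).card = 3 := by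
      rw [Finset.card_eq_three]
      refine ⟨_, _, _, ?_, ?_, ?_, rfl⟩
      · simp [Sym2.eq_iff, hx.symm]; grind
      · simp [Sym2.eq_iff]; grind
      · simp [Sym2.eq_iff]; grind
    rw [← this]
    apply Finset.card_le_card
    intro e he'
    simp only [Finset.mem_insert, Finset.mem_singleton] at he'
    rcases he' with rfl | rfl | rfl <;> simp_all)
  norm_num at this

theorem no_K33 : ¬ PL (completeBipartiteGraph (Fin 3) (Fin 3)) := by
  rintro ⟨F, l, r, h⟩
  have := euler' h 4 9 6 (Sum.inl 0) (fun {_} => by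
      have h1 := encard_edgeSet_completeBipartiteGraph (W₁ := Fin 3) (W₂ := Fin 3)
      rw [← coe_edgeFinset, Set.encard_coe_eq_coe_finsetCard] at h1
      simp only [ENat.card_eq_coe_fintype_card, Fintype.card_fin] at h1
      exact_mod_cast h1) (by simp) (by norm_num) (by
    intro c hc hb hne
    have hadj : ∀ a b, c s(a, b) ≠ 0 -> (a.isLeft ∧ b.isRight ∨ a.isRight ∧ b.isLeft) := by
      intro a b hh
      by_contra h'
      exact hh (hc _ h')
    obtain ⟨e, he⟩ := Function.ne_iff.1 hne
    induction e with
    | h a b =>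
    obtain ⟨x, hx, hcx⟩ := other_edge hb he
    obtain ⟨y, hy, hcy⟩ := other_edge hb (a := b) (b := a) (by rwa [Sym2.eq_swap])
    obtain ⟨z, hz, hcz⟩ := other_edge hb (a := x) (b := a) (by rwa [Sym2.eq_swap])
    have a1 := hadj _ _ he
    have a2 := hadj _ _ hcx
    have a3 := hadj _ _ hcy
    have a4 := hadj _ _ hcz
    have dis : ∀ u v : Fin 3 ⊕ Fin 3, u.isLeft -> v.isRight -> u ≠ v := by
      rintro u v hu hv rfl
      cases u <;> simp_all
    have hab : a ≠ b := by rcases a1 with h | h <;> [exact dis _ _ h.1 h.2; exact (dis _ _ h.2 h.1).symm]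
    have hax : a ≠ x := by rcases a2 with h | h <;> [exact dis _ _ h.1 h.2; exact (dis _ _ h.2 h.1).symm]
    have hby : b ≠ y := by rcases a3 with h | h <;> [exact dis _ _ h.1 h.2; exact (dis _ _ h.2 h.1).symm]
    have hxz : x ≠ z := by rcases a4 with h | h <;> [exact dis _ _ h.1 h.2; exact (dis _ _ h.2 h.1).symm]
    have : ({s(a, b), s(a, x), s(b, y), s(x, z)} : Finset (Sym2 (Fin 3 ⊕ Fin 3))).card = 4 := by
      rw [Finset.card_eq_succ]
      refine ⟨s(a, b), {s(a, x), s(b, y), s(x, z)}, ?_, rfl, ?_⟩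
      · simp [Sym2.eq_iff]; grind
      · rw [Finset.card_eq_three]
        refine ⟨_, _, _, ?_, ?_, ?_, rfl⟩
        · simp [Sym2.eq_iff]; grind
        · simp [Sym2.eq_iff]; grind
        · simp [Sym2.eq_iff]; grind
    rw [← this]
    apply Finset.card_le_card
    intro e he'
    simp only [Finset.mem_insert, Finset.mem_singleton] at he'
    rcases he' with rfl | rfl | rfl | rfl <;> simp_all)
  norm_num at this

end count

/-- no Kuratowski minors -/
def KF {V : Type*} (G : SimpleGraph V) : Prop :=
  ¬ HasMinor G (completeGraph (Fin 5)) ∧ ¬ HasMinor G (completeBipartiteGraph (Fin 3) (Fin 3))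

theorem KF.mono {V : Type*} {G H : SimpleGraph V} (h : KF G) (hle : H ≤ G) : KF H :=
  ⟨fun hh => h.1 (HasMinor.mono hh hle), fun hh => h.2 (HasMinor.mono hh hle)⟩

theorem KF.minor {V W : Type*} {G : SimpleGraph V} {H : SimpleGraph W} (h : KF G) (hm : HasMinor G H) : KF H :=
  ⟨fun hh => h.1 (HasMinor.trans hm hh), fun hh => h.2 (HasMinor.trans hm hh)⟩

section glue2
variable {V : Type*} [Fintype V] {F : Type}

theorem rst_sup (E : Set (Sym2 V)) (c : Sym2 V -> ZMod 2) : Sup E (rst E c) :=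
  fun e he => by simp [rst, he]

theorem glueS {F₁ F₂ : Type} {G₁ G₂ : SimpleGraph V} {l₁ r₁ : Sym2 V -> F₁} {l₂ r₂ : Sym2 V -> F₂}
    (h₁ : IsRep G₁ l₁ r₁) (h₂ : IsRep G₂ l₂ r₂) (o₁ : F₁) (o₂ : F₂)
    (c₁ : ∀ e ∈ G₁.edgeSet, e ∈ G₂.edgeSet -> l₁ e = o₁ ∨ r₁ e = o₁)
    (c₂ : ∀ e ∈ G₁.edgeSet, e ∈ G₂.edgeSet -> l₂ e = o₂ ∨ r₂ e = o₂)
    (S : Set V) (x0 : V) (hK : ∀ t ∈ S, (G₁ ⊓ G₂).Reachable x0 t)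
    (hS : ∀ v ∉ S, (∀ u, G₁.Adj v u -> G₂.Adj v u) ∨ (∀ u, ¬ G₂.Adj v u)) :
    PL (G₁ ⊔ G₂) := by
  refine glue h₁ h₂ o₁ o₂ c₁ c₂ ?_
  intro c hc hb
  have := tjoin (K := G₁ ⊓ G₂) (x0 := x0) (bd (rst (G₁.edgeSet \ G₂.edgeSet) c)) (by
    have := sum_bd (rst (G₁.edgeSet \ G₂.edgeSet) c) (K := G₁)
      ((rst_sup _ _).mono Set.diff_subset) Set.univ (fun _ _ _ _ _ => trivial)
    simpa using this) (by
    intro v hv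
    refine hK v ?_
    by_contra hvS
    apply hv
    rcases hS v hvS with h | h
    · rw [bd_apply]
      refine Finset.sum_eq_zero fun u _ => ?_
      simp only [rst]
      rw [if_neg]
      rintro ⟨h1, h2⟩
      exact h2 (h u h1)
    · rw [← Pi.zero_apply (M := fun _ => ZMod 2) v, ← hb, bd_apply, bd_apply]
      refine Finset.sum_congr rfl fun u _ => ?_
      simp only [rst]
      by_cases h1 : s(v, u) ∈ G₁.edgeSet
      · have : s(v, u) ∉ G₂.edgeSet := h u
        simp [h1, this]
      · have : s(v, u) ∉ G₂.edgeSet := h u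
        rw [if_neg (by simp [h1])]
        exact (hc _ (by simp [h1, this])).symm)
  obtain ⟨k, h1, h2⟩ := this
  refine ⟨k, h1.mono ?_, h2.symm⟩
  rw [edgeSet_inf]

theorem rep_ne {G : SimpleGraph V} {l r : Sym2 V -> F} (h : IsRep G l r) {c : Sym2 V -> ZMod 2}
    (hc : Sup G.edgeSet c) (hb : bd c = 0) {e : Sym2 V} (he : c e ≠ 0) : l e ≠ r e := by
  obtain ⟨a, rfl⟩ := h.full c hc hb
  intro hh
  have hE : e ∈ G.edgeSet := by by_contra h'; exact he (hc _ h')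
  rw [dl_edge _ _ _ hE, hh, z2] at he
  exact he rfl

theorem PL_bot : PL (⊥ : SimpleGraph V) :=
  ⟨Unit, fun _ => (), fun _ => (), fun a => by
    have : dl (⊥ : SimpleGraph V) (fun _ => ()) (fun _ => ()) a = 0 := by ext e; simp [dl]
    rw [this, map_zero], fun c hc _ => ⟨0, by ext e; rw [hc e (by simp)]; simp [dl]⟩⟩

theorem PL_edge {p q : V} (h : p ≠ q) : PL (SimpleGraph.edge p q) := by
  refine ⟨Unit, fun _ => (), fun _ => (), fun a => ?_, fun c hc hb => ⟨0, ?_⟩⟩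
  · have : dl (SimpleGraph.edge p q) (fun _ => ()) (fun _ => ()) a = 0 := by
      ext e; simp only [dl, z2, ite_self, Pi.zero_apply]
    rw [this, map_zero]
  · rw [edge_edgeSet_of_ne h] at hc
    have h1 : c = c s(p, q) • sg s(p, q) := by
      ext e
      by_cases he : e = s(p, q)
      · subst he; simp
      · rw [hc e (by simpa using he)]; simp [Pi.single_apply, he]
    have h2 := congrFun hb p
    rw [h1, map_smul, bd_sg h] at h2
    simp [Pi.single_apply, h] at h2
    rw [h1, h2]; ext e; simp [dl]

/-- triangle -/
def tri (v p q : V) : SimpleGraph V := SimpleGraph.edge v p ⊔ SimpleGraph.edge v q ⊔ SimpleGraph.edge p q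

theorem PL_tri {v p q : V} (h1 : v ≠ p) (h2 : v ≠ q) (h3 : p ≠ q) :
    ∃ l r : Sym2 V -> Bool, IsRep (tri v p q) l r := by
  have hE : (tri v p q).edgeSet = {s(v, p), s(v, q), s(p, q)} := by
    rw [tri, edgeSet_sup, edgeSet_sup, edge_edgeSet_of_ne h1, edge_edgeSet_of_ne h2, edge_edgeSet_of_ne h3]
    ext e; simp; tauto
  have d1 : s(v, p) ≠ s(v, q) := by simp [Sym2.eq_iff]; grind
  have d2 : s(v, p) ≠ s(p, q) := by simp [Sym2.eq_iff]; grind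
  have d3 : s(v, q) ≠ s(p, q) := by simp [Sym2.eq_iff]; grind
  have exp : ∀ c, Sup (tri v p q).edgeSet c -> c = c s(v, p) • sg s(v, p) + c s(v, q) • sg s(v, q) + c s(p, q) • sg s(p, q) := by
    intro c hc
    ext e
    by_cases e1 : e = s(v, p)
    · subst e1; simp [Pi.single_apply, d1, d2]
    by_cases e2 : e = s(v, q)
    · subst e2; simp [Pi.single_apply, d1.symm, d3]
    by_cases e3 : e = s(p, q)
    · subst e3; simp [Pi.single_apply, d2.symm, d3.symm]
    rw [hc e (by rw [hE]; simp [e1, e2, e3])]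
    simp [Pi.single_apply, e1, e2, e3]
  refine ⟨fun _ => false, fun _ => true, fun a => ?_, fun c hc hb => ?_⟩
  · rw [exp _ (dl_sup _ _ _ _), dl_edge _ _ _ (by rw [hE]; simp), dl_edge _ _ _ (by rw [hE]; simp),
      dl_edge _ _ _ (by rw [hE]; simp), map_add, map_add, map_smul, map_smul, map_smul, bd_sg h1, bd_sg h2, bd_sg h3]
    ext w
    simp only [Pi.add_apply, Pi.smul_apply, smul_eq_mul, Pi.zero_apply]
    have t1 := z2 ((a false + a true) * sv v w)
    have t2 := z2 ((a false + a true) * sv p w)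
    have t3 := z2 ((a false + a true) * sv q w)
    linear_combination t1 + t2 + t3
  · have hb' := hb
    rw [exp c hc, map_add, map_add, map_smul, map_smul, map_smul, bd_sg h1, bd_sg h2, bd_sg h3] at hb'
    have e1 := congrFun hb' v
    have e2 := congrFun hb' p
    simp [Pi.single_apply, h1, h2, h3, h1.symm, h3.symm] at e1 e2
    rw [z2eq] at e1 e2
    refine ⟨fun b => if b then c s(v, p) else 0, ?_⟩
    ext e
    by_cases he : e ∈ (tri v p q).edgeSet
    · rw [dl_edge _ _ _ he]
      rw [hE] at he
      simp only [Set.mem_insert_iff, Set.mem_singleton_iff] at he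
      rcases he with rfl | rfl | rfl
      · simp
      · simp [e1]
      · simp [e2]
    · rw [hc e he, dl_sup _ _ _ _ _ he]

end glue2

section contract
variable {V : Type*} [Fintype V]

/-- contract `y` into `x`, same vertex set -/
def ctr (G : SimpleGraph V) (x y : V) : SimpleGraph V where
  Adj a b := a ≠ b ∧ a ≠ y ∧ b ≠ y ∧ (G.Adj a b ∨ (a = x ∧ G.Adj y b) ∨ (b = x ∧ G.Adj a y))
  symm := ⟨fun a b h => ⟨h.1.symm, h.2.2.1, h.2.1, by
    rcases h.2.2.2 with h | h | h
    · exact Or.inl h.symm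
    · exact Or.inr (Or.inr ⟨h.1, h.2.symm⟩)
    · exact Or.inr (Or.inl ⟨h.1, h.2.symm⟩)⟩⟩
  loopless := ⟨fun a h => h.1 rfl⟩

theorem ctr_minor {W : Type*} {G : SimpleGraph V} {x y : V} (hxy : G.Adj x y) {H : SimpleGraph W}
    (hH : ∀ w, ∃ w', H.Adj w w') (h : HasMinor (ctr G x y) H) : HasMinor G H := by
  rw [hasMinor_iff] at h ⊢
  obtain ⟨f, h1, h2, h3⟩ := h
  have hy : ∀ w, y ∉ f w := by
    intro w hw
    obtain ⟨w', hw'⟩ := hH w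
    obtain ⟨a, ha, b, hb, hab⟩ := h3 hw'
    have : ∀ v ∈ f w, v = y := (h1 w).closed (fun v => v = y) hw rfl (by
      rintro a _ b _ hab rfl
      exact (hab.2.1 rfl).elim)
    exact hab.2.1 (this a ha)
  let g : W -> Set V := fun w => if x ∈ f w then insert y (f w) else f w
  have hsub : ∀ w, f w ⊆ g w := by
    intro w; simp only [g]; split_ifs
    · exact Set.subset_insert _ _
    · exact le_rfl
  have hg : ∀ w v, v ∈ g w ↔ v ∈ f w ∨ (v = y ∧ x ∈ f w) := by
    intro w v; simp only [g]; split_ifs with hh <;> simp [hh]; tauto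
  have step : ∀ w a b, (ctr G x y).Adj a b -> a ∈ f w -> b ∈ f w -> (ins G (g w)).Reachable a b := by
    rintro w a b ⟨_, _, _, h | ⟨rfl, h⟩ | ⟨rfl, h⟩⟩ ha hb
    · exact Adj.reachable ⟨h, hsub w ha, hsub w hb⟩
    · have hy : y ∈ g w := (hg _ _).2 (Or.inr ⟨rfl, ha⟩)
      have e1 : (ins G (g w)).Adj a y := ⟨hxy, hsub w ha, hy⟩
      have e2 : (ins G (g w)).Adj y b := ⟨h, hy, hsub w hb⟩
      exact e1.reachable.trans e2.reachable
    · have hy : y ∈ g w := (hg _ _).2 (Or.inr ⟨rfl, hb⟩)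
      have e1 : (ins G (g w)).Adj a y := ⟨h, hsub w ha, hy⟩
      have e2 : (ins G (g w)).Adj y b := ⟨hxy.symm, hy, hsub w hb⟩
      exact e1.reachable.trans e2.reachable
  refine ⟨g, fun w => ?_, fun w w' hne => ?_, fun w w' hh => ?_⟩
  · obtain ⟨v0, hv0⟩ := (h1 w).1
    have key : ∀ v ∈ f w, (ins G (g w)).Reachable v0 v :=
      (h1 w).closed _ hv0 (Reachable.refl _) (fun a ha b hb hab ih => ih.trans (step w a b hab ha hb))
    have key2 : ∀ v ∈ g w, (ins G (g w)).Reachable v0 v := by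
      intro v hv
      rcases (hg _ _).1 hv with h | ⟨rfl, hx⟩
      · exact key v h
      · exact (key x hx).trans (Adj.reachable ⟨hxy, hsub w hx, hv⟩)
    exact ⟨⟨v0, hsub w hv0⟩, fun a ha b hb => (key2 a ha).symm.trans (key2 b hb)⟩
  · rw [Set.disjoint_left]
    intro v hv hv'
    have hd := Set.disjoint_left.1 (h2 w w' hne)
    rcases (hg _ _).1 hv with h | ⟨rfl, hx⟩ <;> rcases (hg _ _).1 hv' with h' | ⟨h', hx'⟩
    · exact hd h h'
    · subst h'; exact hy _ h
    · exact hy _ h'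
    · exact hd hx hx'
  · obtain ⟨a, ha, b, hb, hne, _, _, h | ⟨rfl, h⟩ | ⟨rfl, h⟩⟩ := h3 hh
    · exact ⟨a, hsub _ ha, b, hsub _ hb, h⟩
    · exact ⟨y, (hg _ _).2 (Or.inr ⟨rfl, ha⟩), b, hsub _ hb, h⟩
    · exact ⟨a, hsub _ ha, y, (hg _ _).2 (Or.inr ⟨rfl, hb⟩), h⟩

theorem KF.ctr {G : SimpleGraph V} (h : KF G) {x y : V} (hxy : G.Adj x y) : KF (ctr G x y) := by
  constructor
  · refine fun hh => h.1 (ctr_minor hxy ?_ hh)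
    intro w
    exact ⟨w + 1, by simp [completeGraph]⟩
  · refine fun hh => h.2 (ctr_minor hxy ?_ hh)
    rintro (w | w)
    · exact ⟨Sum.inr 0, by simp⟩
    · exact ⟨Sum.inl 0, by simp⟩

theorem ctr_card {G : SimpleGraph V} {x y : V} (hxy : G.Adj x y) :
    (ctr G x y).edgeSet.ncard < G.edgeSet.ncard := by
  let π : V -> V := fun v => if v = y then x else v
  have h1 : (ctr G x y).edgeSet ⊆ (Sym2.map π) '' (G.edgeSet \ {s(x, y)}) := by
    intro e
    induction e with
    | h a b =>
    rintro ⟨hne, ha, hb, h | ⟨rfl, h⟩ | ⟨rfl, h⟩⟩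
    · refine ⟨s(a, b), ⟨h, ?_⟩, by simp [π, ha, hb]⟩
      simp [Sym2.eq_iff]; grind
    · refine ⟨s(y, b), ⟨h, ?_⟩, by simp [π, hb]⟩
      simp [Sym2.eq_iff]; grind
    · refine ⟨s(a, y), ⟨h, ?_⟩, by simp [π, ha]⟩
      simp [Sym2.eq_iff]; grind
  have h2 : (G.edgeSet \ {s(x, y)}).ncard < G.edgeSet.ncard := by
    refine Set.ncard_lt_ncard ?_ (Set.toFinite _)
    refine ⟨Set.diff_subset, fun hh => ?_⟩
    exact (hh (show s(x, y) ∈ G.edgeSet from hxy)).2 rfl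
  exact ((Set.ncard_le_ncard h1 (Set.toFinite _)).trans (Set.ncard_image_le (Set.toFinite _))).trans_lt h2

end contract

section minimal
variable {V : Type*} [Fintype V]

/-- minimal counterexample -/
structure Mn (G : SimpleGraph V) : Prop where
  kf : KF G
  npl : ¬ PL G
  ih : ∀ H : SimpleGraph V, H.edgeSet.ncard < G.edgeSet.ncard -> KF H -> PL H

theorem Mn.sub {G H : SimpleGraph V} (h : Mn G) (hle : H ≤ G) {e : Sym2 V} (he : e ∈ G.edgeSet) (he' : e ∉ H.edgeSet) :
    PL H := by
  refine h.ih H (Set.ncard_lt_ncard ?_ (Set.toFinite _)) (h.kf.mono hle)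
  exact ⟨edgeSet_subset_edgeSet.2 hle, fun hh => he' (hh he)⟩

/-- edges of `G` satisfying a predicate -/
def fl (G : SimpleGraph V) (P : Sym2 V -> Prop) : SimpleGraph V where
  Adj a b := G.Adj a b ∧ P s(a, b)
  symm := ⟨fun a b h => ⟨h.1.symm, by rw [Sym2.eq_swap]; exact h.2⟩⟩
  loopless := ⟨fun a h => G.loopless.irrefl _ h.1⟩

theorem fl_le (G : SimpleGraph V) (P : Sym2 V -> Prop) : fl G P ≤ G := fun _ _ h => h.1

theorem mem_fl {G : SimpleGraph V} {P : Sym2 V -> Prop} {e : Sym2 V} : e ∈ (fl G P).edgeSet ↔ e ∈ G.edgeSet ∧ P e := by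
  induction e with
  | h a b => rfl

/-- nonisolated -/
def NI (G : SimpleGraph V) (v : V) : Prop := ∃ u, G.Adj v u

theorem Mn.c2 {G : SimpleGraph V} (h : Mn G) {x y : V} (hxy : x = y ∨ G.Adj x y) {u w : V}
    (hu : NI G u) (hw : NI G w) (hux : u ≠ x) (huy : u ≠ y) (hwx : w ≠ x) (hwy : w ≠ y) :
    (ins G {x, y}ᶜ).Reachable u w := by
  by_contra hnr
  let A : Set V := {a | (ins G {x, y}ᶜ).Reachable u a}
  have hA : ∀ a ∈ A, a ≠ x ∧ a ≠ y := by
    intro a ha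
    have := reach_ins_mem ha (by simp [hux, huy])
    simpa using this
  have hcl : ∀ a ∈ A, ∀ b, G.Adj a b -> b ≠ x -> b ≠ y -> b ∈ A := by
    intro a ha b hab h1 h2
    have ha' := hA a ha
    exact ha.trans (Adj.reachable ⟨hab, by simp [ha'], by simp [h1, h2]⟩)
  let G₁ := fl G (fun e => (∃ v ∈ e, v ∈ A) ∨ e = s(x, y))
  let G₂ := fl G (fun e => ¬ ∃ v ∈ e, v ∈ A)
  have hsup : G₁ ⊔ G₂ = G := by
    ext a b
    constructor
    · rintro (h | h) <;> exact h.1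
    · intro hab
      by_cases hA' : ∃ v ∈ s(a, b), v ∈ A
      · exact Or.inl ⟨hab, Or.inl hA'⟩
      · exact Or.inr ⟨hab, hA'⟩
  obtain ⟨u', hu'⟩ := hu
  obtain ⟨w', hw'⟩ := hw
  have huA : u ∈ A := Reachable.refl _
  have hwA : w ∉ A := hnr
  have hw'A : w' ∉ A := fun hh => hwA (hcl w' hh w hw'.symm hwx hwy)
  obtain ⟨F₁, l₁, r₁, h₁⟩ : PL G₁ := h.sub (fl_le _ _) (e := s(w, w')) hw' (by
    rw [mem_fl]
    rintro ⟨_, ⟨v, hv, hvA⟩ | hh⟩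
    · rcases Sym2.mem_iff.1 hv with rfl | rfl
      · exact hwA hvA
      · exact hw'A hvA
    · rw [Sym2.eq_iff] at hh
      rcases hh with hh | hh
      · exact hwx hh.1
      · exact hwy hh.1)
  obtain ⟨F₂, l₂, r₂, h₂⟩ : PL G₂ := h.sub (fl_le _ _) (e := s(u, u')) hu' (by
    rw [mem_fl]
    rintro ⟨_, hh⟩
    exact hh ⟨u, by simp, huA⟩)
  have hcom : ∀ e ∈ G₁.edgeSet, e ∈ G₂.edgeSet -> e = s(x, y) := by
    intro e h1 h2
    rw [mem_fl] at h1 h2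
    exact h1.2.resolve_left h2.2
  refine h.npl (hsup ▸ glueS h₁ h₂ (l₁ s(x, y)) (l₂ s(x, y)) (fun e h1 h2 => Or.inl (by rw [hcom e h1 h2]))
    (fun e h1 h2 => Or.inl (by rw [hcom e h1 h2])) {x, y} x ?_ ?_)
  · rintro t (rfl | rfl)
    · exact Reachable.refl _
    · rcases hxy with rfl | hxy
      · exact Reachable.refl _
      · refine Adj.reachable ⟨⟨hxy, Or.inr rfl⟩, hxy, ?_⟩
        rintro ⟨v, hv, hvA⟩
        rcases Sym2.mem_iff.1 hv with rfl | rfl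
        · exact (hA _ hvA).1 rfl
        · exact (hA _ hvA).2 rfl
  · intro v hv
    simp only [Set.mem_insert_iff, Set.mem_singleton_iff, not_or] at hv
    by_cases hvA : v ∈ A
    · right
      intro b hb
      exact hb.2 ⟨v, by simp, hvA⟩
    · left
      rintro b ⟨hb, ⟨t, ht, htA⟩ | hh⟩
      · rcases Sym2.mem_iff.1 ht with rfl | rfl
        · exact (hvA htA).elim
        · exact (hvA (hcl t htA v hb.symm hv.1 hv.2)).elim
      · rw [Sym2.eq_iff] at hh
        rcases hh with hh | hh
        · exact (hv.1 hh.1).elim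
        · exact (hv.2 hh.1).elim

theorem Mn.c1 {G : SimpleGraph V} (h : Mn G) {x u w : V}
    (hu : NI G u) (hw : NI G w) (hux : u ≠ x) (hwx : w ≠ x) :
    (ins G {x}ᶜ).Reachable u w := by
  have := h.c2 (x := x) (y := x) (Or.inl rfl) hu hw hux hux hwx hwx
  simpa using this

theorem Mn.deg3 {G : SimpleGraph V} (h : Mn G) {v p : V} (hp : G.Adj v p) (q : V) :
    ∃ t, G.Adj v t ∧ t ≠ p ∧ t ≠ q := by
  by_contra hh
  push Not at hh
  have hh : ∀ t, G.Adj v t -> t = p ∨ t = q := fun t ht => by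
    by_cases e : t = p
    · exact Or.inl e
    · exact Or.inr (hh t ht e)
  by_cases hq : G.Adj v q ∧ p ≠ q
  · obtain ⟨hq, hpq⟩ := hq
    -- degree two
    have hle : ins G {v}ᶜ ⊔ SimpleGraph.edge p q ≤ ctr G p v := by
      apply sup_le
      · rintro a b ⟨hab, ha, hb⟩
        exact ⟨hab.ne, ha, hb, Or.inl hab⟩
      · rw [edge_le_iff]
        right
        exact ⟨hpq, hp.ne', hq.ne', Or.inr (Or.inl ⟨rfl, hq⟩)⟩
    have hPL : PL (ins G {v}ᶜ ⊔ SimpleGraph.edge p q) := by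
      refine h.ih _ ?_ ((h.kf.ctr hp.symm).mono hle)
      refine lt_of_le_of_lt (Set.ncard_le_ncard (edgeSet_subset_edgeSet.2 hle) (Set.toFinite _)) (ctr_card hp.symm)
    obtain ⟨F₁, l₁, r₁, h₁⟩ := hPL
    obtain ⟨l₂, r₂, h₂⟩ := PL_tri (v := v) (p := p) (q := q) hp.ne hq.ne hpq
    have hG : G ≤ (ins G {v}ᶜ ⊔ SimpleGraph.edge p q) ⊔ tri v p q := by
      intro a b hab
      by_cases ha : a = v
      · subst ha
        right
        rcases hh b hab with rfl | rfl
        · left; left; simp [edge_adj, hab.ne]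
        · left; right; simp [edge_adj, hab.ne]
      · by_cases hb : b = v
        · subst hb
          right
          rcases hh a hab.symm with rfl | rfl
          · left; left; simp [edge_adj, hab.ne]
          · left; right; simp [edge_adj, hab.ne]
        · left; left
          exact ⟨hab, ha, hb⟩
    have hnv : ∀ b, ¬ (ins G {v}ᶜ ⊔ SimpleGraph.edge p q).Adj v b := by
      rintro b (⟨_, h1, _⟩ | h1)
      · exact h1 rfl
      · rw [edge_adj] at h1
        rcases h1.1 with ⟨rfl, _⟩ | ⟨rfl, _⟩
        · exact hp.ne rfl
        · exact hq.ne rfl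
    have hcom : ∀ e ∈ (ins G {v}ᶜ ⊔ SimpleGraph.edge p q).edgeSet, e ∈ (tri v p q).edgeSet -> e = s(p, q) := by
      intro e
      induction e with
      | h a b =>
      intro h1 h2
      have ha : a ≠ v := by rintro rfl; exact hnv _ h1
      have hb : b ≠ v := by rintro rfl; exact hnv _ h1.symm
      rcases h2 with (h2 | h2) | h2
      · rw [edge_adj] at h2; exfalso; rcases h2.1 with ⟨rfl, rfl⟩ | ⟨rfl, rfl⟩ <;> [exact ha rfl; exact hb rfl]
      · rw [edge_adj] at h2; exfalso; rcases h2.1 with ⟨rfl, rfl⟩ | ⟨rfl, rfl⟩ <;> [exact ha rfl; exact hb rfl]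
      · rw [edge_adj] at h2
        rw [Sym2.eq_iff]; exact h2.1
    refine h.npl (PL.sub (glueS h₁ h₂ (l₁ s(p, q)) (l₂ s(p, q)) (fun e h1 h2 => Or.inl (by rw [hcom e h1 h2]))
      (fun e h1 h2 => Or.inl (by rw [hcom e h1 h2])) {p, q} p ?_ ?_) hG)
    · rintro t (rfl | rfl)
      · exact Reachable.refl _
      · refine Adj.reachable ⟨Or.inr ?_, Or.inr ?_⟩ <;> simp [edge_adj, hpq]
    · intro t ht
      simp only [Set.mem_insert_iff, Set.mem_singleton_iff, not_or] at ht
      by_cases e : t = v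
      · subst e
        left
        intro b hb; exact (hnv b hb).elim
      · right
        rintro b ((h2 | h2) | h2)
        all_goals
          rw [edge_adj] at h2
          rcases h2.1 with ⟨rfl, rfl⟩ | ⟨rfl, rfl⟩ <;> simp_all
  · -- degree one
    have hh1 : ∀ t, G.Adj v t -> t = p := by
      intro t ht
      rcases hh t ht with e | rfl
      · exact e
      · by_contra hne; exact hq ⟨ht, fun e => hne e.symm⟩
    obtain ⟨F₁, l₁, r₁, h₁⟩ : PL (ins G {v}ᶜ) := h.sub (ins_le _) (e := s(v, p)) hp (fun hh => hh.2.1 rfl)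
    obtain ⟨F₂, l₂, r₂, h₂⟩ := PL_edge hp.ne
    have hG : G ≤ ins G {v}ᶜ ⊔ SimpleGraph.edge v p := by
      intro a b hab
      by_cases ha : a = v
      · subst ha
        right
        simp [edge_adj, hp.ne, hh1 b hab]
      · by_cases hb : b = v
        · subst hb
          right
          simp [edge_adj, hp.ne', hh1 a hab.symm]
        · left
          exact ⟨hab, ha, hb⟩
    have hcom : ∀ e ∈ (ins G {v}ᶜ).edgeSet, e ∈ (SimpleGraph.edge v p).edgeSet -> False := by
      intro e
      induction e with
      | h a b =>
      intro h1 h2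
      have h2 : (SimpleGraph.edge v p).Adj a b := h2
      rw [edge_adj] at h2
      rcases h2.1 with ⟨rfl, rfl⟩ | ⟨rfl, rfl⟩
      · exact h1.2.1 rfl
      · exact h1.2.2 rfl
    refine h.npl (PL.sub (glueS h₁ h₂ (l₁ s(v, p)) (l₂ s(v, p)) (fun e h1 h2 => (hcom e h1 h2).elim)
      (fun e h1 h2 => (hcom e h1 h2).elim) {p} p ?_ ?_) hG)
    · rintro t rfl; exact Reachable.refl _
    · intro t ht
      by_cases e : t = v
      · subst e; left; intro b hb; exact (hb.2.1 rfl).elim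
      · right
        intro b h2
        rw [edge_adj] at h2
        rcases h2.1 with ⟨rfl, rfl⟩ | ⟨rfl, rfl⟩ <;> simp_all

/-- (e) -/
theorem Mn.e {G : SimpleGraph V} (h : Mn G) {u x y u' : V} (hxy : G.Adj x y) (hux : G.Adj u x) (huy : G.Adj u y)
    (hu' : G.Adj u u') (h1 : u' ≠ x) (h2 : u' ≠ y) (hN : ∀ t, G.Adj u t -> t = x ∨ t = y ∨ t = u') : False := by
  let G' := fl G (fun e => e ≠ s(x, y))
  have hG' : G' ⊔ SimpleGraph.edge x y = G := by
    ext a b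
    simp only [G', fl, sup_adj, edge_adj]
    constructor
    · rintro (h | ⟨⟨rfl, rfl⟩ | ⟨rfl, rfl⟩, _⟩)
      · exact h.1
      · exact hxy
      · exact hxy.symm
    · intro hab
      by_cases e : s(a, b) = s(x, y)
      · right
        rw [Sym2.eq_iff] at e
        exact ⟨e, hab.ne⟩
      · exact Or.inl ⟨hab, e⟩
  obtain ⟨F, l, r, hrep⟩ : PL G' := h.sub (fl_le _ _) (e := s(x, y)) hxy (by rw [mem_fl]; simp)
  have a1 : G'.Adj u x := ⟨hux, by simp [Sym2.eq_iff]; grind [hux.ne, huy.ne]⟩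
  have a2 : G'.Adj u y := ⟨huy, by simp [Sym2.eq_iff]; grind [hux.ne, huy.ne]⟩
  have a3 : G'.Adj u u' := ⟨hu', by simp [Sym2.eq_iff]; grind [hux.ne, huy.ne]⟩
  -- not bridges
  have nb : ∀ y x, G.Adj u y -> G.Adj u x -> x ≠ y -> ins G {y}ᶜ ≤ G' -> (∀ w, G.Adj y w -> w ≠ x -> G'.Adj y w) →
      l s(u, y) ≠ r s(u, y) := by
    intro y x huy hux hxy hle hyw
    obtain ⟨w, hw, hwu, hwx⟩ := h.deg3 huy.symm x
    have hr := h.c1 (x := y) (u := u) (w := w) ⟨y, huy⟩ ⟨y, hw.symm⟩ huy.ne hw.ne'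
    have hK : (fl G' (fun e => e ≠ s(u, y))).Reachable u w := by
      refine hr.mono ?_
      intro a b hab
      refine ⟨hle hab, ?_⟩
      intro he
      rw [Sym2.eq_iff] at he
      rcases he with ⟨_, rfl⟩ | ⟨rfl, _⟩
      · exact hab.2.2 rfl
      · exact hab.2.1 rfl
    have hK2 : (fl G' (fun e => e ≠ s(u, y))).Adj w y := by
      refine ⟨(hyw w hw hwx).symm, ?_⟩
      simp [Sym2.eq_iff]; grind [huy.ne]
    obtain ⟨k, hk, hkb⟩ := reach_chain (hK.trans hK2.reachable)
    have huy' : G'.Adj u y := (hyw u huy.symm hux.ne).symm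
    have hc : Sup G'.edgeSet (k + sg s(u, y)) :=
      (hk.mono (edgeSet_subset_edgeSet.2 (fl_le _ _))).add (Sup.sg huy')
    refine rep_ne hrep hc ?_ ?_
    · rw [map_add, hkb, bd_sg huy.ne]; ext; exact z2 _
    · have : k s(u, y) = 0 := hk _ (by rw [mem_fl]; simp)
      simp [this]
  have insle : ∀ y', y' = x ∨ y' = y -> ins G {y'}ᶜ ≤ G' := by
    rintro y' hy' a b ⟨hab, ha, hb⟩
    refine ⟨hab, ?_⟩
    intro he
    rw [Sym2.eq_iff] at he
    have ha : a ≠ y' := ha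
    have hb : b ≠ y' := hb
    grind
  have n1 : l s(u, x) ≠ r s(u, x) := nb x y hux huy hxy.ne' (insle x (Or.inl rfl)) (by
    intro w hw hne
    exact ⟨hw, by simp [Sym2.eq_iff]; grind [hxy.ne]⟩)
  have n2 : l s(u, y) ≠ r s(u, y) := nb y x huy hux hxy.ne (insle y (Or.inr rfl)) (by
    intro w hw hne
    exact ⟨hw, by simp [Sym2.eq_iff]; grind [hxy.ne]⟩)
  -- common face suffices
  have fin : ∀ f, (l s(u, x) = f ∨ r s(u, x) = f) -> (l s(u, y) = f ∨ r s(u, y) = f) -> False := by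
    intro f hf1 hf2
    refine h.npl ?_
    rw [← hG']
    have dne : s(u, x) ≠ s(u, y) := by simp [Sym2.eq_iff]; grind [hxy.ne, hux.ne]
    refine ⟨Option F, _, _, chord hrep hxy.ne (fun hh => hh.2 rfl) f (sg s(u, x) + sg s(u, y))
      ((Sup.sg a1).add (Sup.sg a2)) ?_ ?_⟩
    · rw [map_add, bd_sg hux.ne, bd_sg huy.ne]
      ext w
      simp only [Pi.add_apply]
      have := z2 (sv u w)
      linear_combination this
    · intro e he
      by_cases e1 : e = s(u, x)
      · subst e1
        rcases hf1 with rfl | rfl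
        · exact Or.inl ⟨rfl, n1.symm⟩
        · exact Or.inr ⟨n1, rfl⟩
      · by_cases e2 : e = s(u, y)
        · subst e2
          rcases hf2 with rfl | rfl
          · exact Or.inl ⟨rfl, n2.symm⟩
          · exact Or.inr ⟨n2, rfl⟩
        · simp [Pi.single_apply, e1, e2] at he
  have ev : ∀ f, dl G' l r (Pi.single f 1) s(u, x) + dl G' l r (Pi.single f 1) s(u, y)
      + dl G' l r (Pi.single f 1) s(u, u') = 0 := by
    intro f
    have := congrFun (hrep.even (Pi.single f 1)) u
    rw [bd_apply, ← Finset.sum_subset (Finset.subset_univ ({x, y, u'} : Finset V))] at this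
    · rw [Finset.sum_insert, Finset.sum_insert, Finset.sum_singleton] at this
      · simp only [Pi.zero_apply] at this
        rw [add_assoc]; exact this
      · simp [h2.symm]
      · simp [h1.symm, hxy.ne]
    · intro t _ ht
      refine dl_sup _ _ _ _ _ ?_
      intro hh
      have := hN t hh.1
      simp at ht
      tauto
  simp only [dl_edge _ _ _ (show s(u, x) ∈ G'.edgeSet from a1), dl_edge _ _ _ (show s(u, y) ∈ G'.edgeSet from a2),
    dl_edge _ _ _ (show s(u, u') ∈ G'.edgeSet from a3), Pi.single_apply] at ev
  have f1 := fin (l s(u, x)) (Or.inl rfl)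
  have f2 := fin (r s(u, x)) (Or.inr rfl)
  simp only [imp_false, not_or] at f1 f2
  have v1 := ev (l s(u, x))
  have v2 := ev (r s(u, x))
  have v3 := ev (l s(u, y))
  have hz : (1 : ZMod 2) ≠ 0 := one_ne_zero
  have hz2 : (1 : ZMod 2) + 1 = 0 := z2 1
  grind

end minimal

section ears
variable {V : Type*} [Fintype V] {F : Type}

/-- merging one side of a circuit into a single face, deleting everything strictly there -/
theorem merge2 {Q G₂ : SimpleGraph V} {l r : Sym2 V -> F} (h : IsRep Q l r) (hle : G₂ ≤ Q) (β : F -> ZMod 2)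
    (hC : Circ (dl Q l r β)) (h1 : ∀ e ∈ Q.edgeSet, e ∉ G₂.edgeSet -> β (l e) ≠ 0 ∧ β (r e) ≠ 0)
    (h0 : ∀ e ∈ G₂.edgeSet, dl Q l r β e = 0 -> β (l e) = 0) :
    ∃ (l' r' : Sym2 V -> Option F), IsRep G₂ l' r' ∧
      ∀ e, dl Q l r β e ≠ 0 -> l' e = none ∨ r' e = none := by
  let μ : F -> Option F := fun f => if β f = 0 then some f else none
  have hE : G₂.edgeSet ⊆ Q.edgeSet := edgeSet_subset_edgeSet.2 hle
  have key : ∀ a : Option F -> ZMod 2, dl G₂ (fun e => μ (l e)) (fun e => μ (r e)) a =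
      dl Q l r (fun f => a (μ f)) := fun a => by
    ext e
    by_cases h2 : e ∈ G₂.edgeSet
    · rw [dl_edge _ _ _ h2, dl_edge _ _ _ (hE h2)]
    · rw [dl_sup _ _ _ _ _ h2]
      by_cases hQ : e ∈ Q.edgeSet
      · rw [dl_edge _ _ _ hQ]
        simp [μ, h1 e hQ h2, z2]
      · rw [dl_sup _ _ _ _ _ hQ]
  refine ⟨fun e => μ (l e), fun e => μ (r e), ⟨fun a => ?_, fun c hc hb => ?_⟩, ?_⟩
  · rw [key]; exact h.even _
  · obtain ⟨a, rfl⟩ := h.full c (hc.mono hE) hb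
    have h1' := hC.2.2 (dl Q l r (fun f => a f * β f)) (h.even _) (by
      intro e he
      by_cases hQ : e ∈ Q.edgeSet
      · rw [dl_edge _ _ _ hQ]
        by_cases h2 : e ∈ G₂.edgeSet
        · have hl := h0 e h2 he
          rw [dl_edge _ _ _ hQ] at he
          have hr : β (r e) = 0 := by rw [hl, zero_add] at he; exact he
          rw [hl, hr]; simp
        · have := hc e h2
          rw [dl_edge _ _ _ hQ] at this
          obtain ⟨b1, b2⟩ := h1 e hQ h2
          rw [z2ne b1, z2ne b2, mul_one, mul_one, this]
      · exact dl_sup _ _ _ _ _ hQ)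
    have : ∃ t : ZMod 2, ∀ e ∈ G₂.edgeSet, (β (l e) ≠ 0 -> a (l e) = t) ∧ (β (r e) ≠ 0 -> a (r e) = t) := by
      have main : ∀ t : ZMod 2, (∀ e ∈ G₂.edgeSet, dl Q l r β e ≠ 0 -> dl Q l r (fun f => a f * β f) e = t) →
        ∀ e ∈ G₂.edgeSet, (β (l e) ≠ 0 -> a (l e) = t) ∧ (β (r e) ≠ 0 -> a (r e) = t) := by
        intro t ht e he
        have h2 := ht e he
        have h3 := h0 e he
        rw [dl_edge _ _ _ (hE he)] at h2 h3
        rw [dl_edge _ _ _ (hE he)] at h2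
        rcases z2cases (β (l e)) with hl | hl <;> rcases z2cases (β (r e)) with hr | hr
        · simp [hl, hr]
        · simp [hl, hr] at h2 ⊢; exact h2
        · simp [hl, hr] at h2 ⊢; exact h2
        · rw [hl, hr] at h3; exact absurd (h3 (z2 1)) one_ne_zero
      rcases h1' with h1 | h1
      · exact ⟨0, main 0 fun e _ _ => by rw [h1]; rfl⟩
      · exact ⟨1, main 1 fun e _ hne => by rw [h1]; exact z2ne hne⟩
    obtain ⟨t, ht⟩ := this
    refine ⟨fun x => x.elim t a, ?_⟩
    ext e
    by_cases h2 : e ∈ G₂.edgeSet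
    · rw [dl_edge _ _ _ h2, dl_edge _ _ _ (hE h2)]
      obtain ⟨t1, t2⟩ := ht e h2
      congr 1
      · by_cases hz : β (l e) = 0
        · simp [μ, hz]
        · simp [μ, hz, t1 hz]
      · by_cases hz : β (r e) = 0
        · simp [μ, hz]
        · simp [μ, hz, t2 hz]
    · rw [dl_sup _ _ _ _ _ h2, hc e h2]
  · intro e he
    have hE : e ∈ Q.edgeSet := by by_contra hh; exact he (dl_sup _ _ _ _ _ hh)
    rw [dl_edge _ _ _ hE] at he
    by_cases hz : β (l e) = 0
    · right
      have : β (r e) ≠ 0 := by intro h'; exact he (by rw [hz, h', add_zero])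
      simp [μ, this]
    · left; simp [μ, hz]

/-- vertices of a chain -/
def VC (C : Sym2 V -> ZMod 2) : Set V := {v | ∃ u, C s(v, u) ≠ 0}

theorem nVC {C : Sym2 V -> ZMod 2} {v : V} (h : v ∉ VC C) (u : V) : C s(v, u) = 0 := by
  by_contra hh; exact h ⟨u, hh⟩

theorem bd_nVC {C m : Sym2 V -> ZMod 2} {v : V} (h : v ∉ VC C) (hm : ∀ e, C e = 0 -> m e = 0) : bd m v = 0 := by
  rw [bd_apply]; exact Finset.sum_eq_zero fun u _ => hm _ (nVC h u)

theorem VC_sup {K : SimpleGraph V} {C : Sym2 V -> ZMod 2} (hK : Sup K.edgeSet C) {v u : V} (h : C s(v, u) ≠ 0) : K.Adj v u := by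
  by_contra hh; exact h (hK _ hh)

theorem circ_conn {K : SimpleGraph V} {C : Sym2 V -> ZMod 2} (hC : Circ C) (hK : Sup K.edgeSet C) {u v : V}
    (hu : u ∈ VC C) (hv : v ∈ VC C) : (fl K (fun e => C e ≠ 0)).Reachable u v := by
  let A : Set V := {a | (fl K (fun e => C e ≠ 0)).Reachable u a}
  have hst : ∀ a b, C s(a, b) ≠ 0 -> a ∈ A -> b ∈ A := fun a b h ha =>
    ha.trans (Adj.reachable ⟨VC_sup hK h, h⟩)
  let d : Sym2 V -> ZMod 2 := fun e => if ∃ v ∈ e, v ∈ A then C e else 0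
  have hd : bd d = 0 := by
    ext w
    rw [bd_apply, Pi.zero_apply]
    by_cases hw : w ∈ A
    · have := congrFun hC.2.1 w
      rw [bd_apply, Pi.zero_apply] at this
      rw [← this]
      refine Finset.sum_congr rfl fun t _ => ?_
      simp only [d]
      rw [if_pos ⟨w, by simp, hw⟩]
    · refine Finset.sum_eq_zero fun t _ => ?_
      simp only [d]
      by_contra hh
      have h1 : ∃ v ∈ s(w, t), v ∈ A := by by_contra h'; exact hh (if_neg h')
      rw [if_pos h1] at hh
      obtain ⟨z, hz, hzA⟩ := h1
      rcases Sym2.mem_iff.1 hz with rfl | rfl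
      · exact hw hzA
      · exact hw (hst _ _ (by rw [Sym2.eq_swap]; exact hh) hzA)
  rcases hC.2.2 d hd (fun e he => by simp only [d]; split_ifs; exact he; rfl) with h | h
  · obtain ⟨t, ht⟩ := hu
    have := congrFun h s(u, t)
    simp only [d] at this
    rw [if_pos ⟨u, by simp, Reachable.refl _⟩] at this
    exact (ht this).elim
  · obtain ⟨t, ht⟩ := hv
    have := congrFun h s(v, t)
    simp only [d] at this
    have h1 : ∃ z ∈ s(v, t), z ∈ A := by
      by_contra h'; rw [if_neg h'] at this; exact ht this.symm
    obtain ⟨z, hz, hzA⟩ := h1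
    rcases Sym2.mem_iff.1 hz with rfl | rfl
    · exact hzA
    · exact hst _ _ (by rw [Sym2.eq_swap]; exact ht) hzA

def Ear (K : SimpleGraph V) (C : Sym2 V -> ZMod 2) : Prop :=
  (∃ p ∈ VC C, ∃ q ∈ VC C, K.Adj p q ∧ C s(p, q) = 0) ∨
  (∃ D : Set V, Cn K D ∧ Disjoint D (VC C) ∧ ∃ p ∈ VC C, ∃ q ∈ VC C, p ≠ q ∧ (∃ d ∈ D, K.Adj p d) ∧ ∃ d ∈ D, K.Adj q d)

theorem Ear.aux {K : SimpleGraph V} {C : Sym2 V -> ZMod 2} (h : Ear K C) :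
    ∃ (p q : V) (K0 : SimpleGraph V), K0 ≤ K ∧ p ≠ q ∧ p ∈ VC C ∧ q ∈ VC C ∧ K0.Reachable p q ∧
      ∀ a b, K0.Adj a b -> C s(a, b) = 0 ∧ (a ∈ VC C -> a = p ∨ a = q) := by
  rcases h with ⟨p, hp, q, hq, hpq, hC⟩ | ⟨D, hD, hdis, p, hp, q, hq, hpq, ⟨d, hd, hpd⟩, d', hd', hqd⟩
  · refine ⟨p, q, SimpleGraph.edge p q, ?_, hpq.ne, hp, hq, Adj.reachable ?_, ?_⟩
    · rw [edge_le_iff]; exact Or.inr hpq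
    · simp [edge_adj, hpq.ne]
    · intro a b hab
      rw [edge_adj] at hab
      rcases hab.1 with ⟨rfl, rfl⟩ | ⟨rfl, rfl⟩
      · exact ⟨hC, fun _ => Or.inl rfl⟩
      · exact ⟨by rw [Sym2.eq_swap]; exact hC, fun _ => Or.inr rfl⟩
  · have hD' : ∀ d ∈ D, d ∉ VC C := fun d hd h => Set.disjoint_left.1 hdis hd h
    refine ⟨p, q, fl (ins K (D ∪ {p, q})) (fun e => ∃ d ∈ e, d ∈ D), ?_, hpq, hp, hq, ?_, ?_⟩
    · intro a b hab; exact hab.1.1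
    · have h1 : (fl (ins K (D ∪ {p, q})) (fun e => ∃ d ∈ e, d ∈ D)).Adj p d :=
        ⟨⟨hpd, by simp, Or.inl hd⟩, d, by simp, hd⟩
      have h2 : (fl (ins K (D ∪ {p, q})) (fun e => ∃ d ∈ e, d ∈ D)).Adj q d' :=
        ⟨⟨hqd, by simp, Or.inl hd'⟩, d', by simp, hd'⟩
      have h3 := (hD.2 d hd d' hd').mono (show ins K D ≤ fl (ins K (D ∪ {p, q})) (fun e => ∃ d ∈ e, d ∈ D) from
        fun a b hab => ⟨⟨hab.1, Or.inl hab.2.1, Or.inl hab.2.2⟩, a, by simp, hab.2.1⟩)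
      exact (h1.reachable.trans h3).trans h2.symm.reachable
    · rintro a b ⟨⟨_, ha, hb⟩, d, hd, hdD⟩
      refine ⟨?_, fun h => ?_⟩
      · rcases Sym2.mem_iff.1 hd with rfl | rfl
        · exact nVC (hD' _ hdD) _
        · rw [Sym2.eq_swap]; exact nVC (hD' _ hdD) _
      · rcases ha with ha | ha
        · exact (hD' _ ha h).elim
        · exact ha

structure EarC (K : SimpleGraph V) (C M : Sym2 V -> ZMod 2) (p q : V) : Prop where
  ne : p ≠ q
  hp : p ∈ VC C
  hq : q ∈ VC C
  sup : Sup K.edgeSet M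
  bdM : bd M = sv p + sv q
  dis : ∀ e, M e ≠ 0 -> C e = 0
  min : ∀ m, (∀ e, M e = 0 -> m e = 0) -> (∀ v ∉ VC C, bd m v = 0) -> m = 0 ∨ m = M

theorem sv_ne {p q : V} (h : p ≠ q) : (sv p + sv q : V -> ZMod 2) ≠ 0 := by
  intro hh
  have := congrFun hh p
  simp [Pi.single_apply, h] at this

theorem Ear.chain {K : SimpleGraph V} {C : Sym2 V -> ZMod 2} (h : Ear K C) : ∃ M p q, EarC K C M p q := by
  obtain ⟨p, q, K0, hle, hpq, hp, hq, hr, hK0⟩ := h.aux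
  obtain ⟨k, hk, hkb⟩ := reach_chain hr
  let X : Finset (Sym2 V -> ZMod 2) := Finset.univ.filter (fun M => Sup K0.edgeSet M ∧ bd M = sv p + sv q)
  obtain ⟨M, hM, hmin⟩ := X.exists_min_image (fun M => (Finset.univ.filter (fun e => M e ≠ 0)).card)
    ⟨k, by simp [X, hk, hkb]⟩
  simp only [X, Finset.mem_filter, Finset.mem_univ, true_and] at hM hmin
  have hmin' : ∀ m, (∀ e, M e = 0 -> m e = 0) -> bd m = sv p + sv q -> m = M := by
    intro m hm hb
    have h1 := hmin m ⟨fun e he => hm e (hM.1 e he), hb⟩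
    have h2 : Finset.univ.filter (fun e => m e ≠ 0) = Finset.univ.filter (fun e => M e ≠ 0) := by
      refine Finset.eq_of_subset_of_card_le ?_ h1
      intro e he
      simp only [Finset.mem_filter, Finset.mem_univ, true_and] at he ⊢
      exact fun hh => he (hm e hh)
    ext e
    have h3 := Finset.ext_iff.1 h2 e
    simp only [Finset.mem_filter, Finset.mem_univ, true_and] at h3
    by_cases h4 : m e = 0
    · rw [h4]; by_contra h5; exact (h3.2 (Ne.symm h5)) h4
    · rw [z2ne h4, z2ne (h3.1 h4)]
  refine ⟨M, p, q, hpq, hp, hq, hM.1.mono (edgeSet_subset_edgeSet.2 hle), hM.2, ?_, ?_⟩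
  · intro e
    induction e with
    | h a b =>
      intro he
      exact (hK0 a b (VC_sup hM.1 he)).1
  · intro m hm hv
    have hsm : Sup K0.edgeSet m := fun e he => hm e (hM.1 e he)
    have hz : ∀ v, v ≠ p -> v ≠ q -> bd m v = 0 := by
      intro v h1 h2
      by_cases hvC : v ∈ VC C
      · refine hsm.bd_zero fun u hu => ?_
        rcases (hK0 v u hu).2 hvC with h | h
        · exact h1 h
        · exact h2 h
      · exact hv v hvC
    have hs := sum_bd m hsm Set.univ (fun _ _ _ _ _ => trivial)
    simp only [Set.mem_univ, if_true] at hs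
    rw [← Finset.sum_subset (Finset.subset_univ ({p, q} : Finset V)), Finset.sum_pair hpq, z2eq] at hs
    · rcases z2cases (bd m p) with h0 | h0
      · have hb0 : bd m = 0 := by
          ext v
          by_cases h1 : v = p
          · rw [h1, h0]; rfl
          · by_cases h2 : v = q
            · rw [h2, ← hs, h0]; rfl
            · exact hz v h1 h2
        left
        have := hmin' (M + m) (fun e he => by simp [he, hm e he]) (by rw [map_add, hb0, hM.2, add_zero])
        simpa using this
      · right
        refine hmin' m hm ?_
        ext v
        by_cases h1 : v = p
        · rw [h1, h0]; simp [Pi.single_apply, hpq]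
        · by_cases h2 : v = q
          · rw [h2, ← hs, h0]; simp [Pi.single_apply, hpq.symm]
          · rw [hz v h1 h2]; simp [Pi.single_apply, h1, h2]
    · intro v _ hv
      simp at hv
      exact hz v hv.1 hv.2

theorem EarC.circ {K : SimpleGraph V} {C M σ : Sym2 V -> ZMod 2} {p q : V} (h : EarC K C M p q) (hC : Circ C)
    (hσ : ∀ e, C e = 0 -> σ e = 0) (hb : bd σ = sv p + sv q) : Circ (M + σ) := by
  have two : ∀ d : V -> ZMod 2, d + d = 0 := fun d => by ext v; exact z2 _
  have hMσ : ∀ e, M e ≠ 0 -> σ e = 0 := fun e he => hσ e (h.dis e he)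
  have small : ∀ s, (∀ e, σ e = 0 -> s e = 0) -> bd s = 0 -> s = 0 := by
    intro s hs hsb
    rcases hC.2.2 s hsb (fun e he => hs e (hσ e he)) with h1 | h1
    · exact h1
    · exfalso
      have : σ = C := by
        ext e
        by_cases he : C e = 0
        · rw [he, hσ e he]
        · rw [z2ne he]; refine z2ne fun h2 => he ?_
          rw [← h1]; exact hs e h2
      rw [this, hC.2.1] at hb
      exact sv_ne h.ne hb.symm
  refine ⟨?_, ?_, ?_⟩
  · intro h0
    have : M = 0 := by
      ext e
      by_contra he
      have := congrFun h0 e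
      rw [Pi.add_apply, hMσ e he, add_zero] at this
      exact he this
    have h2 := h.bdM
    rw [this, map_zero] at h2
    exact sv_ne h.ne h2.symm
  · rw [map_add, h.bdM, hb, two]
  · intro d hd hle
    let m : Sym2 V -> ZMod 2 := fun e => if M e = 0 then 0 else d e
    let s : Sym2 V -> ZMod 2 := fun e => if M e = 0 then d e else 0
    have hds : d = m + s := by
      ext e; simp only [m, s, Pi.add_apply]; split_ifs <;> simp
    have hs : ∀ e, σ e = 0 -> s e = 0 := by
      intro e he
      simp only [s]
      split_ifs with h1
      · exact hle e (by simp [he, h1])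
      · rfl
    have hms : bd m = bd s := by
      have : bd m + bd s = 0 := by rw [← map_add, ← hds, hd]
      ext v; exact z2eq.1 (congrFun this v)
    rcases h.min m (fun e he => by simp [m, he]) (fun v hv => by
      rw [hms]; exact bd_nVC hv (fun e he => hs e (hσ e he))) with h0 | h0
    · left
      have hs0 := small s hs (by rw [← hms, h0, map_zero])
      rw [hds, h0, hs0, add_zero]
    · right
      have hs0 := small (s + σ) (fun e he => by simp [hs e he, he]) (by rw [map_add, ← hms, h0, h.bdM, hb, two])
      have : s = σ := by ext e; exact z2eq.1 (congrFun hs0 e)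
      rw [hds, h0, this]

theorem EarC.split {K : SimpleGraph V} {C M : Sym2 V -> ZMod 2} {p q : V} (h : EarC K C M p q) (hC : Circ C)
    (hK : Sup K.edgeSet C) : ∃ σ, (∀ e, C e = 0 -> σ e = 0) ∧ bd σ = sv p + sv q := by
  obtain ⟨k, hk, hkb⟩ := reach_chain (circ_conn hC hK h.hp h.hq)
  refine ⟨k, fun e he => hk e ?_, hkb⟩
  rw [mem_fl]
  exact fun hh => hh.2 he

theorem same_side {Q : SimpleGraph V} {l r : Sym2 V -> F} (h : IsRep Q l r) (β : F -> ZMod 2) {v u w : V}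
    (hv : ∀ t, dl Q l r β s(v, t) = 0) (hu : Q.Adj v u) (hw : Q.Adj v w)
    (hr : (ins Q {v}ᶜ).Reachable u w) : β (l s(v, u)) = β (l s(v, w)) := by
  by_cases huw : u = w
  · rw [huw]
  obtain ⟨k, hk, hkb⟩ := reach_chain hr
  have hkv : ∀ t, k s(v, t) = 0 := fun t => hk _ (fun hh => hh.2.1 rfl)
  have := lemmaS h β (c := k + sg s(v, u) + sg s(v, w))
    (((hk.mono (edgeSet_subset_edgeSet.2 (ins_le _))).add (Sup.sg hu)).add (Sup.sg hw)) (by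
      rw [map_add, map_add, hkb, bd_sg hu.ne, bd_sg hw.ne]
      ext t
      simp only [Pi.add_apply, Pi.zero_apply]
      have t1 := z2 (sv u t)
      have t2 := z2 (sv w t)
      have t3 := z2 (sv v t)
      linear_combination t1 + t2 + t3) v hv
  have e1 : ∀ t, (k + sg s(v, u) + sg s(v, w)) s(v, t) * β (l s(v, t)) =
      (if t = u then β (l s(v, u)) else 0) + (if t = w then β (l s(v, w)) else 0) := by
    intro t
    simp only [Pi.add_apply, hkv, zero_add, Pi.single_apply]
    by_cases h1 : t = u
    · subst h1; simp [huw, hw.ne]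
    · by_cases h2 : t = w
      · subst h2; simp [h1, hu.ne]
      · simp [h1, h2, hu.ne, hw.ne]
  rw [Finset.sum_congr rfl (fun t _ => e1 t), Finset.sum_add_distrib] at this
  simp at this
  exact z2eq.1 this

end ears

section ff
variable {V : Type*} [Fintype V] {F : Type}

theorem dl_const (Q : SimpleGraph V) (l r : Sym2 V -> F) (t : ZMod 2) : dl Q l r (fun _ => t) = 0 := by
  ext e; simp only [dl, z2, ite_self, Pi.zero_apply]

/-- circuits off `x`, normalised to be one at `x` -/
structure SS (Q H : SimpleGraph V) (l r : Sym2 V -> F) (x : V) (β : F -> ZMod 2) : Prop where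
  circ : Circ (dl Q l r β)
  sup : Sup H.edgeSet (dl Q l r β)
  one : ∀ u, Q.Adj x u -> β (l s(x, u)) = 1 ∧ β (r s(x, u)) = 1

theorem SS.norm {Q H : SimpleGraph V} {l r : Sym2 V -> F} {x : V} (h : IsRep Q l r) (hHQ : H ≤ ins Q {x}ᶜ)
    (hcon : ∀ u w, Q.Adj x u -> Q.Adj x w -> H.Reachable u w) {C : Sym2 V -> ZMod 2} (hC : Circ C)
    (hS : Sup H.edgeSet C) : ∃ β, dl Q l r β = C ∧ SS Q H l r x β := by
  obtain ⟨β, rfl⟩ := h.full C (hS.mono (edgeSet_subset_edgeSet.2 (hHQ.trans (ins_le _)))) hC.2.1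
  have hx : ∀ t, dl Q l r β s(x, t) = 0 := fun t => hS _ (fun hh => (hHQ hh).2.1 rfl)
  have hss : ∀ u w, Q.Adj x u -> Q.Adj x w -> β (l s(x, u)) = β (l s(x, w)) := fun u w hu hw =>
    same_side h β hx hu hw ((hcon u w hu hw).mono hHQ)
  have hlr : ∀ u, Q.Adj x u -> β (r s(x, u)) = β (l s(x, u)) := fun u hu => by
    have := hx u
    rw [dl_edge _ _ _ (show s(x, u) ∈ Q.edgeSet from hu), z2eq] at this
    exact this.symm
  by_cases hex : ∃ u, Q.Adj x u
  · obtain ⟨u, hu⟩ := hex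
    have hd : dl Q l r (β + fun _ => β (l s(x, u)) + 1) = dl Q l r β := by
      rw [dl_add, dl_const, add_zero]
    refine ⟨_, hd, by rw [hd]; exact hC, by rw [hd]; exact hS, fun w hw => ?_⟩
    have := z2 (β (l s(x, u)))
    simp only [Pi.add_apply, hlr w hw, hss w u hw hu]
    constructor <;> linear_combination this
  · exact ⟨β, rfl, hC, hS, fun u hu => (hex ⟨u, hu⟩).elim⟩

/-- from a circuit with an ear, a normalised circuit with an edge on the other side -/
theorem SS.start {Q H : SimpleGraph V} {l r : Sym2 V -> F} {x : V} (h : IsRep Q l r) (hHQ : H ≤ ins Q {x}ᶜ)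
    (hcon : ∀ u w, Q.Adj x u -> Q.Adj x w -> H.Reachable u w) {C : Sym2 V -> ZMod 2} (hC : Circ C)
    (hS : Sup H.edgeSet C) (hE : Ear H C) :
    ∃ β, SS Q H l r x β ∧ ∃ e ∈ H.edgeSet, β (l e) = 0 ∧ β (r e) = 0 := by
  by_contra hno
  have hHQ' : H.edgeSet ⊆ Q.edgeSet := edgeSet_subset_edgeSet.2 (hHQ.trans (ins_le _))
  have hno' : ∀ β, SS Q H l r x β -> ∀ e ∈ H.edgeSet, dl Q l r β e = 0 -> β (l e) = 1 ∧ β (r e) = 1 := by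
    intro β hβ e he hd
    rw [dl_edge _ _ _ (hHQ' he), z2eq] at hd
    have : β (l e) ≠ 0 := fun h0 => hno ⟨β, hβ, e, he, h0, by rw [← hd, h0]⟩
    exact ⟨z2ne this, by rw [← hd]; exact z2ne this⟩
  obtain ⟨M, p, q, hM⟩ := hE.chain
  obtain ⟨σ, hσ, hσb⟩ := hM.split hC hS
  have two : ∀ d : V -> ZMod 2, d + d = 0 := fun d => by ext v; exact z2 _
  have hσS : Sup H.edgeSet σ := fun e he => hσ e (hS e he)
  obtain ⟨α, hα, hαS⟩ := SS.norm h hHQ hcon hC hS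
  obtain ⟨γ, hγ, hγS⟩ := SS.norm h hHQ hcon (hM.circ hC hσ hσb) (hM.sup.add hσS)
  have h3 := hM.circ (σ := C + σ) hC (fun e he => by simp [he, hσ e he]) (by rw [map_add, hC.2.1, zero_add, hσb])
  have hd3 : dl Q l r (α + γ + fun _ => 1) = M + (C + σ) := by
    rw [dl_add, dl_add, dl_const, hα, hγ]; ext e; simp only [Pi.add_apply, Pi.zero_apply]; ring
  have h3S : SS Q H l r x (α + γ + fun _ => 1) := by
    refine ⟨by rw [hd3]; exact h3, by rw [hd3]; exact hM.sup.add (hS.add hσS), fun u hu => ?_⟩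
    simp only [Pi.add_apply, (hαS.one u hu).1, (hαS.one u hu).2, (hγS.one u hu).1, (hγS.one u hu).2]
    decide
  have key : dl Q l r (fun f => α f * γ f) = M + C := by
    ext e
    by_cases hQ : e ∈ Q.edgeSet
    · have a1 := congrFun hα e
      have g1 := congrFun hγ e
      have n1 := hno' α hαS e
      have n2 := hno' γ hγS e
      have n3 := hno' _ h3S e
      have d3 := congrFun hd3 e
      rw [dl_edge _ _ _ hQ] at a1 g1 d3 n1 n2 n3 ⊢
      simp only [Pi.add_apply] at g1 d3 n3 ⊢
      by_cases hH : e ∈ H.edgeSet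
      · have := n1 hH
        have := n2 hH
        have := n3 hH
        have t1 := hM.dis e
        have t2 := hσ e
        revert a1 g1 n1 n2 n3 d3 t1 t2
        generalize α (l e) = a
        generalize α (r e) = a'
        generalize γ (l e) = g
        generalize γ (r e) = g'
        generalize M e = m
        generalize C e = c
        generalize σ e = s
        simp only [hH, true_imp_iff]
        clear * -
        revert a a' g g' m c s
        decide
      · rw [hM.sup e hH, hS e hH, add_zero]
        rw [hM.sup e hH, hσS e hH, add_zero, z2eq] at g1
        rw [hS e hH, z2eq] at a1
        rw [a1, g1, z2]
    · rw [dl_sup _ _ _ _ _ hQ, Pi.add_apply, hM.sup e (fun hh => hQ (hHQ' hh)), hS e (fun hh => hQ (hHQ' hh)), add_zero]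
  have := h.even (fun f => α f * γ f)
  rw [key, map_add, hC.2.1, add_zero, hM.bdM] at this
  exact sv_ne hM.ne this

/-- minimal one has no inner ear -/
theorem SS.minimal {Q H : SimpleGraph V} {l r : Sym2 V -> F} {x : V} (h : IsRep Q l r) (hHQ : H ≤ ins Q {x}ᶜ)
    (hcon : ∀ u w, Q.Adj x u -> Q.Adj x w -> H.Reachable u w) {β₀ : F -> ZMod 2} (h0 : SS Q H l r x β₀) :
    ∃ β, SS Q H l r x β ∧ (∀ f, β₀ f = 0 -> β f = 0) ∧
      ¬ Ear (fl H (fun e => β (l e) ≠ 0 ∧ β (r e) ≠ 0)) (dl Q l r β) := by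
  have hHQ' : H.edgeSet ⊆ Q.edgeSet := edgeSet_subset_edgeSet.2 (hHQ.trans (ins_le _))
  let cnt : (F -> ZMod 2) -> ℕ := fun β => (Finset.univ.filter (fun e => e ∈ Q.edgeSet ∧ (β (l e) ≠ 0 ∨ β (r e) ≠ 0))).card
  have hex : ∃ n β, SS Q H l r x β ∧ (∀ f, β₀ f = 0 -> β f = 0) ∧ cnt β = n := ⟨_, β₀, h0, fun _ h => h, rfl⟩
  obtain ⟨β, hβ, hle, hc⟩ := Nat.find_spec hex
  have hmin : ∀ β', SS Q H l r x β' -> (∀ f, β₀ f = 0 -> β' f = 0) -> cnt β ≤ cnt β' := fun β' h1 h2 => by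
    rw [hc]; exact Nat.find_min' hex ⟨β', h1, h2, rfl⟩
  refine ⟨β, hβ, hle, fun hE => ?_⟩
  obtain ⟨M, p, q, hM⟩ := hE.chain
  have hMin : ∀ e, M e ≠ 0 -> e ∈ H.edgeSet ∧ β (l e) ≠ 0 ∧ β (r e) ≠ 0 := fun e he => by
    have : e ∈ (fl H (fun e => β (l e) ≠ 0 ∧ β (r e) ≠ 0)).edgeSet := by by_contra hh; exact he (hM.sup e hh)
    rwa [mem_fl] at this
  have hM' : EarC H (dl Q l r β) M p q := ⟨hM.ne, hM.hp, hM.hq, fun e he => by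
    by_contra hh; exact he (hMin e hh).1, hM.bdM, hM.dis, hM.min⟩
  obtain ⟨σ, hσ, hσb⟩ := hM'.split hβ.circ hβ.sup
  have hσS : Sup H.edgeSet σ := fun e he => hσ e (hβ.sup e he)
  obtain ⟨γ, hγ, hγS⟩ := SS.norm h hHQ hcon (hM'.circ hβ.circ hσ hσb) (hM'.sup.add hσS)
  let c : Sym2 V -> ZMod 2 := dl Q l r (fun f => β f * γ f) + M
  have two : ∀ d : V -> ZMod 2, d + d = 0 := fun d => by ext v; exact z2 _
  have hcC : ∀ e, dl Q l r β e = 0 -> c e = 0 := by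
    intro e he
    have hσe := hσ e he
    simp only [c, Pi.add_apply]
    by_cases hQ : e ∈ Q.edgeSet
    · have g := congrFun hγ e
      rw [dl_edge _ _ _ hQ] at g he ⊢
      rw [Pi.add_apply, hσe, add_zero] at g
      rw [z2eq] at he
      by_cases hm : M e = 0
      · rw [hm, z2eq] at g; rw [hm, he, g, z2, add_zero]
      · rw [z2ne (hMin e hm).2.1, z2ne (hMin e hm).2.2, one_mul, one_mul, g, z2]
    · rw [dl_sup _ _ _ _ _ hQ, hM'.sup e (fun hh => hQ (hHQ' hh)), add_zero]
  have hcb : bd c = sv p + sv q := by rw [map_add, h.even, zero_add, hM.bdM]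
  have hdl : dl Q l r (fun f => β f * γ f) = M + c := by
    ext e; simp only [c, Pi.add_apply]
    have := z2 (M e); linear_combination -this
  have hS : SS Q H l r x (fun f => β f * γ f) := by
    refine ⟨by rw [hdl]; exact hM'.circ hβ.circ hcC hcb, by
      rw [hdl]; exact hM'.sup.add (fun e he => hcC e (hβ.sup e he)), fun u hu => ?_⟩
    simp [hβ.one u hu, hγS.one u hu]
  have hlt := hmin _ hS (fun f hf => by simp [hle f hf])
  have hne : ∃ e, dl Q l r β e ≠ 0 ∧ c e = 0 := by
    by_contra hh
    push Not at hh
    have : c = dl Q l r β := by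
      ext e
      by_cases he : dl Q l r β e = 0
      · rw [he, hcC e he]
      · rw [z2ne he, z2ne (hh e he)]
    rw [this, hβ.circ.2.1] at hcb
    exact sv_ne hM.ne hcb.symm
  obtain ⟨e, he1, he2⟩ := hne
  have hQ : e ∈ Q.edgeSet := by by_contra hh; exact he1 (dl_sup _ _ _ _ _ hh)
  have hMe : M e = 0 := by by_contra hh; exact he1 (hM.dis e hh)
  have he3 := congrFun hdl e
  rw [Pi.add_apply, hMe, he2, add_zero] at he3
  rw [dl_edge _ _ _ hQ] at he1 he3
  refine absurd hlt (not_le.2 (Finset.card_lt_card ⟨?_, fun hh => ?_⟩))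
  · intro e' he'
    simp only [Finset.mem_filter, Finset.mem_univ, true_and] at he' ⊢
    refine ⟨he'.1, he'.2.imp ?_ ?_⟩
    · exact fun h1 h2 => h1 (by simp [h2])
    · exact fun h1 h2 => h1 (by simp [h2])
  · have h1 : e ∈ Finset.univ.filter (fun e => e ∈ Q.edgeSet ∧ (β (l e) ≠ 0 ∨ β (r e) ≠ 0)) := by
      simp only [Finset.mem_filter, Finset.mem_univ, true_and]
      refine ⟨hQ, ?_⟩
      by_contra h'; push Not at h'; rw [h'.1, h'.2, add_zero] at he1; exact he1 rfl
    have h2 := hh h1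
    simp only [Finset.mem_filter, Finset.mem_univ, true_and] at h2
    revert he1 he3 h2
    generalize β (l e) = a
    generalize β (r e) = a'
    generalize γ (l e) = g
    generalize γ (r e) = g'
    simp only [hQ, true_and]
    clear * -
    revert a a' g g'
    decide
end ff

section ff
variable {V : Type*} [Fintype V]

/-- (f): no circuit with an ear avoiding an edge -/
theorem Mn.f {G : SimpleGraph V} (h : Mn G) {x y : V} (hxy : G.Adj x y) {C₀ : Sym2 V -> ZMod 2} (hC₀ : Circ C₀)
    (hS₀ : Sup (ins G {x, y}ᶜ).edgeSet C₀) (hE₀ : Ear (ins G {x, y}ᶜ) C₀) : False := by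
  let Q := ctr G x y
  let H := ins G {x, y}ᶜ
  obtain ⟨F, l, r, hrep⟩ : PL Q := h.ih Q (ctr_card hxy) (h.kf.ctr hxy)
  have hHa : ∀ {a b}, H.Adj a b -> G.Adj a b ∧ a ≠ x ∧ a ≠ y ∧ b ≠ x ∧ b ≠ y := by
    rintro a b ⟨h1, h2, h3⟩
    simp only [Set.mem_compl_iff, Set.mem_insert_iff, Set.mem_singleton_iff, not_or] at h2 h3
    exact ⟨h1, h2.1, h2.2, h3.1, h3.2⟩
  have hHb : ∀ {a b}, G.Adj a b -> a ≠ x -> a ≠ y -> b ≠ x -> b ≠ y -> H.Adj a b := by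
    intro a b h1 h2 h3 h4 h5
    refine ⟨h1, ?_, ?_⟩ <;> simp [*]
  have hHQ : H ≤ ins Q {x}ᶜ := by
    intro a b hab
    obtain ⟨h1, h2, h3, h4, h5⟩ := hHa hab
    exact ⟨⟨h1.ne, h3, h5, Or.inl h1⟩, h2, h4⟩
  have hQNI : ∀ {a b}, Q.Adj a b -> NI G a := by
    rintro a b ⟨h1, h2, h3, h4 | ⟨rfl, h4⟩ | ⟨rfl, h4⟩⟩
    · exact ⟨b, h4⟩
    · exact ⟨y, hxy⟩
    · exact ⟨y, h4⟩
  have hcon : ∀ u w, Q.Adj x u -> Q.Adj x w -> H.Reachable u w := fun u w hu hw =>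
    h.c2 (Or.inr hxy) (hQNI hu.symm) (hQNI hw.symm) hu.ne' hu.2.2.1 hw.ne' hw.2.2.1
  obtain ⟨β₀, hβ₀, es, hes, hes1, hes2⟩ := SS.start hrep hHQ hcon hC₀ hS₀ hE₀
  obtain ⟨β, hβ, hle, hnoear⟩ := SS.minimal hrep hHQ hcon hβ₀
  set C := dl Q l r β with hCdef
  have hC := hβ.circ
  have hCS := hβ.sup
  have hHQ' : ∀ {e}, e ∈ H.edgeSet -> e ∈ Q.edgeSet := fun {e} he => edgeSet_subset_edgeSet.2 (hHQ.trans (ins_le _)) he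
  have hVC : ∀ v ∈ VC C, v ≠ x ∧ v ≠ y := by
    rintro v ⟨u, hu⟩
    obtain ⟨h1, h2, h3, h4, h5⟩ := hHa (VC_sup hCS hu)
    exact ⟨h2, h3⟩
  let Inn := fl H (fun e => β (l e) ≠ 0 ∧ β (r e) ≠ 0)
  let G₁ := fl G (fun e => x ∈ e ∨ y ∈ e ∨ C e ≠ 0 ∨ (β (l e) ≠ 0 ∧ β (r e) ≠ 0))
  let G₂ := fl H (fun e => C e ≠ 0 ∨ β (l e) = 0)
  have hCl : ∀ {e}, e ∈ H.edgeSet -> C e = 0 -> β (l e) = β (r e) := by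
    intro e he h0
    rw [hCdef, dl_edge _ _ _ (hHQ' he), z2eq] at h0
    exact h0
  have hsup : G₁ ⊔ G₂ = G := by
    ext a b
    constructor
    · rintro (h1 | h1)
      · exact h1.1
      · exact h1.1.1
    · intro hab
      by_cases hx : x ∈ s(a, b)
      · exact Or.inl ⟨hab, Or.inl hx⟩
      by_cases hy : y ∈ s(a, b)
      · exact Or.inl ⟨hab, Or.inr (Or.inl hy)⟩
      simp only [Sym2.mem_iff, not_or] at hx hy
      have hH : H.Adj a b := hHb hab (Ne.symm hx.1) (Ne.symm hy.1) (Ne.symm hx.2) (Ne.symm hy.2)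
      by_cases h1 : C s(a, b) ≠ 0
      · exact Or.inr ⟨hH, Or.inl h1⟩
      · push Not at h1
        by_cases h2 : β (l s(a, b)) = 0
        · exact Or.inr ⟨hH, Or.inr h2⟩
        · exact Or.inl ⟨hab, Or.inr (Or.inr (Or.inr ⟨h2, by rw [← hCl hH h1]; exact h2⟩))⟩
  have hG1 : ∀ {a b}, G₁.Adj a b -> a ≠ x -> a ≠ y -> b ≠ x -> b ≠ y -> C s(a, b) = 0 -> Inn.Adj a b := by
    rintro a b ⟨h1, h2⟩ h3 h4 h5 h6 h7
    refine ⟨hHb h1 h3 h4 h5 h6, ?_⟩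
    rcases h2 with h2 | h2 | h2 | h2
    · simp at h2; rcases h2 with h2 | h2
      · exact (h3 h2.symm).elim
      · exact (h5 h2.symm).elim
    · simp at h2; rcases h2 with h2 | h2
      · exact (h4 h2.symm).elim
      · exact (h6 h2.symm).elim
    · exact (h2 h7).elim
    · exact h2
  have hcom : ∀ e ∈ G₁.edgeSet, e ∈ G₂.edgeSet -> C e ≠ 0 := by
    intro e
    induction e with
    | h a b =>
    intro h1 h2 h3
    have h2' : G₂.Adj a b := h2
    obtain ⟨_, h5, h6, h7, h8⟩ := hHa h2'.1
    have h4 := hG1 h1 h5 h6 h7 h8 h3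
    rcases h2'.2 with h9 | h9
    · exact h9 h3
    · exact h4.2.1 h9
  -- sides at vertices off the circuit
  have hside : ∀ v, v ∉ VC C -> v ≠ x -> v ≠ y -> ∀ u w, Q.Adj v u -> Q.Adj v w -> β (l s(v, u)) = β (l s(v, w)) := by
    intro v hv hvx hvy u w hu hw
    refine same_side hrep β (fun t => nVC hv t) hu hw ?_
    have hr := h.c1 (x := v) (hQNI hu.symm) (hQNI hw.symm) hu.ne' hw.ne'
    let π : V -> V := fun t => if t = y then x else t
    have hπ : ∀ a b, (ins G {v}ᶜ).Reachable a b -> (ins Q {v}ᶜ).Reachable (π a) (π b) := by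
      intro a b hab
      refine reach_closed (fun t => (ins Q {v}ᶜ).Reachable (π a) (π t)) hab (Reachable.refl _) ?_
      intro s t hst ih
      refine ih.trans ?_
      obtain ⟨h1, h2, h3⟩ := hst
      have h2 : s ≠ v := h2
      have h3 : t ≠ v := h3
      by_cases e1 : s = y
      · by_cases e2 : t = x
        · simp only [π, e1, e2, if_true, hxy.ne, if_false]; exact Reachable.refl _
        · have e3 : t ≠ y := by rintro rfl; exact h1.ne e1
          simp only [π, e1, e3, if_true, if_false]
          subst e1
          exact Adj.reachable ⟨⟨Ne.symm e2, hxy.ne, e3, Or.inr (Or.inl ⟨rfl, h1⟩)⟩, hvx.symm, h3⟩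
      · by_cases e2 : t = y
        · subst e2
          by_cases e3 : s = x
          · simp only [π, e3, if_true, hxy.ne, if_false]; exact Reachable.refl _
          · simp only [π, e1, if_true, if_false]
            exact Adj.reachable ⟨⟨e3, e1, hxy.ne, Or.inr (Or.inr ⟨rfl, h1⟩)⟩, h2, hvx.symm⟩
        · simp only [π, e1, e2, if_false]
          exact Adj.reachable ⟨⟨h1.ne, e1, e2, Or.inl h1⟩, h2, h3⟩
    have := hπ u w hr
    simp only [π, if_neg hu.2.2.1, if_neg hw.2.2.1] at this
    exact this
  have hNI1 : ∀ v, v ∉ VC C -> NI G₁ v -> ∀ u, ¬ G₂.Adj v u := by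
    rintro v hv ⟨w, hw⟩ u hu
    obtain ⟨k1, k2, k3, k4, k5⟩ := hHa hu.1
    have hu0 : β (l s(v, u)) = 0 := hu.2.resolve_left (fun hh => hh (nVC hv u))
    have hQu : Q.Adj v u := ⟨k1.ne, k3, k5, Or.inl k1⟩
    by_cases hwxy : w = x ∨ w = y
    · have hQx : Q.Adj v x := by
        rcases hwxy with rfl | rfl
        · exact ⟨k2, k3, hxy.ne, Or.inl hw.1⟩
        · exact ⟨k2, k3, hxy.ne, Or.inr (Or.inr ⟨rfl, hw.1⟩)⟩
      have h1 := hside v hv k2 k3 u x hQu hQx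
      rw [hu0, Sym2.eq_swap, (hβ.one v hQx.symm).1] at h1
      exact zero_ne_one h1
    · push Not at hwxy
      have hi := hG1 hw k2 k3 hwxy.1 hwxy.2 (nVC hv w)
      have h1 := hside v hv k2 k3 u w hQu ⟨hw.ne, k3, hwxy.2, Or.inl hw.1⟩
      rw [hu0] at h1
      exact hi.2.1 h1.symm
  have hG1all : ∀ v, v ∉ VC C -> NI G₁ v -> ∀ u, G.Adj v u -> G₁.Adj v u := by
    intro v hv hn u hu
    rw [← hsup] at hu
    exact hu.resolve_right (hNI1 v hv hn u)
  have hCG1 : Sup G₁.edgeSet C := by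
    intro e he
    by_contra hh
    have : e ∈ H.edgeSet := by by_contra h'; exact hh (hCS e h')
    apply he
    rw [mem_fl]
    refine ⟨edgeSet_subset_edgeSet.2 (ins_le _) this, Or.inr (Or.inr (Or.inl hh))⟩
  -- rep of the two parts
  obtain ⟨l₂, r₂, h₂, o₂⟩ := merge2 hrep (G₂ := G₂) (fun a b hab => (hHQ hab.1).1) β hC (by
    intro e
    induction e with
    | h a b =>
    intro hQ h2
    have hQ : Q.Adj a b := hQ
    by_cases hax : a = x
    · subst hax
      have := hβ.one b hQ
      rw [this.1, this.2]; simp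
    by_cases hbx : b = x
    · subst hbx
      have := hβ.one a hQ.symm
      rw [Sym2.eq_swap, this.1, this.2]; simp
    have hG : G.Adj a b := by
      rcases hQ.2.2.2 with h4 | h4 | h4
      · exact h4
      · exact (hax h4.1).elim
      · exact (hbx h4.1).elim
    have hH := hHb hG hax hQ.2.1 hbx hQ.2.2.1
    have h0 : C s(a, b) = 0 := by by_contra hh; exact h2 ⟨hH, Or.inl hh⟩
    have h1 : β (l s(a, b)) ≠ 0 := fun hh => h2 ⟨hH, Or.inr hh⟩
    exact ⟨h1, by rw [← hCl hH h0]; exact h1⟩) (by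
    intro e he h0
    rw [mem_fl] at he
    exact he.2.resolve_left (fun hh => hh h0))
  obtain ⟨F₁, l₁, r₁, h₁⟩ : PL G₁ := h.sub (fl_le _ _) (e := es) (edgeSet_subset_edgeSet.2 (ins_le _) hes) (by
    rw [mem_fl]
    have k1 : β (l es) = 0 := hle _ hes1
    have k2 : β (r es) = 0 := hle _ hes2
    rintro ⟨_, h1 | h1 | h1 | h1⟩
    · induction es with
      | h a b =>
      obtain ⟨_, h5, h6, h7, h8⟩ := hHa hes
      rcases Sym2.mem_iff.1 h1 with h1 | h1
      · exact h5 h1.symm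
      · exact h7 h1.symm
    · induction es with
      | h a b =>
      obtain ⟨_, h5, h6, h7, h8⟩ := hHa hes
      rcases Sym2.mem_iff.1 h1 with h1 | h1
      · exact h6 h1.symm
      · exact h8 h1.symm
    · rw [hCdef, dl_edge _ _ _ (hHQ' hes), k1, k2, add_zero] at h1
      exact h1 rfl
    · exact h1.1 k1)
  obtain ⟨β₁, hβ₁⟩ := h₁.full C hCG1 hC.2.1
  have hxC : x ∉ VC C := fun hh => (hVC x hh).1 rfl
  have hyC : y ∉ VC C := fun hh => (hVC y hh).2 rfl
  have hx1 : G₁.Adj x y := ⟨hxy, Or.inl (by simp)⟩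
  have hside1 : ∀ w, w ∉ VC C -> ∀ u w', G₁.Adj w u -> G₁.Adj w w' -> β₁ (l₁ s(w, u)) = β₁ (l₁ s(w, w')) := by
    intro w hw u w' hu hw'
    refine same_side h₁ β₁ (fun t => by rw [← hβ₁]; exact nVC hw t) hu hw' ?_
    have hr := h.c1 (x := w) (u := u) (w := w') ⟨w, hu.1.symm⟩ ⟨w, hw'.1.symm⟩ hu.ne' hw'.ne'
    have main : ∀ u w', G₁.Adj w u -> (ins G {w}ᶜ).Reachable u w' →
        (ins G₁ {w}ᶜ).Reachable u w' ∨ ∃ c ∈ VC C, (ins G₁ {w}ᶜ).Reachable u c := by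
      intro u w' hu hr
      by_contra hh
      push Not at hh
      refine hh.1 (reach_closed (fun t => (ins G₁ {w}ᶜ).Reachable u t) hr (Reachable.refl _) ?_)
      intro a b hab ha
      refine ha.trans (Adj.reachable ⟨?_, hab.2⟩)
      have haC : a ∉ VC C := fun h' => hh.2 a h' ha
      refine hG1all a haC ?_ b hab.1
      by_cases e : a = u
      · rw [e]; exact ⟨w, hu.symm⟩
      · obtain ⟨p⟩ := ha.symm
        cases p with
        | nil => exact (e rfl).elim
        | cons h' _ => exact ⟨_, h'.1⟩
    rcases main u w' hu hr with h1 | ⟨c, hc, hc1⟩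
    · exact h1
    rcases main w' u hw' hr.symm with h1 | ⟨c', hc', hc1'⟩
    · exact h1.symm
    refine hc1.trans (Reachable.trans ?_ hc1'.symm)
    refine (circ_conn hC hCG1 hc hc').mono ?_
    rintro a b ⟨h1, h2⟩
    refine ⟨h1, ?_, ?_⟩
    · rintro rfl; exact h2 (nVC hw b)
    · rintro rfl; exact h2 (by rw [Sym2.eq_swap]; exact nVC hw a)
  -- everything off the circuit is connected to `x`
  have hconn : ∀ w, w ∉ VC C -> NI G₁ w -> (ins G₁ (VC C)ᶜ).Reachable x w := by
    intro w hw hn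
    by_contra hnr
    let D : Set V := {a | (ins G₁ (VC C)ᶜ).Reachable w a}
    have hwD : w ∈ D := Reachable.refl _
    have hDC : ∀ a ∈ D, a ∉ VC C := fun a ha => reach_ins_mem ha hw
    have hDn : ∀ a ∈ D, NI G₁ a := by
      intro a ha
      by_cases e : a = w
      · rw [e]; exact hn
      · obtain ⟨p⟩ := ha.symm
        cases p with
        | nil => exact (e rfl).elim
        | cons h' _ => exact ⟨_, h'.1⟩
    have hDst : ∀ a ∈ D, ∀ b, G.Adj a b -> b ∉ VC C -> b ∈ D := fun a ha b hab hb =>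
      ha.trans (Adj.reachable ⟨hG1all a (hDC a ha) (hDn a ha) b hab, hDC a ha, hb⟩)
    have hxD : x ∉ D := fun hh => hnr hh.symm
    have hyD : y ∉ D := fun hh => hxD (hDst y hh x hxy.symm hxC)
    have hDI : ∀ a ∈ D, ∀ b, G.Adj a b -> Inn.Adj a b := by
      intro a ha b hab
      have ax : a ≠ x := by rintro rfl; exact hxD ha
      have ay : a ≠ y := by rintro rfl; exact hyD ha
      have bx : b ≠ x := by rintro rfl; exact hxD (hDst a ha _ hab hxC)
      have by' : b ≠ y := by rintro rfl; exact hyD (hDst a ha _ hab hyC)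
      exact hG1 (hG1all a (hDC a ha) (hDn a ha) b hab) ax ay bx by' (nVC (hDC a ha) b)
    have hDcn : Cn Inn D := by
      have : ∀ a ∈ D, (ins Inn D).Reachable w a := by
        intro a ha
        have := reach_closed (fun t => (ins Inn D).Reachable w t ∧ t ∈ D) ha ⟨Reachable.refl _, hwD⟩ (by
          rintro s t hst ⟨i1, i2⟩
          have ht : t ∈ D := i2.trans (Adj.reachable hst)
          exact ⟨i1.trans (Adj.reachable ⟨hDI s i2 t hst.1.1, i2, ht⟩), ht⟩)
        exact this.1
      exact ⟨⟨w, hwD⟩, fun a ha b hb => (this a ha).symm.trans (this b hb)⟩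
    have hatt : ∃ p0 ∈ VC C, ∀ p ∈ VC C, (∃ d ∈ D, G.Adj d p) -> p = p0 := by
      by_cases hA : ∃ p ∈ VC C, ∃ d ∈ D, G.Adj d p
      · obtain ⟨p0, hp0, d, hd, hdp⟩ := hA
        refine ⟨p0, hp0, ?_⟩
        rintro p hp ⟨d', hd', hdp'⟩
        by_contra hne
        exact hnoear (Or.inr ⟨D, hDcn, Set.disjoint_left.2 hDC, p, hp, p0, hp0, hne,
          ⟨d', hd', (hDI d' hd' p hdp').symm⟩, d, hd, (hDI d hd p0 hdp).symm⟩)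
      · obtain ⟨e, he⟩ : ∃ e, C e ≠ 0 := by
          by_contra hh; push Not at hh; exact hC.1 (funext hh)
        induction e with
        | h a b => exact ⟨a, ⟨b, he⟩, fun p hp hd => (hA ⟨p, hp, hd⟩).elim⟩
    obtain ⟨p0, hp0, hp0'⟩ := hatt
    have hr := h.c1 (x := p0) (u := w) (w := x) (by obtain ⟨t, ht⟩ := hn; exact ⟨t, ht.1⟩) ⟨y, hxy⟩
      (by rintro rfl; exact hw hp0) (by rintro rfl; exact hxC hp0)
    refine hxD (reach_closed (fun t => t ∈ D) hr hwD ?_)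
    intro a b hab ha
    refine hDst a ha b hab.1 fun hb => ?_
    exact hab.2.2 (hp0' b hb ⟨a, ha, hab.1⟩)
  have hall : ∀ w, w ∉ VC C -> ∀ u, G₁.Adj w u -> β₁ (l₁ s(w, u)) = β₁ (l₁ s(x, y)) := by
    intro w hw u hu
    have hr := hconn w hw ⟨u, hu⟩
    have := reach_closed (fun t => ∀ u, G₁.Adj t u -> β₁ (l₁ s(t, u)) = β₁ (l₁ s(x, y))) hr
      (fun u hu => hside1 x hxC u y hu hx1) (by
        rintro a b ⟨hab, ha, hb⟩ ih u hu
        rw [hside1 b hb u a hu hab.symm, Sym2.eq_swap]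
        exact ih b hab)
    exact this u hu
  let β₂ : F₁ -> ZMod 2 := β₁ + fun _ => β₁ (l₁ s(x, y))
  have hβ₂ : dl G₁ l₁ r₁ β₂ = C := by rw [dl_add, dl_const, add_zero, ← hβ₁]
  obtain ⟨l₁', r₁', h₁', o₁⟩ := merge h₁ β₂ (by rw [hβ₂]; exact hC) (by
    intro e
    induction e with
    | h a b =>
    intro he h0
    rw [hβ₂] at h0
    have he : G₁.Adj a b := he
    simp only [β₂, Pi.add_apply]
    rw [z2eq]
    by_cases ha : a ∈ VC C
    · by_cases hb : b ∈ VC C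
      · exfalso
        have hi := hG1 he (hVC a ha).1 (hVC a ha).2 (hVC b hb).1 (hVC b hb).2 h0
        exact hnoear (Or.inl ⟨a, ha, b, hb, hi, h0⟩)
      · rw [Sym2.eq_swap]; exact hall b hb a he.symm
    · exact hall a ha b he)
  rw [hβ₂] at o₁
  obtain ⟨x0, hx0⟩ : ∃ x0, x0 ∈ VC C := by
    obtain ⟨e, he⟩ : ∃ e, C e ≠ 0 := by
      by_contra hh; push Not at hh; exact hC.1 (funext hh)
    induction e with
    | h a b => exact ⟨a, ⟨b, he⟩⟩
  refine h.npl (hsup ▸ glueS h₁' h₂ none none (fun e he he' => o₁ e (hcom e he he'))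
    (fun e he he' => o₂ e (hcom e he he')) (VC C) x0 ?_ ?_)
  · intro t ht
    refine (circ_conn hC hCS hx0 ht).mono ?_
    rintro a b ⟨k1, k2⟩
    exact ⟨⟨k1.1, Or.inr (Or.inr (Or.inl k2))⟩, k1, Or.inl k2⟩
  · intro v hv
    by_cases hn : NI G₁ v
    · exact Or.inr (hNI1 v hv hn)
    · exact Or.inl fun u hu => (hn ⟨u, hu⟩).elim

end ff

section lp
variable {V : Type*}

/-- path in `K` -/
structure LP (K : SimpleGraph V) (u : ℕ -> V) (k : ℕ) : Prop where
  adj : ∀ t < k, K.Adj (u t) (u (t + 1))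
  inj : ∀ i ≤ k, ∀ j ≤ k, u i = u j -> i = j

theorem LP.mono {K : SimpleGraph V} {u : ℕ -> V} {k m : ℕ} (h : LP K u m) (hk : k ≤ m) : LP K u k :=
  ⟨fun t ht => h.adj t ω, fun i hi j hj => h.inj i ω j ω⟩

theorem LP.shift {K : SimpleGraph V} {u : ℕ -> V} {j m : ℕ} (h : LP K u m) (hj : j ≤ m) : LP K (fun t => u (j + t)) (m - j) :=
  ⟨fun t ht => h.adj (j + t) ω, fun i hi i' hi' hh => by have := h.inj _ ω _ ω hh; omega⟩

theorem LP.rev {K : SimpleGraph V} {u : ℕ -> V} {m : ℕ} (h : LP K u m) : LP K (fun t => u (m - t)) m :=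
  ⟨fun t ht => by
    have := h.adj (m - (t + 1)) ω
    rw [show m - (t + 1) + 1 = m - t by omega] at this
    exact this.symm, fun i hi i' hi' hh => by have := h.inj _ ω _ ω hh; omega⟩

theorem LP.seg {K : SimpleGraph V} {u : ℕ -> V} {m a b : ℕ} (h : LP K u m) (hab : a ≤ b) (hb : b ≤ m) :
    Cn K {v | ∃ t, a ≤ t ∧ t ≤ b ∧ v = u t} := by
  induction b with
  | zero =>
    have : {v | ∃ t, a ≤ t ∧ t ≤ 0 ∧ v = u t} = {u 0} := by
      ext v; simp only [Set.mem_setOf_eq, Set.mem_singleton_iff]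
      constructor
      · rintro ⟨t, _, h2, rfl⟩; rw [show t = 0 by omega]
      · rintro rfl; exact ⟨0, ω, le_rfl, rfl⟩
    rw [this]; exact Cn.single _
  | succ b ih =>
    by_cases e : a = b + 1
    · have : {v | ∃ t, a ≤ t ∧ t ≤ b + 1 ∧ v = u t} = {u (b + 1)} := by
        ext v; simp only [Set.mem_setOf_eq, Set.mem_singleton_iff]
        constructor
        · rintro ⟨t, _, h2, rfl⟩; rw [show t = b + 1 by omega]
        · rintro rfl; exact ⟨b + 1, ω, le_rfl, rfl⟩
      rw [this]; exact Cn.single _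
    · have := (ih ω ω).insert (a := u b) (b := u (b + 1)) ⟨b, ω, le_rfl, rfl⟩ (h.adj b ω)
      convert this using 1
      ext v
      simp only [Set.mem_setOf_eq, Set.mem_insert_iff]
      constructor
      · rintro ⟨t, h1, h2, rfl⟩
        by_cases e : t = b + 1
        · left; rw [e]
        · right; exact ⟨t, h1, ω, rfl⟩
      · rintro (rfl | ⟨t, h1, h2, rfl⟩)
        · exact ⟨b + 1, ω, le_rfl, rfl⟩
        · exact ⟨t, h1, ω, rfl⟩

end lp

section cycles
variable {V : Type*} [Fintype V]

theorem circ_of_two {K : SimpleGraph V} {C : Sym2 V -> ZMod 2} (hK : Sup K.edgeSet C) {x0 : V} (hx0 : x0 ∈ VC C)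
    (h2 : ∀ v ∈ VC C, ∃ a b, a ≠ b ∧ ∀ w, C s(v, w) ≠ 0 ↔ w = a ∨ w = b)
    (hc : ∀ v ∈ VC C, (fl K (fun e => C e ≠ 0)).Reachable x0 v) : Circ C := by
  have hsum : ∀ d : Sym2 V -> ZMod 2, (∀ e, C e = 0 -> d e = 0) -> ∀ v a b, a ≠ b →
      (∀ w, C s(v, w) ≠ 0 ↔ w = a ∨ w = b) -> bd d v = d s(v, a) + d s(v, b) := by
    intro d hd v a b hab hw
    rw [bd_apply, ← Finset.sum_subset (Finset.subset_univ ({a, b} : Finset V)), Finset.sum_pair hab]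
    intro w _ hw'
    apply hd
    by_contra hh
    simp at hw'
    have := (hw w).1 hh
    tauto
  refine ⟨?_, ?_, ?_⟩
  · rintro rfl
    obtain ⟨u, hu⟩ := hx0
    exact hu rfl
  · ext v
    by_cases hv : v ∈ VC C
    · obtain ⟨a, b, hab, hw⟩ := h2 v hv
      rw [hsum C (fun _ h => h) v a b hab hw, z2ne ((hw a).2 (Or.inl rfl)), z2ne ((hw b).2 (Or.inr rfl))]
      exact z2 1
    · exact bd_nVC hv (fun _ h => h)
  · intro d hb hd
    have hloc : ∀ v ∈ VC C, ∀ w w', C s(v, w) ≠ 0 -> C s(v, w') ≠ 0 -> d s(v, w) = d s(v, w') := by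
      intro v hv w w' hw hw'
      obtain ⟨a, b, hab, hh⟩ := h2 v hv
      have h3 := hsum d hd v a b hab hh
      rw [hb, Pi.zero_apply, eq_comm, z2eq] at h3
      rcases (hh w).1 hw with rfl | rfl <;> rcases (hh w').1 hw' with rfl | rfl <;> simp [h3]
    obtain ⟨u0, hu0⟩ := hx0
    have hall : ∀ v ∈ VC C, ∀ w, C s(v, w) ≠ 0 -> d s(v, w) = d s(x0, u0) := by
      intro v hv
      refine reach_closed (fun v => ∀ w, C s(v, w) ≠ 0 -> d s(v, w) = d s(x0, u0)) (hc v hv)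
        (fun w hw => hloc x0 ⟨u0, hu0⟩ w u0 hw hu0) ?_
      rintro a b ⟨_, hab⟩ ih w hw
      rw [← ih b hab, Sym2.eq_swap (a := a)]
      exact hloc b ⟨w, hw⟩ w a hw (by rw [Sym2.eq_swap]; exact hab)
    rcases z2cases (d s(x0, u0)) with h0 | h0
    · left
      ext e
      induction e with
      | h a b =>
      by_cases he : C s(a, b) = 0
      · exact hd _ he
      · rw [hall a ⟨b, he⟩ b he, h0]; rfl
    · right
      ext e
      induction e with
      | h a b =>
      by_cases he : C s(a, b) = 0
      · rw [hd _ he, he]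
      · rw [hall a ⟨b, he⟩ b he, h0, z2ne he]

/-- closed sequence as a chain -/
def cyc (u : ℕ -> V) (k : ℕ) : Sym2 V -> ZMod 2 :=
  fun e => if (∃ t < k, e = s(u t, u (t + 1))) ∨ e = s(u 0, u k) then 1 else 0

theorem cyc_iff {K : SimpleGraph V} {u : ℕ -> V} {k : ℕ} (h : LP K u k) {i : ℕ} (hi : i ≤ k) (w : V) :
    cyc u k s(u i, w) ≠ 0 ↔ ∃ j ≤ k, w = u j ∧ (j = i + 1 ∨ i = j + 1 ∨ (i = 0 ∧ j = k) ∨ (i = k ∧ j = 0)) := by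
  simp only [cyc, ne_eq, ite_eq_right_iff, one_ne_zero, imp_false, not_not]
  constructor
  · rintro (⟨t, ht, he⟩ | he)
    · rw [Sym2.eq_iff] at he
      rcases he with ⟨h1, rfl⟩ | ⟨h1, rfl⟩
      · have := h.inj i hi t ω h1
        exact ⟨t + 1, ω, rfl, Or.inl ω⟩
      · have := h.inj i hi _ ω h1
        exact ⟨t, ω, rfl, Or.inr (Or.inl ω)⟩
    · rw [Sym2.eq_iff] at he
      rcases he with ⟨h1, rfl⟩ | ⟨h1, rfl⟩
      · have := h.inj i hi _ ω h1
        exact ⟨k, le_rfl, rfl, Or.inr (Or.inr (Or.inl ⟨this, rfl⟩))⟩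
      · have := h.inj i hi _ ω h1
        exact ⟨0, ω, rfl, Or.inr (Or.inr (Or.inr ⟨this, rfl⟩))⟩
  · rintro ⟨j, hj, rfl, rfl | rfl | ⟨rfl, rfl⟩ | ⟨rfl, rfl⟩⟩
    · exact Or.inl ⟨i, ω, rfl⟩
    · exact Or.inl ⟨j, ω, Sym2.eq_swap⟩
    · exact Or.inr rfl
    · exact Or.inr Sym2.eq_swap

theorem cyc_VC {K : SimpleGraph V} {u : ℕ -> V} {k : ℕ} (h : LP K u k) (hk : 2 ≤ k) {v : V} :
    v ∈ VC (cyc u k) ↔ ∃ t ≤ k, v = u t := by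
  constructor
  · rintro ⟨w, hw⟩
    simp only [cyc, ne_eq, ite_eq_right_iff, one_ne_zero, imp_false, not_not] at hw
    rcases hw with ⟨t, ht, he⟩ | he
    · rw [Sym2.eq_iff] at he
      rcases he with ⟨rfl, _⟩ | ⟨rfl, _⟩
      · exact ⟨t, ω, rfl⟩
      · exact ⟨t + 1, ω, rfl⟩
    · rw [Sym2.eq_iff] at he
      rcases he with ⟨rfl, _⟩ | ⟨rfl, _⟩
      · exact ⟨0, ω, rfl⟩
      · exact ⟨k, ω, rfl⟩
  · rintro ⟨t, ht, rfl⟩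
    by_cases e : t = k
    · exact ⟨u 0, (cyc_iff h ht _).2 ⟨0, ω, rfl, Or.inr (Or.inr (Or.inr ⟨e, rfl⟩))⟩⟩
    · exact ⟨u (t + 1), (cyc_iff h ht _).2 ⟨t + 1, ω, rfl, Or.inl rfl⟩⟩

theorem cyc_sup {K : SimpleGraph V} {u : ℕ -> V} {k : ℕ} (h : LP K u k) (hc : K.Adj (u 0) (u k)) :
    Sup K.edgeSet (cyc u k) := by
  intro e he
  simp only [cyc]
  rw [if_neg]
  rintro (⟨t, ht, rfl⟩ | rfl)
  · exact he (h.adj t ht)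
  · exact he hc

theorem cyc_two {K : SimpleGraph V} {u : ℕ -> V} {k : ℕ} (h : LP K u k) (hk : 2 ≤ k) :
    ∀ v ∈ VC (cyc u k), ∃ a b, a ≠ b ∧ ∀ w, cyc u k s(v, w) ≠ 0 ↔ w = a ∨ w = b := by
  intro v hv
  obtain ⟨t, ht, rfl⟩ := (cyc_VC h hk).1 hv
  have hI : ∀ i ≤ k, ∀ j ≤ k, i ≠ j -> u i ≠ u j := fun i hi j hj hne hh => hne (h.inj i hi j hj hh)
  by_cases e0 : t = 0
  · refine ⟨u 1, u k, hI _ ω _ ω ω, fun w => ?_⟩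
    rw [cyc_iff h ht]
    constructor
    · rintro ⟨j, hj, rfl, hh⟩
      have : j = 1 ∨ j = k := by omega
      rcases this with rfl | rfl <;> simp
    · rintro (rfl | rfl)
      · exact ⟨1, ω, rfl, ω⟩
      · exact ⟨k, ω, rfl, ω⟩
  · by_cases e1 : t = k
    · refine ⟨u (k - 1), u 0, hI _ ω _ ω ω, fun w => ?_⟩
      rw [cyc_iff h ht]
      constructor
      · rintro ⟨j, hj, rfl, hh⟩
        have : j = k - 1 ∨ j = 0 := by omega
        rcases this with rfl | rfl <;> simp
      · rintro (rfl | rfl)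
        · exact ⟨k - 1, ω, rfl, ω⟩
        · exact ⟨0, ω, rfl, ω⟩
    · refine ⟨u (t - 1), u (t + 1), hI _ ω _ ω ω, fun w => ?_⟩
      rw [cyc_iff h ht]
      constructor
      · rintro ⟨j, hj, rfl, hh⟩
        have : j = t - 1 ∨ j = t + 1 := by omega
        rcases this with rfl | rfl <;> simp
      · rintro (rfl | rfl)
        · exact ⟨t - 1, ω, rfl, ω⟩
        · exact ⟨t + 1, ω, rfl, ω⟩

theorem cyc_circ {K : SimpleGraph V} {u : ℕ -> V} {k : ℕ} (h : LP K u k) (hk : 2 ≤ k) (hc : K.Adj (u 0) (u k)) :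
    Circ (cyc u k) := by
  refine circ_of_two (cyc_sup h hc) (x0 := u 0) ((cyc_VC h hk).2 ⟨0, ω, rfl⟩) (cyc_two h hk) ?_
  · intro v hv
    obtain ⟨t, ht, rfl⟩ := (cyc_VC h hk).1 hv
    clear hv
    induction t with
    | zero => exact Reachable.refl _
    | succ t ih =>
      refine (ih ω).trans (Adj.reachable ⟨h.adj t ω, ?_⟩)
      exact (cyc_iff h ω _).2 ⟨t + 1, ht, rfl, Or.inl rfl⟩

end cycles

section final
variable {V : Type*} [Fintype V]

theorem Mn.f' {G : SimpleGraph V} (h : Mn G) {x c : V} (hxc : G.Adj x c) {C : Sym2 V -> ZMod 2} (hC : Circ C)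
    (hS : Sup G.edgeSet C) (hx : x ∉ VC C) (hc : c ∉ VC C) {D : Set V} (hD : Cn G D) (hxD : x ∉ D) (hcD : c ∉ D)
    (hdis : ∀ v ∈ D, v ∉ VC C) {p q : V} (hp : p ∈ VC C) (hq : q ∈ VC C) (hpq : p ≠ q)
    (hpD : ∃ d ∈ D, G.Adj p d) (hqD : ∃ d ∈ D, G.Adj q d) : False := by
  have hmem : ∀ v, v ∈ VC C ∨ v ∈ D -> v ∈ ({x, c}ᶜ : Set V) := by
    intro v hv
    simp only [Set.mem_compl_iff, Set.mem_insert_iff, Set.mem_singleton_iff, not_or]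
    constructor <;> rintro rfl <;> tauto
  refine h.f hxc hC ?_ (Or.inr ⟨D, ?_, Set.disjoint_left.2 hdis, p, hp, q, hq, hpq, ?_, ?_⟩)
  · intro e
    induction e with
    | h a b =>
    intro he
    by_contra hh
    exact he ⟨VC_sup hS hh, hmem a (Or.inl ⟨b, hh⟩), hmem b (Or.inl ⟨a, by rw [Sym2.eq_swap]; exact hh⟩)⟩
  · rw [Cn.ins_iff]
    · exact hD
    · exact fun v hv => hmem v (Or.inr hv)
  · obtain ⟨d, hd, hpd⟩ := hpD
    exact ⟨d, hd, hpd, hmem p (Or.inl hp), hmem d (Or.inr hd)⟩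
  · obtain ⟨d, hd, hpd⟩ := hqD
    exact ⟨d, hd, hpd, hmem q (Or.inl hq), hmem d (Or.inr hd)⟩

structure TL (G : SimpleGraph V) (x y : V) (C₁ C₂ : Sym2 V -> ZMod 2) (p₁ p₂ a₁ b₁ a₂ b₂ : V) : Prop where
  hxy : G.Adj x y
  c₁ : Circ C₁
  c₂ : Circ C₂
  s₁ : Sup G.edgeSet C₁
  s₂ : Sup G.edgeSet C₂
  x₁ : x ∉ VC C₁
  x₂ : x ∉ VC C₂
  y₁ : y ∉ VC C₁
  y₂ : y ∉ VC C₂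
  int : ∀ v ∈ VC C₁, v ∈ VC C₂ -> v = p₁ ∧ v = p₂
  ha₁ : a₁ ∈ VC C₁
  hb₁ : b₁ ∈ VC C₁
  ha₂ : a₂ ∈ VC C₂
  hb₂ : b₂ ∈ VC C₂
  ha₁p : a₁ ≠ p₁
  hb₁p : b₁ ≠ p₁
  ha₂p : a₂ ≠ p₂
  hb₂p : b₂ ≠ p₂
  n₁ : a₁ ≠ b₁
  n₂ : a₂ ≠ b₂
  ja₁ : G.Adj x a₁ ∨ G.Adj y a₁
  jb₁ : G.Adj x b₁ ∨ G.Adj y b₁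
  ja₂ : G.Adj x a₂ ∨ G.Adj y a₂
  jb₂ : G.Adj x b₂ ∨ G.Adj y b₂
  hp₂ : p₂ ∈ VC C₂
  con : ∀ d, d = a₁ ∨ d = b₁ -> ∃ D, Cn G D ∧ d ∈ D ∧ (∀ v ∈ D, v = d ∨ (v ≠ a₁ ∧ v ≠ b₁)) ∧ (∀ v ∈ D, v ∉ VC C₂) ∧
    x ∉ D ∧ y ∉ D ∧ ∃ z ∈ D, G.Adj p₂ z

theorem TL.swap {G : SimpleGraph V} {x y : V} {C₁ C₂ : Sym2 V -> ZMod 2} {p₁ p₂ a₁ b₁ a₂ b₂ : V}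
    (h : TL G x y C₁ C₂ p₁ p₂ a₁ b₁ a₂ b₂) : TL G y x C₁ C₂ p₁ p₂ a₁ b₁ a₂ b₂ :=
  { h with
    hxy := h.hxy.symm, x₁ := h.y₁, x₂ := h.y₂, y₁ := h.x₁, y₂ := h.x₂, ja₁ := h.ja₁.symm, jb₁ := h.jb₁.symm
    ja₂ := h.ja₂.symm, jb₂ := h.jb₂.symm
    con := fun d hd => by
      obtain ⟨D, h1, h2, h3, h4, h5, h6, h7⟩ := h.con d hd
      exact ⟨D, h1, h2, h3, h4, h6, h5, h7⟩ }

theorem TL.A2 {G : SimpleGraph V} {x y : V} {C₁ C₂ : Sym2 V -> ZMod 2} {p₁ p₂ a₁ b₁ a₂ b₂ : V}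
    (h : TL G x y C₁ C₂ p₁ p₂ a₁ b₁ a₂ b₂) (hM : Mn G) {c s t : V} (hc : c ∈ VC C₁) (hcp : c ≠ p₁) (hxc : G.Adj x c)
    (hs : s ∈ VC C₂) (ht : t ∈ VC C₂) (hys : G.Adj y s) (hyt : G.Adj y t) : s = t := by
  by_contra hst
  refine hM.f' hxc h.c₂ h.s₂ h.x₂ (fun hh => hcp (h.int c hc hh).1) (D := {y}) (Cn.single y) ?_ ?_ ?_ hs ht hst
    ⟨y, rfl, hys.symm⟩ ⟨y, rfl, hyt.symm⟩
  · exact h.hxy.ne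
  · rintro rfl; exact h.y₁ hc
  · rintro v rfl; exact h.y₂

theorem TL.A1 {G : SimpleGraph V} {x y : V} {C₁ C₂ : Sym2 V -> ZMod 2} {p₁ p₂ a₁ b₁ a₂ b₂ : V}
    (h : TL G x y C₁ C₂ p₁ p₂ a₁ b₁ a₂ b₂) (hM : Mn G) {c s t : V} (hc : c ∈ VC C₂) (hcp : c ≠ p₂) (hxc : G.Adj x c)
    (hs : s ∈ VC C₁) (ht : t ∈ VC C₁) (hys : G.Adj y s) (hyt : G.Adj y t) : s = t := by
  by_contra hst
  refine hM.f' hxc h.c₁ h.s₁ h.x₁ (fun hh => hcp (h.int c hh hc).2) (D := {y}) (Cn.single y) ?_ ?_ ?_ hs ht hst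
    ⟨y, rfl, hys.symm⟩ ⟨y, rfl, hyt.symm⟩
  · exact h.hxy.ne
  · rintro rfl; exact h.y₂ hc
  · rintro v rfl; exact h.y₁

/-- only `x` sees the first loop -/
theorem TL.only {G : SimpleGraph V} {x y : V} {C₁ C₂ : Sym2 V -> ZMod 2} {p₁ p₂ a₁ b₁ a₂ b₂ : V}
    (h : TL G x y C₁ C₂ p₁ p₂ a₁ b₁ a₂ b₂) (hM : Mn G) (xa : G.Adj x a₁) (xb : G.Adj x b₁) : False := by
  have hy2 : ∀ c ∈ VC C₂, c ≠ p₂ -> ¬ G.Adj y c := fun c hc hcp hyc =>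
    h.n₁ (h.swap.A1 hM hc hcp hyc h.ha₁ h.hb₁ xa xb)
  have xa2 : G.Adj x a₂ := h.ja₂.resolve_right (hy2 _ h.ha₂ h.ha₂p)
  have xb2 : G.Adj x b₂ := h.jb₂.resolve_right (hy2 _ h.hb₂ h.hb₂p)
  have key : ∀ t, G.Adj y t -> t ≠ x -> t = p₁ := by
    intro t ht htx
    have t1 : t ∈ VC C₁ := by
      by_contra hh
      refine hM.f' ht h.c₁ h.s₁ h.y₁ hh (D := {x}) (Cn.single x) h.hxy.ne' htx ?_ h.ha₁ h.hb₁ h.n₁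
        ⟨x, rfl, xa.symm⟩ ⟨x, rfl, xb.symm⟩
      rintro v rfl; exact h.x₁
    have t2 : t ∈ VC C₂ := by
      by_contra hh
      refine hM.f' ht h.c₂ h.s₂ h.y₂ hh (D := {x}) (Cn.single x) h.hxy.ne' htx ?_ h.ha₂ h.hb₂ h.n₂
        ⟨x, rfl, xa2.symm⟩ ⟨x, rfl, xb2.symm⟩
      rintro v rfl; exact h.x₂
    exact (h.int t t1 t2).1
  obtain ⟨t, h1, h2, h3⟩ := hM.deg3 h.hxy.symm p₁
  exact h3 (key t h1 h2)

theorem TL.both {G : SimpleGraph V} {x y : V} {C₁ C₂ : Sym2 V -> ZMod 2} {p₁ p₂ a₁ b₁ a₂ b₂ : V}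
    (h : TL G x y C₁ C₂ p₁ p₂ a₁ b₁ a₂ b₂) (hM : Mn G) {c₁ d₁ : V} (hc₁ : c₁ = a₁ ∨ c₁ = b₁) (hd₁ : d₁ = a₁ ∨ d₁ = b₁)
    (xc : G.Adj x c₁) (yd : G.Adj y d₁) : False := by
  have hcm : c₁ ∈ VC C₁ ∧ c₁ ≠ p₁ := by rcases hc₁ with rfl | rfl; exacts [⟨h.ha₁, h.ha₁p⟩, ⟨h.hb₁, h.hb₁p⟩]
  have hdm : d₁ ∈ VC C₁ ∧ d₁ ≠ p₁ := by rcases hd₁ with rfl | rfl; exacts [⟨h.ha₁, h.ha₁p⟩, ⟨h.hb₁, h.hb₁p⟩]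
  have ny : ¬ (G.Adj y a₂ ∧ G.Adj y b₂) := fun hh => h.n₂ (h.A2 hM hcm.1 hcm.2 xc h.ha₂ h.hb₂ hh.1 hh.2)
  have nx : ¬ (G.Adj x a₂ ∧ G.Adj x b₂) := fun hh => h.n₂ (h.swap.A2 hM hdm.1 hdm.2 yd h.ha₂ h.hb₂ hh.1 hh.2)
  have ja := h.ja₂
  have jb := h.jb₂
  have hyd2 : ∃ d₂ ∈ VC C₂, d₂ ≠ p₂ ∧ G.Adj y d₂ := by
    by_cases hh : G.Adj y a₂
    · exact ⟨a₂, h.ha₂, h.ha₂p, hh⟩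
    · exact ⟨b₂, h.hb₂, h.hb₂p, by tauto⟩
  have hxc2 : ∃ c₂ ∈ VC C₂, c₂ ≠ p₂ ∧ G.Adj x c₂ := by
    by_cases hh : G.Adj x a₂
    · exact ⟨a₂, h.ha₂, h.ha₂p, hh⟩
    · exact ⟨b₂, h.hb₂, h.hb₂p, by tauto⟩
  obtain ⟨d₂, hd₂, hd₂p, yd₂⟩ := hyd2
  obtain ⟨c₂, hc₂, hc₂p, xc₂⟩ := hxc2
  have ny' : ¬ (G.Adj y a₁ ∧ G.Adj y b₁) := fun hh => h.n₁ (h.A1 hM hc₂ hc₂p xc₂ h.ha₁ h.hb₁ hh.1 hh.2)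
  have nx' : ¬ (G.Adj x a₁ ∧ G.Adj x b₁) := fun hh => h.n₁ (h.swap.A1 hM hd₂ hd₂p yd₂ h.ha₁ h.hb₁ hh.1 hh.2)
  have ja' := h.ja₁
  have jb' := h.jb₁
  have hne : c₁ ≠ d₁ := by
    intro e
    rw [← e] at yd
    rcases hc₁ with e1 | e1
    · rw [e1] at xc yd
      rcases jb' with hh | hh
      · exact nx' ⟨xc, hh⟩
      · exact ny' ⟨yd, hh⟩
    · rw [e1] at xc yd
      rcases ja' with hh | hh
      · exact nx' ⟨hh, xc⟩
      · exact ny' ⟨hh, yd⟩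
  obtain ⟨D, D1, D2, D3, D4, D5, D6, z, hz, hpz⟩ := h.con d₁ hd₁
  have hcD : c₁ ∉ D := by
    intro hh
    rcases D3 _ hh with e | e
    · exact hne e
    · rcases hc₁ with e1 | e1
      · exact e.1 e1
      · exact e.2 e1
  refine hM.f' xc h.c₂ h.s₂ h.x₂ (fun hh => hcm.2 (h.int _ hcm.1 hh).1) (D := insert y D) (D1.insert D2 yd.symm)
    ?_ ?_ ?_ hd₂ h.hp₂ hd₂p ⟨y, by simp, yd₂.symm⟩ ⟨z, by simp [hz], hpz⟩
  · simp [h.hxy.ne, D5]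
  · simp only [Set.mem_insert_iff, not_or]
    exact ⟨by rintro rfl; exact h.y₁ hcm.1, hcD⟩
  · rintro v (rfl | hv)
    · exact h.y₂
    · exact D4 v hv

theorem TL.false {G : SimpleGraph V} {x y : V} {C₁ C₂ : Sym2 V -> ZMod 2} {p₁ p₂ a₁ b₁ a₂ b₂ : V}
    (h : TL G x y C₁ C₂ p₁ p₂ a₁ b₁ a₂ b₂) (hM : Mn G) : False := by
  have ja := h.ja₁
  have jb := h.jb₁
  by_cases h1 : G.Adj x a₁
  · by_cases h2 : G.Adj x b₁
    · exact h.only hM h1 h2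
    · exact h.both hM (Or.inl rfl) (Or.inr rfl) h1 (by tauto)
  · by_cases h2 : G.Adj x b₁
    · exact h.both hM (Or.inr rfl) (Or.inl rfl) h2 (by tauto)
    · exact h.swap.only hM (by tauto) (by tauto)

end final

section reg
variable {V : Type*} [Fintype V]

theorem LP.lt {H : SimpleGraph V} {u : ℕ -> V} {m : ℕ} (h : LP H u m) : m < Fintype.card V := by
  have : Fintype.card (Fin (m + 1)) ≤ Fintype.card V :=
    Fintype.card_le_of_injective (fun i : Fin (m + 1) => u i)
      (fun i j hij => Fin.ext (h.inj i ω j ω hij))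
  simpa using this

theorem LP.cons {H : SimpleGraph V} {u : ℕ -> V} {m : ℕ} (h : LP H u m) {w : V} (hw : H.Adj (u 0) w)
    (hn : ∀ i ≤ m, w ≠ u i) : LP H (fun i => if i = 0 then w else u (i - 1)) (m + 1) := by
  constructor
  · intro t ht
    by_cases e : t = 0
    · subst e; simpa using hw.symm
    · have := h.adj (t - 1) ω
      rw [show t - 1 + 1 = t by omega] at this
      simpa [e] using this
  · intro i hi j hj hij
    by_cases e : i = 0 <;> by_cases e' : j = 0
    · omega
    · simp [e, e'] at hij; exact absurd hij (hn _ ω)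
    · simp [e, e'] at hij; exact absurd hij.symm (hn _ ω)
    · simp [e, e'] at hij
      have := h.inj _ ω _ ω hij
      omega

theorem no_two {H : SimpleGraph V} (hE : ∀ C, Circ C -> Sup H.edgeSet C -> Ear H C -> False)
    {u : ℕ -> V} {m : ℕ} (h : LP H u m) {i k : ℕ} (hi : 2 ≤ i) (hik : i < k) (hk : k ≤ m)
    (h1 : H.Adj (u 0) (u i)) (h2 : H.Adj (u 0) (u k)) : False := by
  have hl := h.mono hk
  refine hE _ (cyc_circ hl ω h2) (cyc_sup hl h2) (Or.inl ⟨u 0, ?_, u i, ?_, h1, ?_⟩)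
  · exact (cyc_VC hl ω).2 ⟨0, ω, rfl⟩
  · exact (cyc_VC hl ω).2 ⟨i, ω, rfl⟩
  · by_contra hh
    obtain ⟨j, hj, hj', hjj⟩ := (cyc_iff hl (Nat.zero_le _) _).1 hh
    have := hl.inj _ ω _ hj hj'
    omega

theorem LP.endL {H : SimpleGraph V} (hE : ∀ C, Circ C -> Sup H.edgeSet C -> Ear H C -> False)
    (hd : ∀ v t p, H.Adj v t -> ∃ q, H.Adj v q ∧ q ≠ p)
    {u : ℕ -> V} {m : ℕ} (h : LP H u m) (hmax : ∀ u' m', LP H u' m' -> m' ≤ m) (hm : 1 ≤ m) :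
    ∃ k, 2 ≤ k ∧ k ≤ m ∧ H.Adj (u 0) (u k) ∧ (∀ t, H.Adj (u 0) t -> t = u 1 ∨ t = u k) ∧
      (∀ t, H.Adj (u (k - 1)) t -> t = u (k - 2) ∨ t = u k) := by
  have hend : ∀ (u : ℕ -> V), LP H u m -> ∀ w, H.Adj (u 0) w -> ∃ i, 1 ≤ i ∧ i ≤ m ∧ w = u i := by
    intro u h w hw
    by_contra hh
    push Not at hh
    have := hmax _ _ (h.cons hw (fun i hi => by
      by_cases e : i = 0
      · rw [e]; exact hw.ne'
      · exact hh i ω hi))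
    omega
  have hN : ∀ (u : ℕ -> V), LP H u m -> ∀ k, 2 ≤ k -> k ≤ m -> H.Adj (u 0) (u k) -> ∀ t, H.Adj (u 0) t -> t = u 1 ∨ t = u k := by
    intro u h k hk hkm hadj t ht
    obtain ⟨i, hi, him, rfl⟩ := hend u h t ht
    by_cases e1 : i = 1
    · rw [e1]; simp
    by_cases ek : i = k
    · rw [ek]; simp
    exfalso
    rcases lt_or_gt_of_ne ek with hh | hh
    · exact no_two hE h ω hh hkm ht hadj
    · exact no_two hE h ω hh him hadj ht
  obtain ⟨q, hq, hq1⟩ := hd (u 0) (u 1) (u 1) (h.adj 0 ω)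
  obtain ⟨k, hk, hkm, rfl⟩ := hend u h q hq
  have hk2 : 2 ≤ k := by
    by_contra hh
    exact hq1 (by rw [show k = 1 by omega])
  refine ⟨k, hk2, hkm, hq, hN u h k hk2 hkm hq, ?_⟩
  have hr : LP H (fun i => if i < k then u (k - 1 - i) else u i) m := by
    constructor
    · intro t ht
      by_cases e1 : t + 1 < k
      · have := h.adj (k - 1 - (t + 1)) ω
        rw [show k - 1 - (t + 1) + 1 = k - 1 - t by omega] at this
        simpa [e1, show t < k by omega] using this.symm
      · by_cases e2 : t < k
        · have e3 : t + 1 = k := by omega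
          have e4 : k - 1 - t = 0 := by omega
          simp only [e3, e2, e4, if_true, lt_irrefl, if_false]
          exact hq
        · simpa [e1, e2] using h.adj t ht
    · intro i hi j hj hij
      by_cases e1 : i < k <;> by_cases e2 : j < k <;> simp only [e1, e2, if_true, if_false] at hij <;>
        have := h.inj _ ω _ ω hij <;> omega
  have := hN _ hr k hk2 hkm (by
    simp only [show 0 < k by omega, if_true, lt_irrefl, if_false]
    have := h.adj (k - 1) ω
    rw [show k - 1 + 1 = k by omega] at this
    exact this)
  intro t ht
  have := this t (by simpa [show 0 < k by omega] using ht)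
  simpa [show 1 < k by omega, show k - 1 - 1 = k - 2 by omega] using this

theorem two_reg {H : SimpleGraph V} (P : V -> Prop) (hE : ∀ C, Circ C -> Sup H.edgeSet C -> Ear H C -> False)
    (hd : ∀ v p, P v -> ∃ q, H.Adj v q ∧ q ≠ p) (hP : ∀ v t, H.Adj v t -> P v)
    (hc : ∀ v w, P v -> P w -> H.Reachable v w) (hne : ∃ v, P v) :
    (∀ v, P v -> ∃ a b, a ≠ b ∧ ∀ t, H.Adj v t ↔ t = a ∨ t = b) ∨
    ∃ (u : ℕ -> V) (m k j : ℕ), LP H u m ∧ 2 ≤ k ∧ k ≤ j ∧ j + 2 ≤ m ∧ H.Adj (u 0) (u k) ∧ H.Adj (u m) (u j) ∧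
      (∀ t, H.Adj (u 0) t -> t = u 1 ∨ t = u k) ∧ (∀ t, H.Adj (u (k - 1)) t -> t = u (k - 2) ∨ t = u k) ∧
      (∀ t, H.Adj (u m) t -> t = u (m - 1) ∨ t = u j) ∧ (∀ t, H.Adj (u (j + 1)) t -> t = u (j + 2) ∨ t = u j) := by
  obtain ⟨v0, hv0⟩ := hne
  obtain ⟨t0, ht0, _⟩ := hd v0 v0 hv0
  have hex : ∃ m, ∃ u, LP H u m ∧ ∀ u' m', LP H u' m' -> m' ≤ m := by
    let S : Set ℕ := {m | ∃ u, LP H u m}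
    have hS : S.Finite := (Set.finite_lt_nat (Fintype.card V)).subset (by rintro m ⟨u, hu⟩; exact hu.lt)
    have hSn : S.Nonempty := ⟨0, fun _ => v0, ⟨ω, ω⟩⟩
    obtain ⟨m, ⟨u, hu⟩, hm⟩ := Set.exists_max_image S id hS hSn
    exact ⟨m, u, hu, fun u' m' h => hm m' ⟨u', h⟩⟩
  obtain ⟨m, u, h, hmax⟩ := hex
  have hm : 1 ≤ m := by
    have : LP H (fun _ => t0) 0 := ⟨ω, ω⟩
    exact hmax _ _ (this.cons ht0.symm (fun _ _ => ht0.ne))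
  have hd' : ∀ v t p, H.Adj v t -> ∃ q, H.Adj v q ∧ q ≠ p := fun v t p hvt => hd v p (hP v t hvt)
  obtain ⟨k, hk, hkm, a1, n1, n2⟩ := h.endL hE hd' hmax hm
  obtain ⟨k', hk', hkm', a1', n1', n2'⟩ := h.rev.endL hE hd' hmax hm
  simp only [Nat.sub_zero] at a1' n1'
  have hl := h.mono hkm
  by_cases hjk : k ≤ m - k'
  · right
    refine ⟨u, m, k, m - k', h, hk, hjk, ω, a1, a1', n1, n2, n1', ?_⟩
    rw [show m - (k' - 1) = m - k' + 1 by omega, show m - (k' - 2) = m - k' + 2 by omega] at n2'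
    exact n2'
  · left
    have hcirc := cyc_circ hl hk a1
    have hsup := cyc_sup hl a1
    have hkm2 : k = m := by
      by_contra hh
      refine hE _ hcirc hsup (Or.inr ⟨_, h.seg (a := k + 1) (b := m) ω le_rfl, ?_, u k, ?_, u (m - k'), ?_, ?_, ?_, ?_⟩)
      · rw [Set.disjoint_left]
        rintro v ⟨t, ht1, ht2, rfl⟩ hv
        obtain ⟨t', ht', he⟩ := (cyc_VC hl hk).1 hv
        have := h.inj _ ω _ ω he
        omega
      · exact (cyc_VC hl hk).2 ⟨k, le_rfl, rfl⟩
      · exact (cyc_VC hl hk).2 ⟨m - k', ω, rfl⟩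
      · intro he
        have := h.inj _ ω _ ω he
        omega
      · exact ⟨u (k + 1), ⟨k + 1, le_rfl, ω, rfl⟩, h.adj k ω⟩
      · exact ⟨u m, ⟨m, ω, ω, rfl⟩, a1'.symm⟩
    subst hkm2
    have hall : ∀ v, P v -> ∃ i ≤ k, v = u i := by
      intro v hv
      refine reach_closed (fun v => ∃ i ≤ k, v = u i) (hc (u 0) v (hP _ _ a1) hv) ⟨0, ω, rfl⟩ ?_
      rintro _ b hab ⟨i, hi, rfl⟩
      by_contra hh
      push Not at hh
      have hL : LP H (fun t => u ((i + t) % (k + 1))) k := by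
        constructor
        · intro t ht
          by_cases e : (i + t) % (k + 1) = k
          · have e2 : (i + (t + 1)) % (k + 1) = 0 := by
              rw [← add_assoc, Nat.add_mod, e]
              simp
            simp only [e, e2]; exact a1.symm
          · have e1 : (i + t) % (k + 1) < k + 1 := Nat.mod_lt _ ω
            have e2 : (i + (t + 1)) % (k + 1) = (i + t) % (k + 1) + 1 := by
              rw [← add_assoc, Nat.add_mod, Nat.mod_eq_of_lt (show 1 < k + 1 by omega), Nat.mod_eq_of_lt ω]
            rw [e2]
            exact h.adj _ ω
        · intro a ha b hb hab
          have := h.inj _ (by have := Nat.mod_lt (i + a) (show k + 1 > 0 by omega); omega) _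
            (by have := Nat.mod_lt (i + b) (show k + 1 > 0 by omega); omega) hab
          have h3 : a ≡ b [MOD (k + 1)] := Nat.ModEq.add_left_cancel' i this
          exact Nat.ModEq.eq_of_lt_of_lt h3 ω ω
      have := hmax _ _ (hL.cons (w := b) (by simpa [Nat.mod_eq_of_lt (show i < k + 1 by omega)] using hab)
        (fun t _ => hh _ (by have := Nat.mod_lt (i + t) (show k + 1 > 0 by omega); omega)))
      omega
    intro v hv
    obtain ⟨i, hi, rfl⟩ := hall v hv
    have hi' := (cyc_VC hl hk).2 ⟨i, hi, rfl⟩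
    obtain ⟨a, b, hab, hw⟩ := cyc_two hl hk _ hi'
    refine ⟨a, b, hab, fun t => ?_⟩
    rw [← hw]
    constructor
    · intro ht hz
      obtain ⟨j, hj, rfl⟩ := hall t (hP _ _ ht.symm)
      exact hE _ hcirc hsup (Or.inl ⟨_, hi', _, (cyc_VC hl hk).2 ⟨j, hj, rfl⟩, ht, hz⟩)
    · intro hh
      exact VC_sup hsup hh

end reg

theorem minor_of_inj {V W : Type*} {G : SimpleGraph V} {H : SimpleGraph W} (f : W -> V) (hf : Function.Injective f)
    (h : ∀ a b, H.Adj a b -> G.Adj (f a) (f b)) : HasMinor G H := by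
  rw [hasMinor_iff]
  refine ⟨fun w => {f w}, fun w => Cn.single _, ?_, ?_⟩
  · intro w w' hw
    simpa using fun e => hw (hf e)
  · intro w w' hw
    exact ⟨_, rfl, _, rfl, h _ _ hw⟩

section kur
variable {V : Type*} [Fintype V]

theorem Mn.deg3' {G : SimpleGraph V} (h : Mn G) {v : V} (hv : NI G v) (p q : V) :
    ∃ t, G.Adj v t ∧ t ≠ p ∧ t ≠ q := by
  by_cases h1 : G.Adj v p
  · exact h.deg3 h1 q
  by_cases h2 : G.Adj v q
  · obtain ⟨t, a, b, c⟩ := h.deg3 h2 p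
    exact ⟨t, a, c, b⟩
  obtain ⟨w, hw⟩ := hv
  exact ⟨w, hw, by rintro rfl; exact h1 hw, by rintro rfl; exact h2 hw⟩

theorem Mn.deg2 {G : SimpleGraph V} (h : Mn G) {x y v : V} (hxy : G.Adj x y) (hv : NI G v) (p : V) :
    ∃ t, G.Adj v t ∧ t ≠ x ∧ t ≠ y ∧ t ≠ p := by
  by_contra hh
  push Not at hh
  have hx : G.Adj v x := by
    obtain ⟨t, h1, h2, h3⟩ := h.deg3' hv y p
    by_cases e : t = x
    · rwa [e] at h1
    · exact absurd (hh t h1 e h2) h3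
  have hy : G.Adj v y := by
    obtain ⟨t, h1, h2, h3⟩ := h.deg3' hv x p
    by_cases e : t = y
    · rwa [e] at h1
    · exact absurd (hh t h1 h2 e) h3
  obtain ⟨t, h1, h2, h3⟩ := h.deg3' hv x y
  have := hh t h1 h2 h3
  subst this
  refine h.e hxy hx hy h1 h2 h3 fun s hs => ?_
  by_cases e1 : s = x
  · exact Or.inl e1
  by_cases e2 : s = y
  · exact Or.inr (Or.inl e2)
  exact Or.inr (Or.inr (hh s hs e1 e2))

theorem Mn.two {G : SimpleGraph V} (h : Mn G) {x y : V} (hxy : G.Adj x y) {v : V} (hv : NI G v) (hvx : v ≠ x) (hvy : v ≠ y) :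
    ∃ a b, a ≠ b ∧ ∀ t, (ins G {x, y}ᶜ).Adj v t ↔ t = a ∨ t = b := by
  have hmem : ∀ w : V, w ∈ ({x, y}ᶜ : Set V) ↔ w ≠ x ∧ w ≠ y := by intro w; simp
  rcases two_reg (H := ins G {x, y}ᶜ) (fun v => NI G v ∧ v ≠ x ∧ v ≠ y) (fun C h1 h2 h3 => h.f hxy h1 h2 h3)
    (fun v p hv => by
      obtain ⟨t, h1, h2, h3, h4⟩ := h.deg2 hxy hv.1 p
      exact ⟨t, ⟨h1, (hmem _).2 hv.2, (hmem _).2 ⟨h2, h3⟩⟩, h4⟩)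
    (fun v t hvt => ⟨⟨t, hvt.1⟩, (hmem _).1 hvt.2.1⟩)
    (fun v w hv hw => h.c2 (Or.inr hxy) hv.1 hw.1 hv.2.1 hv.2.2 hw.2.1 hw.2.2) ⟨v, hv, hvx, hvy⟩ with hh | hh
  · exact hh v ⟨hv, hvx, hvy⟩
  · exfalso
    obtain ⟨u, m, k, j, hL, hk, hkj, hjm, a1, a2, n1, n2, n3, n4⟩ := hh
    have hu : ∀ t ≤ m, u t ≠ x ∧ u t ≠ y := by
      intro t ht
      by_cases e : t = 0
      · rw [e]; exact (hmem _).1 a1.2.1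
      · have := hL.adj (t - 1) ω
        rw [show t - 1 + 1 = t by omega] at this
        exact (hmem _).1 this.2.2
    have hI : ∀ i ≤ m, ∀ j ≤ m, i ≠ j -> u i ≠ u j := fun i hi j hj hne hh => hne (hL.inj i hi j hj hh)
    have hseen : ∀ t ≤ m, ∀ p q, (∀ w, (ins G {x, y}ᶜ).Adj (u t) w -> w = p ∨ w = q) -> NI G (u t) -> G.Adj x (u t) ∨ G.Adj y (u t) := by
      intro t ht p q hpq hni
      obtain ⟨w, h1, h2, h3⟩ := h.deg3' hni p q
      by_cases ex : w = x
      · left; rw [← ex]; exact h1.symm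
      by_cases ey : w = y
      · right; rw [← ey]; exact h1.symm
      rcases hpq w ⟨h1, (hmem _).2 (hu t ht), (hmem _).2 ⟨ex, ey⟩⟩ with e | e
      · exact absurd e h2
      · exact absurd e h3
    have hni : ∀ t ≤ m, NI G (u t) := by
      intro t ht
      by_cases e : t = 0
      · rw [e]; exact ⟨_, a1.1⟩
      · have := hL.adj (t - 1) ω
        rw [show t - 1 + 1 = t by omega] at this
        exact ⟨_, this.1.symm⟩
    have hl1 := hL.mono (k := k) ω
    have hl2 := hL.shift (j := j) ω
    have hle : (ins G {x, y}ᶜ).edgeSet ⊆ G.edgeSet := edgeSet_subset_edgeSet.2 (ins_le _)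
    have a2' : (ins G {x, y}ᶜ).Adj (u (j + 0)) (u (j + (m - j))) := by
      rw [show j + (m - j) = m by omega]; exact a2.symm
    have hV1 : ∀ v, v ∈ VC (cyc u k) ↔ ∃ t ≤ k, v = u t := fun v => cyc_VC hl1 hk
    have hV2 : ∀ v, v ∈ VC (cyc (fun t => u (j + t)) (m - j)) ↔ ∃ t, j ≤ t ∧ t ≤ m ∧ v = u t := by
      intro v
      rw [cyc_VC hl2 ω]
      constructor
      · rintro ⟨t, ht, rfl⟩; exact ⟨j + t, ω, ω, rfl⟩
      · rintro ⟨t, ht, ht', rfl⟩; exact ⟨t - j, ω, by rw [show j + (t - j) = t by omega]⟩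
    have hTL : TL G x y (cyc u k) (cyc (fun t => u (j + t)) (m - j)) (u k) (u j) (u 0) (u (k - 1)) (u m) (u (j + 1)) := by
      refine ⟨hxy, cyc_circ hl1 hk a1, cyc_circ hl2 ω a2', (cyc_sup hl1 a1).mono hle, (cyc_sup hl2 a2').mono hle,
        ?_, ?_, ?_, ?_, ?_, ?_, ?_, ?_, ?_, ?_, ?_, ?_, ?_, ?_, ?_, ?_, ?_, ?_, ?_, ?_, ?_⟩
      · rw [hV1]; rintro ⟨t, ht, e⟩; exact (hu t ω).1 e.symm
      · rw [hV2]; rintro ⟨t, _, ht, e⟩; exact (hu t ω).1 e.symm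
      · rw [hV1]; rintro ⟨t, ht, e⟩; exact (hu t ω).2 e.symm
      · rw [hV2]; rintro ⟨t, _, ht, e⟩; exact (hu t ω).2 e.symm
      · intro v h1 h2
        obtain ⟨t, ht, rfl⟩ := (hV1 v).1 h1
        obtain ⟨t', ht1, ht2, e⟩ := (hV2 _).1 h2
        have := hL.inj _ ω _ ω e
        constructor <;> congr 1 <;> omega
      · exact (hV1 _).2 ⟨0, ω, rfl⟩
      · exact (hV1 _).2 ⟨k - 1, ω, rfl⟩
      · exact (hV2 _).2 ⟨m, ω, ω, rfl⟩
      · exact (hV2 _).2 ⟨j + 1, ω, ω, rfl⟩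
      · exact hI _ ω _ ω ω
      · exact hI _ ω _ ω ω
      · exact hI _ ω _ ω ω
      · exact hI _ ω _ ω ω
      · exact hI _ ω _ ω ω
      · exact hI _ ω _ ω ω
      · exact hseen _ ω _ _ n1 (hni _ ω)
      · exact hseen _ ω _ _ n2 (hni _ ω)
      · exact hseen _ ω _ _ n3 (hni _ ω)
      · exact hseen _ ω _ _ n4 (hni _ ω)
      · exact (hV2 _).2 ⟨j, ω, ω, rfl⟩
      · intro d hd
        obtain ⟨i, hi, rfl, hik⟩ : ∃ i, (i = 0 ∨ i = k - 1) ∧ d = u i ∧ G.Adj (u i) (u k) := by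
          rcases hd with rfl | rfl
          · exact ⟨0, Or.inl rfl, rfl, a1.1⟩
          · refine ⟨k - 1, Or.inr rfl, rfl, ?_⟩
            have := hL.adj (k - 1) ω
            rw [show k - 1 + 1 = k by omega] at this
            exact this.1
        by_cases e : k = j
        · refine ⟨{u i}, Cn.single _, rfl, ?_, ?_, ?_, ?_, u i, rfl, ?_⟩
          · rintro v rfl; exact Or.inl rfl
          · rintro v rfl hh
            obtain ⟨t', ht1, ht2, e⟩ := (hV2 _).1 hh
            have := hL.inj _ ω _ ω e
            omega
          · exact (hu i ω).1.symm
          · exact (hu i ω).2.symm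
          · rw [← e]; exact hik.symm
        · have hs := (hL.seg (a := k) (b := j - 1) ω ω).mono_graph (ins_le _)
          refine ⟨_, hs.insert (b := u i) ⟨k, ω, ω, rfl⟩ hik.symm, by simp, ?_, ?_, ?_, ?_, u (j - 1), ?_, ?_⟩
          · rintro v (rfl | ⟨t, ht1, ht2, rfl⟩)
            · exact Or.inl rfl
            · exact Or.inr ⟨hI _ ω _ ω ω, hI _ ω _ ω ω⟩
          · rintro v hv' hh
            obtain ⟨t', ht1, ht2, e⟩ := (hV2 _).1 hh
            rcases hv' with rfl | ⟨t, ht1', ht2', rfl⟩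
            · have := hL.inj _ ω _ ω e
              omega
            · have := hL.inj _ ω _ ω e
              omega
          · rintro (e | ⟨t, ht1', ht2', e⟩)
            · exact (hu i ω).1 e.symm
            · exact (hu t ω).1 e.symm
          · rintro (e | ⟨t, ht1', ht2', e⟩)
            · exact (hu i ω).2 e.symm
            · exact (hu t ω).2 e.symm
          · exact Or.inr ⟨j - 1, ω, le_rfl, rfl⟩
          · have := hL.adj (j - 1) ω
            rw [show j - 1 + 1 = j by omega] at this
            exact this.1.symm
    exact hTL.false h

theorem Mn.deg {G : SimpleGraph V} (h : Mn G) {x y : V} (hxy : G.Adj x y) {v : V} (hv : NI G v) (hvx : v ≠ x) (hvy : v ≠ y) :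
    (G.neighborFinset v).card = 2 + ((if G.Adj v x then 1 else 0) + if G.Adj v y then 1 else 0) := by
  obtain ⟨a, b, hab, ht⟩ := h.two hxy hv hvx hvy
  have hmem : ∀ w : V, w ∈ ({x, y}ᶜ : Set V) ↔ w ≠ x ∧ w ≠ y := by intro w; simp
  have ha := (ht a).2 (Or.inl rfl)
  have hb := (ht b).2 (Or.inr rfl)
  have e : G.neighborFinset v = {a, b} ∪ ({x, y} : Finset V).filter (fun t => G.Adj v t) := by
    ext t
    simp only [mem_neighborFinset, Finset.mem_union, Finset.mem_insert, Finset.mem_singleton, Finset.mem_filter]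
    constructor
    · intro hh
      by_cases e : t = x ∨ t = y
      · exact Or.inr ⟨e, hh⟩
      · rw [not_or] at e
        exact Or.inl ((ht t).1 ⟨hh, (hmem _).2 ⟨hvx, hvy⟩, (hmem _).2 e⟩)
    · rintro (hh | hh)
      · exact ((ht t).2 hh).1
      · exact hh.2
  rw [e, Finset.card_union_of_disjoint, Finset.card_pair hab, Finset.card_filter, Finset.sum_pair hxy.ne]
  rw [Finset.disjoint_left]
  intro t h1 h2
  simp only [Finset.mem_insert, Finset.mem_singleton, Finset.mem_filter] at h1 h2
  have := ((ht t).2 h1).2.2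
  rw [hmem] at this
  tauto

theorem Mn.false {G : SimpleGraph V} (h : Mn G) : False := by
  by_cases hne : ∃ x y, G.Adj x y
  · obtain ⟨x, y, hxy⟩ := hne
    by_cases htri : ∃ x y v, G.Adj x y ∧ G.Adj v x ∧ G.Adj v y
    · clear hxy
      obtain ⟨x, y, v, hxy, hvx, hvy⟩ := htri
      have d4 : (G.neighborFinset v).card = 4 := by
        rw [h.deg hxy ⟨x, hvx⟩ hvx.ne hvy.ne, if_pos hvx, if_pos hvy]
      have hed : ∀ p q, G.Adj p q -> p ≠ v -> q ≠ v -> G.Adj v p := by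
        intro p q hpq hp hq
        have := h.deg hpq ⟨x, hvx⟩ hp.symm hq.symm
        rw [d4] at this
        by_contra hh
        rw [if_neg hh] at this
        split_ifs at this <;> omega
      have hvall : ∀ w, NI G w -> w ≠ v -> G.Adj v w := by
        intro w hw hwv
        obtain ⟨t, h1, h2, _⟩ := h.deg3' hw v v
        exact hed w t h1 hwv h2
      have hcl : ∀ w w', G.Adj v w -> G.Adj v w' -> w ≠ w' -> G.Adj w w' := by
        intro w w' hw hw' hne
        by_contra hh
        have d3 := h.deg hw' ⟨v, hw.symm⟩ hw.ne' hne
        rw [if_pos hw.symm, if_neg hh] at d3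
        obtain ⟨s, h1, h2, h3⟩ := h.deg3' ⟨v, hw.symm⟩ v w'
        have d4 := h.deg (hvall s ⟨w, h1.symm⟩ h2) ⟨v, hw.symm⟩ hw.ne' h1.ne
        rw [if_pos hw.symm, if_pos h1] at d4
        omega
      have hS : (insert v (G.neighborFinset v)).card = 5 := by
        rw [Finset.card_insert_of_notMem (by simp), d4]
      let E := (insert v (G.neighborFinset v)).equivFinOfCardEq hS
      refine h.kf.1 (minor_of_inj (fun i => (E.symm i : V)) (Subtype.val_injective.comp E.symm.injective) ?_)
      intro i j hij
      have hij : i ≠ j := hij.ne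
      have hne : (E.symm i : V) ≠ E.symm j := fun e => hij (E.symm.injective (Subtype.ext e))
      have hi := (E.symm i).2
      have hj := (E.symm j).2
      simp only [Finset.mem_insert, mem_neighborFinset] at hi hj
      rcases hi with hi | hi <;> rcases hj with hj | hj
      · exact absurd (hi.trans hj.symm) hne
      · show G.Adj _ _
        rw [hi]; exact hj
      · show G.Adj _ _
        rw [hj]; exact hi.symm
      · exact hcl _ _ hi hj hne
    · push Not at htri
      obtain ⟨x1, hx1, hx1y, _⟩ := h.deg3' ⟨y, hxy⟩ y y
      obtain ⟨x2, hx2, hx2y, hx12⟩ := h.deg3' ⟨y, hxy⟩ y x1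
      obtain ⟨y1, hy1, hy1x, _⟩ := h.deg3' ⟨x, hxy.symm⟩ x x
      obtain ⟨y2, hy2, hy2x, hy12⟩ := h.deg3' ⟨x, hxy.symm⟩ x y1
      have key : ∀ a b, G.Adj x a -> G.Adj y b -> a ≠ y -> b ≠ x -> G.Adj b a := by
        intro a b ha hb hay hbx
        have hbx' : ¬ G.Adj b x := fun hh => htri x y b hxy hh hb.symm
        have hba : b ≠ a := by rintro rfl; exact hbx' ha.symm
        have d1 := h.deg ha ⟨y, hb.symm⟩ hbx hba
        have d2 := h.deg hxy ⟨y, hb.symm⟩ hbx hb.ne'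
        rw [if_neg hbx'] at d1 d2
        rw [if_pos hb.symm] at d2
        by_contra hh
        rw [if_neg hh] at d1
        omega
      have hne : ∀ a b, G.Adj x a -> G.Adj y b -> a ≠ b := by
        rintro a b ha hb rfl
        exact htri x y a hxy ha.symm hb.symm
      have k11 := key x1 y1 hx1 hy1 hx1y hy1x
      have k12 := key x1 y2 hx1 hy2 hx1y hy2x
      have k21 := key x2 y1 hx2 hy1 hx2y hy1x
      have k22 := key x2 y2 hx2 hy2 hx2y hy2x
      refine h.kf.2 (minor_of_inj (Sum.elim ![x, y1, y2] ![y, x1, x2]) ?_ ?_)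
      · refine Function.Injective.sumElim ?_ ?_ ?_
        · intro i j hij
          fin_cases i <;> fin_cases j <;> simp_all
        · intro i j hij
          fin_cases i <;> fin_cases j <;> simp_all
        · intro i j
          fin_cases i <;> fin_cases j
          exacts [hxy.ne, hx1.ne, hx2.ne, hy1.ne', k11.ne, k21.ne, hy2.ne', k12.ne, k22.ne]
      · have hh : ∀ i j, G.Adj ((![x, y1, y2] : Fin 3 -> V) i) ((![y, x1, x2] : Fin 3 -> V) j) := by
          intro i j
          fin_cases i <;> fin_cases j
          exacts [hxy, hx1, hx2, hy1.symm, k11, k21, hy2.symm, k12, k22]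
        rintro (a | a) (b | b) hab
        · simp at hab
        · exact hh a b
        · exact (hh b a).symm
        · simp at hab
  · push Not at hne
    apply h.npl
    have : G = ⊥ := by ext a b; simp [hne]
    rw [this]; exact PL_bot

theorem kuratowski (G : SimpleGraph V) (h : KF G) : PL G := by
  by_contra hh
  have : ∀ n, ∀ G : SimpleGraph V, G.edgeSet.ncard = n -> KF G -> PL G := by
    intro n
    induction n using Nat.strong_induction_on with
    | _ n ih =>
      intro G hn hK
      by_contra hP
      exact Mn.false ⟨hK, hP, fun H hlt hKH => ih _ (hn ▸ hlt) H rfl hKH⟩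
  exact hh (this _ G rfl h)

end kur

section subdiv
variable {V W : Type*} {G : SimpleGraph V}

theorem lift_walk (A : G.Subgraph) {u v : V} (p : G.Walk u v) (hu : u ∈ A.verts) (hv : v ∈ A.verts)
    (h : ∀ a b, s(a, b) ∈ p.edges -> A.Adj a b) :
    ∃ q : A.coe.Walk ⟨u, hu⟩ ⟨v, hv⟩, q.support.map Subtype.val = p.support ∧ q.edges.map (Sym2.map Subtype.val) = p.edges := by
  induction p with
  | nil => exact ⟨Walk.nil, rfl, rfl⟩
  | @cons u w v huw p ih =>
    have h1 : A.Adj u w := h u w (by simp)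
    obtain ⟨q, hq, hq'⟩ := ih (A.edge_vert h1.symm) hv (fun a b hab => h a b (by simp [hab]))
    refine ⟨Walk.cons (show A.coe.Adj ⟨u, hu⟩ ⟨w, _⟩ from h1) q, ?_, ?_⟩
    · simp [hq]
    · simp [hq']

theorem sub_of_walks {H : SimpleGraph W} (f : W -> V) (hf : Function.Injective f)
    (p : ∀ ⦃a b⦄, H.Adj a b -> G.Walk (f a) (f b)) (hp : ∀ ⦃a b⦄ (h : H.Adj a b), (p h).IsPath)
    (h1 : ∀ ⦃a b⦄ (h : H.Adj a b) (w : W), f w ∈ (p h).support -> w = a ∨ w = b)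
    (h2 : ∀ ⦃a b⦄ (h : H.Adj a b) ⦃c d⦄ (h' : H.Adj c d), s(a, b) ≠ s(c, d) →
      ∀ u, u ∈ (p h).support -> u ∈ (p h').support -> (u = f a ∨ u = f b) ∧ (u = f c ∨ u = f d)) :
    ContainsSubdivisionOf G H := by
  let A : G.Subgraph :=
    { verts := {u | u ∈ Set.range f ∨ ∃ (a b : W) (h : H.Adj a b), u ∈ (p h).support}
      Adj := fun x y => ∃ (a b : W) (h : H.Adj a b), s(x, y) ∈ (p h).edges
      adj_sub := by
        rintro x y ⟨a, b, h, hh⟩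
        exact (p h).adj_of_mem_edges hh
      edge_vert := by
        rintro x y ⟨a, b, h, hh⟩
        exact Or.inr ⟨a, b, h, Walk.fst_mem_support_of_mem_edges _ hh⟩
      symm := ⟨by
        rintro x y ⟨a, b, h, hh⟩
        exact ⟨a, b, h, by rwa [Sym2.eq_swap]⟩⟩ }
  have hfA : ∀ w, f w ∈ A.verts := fun w => Or.inl ⟨w, rfl⟩
  have hl : ∀ a b (h : H.Adj a b), ∃ q : A.coe.Walk ⟨f a, hfA a⟩ ⟨f b, hfA b⟩,
      q.support.map Subtype.val = (p h).support ∧ q.edges.map (Sym2.map Subtype.val) = (p h).edges :=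
    fun a b h => lift_walk A (p h) _ _ (fun x y hxy => ⟨a, b, h, hxy⟩)
  choose q hq hq' using hl
  have hsup : ∀ a b (h : H.Adj a b) (u : A.verts), u ∈ (q a b h).support ↔ (u : V) ∈ (p h).support := by
    intro a b h u
    rw [← hq a b h, List.mem_map]
    constructor
    · intro hu; exact ⟨u, hu, rfl⟩
    · rintro ⟨u', hu', e⟩; rwa [← Subtype.ext (a1 := u') (a2 := u) e]
  refine ⟨A, fun w => ⟨f w, hfA w⟩, fun a b h => q a b h, ?_, ?_, ?_, ?_, ?_, ?_⟩
  · intro a b hab; exact hf (congrArg Subtype.val hab)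
  · intro a b h
    have := (hp h).support_nodup
    rw [← hq a b h] at this
    exact (Walk.isPath_def _).2 (List.Nodup.of_map _ this)
  · intro a b h w hw
    exact h1 h w ((hsup _ _ _ _).1 hw)
  · intro a b h c d h' hne u hu hu'
    have := h2 h h' hne u ((hsup _ _ _ _).1 hu) ((hsup _ _ _ _).1 hu')
    simpa [Subtype.ext_iff] using this
  · rintro ⟨u, ⟨w, rfl⟩ | ⟨a, b, h, hu⟩⟩
    · exact Or.inl ⟨w, rfl⟩
    · exact Or.inr ⟨a, b, h, (hsup _ _ _ _).2 hu⟩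
  · intro e
    induction e with
    | h x y =>
    rintro ⟨a, b, h, hh⟩
    refine ⟨a, b, h, ?_⟩
    rw [← hq' a b h, List.mem_map] at hh
    obtain ⟨e', he', hee⟩ := hh
    have : e' = s(x, y) := by
      refine Sym2.map.injective (f := (Subtype.val : A.verts -> V)) Subtype.val_injective ?_
      rw [hee]; rfl
    rwa [← this]

theorem Cn.path {B : Set V} (hB : Cn G B) {s t : V} (hs : s ∈ B) (ht : t ∈ B) :
    ∃ p : G.Walk s t, p.IsPath ∧ ∀ v ∈ p.support, v ∈ B := by
  obtain ⟨p, hp⟩ := (hB.2 s hs t ht).exists_isPath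
  refine ⟨p.mapLe (ins_le _), hp.mapLe _, ?_⟩
  intro v hv
  rw [Walk.support_mapLe_eq_support] at hv
  exact reach_ins_mem (p.takeUntil v hv).reachable hs

theorem star_sub {H : SimpleGraph W} (B : W -> Set V) (hB : ∀ a b, a ≠ b -> Disjoint (B a) (B b)) (c : W -> V)
    (hc : ∀ a, c a ∈ B a)
    (L : W -> W -> Set V) (h1 : ∀ a b, H.Adj a b -> Cn G (L a b) ∧ c a ∈ L a b ∧ L a b ⊆ B a)
    (h2 : ∀ a b b', H.Adj a b -> H.Adj a b' -> b ≠ b' -> ∀ u ∈ L a b, u ∈ L a b' -> u = c a)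
    (h3 : ∀ a b, H.Adj a b -> ∃ s ∈ L a b, ∃ t ∈ L b a, G.Adj s t) : ContainsSubdivisionOf G H := by
  have hdis : ∀ a b u, u ∈ B a -> u ∈ B b -> a = b := by
    intro a b u ha hb
    by_contra hh
    exact Set.disjoint_left.1 (hB a b hh) ha hb
  have hp : ∀ a b, H.Adj a b -> ∃ p : G.Walk (c a) (c b), p.IsPath ∧ ∀ v ∈ p.support, v ∈ L a b ∪ L b a := by
    intro a b hab
    obtain ⟨s, hs, t, ht, hst⟩ := h3 a b hab
    exact ((h1 a b hab).1.union (h1 b a hab.symm).1 (Or.inr ⟨s, hs, t, ht, hst⟩)).path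
      (Or.inl (h1 a b hab).2.1) (Or.inr (h1 b a hab.symm).2.1)
  choose p hp hpL using hp
  refine sub_of_walks c ?_ (fun a b h => p a b h) (fun a b h => hp a b h) ?_ ?_
  · intro a b hab
    exact hdis a b (c a) (hc a) (hab ▸ hc b)
  · intro a b h w hw
    rcases hpL a b h _ hw with hh | hh
    · exact Or.inl (hdis _ _ _ (hc w) ((h1 a b h).2.2 hh))
    · exact Or.inr (hdis _ _ _ (hc w) ((h1 b a h.symm).2.2 hh))
  · intro a b h a' b' h' hne u hu hu'
    have key : ∀ a b a' b', H.Adj a b -> H.Adj a' b' -> s(a, b) ≠ s(a', b') -> u ∈ L a b -> u ∈ L a' b' -> u = c a ∧ u = c a' := by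
      intro a b a' b' h h' hne hu hu'
      have := hdis _ _ _ ((h1 a b h).2.2 hu) ((h1 a' b' h').2.2 hu')
      subst this
      have := h2 a b b' h h' (by rintro rfl; exact hne rfl) u hu hu'
      exact ⟨this, this⟩
    rcases hpL a b h _ hu with hh | hh <;> rcases hpL a' b' h' _ hu' with hh' | hh'
    · have := key _ _ _ _ h h' hne hh hh'; exact ⟨Or.inl this.1, Or.inl this.2⟩
    · have := key _ _ _ _ h h'.symm (by rwa [Sym2.eq_swap (a := b')]) hh hh'; exact ⟨Or.inl this.1, Or.inr this.2⟩
    · have := key _ _ _ _ h.symm h' (by rwa [Sym2.eq_swap (a := b)]) hh hh'; exact ⟨Or.inr this.1, Or.inl this.2⟩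
    · have := key _ _ _ _ h.symm h'.symm (by rwa [Sym2.eq_swap (a := b'), Sym2.eq_swap (a := b)]) hh hh'; exact ⟨Or.inr this.1, Or.inr this.2⟩

theorem minor_terms {H : SimpleGraph W} (h : HasMinor G H) : ∃ (B : W -> Set V) (x : W -> W -> V),
    (∀ w, Cn G (B w)) ∧ (∀ w w', w ≠ w' -> Disjoint (B w) (B w')) ∧
    ∀ a b, H.Adj a b -> x a b ∈ B a ∧ G.Adj (x a b) (x b a) := by
  rw [hasMinor_iff] at h
  obtain ⟨B, h1, h2, h3⟩ := h
  have : ∀ a b, ∃ g : V × V, H.Adj a b -> g.1 ∈ B a ∧ g.2 ∈ B b ∧ G.Adj g.1 g.2 := by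
    intro a b
    by_cases hab : H.Adj a b
    · obtain ⟨s, hs, t, ht, hst⟩ := h3 hab
      exact ⟨(s, t), fun _ => ⟨hs, ht, hst⟩⟩
    · obtain ⟨v, _⟩ := (h1 a).1
      exact ⟨(v, v), fun hh => absurd hh hab⟩
  choose g hg using this
  refine ⟨B, fun a b => if WellOrderingRel a b then (g a b).1 else (g b a).2, h1, h2, ?_⟩
  intro a b hab
  rcases trichotomous_of WellOrderingRel a b with h | h | h
  · have h' : ¬ WellOrderingRel b a := asymm_of WellOrderingRel h
    simp only [h, h', if_true, if_false]
    exact ⟨(hg a b hab).1, (hg a b hab).2.2⟩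
  · exact absurd h hab.ne
  · have h' : ¬ WellOrderingRel a b := asymm_of WellOrderingRel h
    simp only [h, h', if_true, if_false]
    exact ⟨(hg b a hab.symm).2.1, (hg b a hab.symm).2.2.symm⟩

/-- first hit -/
theorem Cn.hit {B S : Set V} (hB : Cn G B) {t : V} (ht : t ∈ B) (hS : ∃ s ∈ S, s ∈ B) :
    ∃ c ∈ S, ∃ L ⊆ B, Cn G L ∧ t ∈ L ∧ c ∈ L ∧ ∀ v ∈ L, v ∈ S -> v = c := by
  obtain ⟨s, hs, hsB⟩ := hS
  refine reach_closed (fun t => ∃ c ∈ S, ∃ L ⊆ B, Cn G L ∧ t ∈ L ∧ c ∈ L ∧ ∀ v ∈ L, v ∈ S -> v = c) (hB.2 s hsB t ht) ?_ ?_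
  · exact ⟨s, hs, {s}, by simpa using hsB, Cn.single _, rfl, rfl, fun v hv _ => hv⟩
  · rintro a b hab ⟨c, hc, L, hLB, hL, ha, hcL, hLS⟩
    by_cases hb : b ∈ S
    · exact ⟨b, hb, {b}, by simpa using hab.2.2, Cn.single _, rfl, rfl, fun v hv _ => hv⟩
    · refine ⟨c, hc, Insert.insert b L, Set.insert_subset hab.2.2 hLB, hL.insert ha hab.1, by simp, by simp [hcL], ?_⟩
      rintro v (rfl | hv) hvS
      · exact absurd hvS hb
      · exact hLS v hv hvS

theorem Cn.lp {B : Set V} (hB : Cn G B) {s t : V} (hs : s ∈ B) (ht : t ∈ B) :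
    ∃ (u : ℕ -> V) (m : ℕ), LP G u m ∧ u 0 = s ∧ u m = t ∧ ∀ i ≤ m, u i ∈ B := by
  obtain ⟨p, hp, hB⟩ := hB.path hs ht
  refine ⟨p.getVert, p.length, ⟨fun t ht => p.adj_getVert_succ ht, fun i hi j hj h => hp.getVert_injOn hi hj h⟩,
    p.getVert_zero, p.getVert_length, fun i hi => hB _ (p.getVert_mem_support i)⟩

/-- a path-like set from `c` to `t` -/
def Lg (G : SimpleGraph V) (c t : V) (L : Set V) : Prop :=
  ∃ (u : ℕ -> V) (m : ℕ), LP G u m ∧ u 0 = c ∧ u m = t ∧ L = {v | ∃ i, 0 ≤ i ∧ i ≤ m ∧ v = u i}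

theorem Lg.cn {c t : V} {L : Set V} (h : Lg G c t L) : Cn G L ∧ c ∈ L ∧ t ∈ L := by
  obtain ⟨u, m, h, rfl, rfl, rfl⟩ := h
  exact ⟨h.seg (Nat.zero_le _) le_rfl, ⟨0, le_rfl, ω, rfl⟩, ⟨m, ω, ω, rfl⟩⟩

theorem Lg.split {c t x : V} {L : Set V} (h : Lg G c t L) (hx : x ∈ L) (hxc : x ≠ c) :
    ∃ A A' : Set V, Cn G A ∧ Cn G A' ∧ c ∈ A ∧ x ∈ A' ∧ t ∈ A' ∧ A ⊆ L ∧ A' ⊆ L ∧ Disjoint A A' ∧ ∃ a ∈ A, G.Adj a x := by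
  obtain ⟨u, m, h, rfl, rfl, rfl⟩ := h
  obtain ⟨i, _, hi, rfl⟩ := hx
  have hi0 : i ≠ 0 := by rintro rfl; exact hxc rfl
  refine ⟨_, _, h.seg (a := 0) (b := i - 1) ω ω, h.seg (a := i) (b := m) ω le_rfl,
    ⟨0, ω, ω, rfl⟩, ⟨i, ω, ω, rfl⟩, ⟨m, ω, ω, rfl⟩, ?_, ?_, ?_, u (i - 1), ⟨i - 1, ω, ω, rfl⟩, ?_⟩
  · rintro v ⟨t, h1, h2, rfl⟩; exact ⟨t, ω, ω, rfl⟩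
  · rintro v ⟨t, h1, h2, rfl⟩; exact ⟨t, ω, ω, rfl⟩
  · rw [Set.disjoint_left]
    rintro v ⟨t, h1, h2, rfl⟩ ⟨t', h1', h2', e⟩
    have := h.inj _ ω _ ω e
    omega
  · have := h.adj (i - 1) ω
    rwa [show i - 1 + 1 = i by omega] at this

theorem Cn.tripod {B : Set V} (hB : Cn G B) {t0 t1 t2 : V} (h0 : t0 ∈ B) (h1 : t1 ∈ B) (h2 : t2 ∈ B) :
    ∃ c L0 L1 L2, Lg G c t0 L0 ∧ Lg G c t1 L1 ∧ Lg G c t2 L2 ∧ L0 ⊆ B ∧ L1 ⊆ B ∧ L2 ⊆ B ∧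
      (∀ v ∈ L0, v ∈ L1 -> v = c) ∧ (∀ v ∈ L0, v ∈ L2 -> v = c) ∧ (∀ v ∈ L1, v ∈ L2 -> v = c) := by
  obtain ⟨u, m, hu, rfl, rfl, huB⟩ := hB.lp h0 h1
  obtain ⟨c, ⟨k, hk, rfl⟩, L, hLB, hL, ht, hcL, hLS⟩ := hB.hit (S := {v | ∃ i ≤ m, v = u i}) h2 ⟨u 0, ⟨0, ω, rfl⟩, h0⟩
  obtain ⟨w, m', hw, hw0, rfl, hwL⟩ := hL.lp hcL ht
  refine ⟨u k, _, _, _, ⟨_, _, (hu.mono hk).rev, by simp, by simp, rfl⟩, ⟨_, _, hu.shift hk, by simp, ?_, rfl⟩,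
    ⟨w, m', hw, hw0, rfl, rfl⟩, ?_, ?_, ?_, ?_, ?_, ?_⟩
  · simp only [show k + (m - k) = m by omega]
  · rintro v ⟨t, h1, h2, rfl⟩; exact huB _ ω
  · rintro v ⟨t, h1, h2, rfl⟩; exact huB _ ω
  · rintro v ⟨t, h1, h2, rfl⟩; exact hLB (hwL _ ω)
  · rintro v ⟨t, h1, h2, rfl⟩ ⟨t', h1', h2', e⟩
    have := hu.inj _ ω _ ω e
    show u _ = u _
    congr 1; omega
  · rintro v ⟨t, h1, h2, rfl⟩ ⟨t', h1', h2', e⟩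
    exact hLS _ (by rw [e]; exact hwL _ h2') ⟨_, ω, rfl⟩
  · rintro v ⟨t, h1, h2, rfl⟩ ⟨t', h1', h2', e⟩
    exact hLS _ (by rw [e]; exact hwL _ h2') ⟨_, ω, rfl⟩

/-- 2-2 split of a branch set -/
def Sp (G : SimpleGraph V) (B : Set V) (a b c d : V) : Prop :=
  ∃ A A' : Set V, Cn G A ∧ Cn G A' ∧ A ⊆ B ∧ A' ⊆ B ∧ Disjoint A A' ∧ (∃ p ∈ A, ∃ q ∈ A', G.Adj p q) ∧
    a ∈ A ∧ b ∈ A ∧ c ∈ A' ∧ d ∈ A'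

theorem Sp_aux {B : Set V} {c t0 t1 t2 t3 x : V} {L0 L1 L2 M : Set V} (g0 : Lg G c t0 L0) (g1 : Lg G c t1 L1) (g2 : Lg G c t2 L2)
    (b0 : L0 ⊆ B) (b1 : L1 ⊆ B) (b2 : L2 ⊆ B) (h01 : ∀ v ∈ L0, v ∈ L1 -> v = c) (h02 : ∀ v ∈ L0, v ∈ L2 -> v = c)
    (hM : Cn G M) (bM : M ⊆ B) (h3 : t3 ∈ M) (hx : x ∈ M) (hxL : x ∈ L0) (hxc : x ≠ c)
    (hMS : ∀ v ∈ M, v ∈ L0 ∪ L1 ∪ L2 -> v = x) : Sp G B t0 t3 t1 t2 := by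
  obtain ⟨A, A', hA, hA', cA, xA, tA, AL, AL', dis, a, ha, hax⟩ := g0.split hxL hxc
  refine ⟨A' ∪ M, A ∪ L1 ∪ L2, hA'.union hM (Or.inl ⟨x, xA, hx⟩),
    (hA.union g1.cn.1 (Or.inl ⟨c, cA, g1.cn.2.1⟩)).union g2.cn.1 (Or.inl ⟨c, Or.inl cA, g2.cn.2.1⟩),
    Set.union_subset (AL'.trans b0) bM, Set.union_subset (Set.union_subset (AL.trans b0) b1) b2, ?_, ⟨x, Or.inl xA, a, Or.inl (Or.inl ha), hax.symm⟩,
    Or.inl tA, Or.inr h3, Or.inl (Or.inr g1.cn.2.2), Or.inr g2.cn.2.2⟩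
  have hcA : c ∉ A' := fun hh => Set.disjoint_left.1 dis cA hh
  rw [Set.disjoint_left]
  rintro v (hv | hv) ((hv' | hv') | hv')
  · exact Set.disjoint_left.1 dis hv' hv
  · exact hcA (h01 v (AL' hv) hv' ▸ hv)
  · exact hcA (h02 v (AL' hv) hv' ▸ hv)
  · have := hMS v hv (Or.inl (Or.inl (AL hv')))
    subst this
    exact Set.disjoint_left.1 dis hv' xA
  · have := hMS v hv (Or.inl (Or.inr hv'))
    subst this
    exact hxc (h01 v hxL hv')
  · have := hMS v hv (Or.inr hv')
    subst this
    exact hxc (h02 v hxL hv')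

theorem Cn.star4 {B : Set V} (hB : Cn G B) {t0 t1 t2 t3 : V} (h0 : t0 ∈ B) (h1 : t1 ∈ B) (h2 : t2 ∈ B) (h3 : t3 ∈ B) :
    (∃ c, c ∈ B ∧ ∃ L : Fin 4 -> Set V, (∀ i, Cn G (L i) ∧ c ∈ L i ∧ (![t0, t1, t2, t3] : Fin 4 -> V) i ∈ L i ∧ L i ⊆ B) ∧
      ∀ i j, i ≠ j -> ∀ v ∈ L i, v ∈ L j -> v = c) ∨
    Sp G B t0 t3 t1 t2 ∨ Sp G B t1 t3 t0 t2 ∨ Sp G B t2 t3 t0 t1 := by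
  obtain ⟨c, L0, L1, L2, g0, g1, g2, b0, b1, b2, h01, h02, h12⟩ := hB.tripod h0 h1 h2
  obtain ⟨x, hxS, M, bM, hM, m3, hx, hMS⟩ := hB.hit (S := L0 ∪ L1 ∪ L2) h3 ⟨c, Or.inl (Or.inl g0.cn.2.1), b0 g0.cn.2.1⟩
  by_cases hxc : x = c
  · left
    subst hxc
    refine ⟨x, b0 g0.cn.2.1, ![L0, L1, L2, M], ?_, ?_⟩
    · intro i
      fin_cases i
      exacts [⟨g0.cn.1, g0.cn.2.1, g0.cn.2.2, b0⟩, ⟨g1.cn.1, g1.cn.2.1, g1.cn.2.2, b1⟩, ⟨g2.cn.1, g2.cn.2.1, g2.cn.2.2, b2⟩, ⟨hM, hx, m3, bM⟩]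
    · have hh : ∀ i j : Fin 4, i < j -> ∀ v ∈ (![L0, L1, L2, M] : Fin 4 -> Set V) i, v ∈ (![L0, L1, L2, M] : Fin 4 -> Set V) j -> v = x := by
        intro i j hij
        fin_cases i <;> fin_cases j <;> first | (exact absurd hij (by decide)) | skip
        exacts [h01, h02, fun v a b => hMS v b (Or.inl (Or.inl a)), h12, fun v a b => hMS v b (Or.inl (Or.inr a)), fun v a b => hMS v b (Or.inr a)]
      intro i j hij v hi hj
      rcases lt_or_gt_of_ne hij with h | h
      · exact hh i j h v hi hj
      · exact hh j i h v hj hi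
  · right
    rcases hxS with (hxS | hxS) | hxS
    · exact Or.inl (Sp_aux g0 g1 g2 b0 b1 b2 h01 h02 hM bM m3 hx hxS hxc hMS)
    · exact Or.inr (Or.inl (Sp_aux g1 g0 g2 b1 b0 b2 (fun v a b => h01 v b a) h12 hM bM m3 hx hxS hxc
        (fun v hv hh => hMS v hv (by simp only [Set.mem_union] at hh ⊢; tauto))))
    · exact Or.inr (Or.inr (Sp_aux g2 g0 g1 b2 b0 b1 (fun v a b => h02 v b a) (fun v a b => h12 v b a) hM bM m3 hx hxS hxc
        (fun v hv hh => hMS v hv (by simp only [Set.mem_union] at hh ⊢; tauto))))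

theorem K33_sub (h : HasMinor G (completeBipartiteGraph (Fin 3) (Fin 3))) :
    ContainsSubdivisionOf G (completeBipartiteGraph (Fin 3) (Fin 3)) := by
  obtain ⟨B, x, h1, h2, h3⟩ := minor_terms h
  have tri : ∀ (B : Set V) (t : Fin 3 -> V), Cn G B -> (∀ i, t i ∈ B) -> ∃ c ∈ B, ∃ L : Fin 3 -> Set V,
      (∀ i, Cn G (L i) ∧ c ∈ L i ∧ t i ∈ L i ∧ L i ⊆ B) ∧ ∀ i j, i ≠ j -> ∀ v ∈ L i, v ∈ L j -> v = c := by
    intro B t hB ht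
    obtain ⟨c, L0, L1, L2, g0, g1, g2, b0, b1, b2, h01, h02, h12⟩ := hB.tripod (ht 0) (ht 1) (ht 2)
    refine ⟨c, b0 g0.cn.2.1, ![L0, L1, L2], ?_, ?_⟩
    · intro i
      fin_cases i
      exacts [⟨g0.cn.1, g0.cn.2.1, g0.cn.2.2, b0⟩, ⟨g1.cn.1, g1.cn.2.1, g1.cn.2.2, b1⟩, ⟨g2.cn.1, g2.cn.2.1, g2.cn.2.2, b2⟩]
    · have hh : ∀ i j : Fin 3, i < j -> ∀ v ∈ (![L0, L1, L2] : Fin 3 -> Set V) i, v ∈ (![L0, L1, L2] : Fin 3 -> Set V) j -> v = c := by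
        intro i j hij
        fin_cases i <;> fin_cases j <;> first | (exact absurd hij (by decide)) | skip
        exacts [h01, h02, h12]
      intro i j hij v hi hj
      rcases lt_or_gt_of_ne hij with h | h
      · exact hh i j h v hi hj
      · exact hh j i h v hj hi
  have hl : ∀ i : Fin 3, ∃ c ∈ B (Sum.inl i), ∃ L : Fin 3 -> Set V,
      (∀ j, Cn G (L j) ∧ c ∈ L j ∧ x (Sum.inl i) (Sum.inr j) ∈ L j ∧ L j ⊆ B (Sum.inl i)) ∧ ∀ j j', j ≠ j' -> ∀ v ∈ L j, v ∈ L j' -> v = c :=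
    fun i => tri _ _ (h1 _) (fun j => (h3 (Sum.inl i) (Sum.inr j) (by simp)).1)
  have hr : ∀ i : Fin 3, ∃ c ∈ B (Sum.inr i), ∃ L : Fin 3 -> Set V,
      (∀ j, Cn G (L j) ∧ c ∈ L j ∧ x (Sum.inr i) (Sum.inl j) ∈ L j ∧ L j ⊆ B (Sum.inr i)) ∧ ∀ j j', j ≠ j' -> ∀ v ∈ L j, v ∈ L j' -> v = c :=
    fun i => tri _ _ (h1 _) (fun j => (h3 (Sum.inr i) (Sum.inl j) (by simp)).1)
  choose cl hcl Ll hLl hLl' using hl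
  choose cr hcr Lr hLr hLr' using hr
  refine star_sub B h2 (Sum.elim cl cr) ?_ (Sum.elim (fun i => Sum.elim (fun _ => ∅) (Ll i)) (fun i => Sum.elim (Lr i) (fun _ => ∅))) ?_ ?_ ?_
  · rintro (i | i)
    · exact hcl i
    · exact hcr i
  · rintro (i | i) (j | j) hij
    · simp at hij
    · exact ⟨(hLl i j).1, (hLl i j).2.1, (hLl i j).2.2.2⟩
    · exact ⟨(hLr i j).1, (hLr i j).2.1, (hLr i j).2.2.2⟩
    · simp at hij
  · rintro (i | i) (j | j) (k | k) hij hik hjk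
    any_goals simp at hij hik
    · exact hLl' i j k (by simpa using hjk)
    · exact hLr' i j k (by simpa using hjk)
  · rintro (i | i) (j | j) hij
    · simp at hij
    · exact ⟨_, (hLl i j).2.2.1, _, (hLr j i).2.2.1, (h3 _ _ hij).2⟩
    · exact ⟨_, (hLr i j).2.2.1, _, (hLl j i).2.2.1, (h3 _ _ hij).2⟩
    · simp at hij

theorem K5_split {B : Fin 5 -> Set V} {x : Fin 5 -> Fin 5 -> V} (h1 : ∀ w, Cn G (B w)) (h2 : ∀ w w', w ≠ w' -> Disjoint (B w) (B w'))
    (h3 : ∀ a b, a ≠ b -> x a b ∈ B a ∧ G.Adj (x a b) (x b a)) {i a b c d : Fin 5} (hn : [i, a, b, c, d].Nodup)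
    (hs : Sp G (B i) (x i a) (x i b) (x i c) (x i d)) : HasMinor G (completeBipartiteGraph (Fin 3) (Fin 3)) := by
  obtain ⟨A, A', hA, hA', AB, AB', dis, ⟨p, hp, q, hq, hpq⟩, ma, mb, mc, md⟩ := hs
  simp only [List.nodup_cons, List.mem_cons, List.not_mem_nil, not_or, or_false, not_false_eq_true, List.nodup_nil, and_true] at hn
  obtain ⟨⟨ia, ib, ic, id⟩, ⟨ab, ac, ad⟩, ⟨bc, bd⟩, cd⟩ := hn
  have sA : ∀ j, i ≠ j -> Disjoint A (B j) := fun j hj => (h2 i j hj).mono_left AB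
  have sA' : ∀ j, i ≠ j -> Disjoint A' (B j) := fun j hj => (h2 i j hj).mono_left AB'
  rw [hasMinor_iff]
  refine ⟨Sum.elim ![A, B c, B d] ![A', B a, B b], ?_, ?_, ?_⟩
  · rintro (j | j) <;> fin_cases j
    exacts [hA, h1 c, h1 d, hA', h1 a, h1 b]
  · have hll : ∀ j k : Fin 3, j < k -> Disjoint ((![A, B c, B d] : Fin 3 -> Set V) j) ((![A, B c, B d] : Fin 3 -> Set V) k) := by
      intro j k hjk
      fin_cases j <;> fin_cases k <;> first | (exact absurd hjk (by decide)) | skip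
      exacts [sA c ic, sA d id, h2 c d cd]
    have hrr : ∀ j k : Fin 3, j < k -> Disjoint ((![A', B a, B b] : Fin 3 -> Set V) j) ((![A', B a, B b] : Fin 3 -> Set V) k) := by
      intro j k hjk
      fin_cases j <;> fin_cases k <;> first | (exact absurd hjk (by decide)) | skip
      exacts [sA' a ia, sA' b ib, h2 a b ab]
    have hlr : ∀ j k : Fin 3, Disjoint ((![A, B c, B d] : Fin 3 -> Set V) j) ((![A', B a, B b] : Fin 3 -> Set V) k) := by
      intro j k
      fin_cases j <;> fin_cases k
      exacts [dis, sA a ia, sA b ib, (sA' c ic).symm, h2 _ _ (Ne.symm ac), h2 _ _ (Ne.symm bc), (sA' d id).symm, h2 _ _ (Ne.symm ad), h2 _ _ (Ne.symm bd)]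
    rintro (j | j) (k | k) hjk
    · rcases lt_or_gt_of_ne (fun e => hjk (congrArg Sum.inl e)) with h | h
      · exact hll j k h
      · exact (hll k j h).symm
    · exact hlr j k
    · exact (hlr k j).symm
    · rcases lt_or_gt_of_ne (fun e => hjk (congrArg Sum.inr e)) with h | h
      · exact hrr j k h
      · exact (hrr k j h).symm
  · have hlr : ∀ j k : Fin 3, ∃ s ∈ ((![A, B c, B d] : Fin 3 -> Set V) j), ∃ t ∈ ((![A', B a, B b] : Fin 3 -> Set V) k), G.Adj s t := by
      have e : ∀ j k, j ≠ k -> ∃ s ∈ B j, ∃ t ∈ B k, G.Adj s t := fun j k hjk =>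
        ⟨_, (h3 j k hjk).1, _, (h3 k j hjk.symm).1, (h3 j k hjk).2⟩
      intro j k
      fin_cases j <;> fin_cases k
      exacts [⟨p, hp, q, hq, hpq⟩, ⟨_, ma, _, (h3 a i (Ne.symm ia)).1, (h3 i a ia).2⟩, ⟨_, mb, _, (h3 b i (Ne.symm ib)).1, (h3 i b ib).2⟩,
        ⟨_, (h3 c i (Ne.symm ic)).1, _, mc, (h3 c i (Ne.symm ic)).2⟩, e _ _ (Ne.symm ac), e _ _ (Ne.symm bc),
        ⟨_, (h3 d i (Ne.symm id)).1, _, md, (h3 d i (Ne.symm id)).2⟩, e _ _ (Ne.symm ad), e _ _ (Ne.symm bd)]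
    rintro (j | j) (k | k) hjk
    · simp at hjk
    · exact hlr j k
    · obtain ⟨s, hs, t, ht, hst⟩ := hlr k j
      exact ⟨t, ht, s, hs, hst.symm⟩
    · simp at hjk

theorem kf_of_planar (h : IsPlanar G) : KF G := by
  have hk : ¬ HasMinor G (completeBipartiteGraph (Fin 3) (Fin 3)) := fun hh => h.2 (K33_sub hh)
  refine ⟨fun hh => h.1 ?_, hk⟩
  obtain ⟨B, x, h1, h2, h3⟩ := minor_terms hh
  have h3 : ∀ a b, a ≠ b -> x a b ∈ B a ∧ G.Adj (x a b) (x b a) := fun a b hab => h3 a b hab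
  have hst : ∀ i : Fin 5, ∃ c ∈ B i, ∃ L : Fin 5 -> Set V, (∀ j, i ≠ j -> Cn G (L j) ∧ c ∈ L j ∧ x i j ∈ L j ∧ L j ⊆ B i) ∧
      ∀ j k, i ≠ j -> i ≠ k -> j ≠ k -> ∀ v ∈ L j, v ∈ L k -> v = c := by
    intro i
    have hm : ∀ j : Fin 4, x i (i.succAbove j) ∈ B i := fun j => (h3 _ _ (Fin.ne_succAbove _ _)).1
    have hi := fun j : Fin 4 => Fin.ne_succAbove i j
    have hinj := Fin.succAbove_right_injective (p := i)
    have nd : ∀ a b c d : Fin 4, [a, b, c, d].Nodup -> [i, i.succAbove a, i.succAbove b, i.succAbove c, i.succAbove d].Nodup := by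
      intro a b c d hh
      simpa [hi, hinj.eq_iff] using hh
    rcases (h1 i).star4 (hm 0) (hm 1) (hm 2) (hm 3) with ⟨c, hc, L, hL, hL'⟩ | hs | hs | hs
    · refine ⟨c, hc, fun j => if hj : i ≠ j then L (Classical.choose (Fin.exists_succAbove_eq (Ne.symm hj))) else ∅, ?_, ?_⟩
      · intro j hj
        simp only [hj, ne_eq, not_false_eq_true, dite_true]
        have e := Classical.choose_spec (Fin.exists_succAbove_eq (Ne.symm hj))
        have := hL (Classical.choose (Fin.exists_succAbove_eq (Ne.symm hj)))
        refine ⟨this.1, this.2.1, ?_, this.2.2.2⟩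
        have h5 : ∀ k : Fin 4, (![x i (i.succAbove 0), x i (i.succAbove 1), x i (i.succAbove 2), x i (i.succAbove 3)] : Fin 4 -> V) k = x i (i.succAbove k) := by
          intro k; fin_cases k <;> rfl
        have h6 := this.2.2.1
        rw [h5, e] at h6
        exact h6
      · intro j k hj hk hjk v
        simp only [hj, hk, ne_eq, not_false_eq_true, dite_true]
        apply hL'
        intro e
        apply hjk
        rw [← Classical.choose_spec (Fin.exists_succAbove_eq (Ne.symm hj)), ← Classical.choose_spec (Fin.exists_succAbove_eq (Ne.symm hk)), e]
    · exact absurd (K5_split h1 h2 h3 (nd _ _ _ _ (by decide)) hs) hk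
    · exact absurd (K5_split h1 h2 h3 (nd _ _ _ _ (by decide)) hs) hk
    · exact absurd (K5_split h1 h2 h3 (nd _ _ _ _ (by decide)) hs) hk
  choose c hc L hL hL' using hst
  refine star_sub B h2 c hc L ?_ ?_ ?_
  · intro a b hab
    exact ⟨(hL a b hab).1, (hL a b hab).2.1, (hL a b hab).2.2.2⟩
  · intro a b b' hab hab' hne
    exact hL' a b b' hab hab' hne
  · intro a b hab
    exact ⟨_, (hL a b hab).2.2.1, _, (hL b a (Ne.symm hab)).2.2.1, (h3 a b hab).2⟩

end subdiv

section society
variable {V : Type*} {F : Type}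

/-- edges of `G` inside `C ∪ L` with an end in `C` -/
def Gs (G : SimpleGraph V) (C : Set V) (L : List V) : SimpleGraph V where
  Adj a b := G.Adj a b ∧ (a ∈ C ∨ a ∈ L) ∧ (b ∈ C ∨ b ∈ L) ∧ (a ∈ C ∨ b ∈ C)
  symm := ⟨fun _ _ h => ⟨h.1.symm, h.2.2.1, h.2.1, h.2.2.2.symm⟩⟩
  loopless := ⟨fun _ h => G.loopless.irrefl _ h.1⟩

/-- society graph with a hub `none` -/
def Jg (G : SimpleGraph V) (C : Set V) (L : List V) : SimpleGraph (Option V) where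
  Adj a b := match a, b with
    | none, none => False
    | none, some v => v ∈ L
    | some v, none => v ∈ L
    | some a, some b => (Gs G C L).Adj a b
  symm := ⟨fun a b h => by
    rcases a with _ | a <;> rcases b with _ | b
    · exact h
    · exact h
    · exact h
    · exact (Gs G C L).symm.symm _ _ h⟩
  loopless := ⟨fun a h => by
    rcases a with _ | a
    · exact h
    · exact (Gs G C L).loopless.irrefl _ h⟩

theorem Jg_ns {G : SimpleGraph V} {C : Set V} {L : List V} {v : V} : (Jg G C L).Adj none (some v) ↔ v ∈ L := Iff.rfl
theorem Jg_ss {G : SimpleGraph V} {C : Set V} {L : List V} {u v : V} :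
    (Jg G C L).Adj (some u) (some v) ↔ (Gs G C L).Adj u v := Iff.rfl

/-- hub edge -/
abbrev hb (v : V) : Sym2 (Option V) := s(none, some v)

/-- consecutive faces around the hub -/
def Seq (l r : Sym2 (Option V) -> F) : F -> List V -> F -> Prop
  | f, [], g => f = g
  | f, v :: L, g => ∃ k, s(l (hb v), r (hb v)) = s(f, k) ∧ Seq l r k L g

/-- disk planarity -/
def DP [Fintype V] (G : SimpleGraph V) (C : Set V) (L : List V) : Prop :=
  L.Nodup ∧ (∀ v ∈ L, v ∉ C) ∧ ∃ (F : Type) (l r : Sym2 (Option V) -> F) (f : F), IsRep (Jg G C L) l r ∧ Seq l r f L f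

theorem Seq.fmap {F' : Type} {l r : Sym2 (Option V) -> F} {l' r' : Sym2 (Option V) -> F'} (q : F -> F') (g : V -> Option V)
    {L : List V} {a b : F} (h : Seq l r a L b)
    (h1 : ∀ v ∈ L, g v = none -> q (l (hb v)) = q (r (hb v)))
    (h2 : ∀ v ∈ L, ∀ w, g v = some w -> s(l' (hb w), r' (hb w)) = s(q (l (hb v)), q (r (hb v)))) :
    Seq l' r' (q a) (L.filterMap g) (q b) := by
  induction L generalizing a with
  | nil => simpa [Seq] using congrArg q h
  | cons v L ih =>
    obtain ⟨k, hk, hs⟩ := h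
    have := ih hs (fun v hv => h1 v (by simp [hv])) (fun v hv => h2 v (by simp [hv]))
    have hk' : s(q (l (hb v)), q (r (hb v))) = s(q a, q k) := by
      have := congrArg (Sym2.map q) hk
      simpa using this
    rcases hg : g v with _ | w
    · rw [List.filterMap_cons_none hg]
      have e := h1 v (by simp) hg
      rw [e] at hk'
      have : q a = q k := by
        rcases Sym2.eq_iff.1 hk' with ⟨e1, e2⟩ | ⟨e1, e2⟩ <;> rw [← e1, ← e2]
      rw [this]; assumption
    · rw [List.filterMap_cons_some hg]
      exact ⟨q k, by rw [h2 v (by simp) w hg, hk'], this⟩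

theorem Seq.map {F' : Type} {l r : Sym2 (Option V) -> F} {l' r' : Sym2 (Option V) -> F'} (q : F -> F')
    {L : List V} {a b : F} (h : Seq l r a L b)
    (h2 : ∀ v ∈ L, s(l' (hb v), r' (hb v)) = s(q (l (hb v)), q (r (hb v)))) :
    Seq l' r' (q a) L (q b) := by
  have := h.fmap (l' := l') (r' := r') q some (fun v _ hv => by simp at hv) (fun v hv w hw => by
    obtain rfl := Option.some.inj hw; exact h2 v hv)
  simpa using this

theorem fm_inj {g : V -> Option V} {L : List V} (h : (L.filterMap g).Nodup) (hL : L.Nodup) {v v' w : V} (hv : v ∈ L) (hv' : v' ∈ L)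
    (e : g v = some w) (e' : g v' = some w) : v = v' := by
  induction L with
  | nil => simp at hv
  | cons x L ih =>
    have hn : (L.filterMap g).Nodup := by
      rcases hg : g x with _ | w
      · rwa [List.filterMap_cons_none hg] at h
      · rw [List.filterMap_cons_some hg] at h; exact (List.nodup_cons.1 h).2
    have key : ∀ y ∈ L, g y = some w -> g x ≠ some w := by
      intro y hy hyw hx
      rw [List.filterMap_cons_some hx] at h
      exact (List.nodup_cons.1 h).1 (List.mem_filterMap.2 ⟨y, hy, hyw⟩)
    rcases List.mem_cons.1 hv with rfl | h1 <;> rcases List.mem_cons.1 hv' with rfl | h2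
    · rfl
    · exact (key _ h2 e' e).elim
    · exact (key _ h1 e e').elim
    · exact ih hn (List.nodup_cons.1 hL).2 h1 h2

variable [Fintype V] {G : SimpleGraph V} {C : Set V} {L : List V}

theorem cn_some {S : Set V} (h : Cn (Gs G C L) S) : Cn (Jg G C L) (some '' S) := by
  refine ⟨h.1.image _, ?_⟩
  rintro _ ⟨u, hu, rfl⟩ _ ⟨v, hv, rfl⟩
  refine reach_closed (fun x => (ins (Jg G C L) (some '' S)).Reachable (some u) (some x)) (h.2 u hu v hv) (Reachable.refl _) ?_
  intro a b hab hr
  refine hr.trans (Adj.reachable ?_)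
  exact ⟨hab.1, ⟨a, hab.2.1, rfl⟩, ⟨b, hab.2.2, rfl⟩⟩

theorem DP.minor (h : DP G C L) (C' : Set V) (g : V -> Option V) (f : V -> Set V) (hC : C' ⊆ C)
    (hnd : (L.filterMap g).Nodup)
    (h1 : ∀ w ∈ L.filterMap g, (w ∈ C ∨ w ∈ L) ∧ w ∈ f w ∧ Cn (Gs G C L) (f w) ∧ ∀ x ∈ f w, x ∉ C')
    (h2 : ∀ w ∈ L.filterMap g, ∀ w' ∈ L.filterMap g, w ≠ w' -> Disjoint (f w) (f w'))
    (hg : ∀ v ∈ L, ∀ w, g v = some w -> v ∈ f w) : DP G C' (L.filterMap g) := by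
  obtain ⟨hn, hd, F, l, r, f0, hR, hS⟩ := h
  have hd' : ∀ v ∈ L.filterMap g, v ∉ C' := fun v hv => (h1 v hv).2.2.2 _ (h1 v hv).2.1
  have hmem : ∀ w, w ∈ L.filterMap g ↔ ∃ v ∈ L, g v = some w := fun w => List.mem_filterMap
  have : ∀ e : Sym2 (Option V), ∃ e', (∀ v ∈ L, ∀ w, g v = some w -> e = hb w -> e' = hb v) ∧
      ((∀ w, e ≠ hb w) -> e' = e) := by
    intro e
    by_cases he : ∃ v ∈ L, ∃ w, g v = some w ∧ e = hb w
    · obtain ⟨v, hv, w, hvw, rfl⟩ := he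
      refine ⟨hb v, fun v' hv' w' hw' e => ?_, fun hh => (hh w rfl).elim⟩
      have : w = w' := by simpa [hb] using e
      subst this
      rw [fm_inj hnd hn hv hv' hvw hw']
    · refine ⟨e, fun v hv w hw e => (he ⟨v, hv, w, hw, e⟩).elim, fun _ => rfl⟩
  choose ψ hψ1 hψ2 using this
  let fo : Option V -> Set (Option V) := fun x => match x with
    | none => {none}
    | some w => if w ∈ C' then {some w} else if w ∈ L.filterMap g then some '' f w else ∅
  have foC : ∀ w ∈ C', fo (some w) = {some w} := fun w hw => by simp only [fo, if_pos hw]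
  have foL : ∀ w ∈ L.filterMap g, fo (some w) = some '' f w := fun w hw => by
    simp only [fo]; rw [if_neg (hd' w hw), if_pos hw]
  have fon : ∀ w, none ∉ fo (some w) := by
    intro w
    by_cases hw : w ∈ C'
    · rw [foC w hw]; simp
    by_cases hw' : w ∈ L.filterMap g
    · rw [foL w hw']; simp
    · simp only [fo, if_neg hw, if_neg hw']; simp
  have hdis : ∀ w w', w ≠ w' -> Disjoint (fo (some w)) (fo (some w')) := by
    intro w w' hne
    rw [Set.disjoint_left]
    intro x hx hx'
    by_cases hw : w ∈ C'
    · rw [foC w hw] at hx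
      obtain rfl : x = some w := hx
      by_cases hw' : w' ∈ C'
      · rw [foC w' hw'] at hx'; exact hne (by simpa using hx')
      by_cases hw'' : w' ∈ L.filterMap g
      · rw [foL w' hw''] at hx'
        obtain ⟨y, hy, e⟩ := hx'
        obtain rfl := Option.some.inj e
        exact (h1 w' hw'').2.2.2 _ hy hw
      · simp only [fo, if_neg hw', if_neg hw''] at hx'; exact hx'
    by_cases hwL : w ∈ L.filterMap g
    · rw [foL w hwL] at hx
      obtain ⟨y, hy, rfl⟩ := hx
      by_cases hw' : w' ∈ C'
      · rw [foC w' hw'] at hx'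
        obtain rfl : y = w' := by simpa using hx'
        exact (h1 w hwL).2.2.2 _ hy hw'
      by_cases hw'' : w' ∈ L.filterMap g
      · rw [foL w' hw''] at hx'
        obtain ⟨z, hz, e⟩ := hx'
        obtain rfl := Option.some.inj e
        exact Set.disjoint_left.1 (h2 w hwL w' hw'' hne) hy hz
      · simp only [fo, if_neg hw', if_neg hw''] at hx'; exact hx'
    · simp only [fo, if_neg hw, if_neg hwL] at hx; exact hx
  have mself : ∀ w, w ∈ C' ∨ w ∈ L.filterMap g -> some w ∈ fo (some w) := by
    rintro w (hw | hw)
    · rw [foC w hw]; rfl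
    · rw [foL w hw]; exact ⟨w, (h1 w hw).2.1, rfl⟩
  have hk0 : ∀ w ∈ L.filterMap g, ∃ v ∈ L, g v = some w ∧ ψ (hb w) = hb v ∧ some v ∈ fo (some w) := by
    intro w hw
    obtain ⟨v, hv, hvw⟩ := (hmem w).1 hw
    refine ⟨v, hv, hvw, hψ1 _ v hv w hvw rfl, ?_⟩
    rw [foL w hw]; exact ⟨v, hg v hv w hvw, rfl⟩
  have g1 : ∀ x, fo x = ∅ ∨ Cn (Jg G C L) (fo x) := by
    intro x
    rcases x with _ | w
    · exact Or.inr (Cn.single _)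
    by_cases hw : w ∈ C'
    · rw [foC w hw]; exact Or.inr (Cn.single _)
    by_cases hw' : w ∈ L.filterMap g
    · rw [foL w hw']; exact Or.inr (cn_some (h1 w hw').2.2.1)
    · left; simp only [fo, if_neg hw, if_neg hw']
  have g2 : ∀ x x', x ≠ x' -> Disjoint (fo x) (fo x') := by
    intro x x' hne
    rcases x with _ | w <;> rcases x' with _ | w'
    · exact (hne rfl).elim
    · rw [Set.disjoint_left]
      rintro _ rfl hx
      exact fon _ hx
    · rw [Set.disjoint_left]
      rintro _ hx rfl
      exact fon _ hx
    · exact hdis w w' (fun h => hne (by rw [h]))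
  have g3 : ∀ x x', (Jg G C' (L.filterMap g)).Adj x x' -> ∃ a ∈ fo x, ∃ b ∈ fo x', (Jg G C L).Adj a b ∧ ψ s(x, x') = s(a, b) := by
    intro x x' hadj
    rcases x with _ | w <;> rcases x' with _ | w'
    · exact hadj.elim
    · obtain ⟨v, hv, _, e, hm⟩ := hk0 w' hadj
      exact ⟨none, rfl, some v, hm, hv, e⟩
    · obtain ⟨v, hv, _, e, hm⟩ := hk0 w hadj
      exact ⟨some v, hm, none, rfl, hv, by
        rw [Sym2.eq_swap (a := some v)]; rw [Sym2.eq_swap (a := some w)]; exact e⟩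
    · refine ⟨some w, mself w hadj.2.1, some w', mself w' hadj.2.2.1, ?_, hψ2 _ (by intro w; simp [hb])⟩
      have up : ∀ w, w ∈ C' ∨ w ∈ L.filterMap g -> w ∈ C ∨ w ∈ L := by
        rintro w (hw | hw)
        · exact Or.inl (hC hw)
        · exact (h1 w hw).1
      exact ⟨hadj.1, up _ hadj.2.1, up _ hadj.2.2.1, hadj.2.2.2.imp (fun h => hC h) (fun h => hC h)⟩
  obtain ⟨F', q, hR', hq⟩ := hR.minor_strong (Jg G C' (L.filterMap g)) fo g1 g2 ψ g3
  · refine ⟨hnd, hd', F', _, _, q f0, hR', ?_⟩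
    refine Seq.fmap q g hS ?_ ?_
    · intro v hv hgv
      refine hq (hb v) hv ?_ ?_
      · rintro ⟨e, he, hev⟩
        induction e with
        | h a b =>
        rcases a with _ | a <;> rcases b with _ | b
        · exact he
        · obtain ⟨v', hv', hgw, e1, _⟩ := hk0 b he
          rw [show s(none, some b) = hb b from rfl, e1] at hev
          obtain rfl : v' = v := by simpa [hb] using hev
          rw [hgv] at hgw; cases hgw
        · obtain ⟨v', hv', hgw, e1, _⟩ := hk0 a he
          rw [Sym2.eq_swap, show s(none, some a) = hb a from rfl, e1] at hev
          obtain rfl : v' = v := by simpa [hb] using hev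
          rw [hgv] at hgw; cases hgw
        · rw [hψ2 _ (by intro w; simp [hb])] at hev
          simp [hb] at hev
      · rintro ⟨w, hw⟩
        have n := hw none (by simp [hb])
        have s := hw (some v) (by simp [hb])
        rcases w with _ | w
        · simp [fo] at s
        · exact fon w n
    · intro v hv w hvw
      simp only [hψ1 _ v hv w hvw rfl]

/-- hub edges lie on cycles -/
theorem hub_ne {F : Type} {l r : Sym2 (Option V) -> F} (hR : IsRep (Jg G C L) l r) (hC : Cn G C) {v1 v2 : V} (hne : v1 ≠ v2)
    (h1 : v1 ∈ L) (h2 : v2 ∈ L) (c1 : ∃ a ∈ C, G.Adj v1 a) (c2 : ∃ a ∈ C, G.Adj v2 a) : l (hb v1) ≠ r (hb v1) := by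
  obtain ⟨a, ha, hva⟩ := c1
  obtain ⟨b, hb', hvb⟩ := c2
  let K : SimpleGraph (Option V) := (Jg G C L).deleteEdges {hb v1}
  have e1 : K.Adj (some v1) (some a) := ⟨⟨hva, Or.inr h1, Or.inl ha, Or.inr ha⟩, by simp [hb]⟩
  have e2 : K.Adj (some v2) (some b) := ⟨⟨hvb, Or.inr h2, Or.inl hb', Or.inr hb'⟩, by simp [hb]⟩
  have e3 : K.Adj none (some v2) := ⟨h2, by simp [hb, hne.symm]⟩
  have e4 : K.Reachable (some a) (some b) := by
    refine reach_closed (fun x => K.Reachable (some a) (some x)) (hC.2 a ha b hb') (Reachable.refl _) ?_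
    intro x y hxy hr
    refine hr.trans (Adj.reachable ⟨⟨hxy.1, Or.inl hxy.2.1, Or.inl hxy.2.2, Or.inl hxy.2.1⟩, by simp [hb]⟩)
  have e5 : K.Reachable none (some v1) := e3.reachable.trans (e2.reachable.trans (e4.symm.trans e1.symm.reachable))
  obtain ⟨k, hk, hkb⟩ := reach_chain e5
  have hkG : Sup (Jg G C L).edgeSet k := hk.mono (by
    rw [edgeSet_deleteEdges]; exact Set.diff_subset)
  refine rep_ne hR (c := k + sg (hb v1)) (hkG.add (Sup.sg h1)) ?_ (e := hb v1) ?_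
  · rw [map_add, hkb, bd_sg (by simp)]
    ext w; simp only [Pi.add_apply]; rw [z2]; rfl
  · have : k (hb v1) = 0 := hk _ (by rw [edgeSet_deleteEdges]; simp)
    simp [this]

theorem seq_sub {F : Type} {K : SimpleGraph (Option V)} {l r : Sym2 (Option V) -> F} (hR : IsRep K l r)
    (hle : Jg G C L ≤ K) {f : F} (hS : Seq l r f L f) (h1 : L.Nodup) (h2 : ∀ v ∈ L, v ∉ C) : DP G C L := by
  obtain ⟨F', q, hq⟩ := hR.sub hle
  exact ⟨h1, h2, F', _, _, q f, hq, hS.map q (fun v hv => rfl)⟩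

theorem DP.add (h : DP G C L) (hC : Cn G C) (hn : ∀ v ∈ L, ∃ a ∈ C, G.Adj v a) (h2 : 2 ≤ L.length) :
    ∃ u ∈ C, ∃ L' : List V, L'.Perm (u :: L) ∧ DP G (C \ {u}) L' := by
  obtain ⟨hnd, hd, F, l, r, f, hR, hS⟩ := h
  rcases L with _ | ⟨v1, L⟩
  · simp at h2
  rcases L with _ | ⟨v2, L⟩
  · simp at h2
  have hne : v1 ≠ v2 := by rintro rfl; simp at hnd
  obtain ⟨k, hk, hS'⟩ := hS
  have hfk := hub_ne hR hC hne (by simp) (by simp) (hn v1 (by simp)) (hn v2 (by simp))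
  have hsum : ∀ a : F -> ZMod 2, a (l (hb v1)) + a (r (hb v1)) = a f + a k := by
    intro a
    rcases Sym2.eq_iff.1 hk with ⟨e1, e2⟩ | ⟨e1, e2⟩
    · rw [e1, e2]
    · rw [e1, e2, add_comm]
  have hfk' : f ≠ k := by
    rcases Sym2.eq_iff.1 hk with ⟨e1, e2⟩ | ⟨e1, e2⟩
    · rwa [e1, e2] at hfk
    · rw [e1, e2] at hfk; exact hfk.symm
  let a : F -> ZMod 2 := fun x => if x = k then 1 else 0
  have hE1 : hb v1 ∈ (Jg G C (v1 :: v2 :: L)).edgeSet := by show v1 ∈ v1 :: v2 :: L; simp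
  have hside : ∀ e, dl (Jg G C (v1 :: v2 :: L)) l r a e ≠ 0 -> (l e = k ∧ r e ≠ k) ∨ (l e ≠ k ∧ r e = k) := by
    intro e he
    have hE : e ∈ (Jg G C (v1 :: v2 :: L)).edgeSet := by by_contra h'; exact he (dl_sup _ _ _ _ _ h')
    rw [dl_edge _ _ _ hE] at he
    by_cases x : l e = k <;> by_cases y : r e = k
    · simp [a, x, y, z2] at he
    · exact Or.inl ⟨x, y⟩
    · exact Or.inr ⟨x, y⟩
    · simp [a, x, y] at he
  have hd1 : dl (Jg G C (v1 :: v2 :: L)) l r a (hb v1) ≠ 0 := by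
    rw [dl_edge _ _ _ hE1, hsum]; simp [a, hfk']
  obtain ⟨x, hx, hxe⟩ := other_edge (hR.even a) (a := some v1) (b := none) (by rw [Sym2.eq_swap]; exact hd1)
  have hxE : (Jg G C (v1 :: v2 :: L)).Adj (some v1) x := by
    by_contra h'; exact hxe (dl_sup _ _ _ _ _ h')
  rcases x with _ | u
  · exact (hx rfl).elim
  have hv1C : v1 ∉ C := hd v1 (by simp)
  have huC : u ∈ C := hxE.2.2.2.resolve_left hv1C
  have hvu : G.Adj v1 u := hxE.1
  have huL : u ∉ v1 :: v2 :: L := fun h => hd u h huC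
  let S : Sym2 (Option V) -> ZMod 2 := sg (hb v1) + sg s(some v1, some u)
  have hS0 : ∀ e, S e ≠ 0 -> e = hb v1 ∨ e = s(some v1, some u) := by
    intro e he
    by_contra hh
    push Not at hh
    apply he
    simp only [S, Pi.add_apply, Pi.single_apply, if_neg hh.1, if_neg hh.2, add_zero]
  have hS1 : S (hb v1) ≠ 0 := by simp [S, Pi.single_apply, hb]
  have hch := chord hR (p := none) (q := some u) (by simp) (by simpa [Jg_ns] using huL) k S
    ((Sup.sg hE1).add (Sup.sg hxE)) (by
      rw [map_add, bd_sg (by simp), bd_sg (by simpa using hvu.ne)]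
      ext w; simp only [Pi.add_apply]
      have := z2 (sv (some v1) w); linear_combination this) (by
      intro e he
      rcases hS0 e he with rfl | rfl
      · exact hside _ hd1
      · exact hside _ hxe)
  refine ⟨u, huC, v1 :: u :: v2 :: L, List.Perm.swap _ _ _, ?_⟩
  have hu1 : hb v1 ≠ s(none, some u) := by simp [hb, hvu.ne]
  refine seq_sub hch ?_ (f := some f) ?_ ?_ ?_
  · intro x y hxy
    rcases x with _ | x <;> rcases y with _ | y
    · exact hxy.elim
    · have : y ∈ v1 :: u :: v2 :: L := hxy
      by_cases hyu : y = u
      · subst hyu; right; simp [edge_adj]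
      · left; rw [Jg_ns]; simp at this ⊢; tauto
    · have : x ∈ v1 :: u :: v2 :: L := hxy
      by_cases hyu : x = u
      · subst hyu; right; simp [edge_adj]
      · left; show x ∈ _; simp at this ⊢; tauto
    · left
      have hu : ∀ w, w ∈ C \ {u} ∨ w ∈ v1 :: u :: v2 :: L -> w ∈ C ∨ w ∈ v1 :: v2 :: L := by
        rintro w (hw | hw)
        · exact Or.inl hw.1
        · simp at hw ⊢
          rcases hw with rfl | rfl | hw
          · tauto
          · exact Or.inl huC
          · tauto
      exact ⟨hxy.1, hu _ hxy.2.1, hu _ hxy.2.2.1, hxy.2.2.2.imp (fun h => h.1) (fun h => h.1)⟩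
  · refine ⟨none, ?_, some k, ?_, ?_⟩
    · simp only [chL, chR, if_neg hu1]
      rcases Sym2.eq_iff.1 hk with ⟨e1, e2⟩ | ⟨e1, e2⟩
      · rw [if_neg (by rw [e1]; tauto), if_pos ⟨hS1, e2⟩, e1]
      · rw [if_neg (c := S (hb v1) ≠ 0 ∧ r (hb v1) = k) (by rw [e2]; tauto), if_pos ⟨hS1, e1⟩, e2, Sym2.eq_swap]
    · simp only [chL, chR, if_pos]; exact Sym2.eq_swap
    · refine Seq.map (l := l) (r := r) some hS' ?_
      intro v hv
      have n1 : hb v ≠ s(none, some u) := by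
        simp only [hb, ne_eq]
        intro hh
        have : v = u := by simpa using hh
        exact huL (by rw [← this]; exact List.mem_cons_of_mem _ hv)
      have n2 : S (hb v) = 0 := by
        by_contra hh
        rcases hS0 _ hh with hh | hh
        · have : v = v1 := by simpa [hb] using hh
          subst this
          exact (List.nodup_cons.1 hnd).1 hv
        · simp [hb] at hh
      simp only [chL, chR, if_neg n1, n2]
      simp
  · have : (u :: v1 :: v2 :: L).Nodup := List.nodup_cons.2 ⟨huL, hnd⟩
    exact (List.Perm.swap _ _ _).nodup_iff.1 this
  · intro v hv hvC
    have : v ≠ u := fun h => hvC.2 h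
    have : v ∈ v1 :: v2 :: L := by simp at hv ⊢; tauto
    exact hd v this hvC.1

theorem DP.start (hK : PL G) (hC : Cn G C) {v u : V} (hv : v ∉ C) (hu : u ∉ C) (hvu : G.Adj v u)
    (c1 : ∃ a ∈ C, G.Adj v a) (c2 : ∃ a ∈ C, G.Adj u a) : DP G C [v, u] := by
  obtain ⟨F, l, r, h⟩ := hK
  let M : SimpleGraph (Option V) := G.map (Function.Embedding.some : V ↪ Option V)
  have hM : ∀ x y, M.Adj x y -> ∃ a b, G.Adj a b ∧ x = some a ∧ y = some b := by
    rintro x y hxy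
    rw [SimpleGraph.map_adj] at hxy
    obtain ⟨a, b, hab, rfl, rfl⟩ := hxy
    exact ⟨a, b, hab, rfl, rfl⟩
  have hM' : ∀ a b, G.Adj a b -> M.Adj (some a) (some b) := fun a b hab => (SimpleGraph.map_adj (Function.Embedding.some : V ↪ Option V) G _ _).2 ⟨a, b, hab, rfl, rfl⟩
  obtain ⟨F1, q1, h1, _⟩ := h.minor_strong M (fun x => {y | some y = x}) (by
    intro x
    rcases x with _ | x
    · left; ext; simp
    · right
      have : {y | some y = some x} = {x} := by ext; simp
      rw [this]; exact Cn.single _) (by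
    intro x x' hne
    rw [Set.disjoint_left]
    intro y hy hy'
    exact hne (Eq.trans (Eq.symm hy) hy')) (fun e => e.map (fun x => x.getD v)) (by
    intro x y hxy
    obtain ⟨a, b, hab, rfl, rfl⟩ := hM x y hxy
    exact ⟨a, rfl, b, rfl, hab, rfl⟩)
  obtain ⟨l2, r2, h2⟩ := PL_tri (v := (none : Option V)) (p := some v) (q := some u) (by simp) (by simp) (by simpa using hvu.ne)
  have tadj : ∀ a b, (tri none (some v) (some u)).Adj a b -> (a = none ∨ a = some v ∨ a = some u) ∧
      (b = none ∨ b = some v ∨ b = some u) := by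
    intro a b hab
    simp only [tri, SimpleGraph.sup_adj, edge_adj] at hab
    tauto
  have hedge : ∀ e ∈ M.edgeSet, e ∈ (tri none (some v) (some u)).edgeSet -> e = s(some v, some u) := by
    intro e
    induction e with
    | h x y =>
    intro he he'
    obtain ⟨a, b, hab, rfl, rfl⟩ := hM x y he
    have := tadj _ _ he'
    have hn := hab.ne
    simp at this
    rcases this with ⟨rfl | rfl, rfl | rfl⟩
    · exact (hn rfl).elim
    · rfl
    · exact Sym2.eq_swap
    · exact (hn rfl).elim
  have hg := glueS h1 h2 (q1 (l s(v, u))) (l2 s(some v, some u)) ?_ ?_ {some v, some u} (some v) ?_ ?_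
  · obtain ⟨F, l, r, hR⟩ := hg
    have hle : Jg G C [v, u] ≤ M ⊔ tri none (some v) (some u) := by
      intro x y hxy
      rcases x with _ | x <;> rcases y with _ | y
      · exact hxy.elim
      · right
        have : y ∈ [v, u] := hxy
        simp at this
        rcases this with rfl | rfl <;> simp [tri, edge_adj]
      · right
        have : x ∈ [v, u] := hxy
        simp at this
        rcases this with rfl | rfl <;> simp [tri, edge_adj]
      · left; exact hM' _ _ hxy.1
    obtain ⟨F, q, hR⟩ := hR.sub hle
    generalize hL : (fun e => q (l e)) = l' at hR
    generalize hr : (fun e => q (r e)) = r' at hR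
    have ne := hub_ne hR hC hvu.ne (by simp) (by simp) c1 c2
    refine ⟨by simpa using hvu.ne, by simp [hv, hu], F, l', r', l' (hb v), hR, r' (hb v), rfl, l' (hb v), ?_, rfl⟩
    have hkey : ∀ a : F -> ZMod 2, a (l' (hb v)) + a (r' (hb v)) + (a (l' (hb u)) + a (r' (hb u))) = 0 := by
      intro a
      have := congrFun (hR.even a) none
      rw [bd_apply, ← Finset.sum_subset (Finset.subset_univ {some v, some u})] at this
      · rw [Finset.sum_pair (by simpa using hvu.ne), dl_edge _ _ _ (by show v ∈ [v, u]; simp), dl_edge _ _ _ (by show u ∈ [v, u]; simp)] at this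
        exact this
      · intro x _ hx
        refine dl_sup _ _ _ _ _ ?_
        rcases x with _ | x
        · exact fun h => h
        · intro h
          have : x ∈ [v, u] := h
          simp at this hx
          tauto
    have k1 := hkey (fun x => if x = l' (hb v) then 1 else 0)
    have k2 := hkey (fun x => if x = r' (hb v) then 1 else 0)
    simp only [if_true, if_neg ne, if_neg ne.symm] at k1 k2
    rw [Sym2.eq_iff]
    by_cases x1 : l' (hb u) = l' (hb v) <;> by_cases x2 : r' (hb u) = l' (hb v) <;>
      by_cases x3 : l' (hb u) = r' (hb v) <;> by_cases x4 : r' (hb u) = r' (hb v) <;>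
      simp [x1, x2, x3, x4, ne, ne.symm] at k1 k2 ⊢
  · intro e he he'
    left
    rw [hedge e he he']
    rfl
  · intro e he he'
    left
    rw [hedge e he he']
  · rintro t (rfl | rfl)
    · exact Reachable.refl _
    · exact Adj.reachable ⟨hM' _ _ hvu, by simp [tri, edge_adj, hvu.ne]⟩
  · intro x hx
    rcases x with _ | x
    · left
      intro y hy
      obtain ⟨a, b, _, h, _⟩ := hM _ _ hy
      cases h
    · right
      intro y hy
      simp at hx
      have := (tadj _ _ hy).1
      simp at this
      tauto

end society

section menger
variable {V : Type*}

theorem LP.reach {K : SimpleGraph V} {u : ℕ -> V} {m : ℕ} (h : LP K u m) {T : Set V} {i j : ℕ} (hij : i ≤ j) (hj : j ≤ m)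
    (hT : ∀ k, i ≤ k -> k ≤ j -> u k ∈ T) : (ins K T).Reachable (u i) (u j) := by
  induction j, hij using Nat.le_induction with
  | base => exact Reachable.refl _
  | succ j hij ih =>
    refine (ih ω (fun k h1 h2 => hT k h1 ω)).trans (Adj.reachable ?_)
    exact ⟨h.adj j ω, hT j hij ω, hT (j + 1) ω le_rfl⟩

theorem LP.concat {K : SimpleGraph V} {u v : ℕ -> V} {m n : ℕ} (h : LP K u m) (h' : LP K v n) (e : u m = v 0)
    (hd : ∀ i ≤ m, ∀ j ≤ n, u i = v j -> i = m ∧ j = 0) : LP K (fun i => if i ≤ m then u i else v (i - m)) (m + n) := by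
  constructor
  · intro t ht
    by_cases h1 : t + 1 ≤ m
    · simp only [if_pos h1, if_pos (show t ≤ m by omega)]; exact h.adj t ω
    · by_cases h2 : t ≤ m
      · obtain rfl : t = m := by omega
        simp only [if_neg h1, if_pos h2, e, show t + 1 - t = 0 + 1 by omega]
        exact h'.adj 0 ω
      · simp only [if_neg h1, if_neg h2, show t + 1 - m = (t - m) + 1 by omega]
        exact h'.adj _ ω
  · intro i hi j hj hij
    by_cases h1 : i ≤ m <;> by_cases h2 : j ≤ m <;> simp only [h1, h2, if_true, if_false] at hij
    · exact h.inj i h1 j h2 hij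
    · have := hd i h1 (j - m) ω hij; omega
    · have := hd j h2 (i - m) ω hij.symm; omega
    · have := h'.inj _ ω _ ω hij; omega

/-- `X` separates `A` from `B` -/
def Sep (K : SimpleGraph V) (A B X : Set V) : Prop :=
  ∀ a ∈ A, ∀ b ∈ B, a ∉ X -> b ∉ X -> ¬ (ins K Xᶜ).Reachable a b

theorem Sep.symm {K : SimpleGraph V} {A B X : Set V} (h : Sep K A B X) : Sep K B A X :=
  fun a ha b hb h1 h2 hr => h b hb a ha h2 h1 hr.symm

/-- disjoint paths indexed by vertices on them -/
def Lk (K : SimpleGraph V) (A B : Set V) (X : Finset V) (u : V -> ℕ -> V) (m : V -> ℕ) : Prop :=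
  (∀ x ∈ X, LP K (u x) (m x) ∧ u x 0 ∈ A ∧ u x (m x) ∈ B ∧ ∃ j ≤ m x, u x j = x) ∧
  ∀ x ∈ X, ∀ y ∈ X, x ≠ y -> ∀ i ≤ m x, ∀ j ≤ m y, u x i ≠ u y j

theorem Lk.reidx {K : SimpleGraph V} {A B : Set V} {X : Finset V} {u : V -> ℕ -> V} {m : V -> ℕ} (h : Lk K A B X u m)
    (Y : Finset V) (hc : Y.card ≤ X.card) (φ : V -> V) (hφ : ∀ x ∈ X, φ x ∈ Y ∧ ∃ j ≤ m x, u x j = φ x) :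
    ∃ σ : V -> V, (∀ y ∈ Y, σ y ∈ X ∧ φ (σ y) = y) ∧ Lk K A B Y (fun y => u (σ y)) (fun y => m (σ y)) := by
  have hinj : Set.InjOn φ (X : Set V) := by
    intro x hx y hy hxy
    by_contra hne
    obtain ⟨_, i, hi, e1⟩ := hφ x hx
    obtain ⟨_, j, hj, e2⟩ := hφ y hy
    exact h.2 x hx y hy hne i hi j hj (by rw [e1, e2, hxy])
  have him : X.image φ = Y := by
    refine Finset.eq_of_subset_of_card_le ?_ ?_
    · intro z hz
      obtain ⟨x, hx, rfl⟩ := Finset.mem_image.1 hz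
      exact (hφ x hx).1
    · rw [Finset.card_image_of_injOn hinj]; exact hc
  have : ∀ y, ∃ x, y ∈ Y -> x ∈ X ∧ φ x = y := by
    intro y
    by_cases hy : y ∈ Y
    · rw [← him] at hy
      obtain ⟨x, hx, rfl⟩ := Finset.mem_image.1 hy
      exact ⟨x, fun _ => ⟨hx, rfl⟩⟩
    · exact ⟨y, fun h => (hy h).elim⟩
  choose σ hσ using this
  refine ⟨σ, hσ, fun y hy => ?_, fun y hy z hz hne => ?_⟩
  · obtain ⟨h1, h2, h3, _⟩ := h.1 _ (hσ y hy).1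
    obtain ⟨j, hj, e⟩ := (hφ _ (hσ y hy).1).2
    exact ⟨h1, h2, h3, j, hj, e.trans (hσ y hy).2⟩
  · refine h.2 _ (hσ y hy).1 _ (hσ z hz).1 ?_
    intro e
    rw [← (hσ y hy).2, ← (hσ z hz).2, e] at hne
    exact hne rfl

theorem Lk.hit {K : SimpleGraph V} {A B : Set V} {X : Finset V} {u : V -> ℕ -> V} {m : V -> ℕ} (h : Lk K A B X u m)
    {Y : Set V} (hY : Sep K A B Y) {x : V} (hx : x ∈ X) : ∃ j ≤ m x, u x j ∈ Y := by
  by_contra hh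
  push Not at hh
  obtain ⟨h1, h2, h3, _⟩ := h.1 x hx
  exact hY _ h2 _ h3 (hh 0 ω) (hh _ le_rfl) (h1.reach (Nat.zero_le _) le_rfl fun k _ hk => hh k hk)

/-- separators in the smaller graph remain separators -/
theorem sep_lift {K K' : SimpleGraph V} {A B S Y : Set V} {x y : V}
    (hK : ∀ a b, K.Adj a b -> K'.Adj a b ∨ s(a, b) = s(x, y))
    (hy : ∀ a ∈ A, a ∉ S -> ¬ (ins K' Sᶜ).Reachable a y)
    (hS : Sep K' A B S) (hY : Sep K' A (insert x S) Y) : Sep K A B Y := by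
  intro a ha b hb haY hbY hr
  have h0 : a ∉ insert x S := fun h => hY a ha a h haY haY (Reachable.refl _)
  have haS : a ∉ S := fun h => h0 (Or.inr h)
  have key : b ∉ insert x S ∧ (ins K' Yᶜ).Reachable a b ∧ (ins K' Sᶜ).Reachable a b := by
    refine reach_closed (fun v => v ∉ insert x S ∧ (ins K' Yᶜ).Reachable a v ∧ (ins K' Sᶜ).Reachable a v) hr
      ⟨h0, Reachable.refl _, Reachable.refl _⟩ ?_
    rintro p q ⟨hpq, hp, hq⟩ ⟨h1, h2, h3⟩
    rcases hK p q hpq with h | h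
    · have h4 : (ins K' Yᶜ).Reachable a q := h2.trans (Adj.reachable ⟨h, hp, hq⟩)
      have h5 : q ∉ insert x S := fun h' => hY a ha q h' haY hq h4
      exact ⟨h5, h4, h3.trans (Adj.reachable ⟨h, fun h' => h1 (Or.inr h'), fun h' => h5 (Or.inr h')⟩)⟩
    · rcases Sym2.eq_iff.1 h with ⟨rfl, rfl⟩ | ⟨rfl, rfl⟩
      · exact (h1 (Or.inl rfl)).elim
      · exact (hy a ha haS h3).elim
  exact hS a ha b hb haS (fun h => key.1 (Or.inr h)) key.2.2

/-- one side of the induction -/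
theorem menger_side {K' : SimpleGraph V} {A : Set V} {S : Finset V} {x : V} {Y : Finset V} {u : V -> ℕ -> V} {m : V -> ℕ}
    (hl : Lk K' A ((insert x S : Finset V) : Set V) Y u m) (hc : (insert x S).card ≤ Y.card)
    (hx : x ∉ S) (hx' : ∃ a ∈ A, a ∉ S ∧ (ins K' (S : Set V)ᶜ).Reachable a x) :
    ∃ (u : V -> ℕ -> V) (m : V -> ℕ), (∀ c ∈ insert x S, LP K' (u c) (m c) ∧ u c 0 ∈ A ∧ u c (m c) = c ∧
      ∀ i ≤ m c, (u c i ∈ S ∧ i = m c) ∨ ∃ a ∈ A, a ∉ S ∧ u c i ∉ S ∧ (ins K' (S : Set V)ᶜ).Reachable a (u c i)) ∧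
      ∀ c ∈ insert x S, ∀ d ∈ insert x S, c ≠ d -> ∀ i ≤ m c, ∀ j ≤ m d, u c i ≠ u d j := by
  obtain ⟨σ, h1, h2⟩ := hl.reidx (insert x S) hc (fun y => u y (m y)) (fun y hy => ⟨(hl.1 y hy).2.2.1, _, le_rfl, rfl⟩)
  refine ⟨_, _, fun c hc => ?_, h2.2⟩
  obtain ⟨h3, h4, h5, _⟩ := h2.1 c hc
  refine ⟨h3, h4, (h1 c hc).2, ?_⟩
  have hS : ∀ i ≤ m (σ c), u (σ c) i ∈ S -> i = m (σ c) := by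
    intro i hi hiS
    by_cases e : u (σ c) i = c
    · refine h3.inj i hi _ le_rfl (e.trans (h1 c hc).2.symm)
    · have := h2.2 c hc _ (Finset.mem_insert_of_mem hiS) (Ne.symm e) i hi _ le_rfl
      exact (this (h1 _ (Finset.mem_insert_of_mem hiS)).2.symm).elim
  intro i hi
  by_cases hiS : u (σ c) i ∈ S
  · exact Or.inl ⟨hiS, hS i hi hiS⟩
  · right
    have hk : ∀ k ≤ i, u (σ c) k ∉ S := by
      intro k hk hkS
      have := hS k ω hkS
      obtain rfl : k = i := by omega
      exact hiS hkS
    exact ⟨_, h4, hk 0 ω, hiS, h3.reach (Nat.zero_le _) hi fun k _ h => hk k h⟩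

theorem menger_step [Fintype V] {K K' : SimpleGraph V} {A B : Set V} {S : Finset V} {x y : V} (hle : K' ≤ K) (hxy : K.Adj x y)
    (hS : Sep K' A B S) {u u' : V -> ℕ -> V} {m m' : V -> ℕ} (hxS : x ∉ S) (hyS : y ∉ S)
    (h1 : (∀ c ∈ insert x S, LP K' (u c) (m c) ∧ u c 0 ∈ A ∧ u c (m c) = c ∧
      ∀ i ≤ m c, (u c i ∈ S ∧ i = m c) ∨ ∃ a ∈ A, a ∉ S ∧ u c i ∉ S ∧ (ins K' (S : Set V)ᶜ).Reachable a (u c i)) ∧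
      ∀ c ∈ insert x S, ∀ d ∈ insert x S, c ≠ d -> ∀ i ≤ m c, ∀ j ≤ m d, u c i ≠ u d j)
    (h2 : (∀ c ∈ insert y S, LP K' (u' c) (m' c) ∧ u' c 0 ∈ B ∧ u' c (m' c) = c ∧
      ∀ i ≤ m' c, (u' c i ∈ S ∧ i = m' c) ∨ ∃ a ∈ B, a ∉ S ∧ u' c i ∉ S ∧ (ins K' (S : Set V)ᶜ).Reachable a (u' c i)) ∧
      ∀ c ∈ insert y S, ∀ d ∈ insert y S, c ≠ d -> ∀ i ≤ m' c, ∀ j ≤ m' d, u' c i ≠ u' d j) :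
    ∃ w n, Lk K A B (insert x S) w n := by
  have mono : ∀ {p : ℕ -> V} {k}, LP K' p k -> LP K p k := fun h => ⟨fun t ht => hle (h.adj t ht), h.inj⟩
  -- common vertices
  have com : ∀ c ∈ insert x S, ∀ d ∈ insert y S, ∀ i ≤ m c, ∀ j ≤ m' d, u c i = u' d j -> i = m c ∧ j = m' d ∧ c = d := by
    intro c hc d hd i hi j hj e
    obtain ⟨_, _, ec, g⟩ := h1.1 c hc
    obtain ⟨_, _, ed, g'⟩ := h2.1 d hd
    rcases g i hi with ⟨k1, k2⟩ | ⟨a, ha, haS, k1, hr⟩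
    · rcases g' j hj with ⟨k3, k4⟩ | ⟨b, hb, hbS, k3, hr'⟩
      · exact ⟨k2, k4, by rw [← ec, ← ed, ← k2, ← k4, e]⟩
      · rw [e] at k1; exact (k3 k1).elim
    · rcases g' j hj with ⟨k3, k4⟩ | ⟨b, hb, hbS, k3, hr'⟩
      · rw [← e] at k3; exact (k1 k3).elim
      · rw [← e] at hr'; exact (hS a ha b hb haS hbS (hr.trans hr'.symm)).elim
  -- the B-parts starting in c
  have hQ : ∀ c, ∃ q k, c ∈ insert x S -> LP K q k ∧ q 0 = c ∧ q k ∈ B ∧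
      (∀ j ≤ k, j ≠ 0 -> ∃ d ∈ insert y S, (d = c ∨ c = x ∧ d = y) ∧ ∃ i ≤ m' d, q j = u' d i ∧ (d = c -> i ≠ m' d)) := by
    intro c
    by_cases hcx : c = x
    · subst hcx
      obtain ⟨g1, g2, g3, g4⟩ := h2.1 y (Finset.mem_insert_self _ _)
      have hn : ∀ i ≤ m' y, c ≠ u' y (m' y - i) := by
        intro i hi e
        have := com c (Finset.mem_insert_self _ _) y (Finset.mem_insert_self _ _) _ le_rfl (m' y - i) ω
          (by rw [(h1.1 c (Finset.mem_insert_self _ _)).2.2.1]; exact e)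
        exact hxy.ne this.2.2
      refine ⟨_, _, fun _ => ⟨LP.cons (mono g1.rev) (w := c) (by simpa [g3] using hxy.symm) hn, by simp, by simpa using g2, ?_⟩⟩
      intro j hj hj0
      refine ⟨y, Finset.mem_insert_self _ _, Or.inr ⟨rfl, rfl⟩, m' y - (j - 1), ω, by simp [hj0], fun h => (hxy.ne h.symm).elim⟩
    · by_cases hcS : c ∈ S
      · obtain ⟨g1, g2, g3, g4⟩ := h2.1 c (Finset.mem_insert_of_mem hcS)
        refine ⟨_, _, fun _ => ⟨mono g1.rev, by simpa using g3, by simpa using g2, ?_⟩⟩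
        intro j hj hj0
        exact ⟨c, Finset.mem_insert_of_mem hcS, Or.inl rfl, m' c - j, ω, rfl, fun _ => by omega⟩
      · exact ⟨u' c, 0, fun h => by simp [hcx, hcS] at h⟩
  choose q k hq using hQ
  refine ⟨fun c i => if i ≤ m c then u c i else q c (i - m c), fun c => m c + k c, fun c hc => ?_, fun c hc d hd hne i hi j hj => ?_⟩
  · obtain ⟨g1, g2, g3, g4⟩ := h1.1 c hc
    obtain ⟨q1, q2, q3, q4⟩ := hq c hc
    refine ⟨LP.concat (mono g1) q1 (by rw [g3, q2]) ?_, by simpa using g2, ?_, m c, Nat.le_add_right _ _, by simpa using g3⟩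
    · intro i hi j hj e
      by_cases hj0 : j = 0
      · subst hj0
        refine ⟨g1.inj i hi _ le_rfl (by rw [e, q2, g3]), rfl⟩
      · obtain ⟨d, hd, hdc, i', hi', e', hh⟩ := q4 j hj hj0
        have := com c hc d hd i hi i' hi' (by rw [e, e'])
        exact (hh this.2.2.symm this.2.1).elim
    · by_cases hk : k c = 0
      · simp only [hk, add_zero, le_refl, if_true]; rw [hk] at q3; rwa [g3, ← q2]
      · simp only [show ¬ (m c + k c ≤ m c) by omega, if_false, show m c + k c - m c = k c by omega]; exact q3
  · have cross : ∀ c ∈ insert x S, ∀ d ∈ insert x S, c ≠ d -> ∀ i ≤ m c, ∀ j ≤ k d, j ≠ 0 -> u c i ≠ q d j := by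
      intro c hc d hd hne i hi j hj hj0 e
      obtain ⟨d', hd', hdc, i', hi', e', hh⟩ := (hq d hd).2.2.2 j hj hj0
      have := com c hc d' hd' i hi i' hi' (by rw [e, e'])
      rcases hdc with rfl | ⟨rfl, rfl⟩
      · exact hne this.2.2
      · rcases Finset.mem_insert.1 hc with h | h
        · exact hne h
        · exact hyS (this.2.2 ▸ h)
    change i ≤ m c + k c at hi
    change j ≤ m d + k d at hj
    by_cases c1 : i ≤ m c <;> by_cases c2 : j ≤ m d <;> simp only [c1, c2, if_true, if_false]
    · exact h1.2 c hc d hd hne i c1 j c2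
    · exact cross c hc d hd hne i c1 _ ω ω
    · exact (cross d hd c hc hne.symm j c2 _ ω ω).symm
    · obtain ⟨c', hc', hcc, i', hi', e', _⟩ := (hq c hc).2.2.2 (i - m c) ω ω
      obtain ⟨d', hd', hdc, j', hj', e'', _⟩ := (hq d hd).2.2.2 (j - m d) ω ω
      rw [e', e'']
      refine h2.2 c' hc' d' hd' ?_ i' hi' j' hj'
      rintro rfl
      rcases hcc with rfl | ⟨rfl, rfl⟩ <;> rcases hdc with h | ⟨rfl, h⟩
      · exact hne h
      · subst h
        rcases Finset.mem_insert.1 hc with h | h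
        · exact hne h
        · exact hyS h
      · subst h
        rcases Finset.mem_insert.1 hd with h | h
        · exact hne h.symm
        · exact hyS h
      · exact hne rfl

theorem menger [Fintype V] (K : SimpleGraph V) (A B : Set V) :
    ∃ X : Finset V, Sep K A B X ∧ ∃ u m, Lk K A B X u m := by
  induction hn : K.edgeSet.ncard using Nat.strong_induction_on generalizing K A B with
  | _ n ih =>
  by_cases hE : ∃ x y, K.Adj x y
  swap
  · push Not at hE
    refine ⟨(A ∩ B).toFinset, ?_, fun x _ => x, fun _ => 0, ?_, ?_⟩
    · intro a ha b hb h1 h2 hr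
      have : a = b := by
        refine reach_closed (fun v => a = v) hr rfl ?_
        intro p q hpq
        exact (hE _ _ hpq.1).elim
      subst this
      exact h1 (by simp [ha, hb])
    · intro x hx
      simp at hx
      exact ⟨⟨by simp, by intro i hi j hj _; simp at hi hj; omega⟩, hx.1, hx.2, 0, le_rfl, rfl⟩
    · intro x _ y _ hne i _ j _; exact hne
  obtain ⟨x0, y0, h0⟩ := hE
  let K' := K.deleteEdges {s(x0, y0)}
  have hle : K' ≤ K := deleteEdges_le _
  have hlt : K'.edgeSet.ncard < n := by
    rw [← hn]
    refine Set.ncard_lt_ncard ⟨edgeSet_subset_edgeSet.2 hle, fun h => ?_⟩ (Set.toFinite _)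
    have : s(x0, y0) ∈ K'.edgeSet := h h0
    simp [K'] at this
  have hKK : ∀ a b, K.Adj a b -> K'.Adj a b ∨ s(a, b) = s(x0, y0) := by
    intro a b hab
    by_cases e : s(a, b) = s(x0, y0)
    · exact Or.inr e
    · left; simp only [K', deleteEdges_adj]; exact ⟨hab, e⟩
  have mono : ∀ {X A B u m}, Lk K' A B X u m -> Lk K A B X u m := fun h =>
    ⟨fun x hx => ⟨⟨fun t ht => hle ((h.1 x hx).1.adj t ht), (h.1 x hx).1.inj⟩, (h.1 x hx).2⟩, h.2⟩
  obtain ⟨S, hS, u, m, hl⟩ := ih _ hlt K' A B rfl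
  by_cases hSK : Sep K A B S
  · exact ⟨S, hSK, u, m, mono hl⟩
  unfold Sep at hSK
  push Not at hSK
  obtain ⟨a, ha, b, hb, haS, hbS, hr⟩ := hSK
  -- orientation
  have cr : ∀ P : V -> Prop, ∀ {a b}, (ins K (S : Set V)ᶜ).Reachable a b -> P a -> ¬ P b →
      (∀ p q, K'.Adj p q -> p ∉ S -> q ∉ S -> P p -> P q) -> ∃ p q, p ∉ S ∧ q ∉ S ∧ K.Adj p q ∧ s(p, q) = s(x0, y0) ∧ P p ∧ ¬ P q := by
    intro P a b hr hPa hPb hst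
    by_contra hh
    push Not at hh
    refine hPb (reach_closed P hr hPa ?_)
    rintro p q ⟨h1, h2, h3⟩ hp
    rcases hKK p q h1 with h | h
    · exact hst p q h h2 h3 hp
    · exact hh p q h2 h3 h1 h hp
  let RA : V -> Prop := fun v => ∃ a ∈ A, a ∉ S ∧ (ins K' (S : Set V)ᶜ).Reachable a v
  let RB : V -> Prop := fun v => ∃ a ∈ B, a ∉ S ∧ (ins K' (S : Set V)ᶜ).Reachable a v
  have hAB : ∀ v, RA v -> ¬ RB v := by
    rintro v ⟨a, ha, haS, h1⟩ ⟨b, hb, hbS, h2⟩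
    exact hS a ha b hb haS hbS (h1.trans h2.symm)
  obtain ⟨x, y, hxS, hyS, hxy, exy, hxA, hyA⟩ := cr RA hr ⟨a, ha, haS, Reachable.refl _⟩
    (fun h => hAB b h ⟨b, hb, hbS, Reachable.refl _⟩) (by
      rintro p q h1 h2 h3 ⟨a, ha, haS, h4⟩
      exact ⟨a, ha, haS, h4.trans (Adj.reachable ⟨h1, h2, h3⟩)⟩)
  obtain ⟨y', x', _, _, _, exy', hyB, hxB⟩ := cr RB hr.symm ⟨b, hb, hbS, Reachable.refl _⟩
    (hAB a ⟨a, ha, haS, Reachable.refl _⟩) (by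
      rintro p q h1 h2 h3 ⟨a, ha, haS, h4⟩
      exact ⟨a, ha, haS, h4.trans (Adj.reachable ⟨h1, h2, h3⟩)⟩)
  have hyB : RB y := by
    rw [← exy] at exy'
    rcases Sym2.eq_iff.1 exy' with ⟨rfl, rfl⟩ | ⟨rfl, rfl⟩
    · exact (hAB _ hxA hyB).elim
    · exact hyB
  rw [← exy] at hKK
  clear hxB exy' cr hr
  -- the two sides
  have fin : ∀ Y : Finset V, Sep K A B Y -> Y.card ≤ S.card -> ∃ X : Finset V, Sep K A B X ∧ ∃ u m, Lk K A B X u m := by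
    intro Y hY hc
    have : ∀ z, ∃ w, z ∈ S -> w ∈ Y ∧ ∃ j ≤ m z, u z j = w := by
      intro z
      by_cases hz : z ∈ S
      · obtain ⟨j, hj, hjY⟩ := (mono hl).hit hY hz
        exact ⟨_, fun _ => ⟨hjY, j, hj, rfl⟩⟩
      · exact ⟨z, fun h => (hz h).elim⟩
    choose φ hφ using this
    obtain ⟨σ, _, hh⟩ := (mono hl).reidx Y hc φ hφ
    exact ⟨Y, hY, _, _, hh⟩
  obtain ⟨Y, hY, u1, m1, hl1⟩ := ih _ hlt K' A ((insert x S : Finset V) : Set V) rfl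
  obtain ⟨Z, hZ, u2, m2, hl2⟩ := ih _ hlt K' B ((insert y S : Finset V) : Set V) rfl
  have hY' : Sep K A B Y := sep_lift (S := (S : Set V)) hKK (fun a ha haS hr => hyA ⟨a, ha, haS, hr⟩) hS (by simpa using hY)
  have hZ' : Sep K A B Z := (sep_lift (S := (S : Set V)) (x := y) (y := x) (fun a b hab => by
    rw [Sym2.eq_swap (a := y)]; exact hKK a b hab) (fun a ha haS hr => hAB x hxA ⟨a, ha, haS, hr⟩) hS.symm (by simpa using hZ)).symm
  by_cases c1 : Y.card ≤ S.card
  · exact fin Y hY' c1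
  by_cases c2 : Z.card ≤ S.card
  · exact fin Z hZ' c2
  obtain ⟨v1, n1, w1⟩ := menger_side hl1 (by rw [Finset.card_insert_of_notMem hxS]; omega) hxS hxA
  obtain ⟨v2, n2, w2⟩ := menger_side hl2 (by rw [Finset.card_insert_of_notMem hyS]; omega) hyS hyB
  refine ⟨insert x S, ?_, menger_step hle hxy hS hxS hyS w1 w2⟩
  intro a ha b hb haX hbX hr
  refine hS a ha b hb (fun h => haX (by simp [Finset.mem_coe.1 h])) (fun h => hbX (by simp [Finset.mem_coe.1 h])) (hr.mono ?_)
  rintro p q ⟨h1, h2, h3⟩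
  simp at h2 h3
  rcases hKK p q h1 with h | h
  · exact ⟨h, by simpa using h2.2, by simpa using h3.2⟩
  · rcases Sym2.eq_iff.1 h with ⟨rfl, rfl⟩ | ⟨rfl, rfl⟩
    · exact (h2.1 rfl).elim
    · exact (h3.1 rfl).elim

end menger

section rows
variable {V : Type*} {K : SimpleGraph V}

/-- some edge between `A` and `B` -/
def Ad (K : SimpleGraph V) (A B : Set V) : Prop := ∃ a ∈ A, ∃ b ∈ B, K.Adj a b

theorem Ad.symm {A B : Set V} (h : Ad K A B) : Ad K B A := by
  obtain ⟨a, ha, b, hb, hab⟩ := h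
  exact ⟨b, hb, a, ha, hab.symm⟩

theorem Ad.mono {A B A' B' : Set V} (h : Ad K A B) (hA : A ⊆ A') (hB : B ⊆ B') : Ad K A' B' := by
  obtain ⟨a, ha, b, hb, hab⟩ := h
  exact ⟨a, hA ha, b, hB hb, hab⟩

theorem KF.k5 (h : KF K) {A B C D E : Set V} (c1 : Cn K A) (c2 : Cn K B) (c3 : Cn K C) (c4 : Cn K D) (c5 : Cn K E)
    (hd : [A, B, C, D, E].Pairwise Disjoint) (ha : [A, B, C, D, E].Pairwise (Ad K)) : False := by
  refine h.1 (hasMinor_iff.2 ⟨fun i => [A, B, C, D, E].get i, ?_, ?_, ?_⟩)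
  · intro w; fin_cases w <;> simpa
  · intro i j hij
    rcases lt_or_gt_of_ne hij with h | h
    · exact List.pairwise_iff_get.1 hd i j h
    · exact (List.pairwise_iff_get.1 hd j i h).symm
  · intro i j hij
    have hij := hij.ne
    rcases lt_or_gt_of_ne hij with h | h
    · exact List.pairwise_iff_get.1 ha i j h
    · exact (List.pairwise_iff_get.1 ha j i h).symm

theorem KF.k33 (h : KF K) {A B C D E F : Set V} (c1 : Cn K A) (c2 : Cn K B) (c3 : Cn K C) (c4 : Cn K D) (c5 : Cn K E) (c6 : Cn K F)
    (hd : [A, B, C, D, E, F].Pairwise Disjoint) (ha : ∀ X ∈ [A, B, C], ∀ Y ∈ [D, E, F], Ad K X Y) : False := by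
  let g : Fin (3 + 3) -> Set V := fun i => [A, B, C, D, E, F].get i
  have hg : ∀ i j : Fin (3 + 3), i < j -> Disjoint (g i) (g j) := fun i j h => List.pairwise_iff_get.1 hd i j h
  have hc : ∀ i, Cn K (g i) := by intro w; fin_cases w <;> simpa [g]
  have had : ∀ i j : Fin 3, Ad K (g (finSumFinEquiv (m := 3) (n := 3) (Sum.inl i))) (g (finSumFinEquiv (m := 3) (n := 3) (Sum.inr j))) := by
    intro i j
    fin_cases i <;> fin_cases j
    exacts [ha A (by simp) D (by simp), ha A (by simp) E (by simp), ha A (by simp) F (by simp), ha B (by simp) D (by simp), ha B (by simp) E (by simp), ha B (by simp) F (by simp), ha C (by simp) D (by simp), ha C (by simp) E (by simp), ha C (by simp) F (by simp)]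
  refine h.2 (hasMinor_iff.2 ⟨fun i => g (finSumFinEquiv i), fun _ => hc _, ?_, ?_⟩)
  · intro i j hij
    rcases lt_or_gt_of_ne (finSumFinEquiv.injective.ne hij) with h | h
    · exact hg _ _ h
    · exact (hg _ _ h).symm
  · rintro (i | i) (j | j) hij
    · simp at hij
    · exact had i j
    · exact (had j i).symm
    · simp at hij

theorem split2 {E X Y : Set V} (hE : Cn K E) (hX : Cn K X) (hY : Cn K Y) (hXE : X ⊆ E) (hYE : Y ⊆ E) (hd : Disjoint X Y) :
    ∃ X', X ⊆ X' ∧ X' ⊆ E ∧ Cn K X' ∧ Disjoint X' Y ∧ Ad K X' Y := by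
  obtain ⟨x, hx⟩ := hX.1
  have hxm : x ∈ E \ Y := ⟨hXE hx, fun h => Set.disjoint_left.1 hd hx h⟩
  let X' : Set V := {v | (ins K (E \ Y)).Reachable x v}
  have hm : ∀ v ∈ X', v ∈ E \ Y := fun v hv => reach_ins_mem hv hxm
  refine ⟨X', fun v hv => ?_, fun v hv => (hm v hv).1, ?_, Set.disjoint_left.2 fun v hv => (hm v hv).2, ?_⟩
  · refine (hX.2 x hx v hv).mono (ins_mono le_rfl fun y hy => ⟨hXE hy, fun h => Set.disjoint_left.1 hd hy h⟩)
  · refine Cn.of_cut ⟨x, Reachable.refl _⟩ fun A hA hne hcl => ?_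
    have key : ∀ v w, (ins K (E \ Y)).Reachable v w -> v ∈ A -> w ∈ A := by
      intro v w hr hv
      refine reach_closed (fun w => w ∈ A) hr hv ?_
      intro a b hab ha
      exact hcl a ha b ((show (ins K (E \ Y)).Reachable x a from hA ha).trans hab.reachable) hab.1
    obtain ⟨a, ha⟩ := hne
    have hxA := key a x (show (ins K (E \ Y)).Reachable x a from hA ha).symm ha
    exact Set.Subset.antisymm hA fun v hv => key x v hv hxA
  · by_contra hn
    obtain ⟨y, hy⟩ := hY.1
    have := hE.closed (fun v => v ∈ X') (hXE hx) (Reachable.refl _) (by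
      intro a ha b hb hab haX
      by_cases hbY : b ∈ Y
      · exact (hn ⟨a, haX, b, hbY, hab⟩).elim
      · exact Reachable.trans haX (Adj.reachable ⟨hab, hm a haX, hb, hbY⟩)) y (hYE hy)
    exact (hm y this).2 hy

def Sg (q : ℕ -> V) (a b : ℕ) : Set V := {v | ∃ t, a ≤ t ∧ t ≤ b ∧ v = q t}

theorem Sg.mem {q : ℕ -> V} {a b t : ℕ} (h1 : a ≤ t) (h2 : t ≤ b) : q t ∈ Sg q a b := ⟨t, h1, h2, rfl⟩

theorem LP.dj {q : ℕ -> V} {n a b c d : ℕ} (h : LP K q n) (hbc : b < c) (hb : d ≤ n) : Disjoint (Sg q a b) (Sg q c d) := by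
  rw [Set.disjoint_left]
  rintro x ⟨t, h1, h2, rfl⟩ ⟨s, h3, h4, h5⟩
  have := h.inj t ω s ω h5
  omega

theorem LP.ad {q : ℕ -> V} {n a b c d : ℕ} (h : LP K q n) (hab : a ≤ b) (hbc : c = b + 1) (hcd : c ≤ d) (hb : d ≤ n) : Ad K (Sg q a b) (Sg q c d) := by
  subst hbc
  exact ⟨q b, Sg.mem hab le_rfl, q (b + 1), Sg.mem le_rfl hcd, h.adj b ω⟩

/-- a row separating an upper part `U` from a lower part `E` -/
structure Row (K : SimpleGraph V) (h : V) (U E : Set V) (q : ℕ -> V) (n : ℕ) : Prop where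
  hU : Cn K U
  hE : Cn K E
  lp : LP K q n
  n1 : 1 ≤ n
  dUE : Disjoint U E
  qU : ∀ t ≤ n, q t ∉ U
  qE : ∀ t ≤ n, q t ∉ E
  qh : ∀ t ≤ n, q t ≠ h
  uh : h ∉ U
  eh : h ∉ E
  aU : Ad K {h} U
  aE : Ad K {h} E
  a0 : K.Adj h (q 0)
  an : K.Adj h (q n)
  U0 : Ad K U {q 0}
  Un : Ad K U {q n}
  E0 : Ad K E {q 0}
  En : Ad K E {q n}

namespace Row
variable {h : V} {U E : Set V} {q : ℕ -> V} {n : ℕ}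

theorem dU (R : Row K h U E q n) {a b : ℕ} (hb : b ≤ n) : Disjoint U (Sg q a b) := by
  rw [Set.disjoint_right]; rintro x ⟨t, h1, h2, rfl⟩; exact R.qU t ω

theorem dE (R : Row K h U E q n) {a b : ℕ} (hb : b ≤ n) : Disjoint E (Sg q a b) := by
  rw [Set.disjoint_right]; rintro x ⟨t, h1, h2, rfl⟩; exact R.qE t ω

theorem dh (R : Row K h U E q n) {a b : ℕ} (hb : b ≤ n) : Disjoint {h} (Sg q a b) := by
  rw [Set.disjoint_right]; rintro x ⟨t, h1, h2, rfl⟩; exact R.qh t ω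

theorem c0 (hK : KF K) (R : Row K h U E q n) : ¬ Ad K U E := by
  intro hUE
  have := R.n1
  refine hK.k5 (Cn.single h) R.hU R.hE (R.lp.seg (le_refl 0) ω) (R.lp.seg (a := 1) (b := n) ω le_rfl) ?_ ?_
  · have h1 := R.dh (a := 0) (b := 0) ω
    have h2 := R.dh (a := 1) (b := n) le_rfl
    have h3 := R.dU (a := 0) (b := 0) ω
    have h4 := R.dU (a := 1) (b := n) le_rfl
    have h5 := R.dE (a := 0) (b := 0) ω
    have h6 := R.dE (a := 1) (b := n) le_rfl
    have h7 := R.lp.dj (a := 0) (b := 0) (c := 1) (d := n) ω le_rfl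
    have h8 : Disjoint {h} U := by simpa using R.uh
    have h9 : Disjoint {h} E := by simpa using R.eh
    simp only [List.pairwise_cons, List.mem_cons, List.not_mem_nil, forall_eq_or_imp, or_false, forall_eq, IsEmpty.forall_iff, implies_true, List.Pairwise.nil, and_true]
    exact ⟨⟨h8, h9, h1, h2⟩, ⟨R.dUE, h3, h4⟩, ⟨h5, h6⟩, h7⟩
  · have s0 : {q 0} ⊆ Sg q 0 0 := by simpa using Sg.mem (q := q) (le_refl 0) (le_refl 0)
    have sn : {q n} ⊆ Sg q 1 n := by simpa using Sg.mem (q := q) R.n1 (le_refl n)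
    simp only [List.pairwise_cons, List.mem_cons, List.not_mem_nil, forall_eq_or_imp, or_false, forall_eq, IsEmpty.forall_iff, implies_true, List.Pairwise.nil, and_true]
    exact ⟨⟨R.aU, R.aE, ⟨h, rfl, q 0, Sg.mem le_rfl le_rfl, R.a0⟩, ⟨h, rfl, q n, Sg.mem R.n1 le_rfl, R.an⟩⟩,
      ⟨hUE, R.U0.mono le_rfl s0, R.Un.mono le_rfl sn⟩, ⟨R.E0.mono le_rfl s0, R.En.mono le_rfl sn⟩, R.lp.ad le_rfl rfl R.n1 le_rfl⟩

theorem c3 (hK : KF K) (R : Row K h U E q n) {X Y : Set V} (hX : Cn K X) (hY : Cn K Y) (hXE : X ⊆ E) (hYE : Y ⊆ E)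
    (hd : Disjoint X Y) {x1 x2 x3 x4 : ℕ} (h1 : x1 < x2) (h2 : x2 < x3) (h3 : x3 < x4) (h4 : x4 ≤ n)
    (a1 : Ad K X {q x1}) (a3 : Ad K X {q x3}) (a2 : Ad K Y {q x2}) (a4 : Ad K Y {q x4}) : False := by
  obtain ⟨X', hXX, hXE', hX', hd', had⟩ := split2 R.hE hX hY hXE hYE hd
  have m : ∀ {a b t : ℕ}, a ≤ t -> t ≤ b -> {q t} ⊆ Sg q a b := fun h1 h2 => by simpa using Sg.mem h1 h2
  have eX : ∀ {a b : ℕ}, b ≤ n -> Disjoint X' (Sg q a b) := fun hb => (R.dE hb).mono_left hXE'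
  have eY : ∀ {a b : ℕ}, b ≤ n -> Disjoint Y (Sg q a b) := fun hb => (R.dE hb).mono_left hYE
  refine hK.k33 (A := Sg q 0 x1 ∪ U) (B := Sg q (x2 + 1) x3) (C := Y) (D := Sg q (x1 + 1) x2) (E := Sg q (x3 + 1) n) (F := X')
    (Cn.union (R.lp.seg ω ω) R.hU (Or.inr (R.U0.symm.mono (m ω ω) le_rfl)))
    (R.lp.seg ω ω) hY (R.lp.seg ω ω) (R.lp.seg ω le_rfl) hX' ?_ ?_
  · simp only [List.pairwise_cons, List.mem_cons, List.not_mem_nil, forall_eq_or_imp, or_false, forall_eq, IsEmpty.forall_iff, implies_true, List.Pairwise.nil, and_true, Set.disjoint_union_left]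
    exact ⟨⟨⟨R.lp.dj ω ω, R.dU ω⟩, ⟨(eY ω).symm, R.dUE.mono_right hYE⟩, ⟨R.lp.dj ω ω, R.dU ω⟩,
      ⟨R.lp.dj ω ω, R.dU ω⟩, ⟨(eX ω).symm, R.dUE.mono_right hXE'⟩⟩,
      ⟨(eY ω).symm, (R.lp.dj ω ω).symm, R.lp.dj ω ω, (eX ω).symm⟩,
      ⟨eY ω, eY ω, hd'.symm⟩, ⟨R.lp.dj ω ω, (eX ω).symm⟩, (eX ω).symm⟩
  · simp only [List.mem_cons, List.not_mem_nil, forall_eq_or_imp, or_false, forall_eq]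
    exact ⟨⟨(R.lp.ad ω rfl ω ω).mono Set.subset_union_left le_rfl, R.Un.mono Set.subset_union_right (m ω ω),
        a1.symm.mono ((m ω ω).trans Set.subset_union_left) hXX⟩,
      ⟨(R.lp.ad ω rfl ω ω).symm, R.lp.ad ω rfl ω ω, a3.symm.mono (m ω ω) hXX⟩,
      ⟨a2.mono le_rfl (m ω ω), a4.mono le_rfl (m ω ω), had.symm⟩⟩

theorem c4 (hK : KF K) (R : Row K h U E q n) {X Z : Set V} (hX : Cn K X) (hZ : Cn K Z) (hXE : X ⊆ E) (hZE : Z ⊆ E)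
    (hd : Disjoint X Z) {x1 x2 x3 : ℕ} (h1 : x1 < x2) (h2 : x2 < x3) (h3 : x3 ≤ n)
    (a1 : Ad K X {q x1}) (a3 : Ad K X {q x3}) (a2 : Ad K Z {q x2}) (ah : Ad K Z {h}) : False := by
  obtain ⟨X', hXX, hXE', hX', hd', had⟩ := split2 R.hE hX hZ hXE hZE hd
  have m : ∀ {a b t : ℕ}, a ≤ t -> t ≤ b -> {q t} ⊆ Sg q a b := fun h1 h2 => by simpa using Sg.mem h1 h2
  have eX : ∀ {a b : ℕ}, b ≤ n -> Disjoint X' (Sg q a b) := fun hb => (R.dE hb).mono_left hXE'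
  have eZ : ∀ {a b : ℕ}, b ≤ n -> Disjoint Z (Sg q a b) := fun hb => (R.dE hb).mono_left hZE
  refine hK.k33 (A := X') (B := U) (C := Sg q (x1 + 1) (x3 - 1)) (D := Sg q 0 x1) (E := Sg q x3 n) (F := Z ∪ {h})
    hX' R.hU (R.lp.seg ω ω) (R.lp.seg ω ω) (R.lp.seg ω le_rfl)
    (hZ.union (Cn.single h) (Or.inr ah)) ?_ ?_
  · simp only [List.pairwise_cons, List.mem_cons, List.not_mem_nil, forall_eq_or_imp, or_false, forall_eq, IsEmpty.forall_iff, implies_true, List.Pairwise.nil, and_true, Set.disjoint_union_right]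
    have h8 : Disjoint U {h} := by simpa using R.uh
    have h9 : Disjoint E {h} := by simpa using R.eh
    exact ⟨⟨R.dUE.symm.mono_left hXE', eX ω, eX ω, eX ω, hd', h9.mono_left hXE'⟩,
      ⟨R.dU ω, R.dU ω, R.dU ω, R.dUE.mono_right hZE, h8⟩,
      ⟨(R.lp.dj ω ω).symm, R.lp.dj ω ω, (eZ ω).symm, (R.dh ω).symm⟩,
      ⟨R.lp.dj ω ω, (eZ ω).symm, (R.dh ω).symm⟩, (eZ ω).symm, (R.dh ω).symm⟩
  · simp only [List.mem_cons, List.not_mem_nil, forall_eq_or_imp, or_false, forall_eq]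
    exact ⟨⟨a1.mono hXX (m ω ω), a3.mono hXX (m ω ω), had.mono le_rfl Set.subset_union_left⟩,
      ⟨R.U0.mono le_rfl (m ω ω), R.Un.mono le_rfl (m ω ω), R.aU.symm.mono le_rfl Set.subset_union_right⟩,
      ⟨(R.lp.ad ω rfl ω ω).symm, R.lp.ad ω ω ω ω, a2.symm.mono (m ω ω) Set.subset_union_left⟩⟩

theorem c5 (hK : KF K) (R : Row K h U E q n) {A B : Set V} (hA : Cn K A) (hB : Cn K B) (hAE : A ⊆ E) (hBE : B ⊆ E)
    (hd : Disjoint A B) {x1 x2 : ℕ} (h1 : x1 < x2) (h2 : x2 ≤ n)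
    (a1 : Ad K A {q x1}) (an : Ad K A {q n}) (a2 : Ad K B {q x2}) (a0 : Ad K B {q 0}) (ab : Ad K A B) (aA : Ad K {h} A) (aB : Ad K {h} B) : False := by
  have m : ∀ {a b t : ℕ}, a ≤ t -> t ≤ b -> {q t} ⊆ Sg q a b := fun h1 h2 => by simpa using Sg.mem h1 h2
  have h8 : Disjoint U {h} := by simpa using R.uh
  have h9 : Disjoint E {h} := by simpa using R.eh
  refine hK.k5 (A := Sg q 0 x1) (B := Sg q (x1 + 1) n) (C := A) (D := B) (E := {h} ∪ U)
    (R.lp.seg ω ω) (R.lp.seg ω ω) hA hB ((Cn.single h).union R.hU (Or.inr R.aU)) ?_ ?_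
  · simp only [List.pairwise_cons, List.mem_cons, List.not_mem_nil, forall_eq_or_imp, or_false, forall_eq, IsEmpty.forall_iff, implies_true, List.Pairwise.nil, and_true, Set.disjoint_union_right]
    exact ⟨⟨R.lp.dj ω ω, ((R.dE ω).mono_left hAE).symm, ((R.dE ω).mono_left hBE).symm, (R.dh ω).symm, (R.dU ω).symm⟩,
      ⟨((R.dE ω).mono_left hAE).symm, ((R.dE ω).mono_left hBE).symm, (R.dh ω).symm, (R.dU ω).symm⟩,
      ⟨hd, h9.mono_left hAE, (R.dUE.mono_right hAE).symm⟩, h9.mono_left hBE, (R.dUE.mono_right hBE).symm⟩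
  · simp only [List.pairwise_cons, List.mem_cons, List.not_mem_nil, forall_eq_or_imp, or_false, forall_eq, IsEmpty.forall_iff, implies_true, List.Pairwise.nil, and_true]
    exact ⟨⟨R.lp.ad ω rfl ω ω, a1.symm.mono (m ω ω) le_rfl, a0.symm.mono (m ω ω) le_rfl,
      R.U0.symm.mono (m ω ω) Set.subset_union_right⟩,
      ⟨an.symm.mono (m ω ω) le_rfl, a2.symm.mono (m ω ω) le_rfl, R.Un.symm.mono (m ω ω) Set.subset_union_right⟩,
      ⟨ab, aA.symm.mono le_rfl Set.subset_union_left⟩, aB.symm.mono le_rfl Set.subset_union_left⟩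

end Row
end rows

section cols
variable {V : Type*} {K : SimpleGraph V}

theorem consec {P Q : ℕ -> Prop} {s0 s1 : ℕ} (h : s0 < s1) (v0 : Q s0) (v1 : Q s1) (h0 : P s0) (h1 : ¬ P s1) :
    ∃ s s', s < s' ∧ s' ≤ s1 ∧ Q s ∧ Q s' ∧ P s ∧ ¬ P s' ∧ ∀ x, s < x -> x < s' -> ¬ Q x := by
  obtain ⟨d, rfl⟩ : ∃ d, s1 = s0 + d := ⟨s1 - s0, ω⟩
  induction d using Nat.strong_induction_on generalizing s0 with
  | _ d ih =>
  by_cases hm : ∃ x, s0 < x ∧ x < s0 + d ∧ Q x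
  · obtain ⟨x, hx1, hx2, hx3⟩ := hm
    by_cases hP : P x
    · obtain ⟨s, s', g⟩ := ih (s0 + d - x) ω (s0 := x) (v0 := hx3) (h0 := hP) ω (by rwa [show x + (s0 + d - x) = s0 + d by omega]) (by rwa [show x + (s0 + d - x) = s0 + d by omega])
      exact ⟨s, s', g.1, ω, g.2.2⟩
    · obtain ⟨s, s', g⟩ := ih (x - s0) ω (s0 := s0) (v0 := v0) (h0 := h0) ω (by rwa [show s0 + (x - s0) = x by omega]) (by rwa [show s0 + (x - s0) = x by omega])
      exact ⟨s, s', g.1, ω, g.2.2⟩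
  · push Not at hm
    exact ⟨s0, s0 + d, h, le_rfl, v0, v1, h0, h1, hm⟩

/-- the columns, relative to a row -/
structure Cols (K : SimpleGraph V) (h : V) (U E : Set V) (q : ℕ -> V) (n a : ℕ) (t : ℕ -> ℕ -> V) (m : ℕ -> ℕ) : Prop where
  lp : ∀ i < a, LP K (t i) (m i)
  dj : ∀ i < a, ∀ k < a, i ≠ k -> ∀ s ≤ m i, ∀ s' ≤ m k, t i s ≠ t k s'
  fin : ∀ i < a, t i (m i) ∈ E
  ah : ∀ i < a, K.Adj h (t i (m i))
  aU : ∀ i < a, Ad K U {t i 0}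
  up : ∀ i < a, ∀ s < m i, t i s ∈ E -> (∀ p ≤ n, t i (s + 1) ≠ q p) -> t i (s + 1) ∈ E
  down : ∀ i < a, ∀ s < m i, t i (s + 1) ∈ E -> (∀ p ≤ n, t i s ≠ q p) -> t i s ∈ E
  span : ∀ i < a, ∀ s s' p p', s < s' -> s' ≤ m i -> p ≤ n -> p' ≤ n -> t i s = q p -> t i s' = q p' →
    (∀ x, s < x -> x < s' -> t i x ∉ E ∧ ∀ p ≤ n, t i x ≠ q p) -> ∀ y, (p ≤ y ∧ y ≤ p' ∨ p' ≤ y ∧ y ≤ p) -> ∃ x ≤ m i, t i x = q y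
  ord : ∀ i k, i < k -> k < a -> ∃ L R : Set V, Cn K L ∧ Cn K R ∧ L ⊆ E ∧ R ⊆ E ∧ Disjoint L R ∧ t i (m i) ∈ L ∧ t k (m k) ∈ R ∧
    Ad K R L ∧ Ad K L {q 0} ∧ Ad K R {q n} ∧ (∀ s ≤ m k, t k s ∉ L) ∧ (∀ s ≤ m i, t i s ∉ R)

namespace Cols
variable {h : V} {U E : Set V} {q : ℕ -> V} {n a : ℕ} {t : ℕ -> ℕ -> V} {m : ℕ -> ℕ}

/-- position `p` of the row is on column `i` -/
def A (q : ℕ -> V) (n : ℕ) (t : ℕ -> ℕ -> V) (m : ℕ -> ℕ) (i p : ℕ) : Prop := p ≤ n ∧ ∃ s ≤ m i, t i s = q p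

theorem seg_up (c : Cols K h U E q n a t m) {i : ℕ} (hi : i < a) {s x : ℕ} (hs : t i s ∈ E) (hsx : s ≤ x) (hx : x ≤ m i)
    (hv : ∀ y, s ≤ y -> y ≤ x -> ∀ p ≤ n, t i y ≠ q p) : t i x ∈ E := by
  induction x, hsx using Nat.le_induction with
  | base => exact hs
  | succ x hsx ih => exact c.up i hi x ω (ih ω fun y h1 h2 => hv y h1 ω) (hv (x + 1) ω le_rfl)

theorem seg_down (c : Cols K h U E q n a t m) {i : ℕ} (hi : i < a) {s x : ℕ} (hs : t i x ∈ E) (hsx : s ≤ x) (hx : x ≤ m i)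
    (hv : ∀ y, s ≤ y -> y ≤ x -> ∀ p ≤ n, t i y ≠ q p) : t i s ∈ E := by
  induction x, hsx using Nat.le_induction with
  | base => exact hs
  | succ x hsx ih => exact ih (c.down i hi x ω hs (hv x ω ω)) ω fun y h1 h2 => hv y h1 ω

theorem not_start (c : Cols K h U E q n a t m) (hK : KF K) (R : Row K h U E q n) {i : ℕ} (hi : i < a) {x : ℕ} (hx : x ≤ m i)
    (hv : ∀ y ≤ x, ∀ p ≤ n, t i y ≠ q p) : t i x ∉ E := by
  intro hE
  have := c.seg_down hi hE (Nat.zero_le x) hx (fun y _ hy => hv y hy)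
  exact R.c0 hK ((c.aU i hi).mono le_rfl (by simpa using this))

theorem hit (c : Cols K h U E q n a t m) (hK : KF K) (R : Row K h U E q n) {i : ℕ} (hi : i < a) : ∃ s ≤ m i, ∃ p ≤ n, t i s = q p := by
  by_contra hh
  push Not at hh
  exact c.not_start hK R hi le_rfl hh (c.fin i hi)

theorem jump (c : Cols K h U E q n a t m) (R : Row K h U E q n) {i : ℕ} (hi : i < a) (P : ℕ -> Prop) {p0 p1 : ℕ}
    (h0 : A q n t m i p0) (h1 : A q n t m i p1) (hp0 : P p0) (hp1 : ¬ P p1) :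
    ∃ p p', A q n t m i p ∧ A q n t m i p' ∧ P p ∧ ¬ P p' ∧ ((∀ y, (p ≤ y ∧ y ≤ p' ∨ p' ≤ y ∧ y ≤ p) -> A q n t m i y) ∨
      ∃ X, Cn K X ∧ X ⊆ E ∧ (∀ v ∈ X, ∃ s ≤ m i, t i s = v) ∧ Ad K X {q p} ∧ Ad K X {q p'}) := by
  obtain ⟨l0, s0, hs0, e0⟩ := h0
  obtain ⟨l1, s1, hs1, e1⟩ := h1
  have gen : ∀ s s', s < s' -> s' ≤ m i -> ∀ p p', p ≤ n -> p' ≤ n -> t i s = q p -> t i s' = q p' →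
      (∀ x, s < x -> x < s' -> ∀ p ≤ n, t i x ≠ q p) -> ((∀ y, (p ≤ y ∧ y ≤ p' ∨ p' ≤ y ∧ y ≤ p) -> A q n t m i y) ∨
      ∃ X, Cn K X ∧ X ⊆ E ∧ (∀ v ∈ X, ∃ s ≤ m i, t i s = v) ∧ Ad K X {q p} ∧ Ad K X {q p'}) := by
    intro s s' hs hs' p p' hp hp' e e' hno
    by_cases hE : ∃ x, s < x ∧ x < s' ∧ t i x ∈ E
    · right
      obtain ⟨x, hx1, hx2, hxE⟩ := hE
      refine ⟨Sg (t i) (s + 1) (s' - 1), (c.lp i hi).seg ω ω, ?_, ?_, ?_, ?_⟩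
      · rintro v ⟨y, hy1, hy2, rfl⟩
        rcases le_total x y with hxy | hxy
        · exact c.seg_up hi hxE hxy ω fun z h1 h2 => hno z ω ω
        · exact c.seg_down hi hxE hxy ω fun z h1 h2 => hno z ω ω
      · rintro v ⟨y, hy1, hy2, rfl⟩; exact ⟨y, ω, rfl⟩
      · exact ⟨t i (s + 1), Sg.mem le_rfl ω, q p, rfl, e ▸ ((c.lp i hi).adj s ω).symm⟩
      · refine ⟨t i (s' - 1), Sg.mem ω le_rfl, q p', rfl, ?_⟩
        have := (c.lp i hi).adj (s' - 1) ω
        rwa [show s' - 1 + 1 = s' by omega, e'] at this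
    · left
      push Not at hE
      intro y hy
      exact ⟨ω, c.span i hi s s' p p' hs hs' hp hp' e e' (fun x h1 h2 => ⟨hE x h1 h2, hno x h1 h2⟩) y hy⟩
  have ne : s0 ≠ s1 := by
    rintro rfl
    have := R.lp.inj p0 l0 p1 l1 (by rw [← e0, e1])
    subst this; exact hp1 hp0
  have uniq : ∀ s p p', p ≤ n -> p' ≤ n -> t i s = q p -> t i s = q p' -> p = p' := fun s p p' h1 h2 h3 h4 => R.lp.inj p h1 p' h2 (by rw [← h3, h4])
  rcases lt_or_gt_of_ne ne with hlt | hlt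
  · obtain ⟨s, s', g1, g2, ⟨p, hp, e⟩, ⟨p', hp', e'⟩, g3, g4, g5⟩ := consec (P := fun s => ∃ p ≤ n, t i s = q p ∧ P p) (Q := fun s => ∃ p ≤ n, t i s = q p) hlt
      ⟨p0, l0, e0⟩ ⟨p1, l1, e1⟩ ⟨p0, l0, e0, hp0⟩ (by rintro ⟨p, hp, e, hP⟩; rw [uniq s1 p p1 hp l1 e e1] at hP; exact hp1 hP)
    obtain ⟨p2, hp2, e2, hP⟩ := g3
    obtain rfl := uniq _ _ _ hp2 hp e2 e
    exact ⟨p2, p', ⟨hp, s, ω, e⟩, ⟨hp', s', ω, e'⟩, hP, fun h => g4 ⟨p', hp', e', h⟩,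
      gen s s' g1 ω p2 p' hp hp' e e' fun x h1 h2 p hp hh => g5 x h1 h2 ⟨p, hp, hh⟩⟩
  · obtain ⟨s, s', g1, g2, ⟨p, hp, e⟩, ⟨p', hp', e'⟩, g3, g4, g5⟩ := consec (P := fun s => ¬ ∃ p ≤ n, t i s = q p ∧ P p) (Q := fun s => ∃ p ≤ n, t i s = q p) hlt
      ⟨p1, l1, e1⟩ ⟨p0, l0, e0⟩ (by rintro ⟨p, hp, e, hP⟩; rw [uniq s1 p p1 hp l1 e e1] at hP; exact hp1 hP) (by simpa using ⟨p0, l0, e0, hp0⟩)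
    rw [not_not] at g4
    obtain ⟨p2, hp2, e2, hP⟩ := g4
    obtain rfl := uniq _ _ _ hp2 hp' e2 e'
    refine ⟨p2, p, ⟨hp', s', ω, e'⟩, ⟨hp, s, ω, e⟩, hP, fun h => g3 ⟨p, hp, e, h⟩, ?_⟩
    rcases gen s s' g1 ω p p2 hp hp' e e' (fun x h1 h2 p hp hh => g5 x h1 h2 ⟨p, hp, hh⟩) with h | ⟨X, x1, x2, x3, x4, x5⟩
    · exact Or.inl fun y hy => h y hy.symm
    · exact Or.inr ⟨X, x1, x2, x3, x5, x4⟩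

theorem A_ne (c : Cols K h U E q n a t m) {i k : ℕ} (hi : i < a) (hk : k < a) (hik : i ≠ k) {p : ℕ}
    (h1 : A q n t m i p) (h2 : A q n t m k p) : False := by
  obtain ⟨_, s, hs, e⟩ := h1
  obtain ⟨_, s', hs', e'⟩ := h2
  exact c.dj i hi k hk hik s hs s' hs' (e.trans e'.symm)

/-- first and last visits -/
theorem visits (c : Cols K h U E q n a t m) (hK : KF K) (R : Row K h U E q n) {i : ℕ} (hi : i < a) : ∃ f l pf pl, f < m i ∧ l < m i ∧ pf ≤ n ∧ pl ≤ n ∧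
    t i f = q pf ∧ t i l = q pl ∧ (∀ s < f, ∀ p ≤ n, t i s ≠ q p) ∧ (∀ s < f, t i s ∉ E) ∧ (∀ s, l < s -> s ≤ m i -> t i s ∈ E) := by
  have hne : ∀ s ≤ m i, ∀ p ≤ n, t i s = q p -> s < m i := by
    intro s hs p hp e
    rcases hs.lt_or_eq with h | h
    · exact h
    · subst h; exact (R.qE p hp (e ▸ c.fin i hi)).elim
  have hex : ∃ s, s ≤ m i ∧ ∃ p ≤ n, t i s = q p := c.hit hK R hi
  obtain ⟨hf, pf, hpf, ef⟩ := Nat.find_spec hex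
  have hmin : ∀ s < Nat.find hex, ∀ p ≤ n, t i s ≠ q p := fun s hs p hp e => Nat.find_min hex hs ⟨ω, p, hp, e⟩
  obtain ⟨s0, hs0, hv0⟩ := hex
  obtain ⟨pl, hpl, el⟩ := Nat.findGreatest_spec (P := fun s => ∃ p ≤ n, t i s = q p) hs0 hv0
  have hmax : ∀ s, Nat.findGreatest (fun s => ∃ p ≤ n, t i s = q p) (m i) < s -> s ≤ m i -> ∀ p ≤ n, t i s ≠ q p :=
    fun s h1 h2 p hp e => Nat.findGreatest_is_greatest h1 h2 ⟨p, hp, e⟩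
  refine ⟨_, _, pf, pl, hne _ hf pf hpf ef, hne _ (Nat.findGreatest_le _) pl hpl el, hpf, hpl, ef, el, hmin, ?_, ?_⟩
  · intro s hs
    exact c.not_start hK R hi ω fun y hy => hmin y ω
  · intro s h1 h2
    exact c.seg_down hi (c.fin i hi) h2 le_rfl fun y h3 h4 => hmax y ω h4

theorem main (c : Cols K h U E q n a t m) (hK : KF K) (R : Row K h U E q n) : ∃ f l pf pl cc : ℕ -> ℕ, ∀ i < a, f i < m i ∧ l i < m i ∧ A q n t m i (pf i) ∧ A q n t m i (pl i) ∧
    t i (f i) = q (pf i) ∧ t i (l i) = q (pl i) ∧ (∀ s < f i, ∀ p ≤ n, t i s ≠ q p) ∧ (∀ s < f i, t i s ∉ E) ∧ (∀ s, l i < s -> s ≤ m i -> t i s ∈ E) ∧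
    A q n t m i (cc i) ∧ (∀ p, A q n t m i p -> p ≤ cc i) ∧ ∀ k < a, i < k -> ∀ p p', A q n t m i p -> A q n t m k p' -> p < p' := by
  have : ∀ i, ∃ f l pf pl cc, i < a -> f < m i ∧ l < m i ∧ A q n t m i pf ∧ A q n t m i pl ∧
      t i f = q pf ∧ t i l = q pl ∧ (∀ s < f, ∀ p ≤ n, t i s ≠ q p) ∧ (∀ s < f, t i s ∉ E) ∧ (∀ s, l < s -> s ≤ m i -> t i s ∈ E) ∧
      A q n t m i cc ∧ (∀ p, A q n t m i p -> p ≤ cc) := by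
    intro i
    by_cases hi : i < a
    · obtain ⟨f, l, pf, pl, g1, g2, g3, g4, g5, g6, g7, g8, g9⟩ := c.visits hK R hi
      have hA : A q n t m i pf := ⟨g3, f, g1.le, g5⟩
      refine ⟨f, l, pf, pl, Nat.findGreatest (A q n t m i) n, fun _ => ⟨g1, g2, hA, ⟨g4, l, g2.le, g6⟩, g5, g6, g7, g8, g9,
        Nat.findGreatest_spec g3 hA, fun p hp => Nat.le_findGreatest hp.1 hp⟩⟩
    · exact ⟨0, 0, 0, 0, 0, fun h => (hi h).elim⟩
  choose f l pf pl cc hh using this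
  -- tails
  let Z : ℕ -> Set V := fun k => Sg (t k) (l k + 1) (m k)
  have hZ : ∀ k < a, Cn K (Z k) := fun k hk => (c.lp k hk).seg (by have := hh k hk; omega) le_rfl
  have hZE : ∀ k < a, Z k ⊆ E := by rintro k hk v ⟨s, h1, h2, rfl⟩; exact (hh k hk).2.2.2.2.2.2.2.2.1 s ω h2
  have hZm : ∀ k < a, t k (m k) ∈ Z k := fun k hk => Sg.mem (by have := hh k hk; omega) le_rfl
  have hZl : ∀ k < a, Ad K (Z k) {q (pl k)} := fun k hk =>
    ⟨t k (l k + 1), Sg.mem le_rfl (by have := hh k hk; omega), _, rfl, by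
      rw [← (hh k hk).2.2.2.2.2.1]; exact ((c.lp k hk).adj _ (by have := hh k hk; omega)).symm⟩
  have hpl : ∀ k < a, A q n t m k (pl k) := fun k hk => (hh k hk).2.2.2.1
  -- one-sidedness
  have side : ∀ i < a, ∀ k < a, i ≠ k -> ∀ p0 p1, A q n t m i p0 -> A q n t m i p1 -> p0 < pl k -> ¬ p1 < pl k -> False := by
    intro i hi k hk hik p0 p1 h0 h1 hp0 hp1
    obtain ⟨p, p', g1, g2, g3, g4, g⟩ := c.jump R hi (fun x => x < pl k) h0 h1 hp0 hp1
    have hne : p' ≠ pl k := by rintro rfl; exact c.A_ne hi hk hik g2 (hpl k hk)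
    rcases g with g | ⟨X, x1, x2, x3, x4, x5⟩
    · exact c.A_ne hi hk hik (g (pl k) ω) (hpl k hk)
    · refine R.c4 hK x1 (hZ k hk) x2 (hZE k hk) ?_ g3 (show pl k < p' by omega) g2.1 x4 x5 (hZl k hk) ⟨_, hZm k hk, h, rfl, (c.ah k hk).symm⟩
      rw [Set.disjoint_left]
      rintro v hv ⟨s, s1, s2, rfl⟩
      obtain ⟨s', h1, e⟩ := x3 _ hv
      exact c.dj i hi k hk hik s' h1 s s2 e
  have ordl : ∀ i k, i < k -> k < a -> pl i < pl k := by
    intro i k hik hk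
    have hi : i < a := by omega
    by_contra hlt
    have hne : pl k ≠ pl i := fun e => c.A_ne hi hk hik.ne (e ▸ hpl i hi) (e ▸ hpl k hk)
    obtain ⟨L, Rt, o1, o2, o3, o4, o5, o6, o7, o8, o9, o10, o11, o12⟩ := c.ord i k hik hk
    refine R.c5 hK (A := Z k ∪ Rt) (B := Z i ∪ L) ((hZ k hk).union o2 (Or.inl ⟨_, hZm k hk, o7⟩)) ((hZ i hi).union o1 (Or.inl ⟨_, hZm i hi, o6⟩))
      (Set.union_subset (hZE k hk) o4) (Set.union_subset (hZE i hi) o3) ?_ (show pl k < pl i by omega) (hpl i hi).1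
      ((hZl k hk).mono Set.subset_union_left le_rfl) (o10.mono Set.subset_union_right le_rfl)
      ((hZl i hi).mono Set.subset_union_left le_rfl) (o9.mono Set.subset_union_right le_rfl) (o8.mono Set.subset_union_right Set.subset_union_right)
      ⟨h, rfl, _, Or.inl (hZm k hk), c.ah k hk⟩ ⟨h, rfl, _, Or.inl (hZm i hi), c.ah i hi⟩
    rw [Set.disjoint_left]
    rintro v (⟨s, s1, s2, rfl⟩ | hv) (⟨s', s3, s4, e⟩ | hv')
    · exact c.dj k hk i hi hik.ne' s s2 s' s4 e
    · exact o11 s s2 hv'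
    · exact o12 s' s4 (e ▸ hv)
    · exact Set.disjoint_left.1 o5 hv' hv
  refine ⟨f, l, pf, pl, cc, fun i hi => ?_⟩
  obtain ⟨g1, g2, g3, g4, g5, g6, g7, g8, g9, g10, g11⟩ := hh i hi
  refine ⟨g1, g2, g3, g4, g5, g6, g7, g8, g9, g10, g11, ?_⟩
  intro k hk hik b0 c0 hb hc
  by_contra hlt
  have hne : b0 ≠ c0 := by rintro rfl; exact c.A_ne hi hk hik.ne hb hc
  have e1 : ∀ p, A q n t m i p -> p < pl k := by
    intro p hp
    by_contra hpk
    exact side i hi k hk hik.ne _ _ g4 hp (ordl i k hik hk) hpk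
  have e2 : ∀ p, A q n t m k p -> pl i < p := by
    intro p hp
    by_contra hpk
    have : p ≠ pl i := by rintro rfl; exact c.A_ne hi hk hik.ne g4 hp
    exact side k hk i hi hik.ne' _ _ hp (hpl k hk) ω (by have := ordl i k hik hk; omega)
  have := e1 _ hb
  have := e2 _ hc
  obtain ⟨x2, x4, k1, k2, k3, k4, kk⟩ := c.jump R hk (fun x => x < b0) hc (hpl k hk) ω ω
  have hx4 : x4 ≠ b0 := by rintro rfl; exact c.A_ne hi hk hik.ne hb k2
  have hx2' := e2 _ k1
  rcases kk with kk | ⟨Y, y1, y2, y3, y4, y5⟩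
  · exact c.A_ne hi hk hik.ne hb (kk b0 ω)
  obtain ⟨x3, x1, j1, j2, j3, j4, jj⟩ := c.jump R hi (fun x => x2 < x ∧ x < x4) hb g4 ⟨k3, ω⟩ ω
  have n1 : x1 ≠ x2 := by rintro rfl; exact c.A_ne hi hk hik.ne j2 k1
  have n2 : x1 ≠ x4 := by rintro rfl; exact c.A_ne hi hk hik.ne j2 k2
  rcases jj with jj | ⟨X, z1, z2, z3, z4, z5⟩
  · rcases lt_or_ge x1 x2 with h | h
    · exact c.A_ne hi hk hik.ne (jj x2 ω) k1
    · exact c.A_ne hi hk hik.ne (jj x4 ω) k2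
  have hd : Disjoint X Y := by
    rw [Set.disjoint_left]
    intro v hv hv'
    obtain ⟨s, hs, e⟩ := z3 v hv
    obtain ⟨s', hs', e'⟩ := y3 v hv'
    exact c.dj i hi k hk hik.ne s hs s' hs' (e.trans e'.symm)
  rcases lt_or_ge x1 x2 with h | h
  · exact R.c3 hK z1 y1 z2 y2 hd h j3.1 j3.2 k2.1 z5 z4 y4 y5
  · exact R.c3 hK y1 z1 y2 z2 hd.symm j3.1 j3.2 (show x4 < x1 by omega) j2.1 y4 y5 z4 z5

end Cols
end cols

section recrows
variable {V : Type*} {K : SimpleGraph V}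

theorem cn_comp (S : Set V) (x : V) : Cn K {v | (ins K S).Reachable x v} := by
  refine Cn.of_cut ⟨x, Reachable.refl _⟩ fun A hA hne hcl => ?_
  have key : ∀ v w, (ins K S).Reachable v w -> v ∈ A -> w ∈ A := by
    intro v w hr hv
    refine reach_closed (fun w => w ∈ A) hr hv ?_
    intro a b hab ha
    exact hcl a ha b ((show (ins K S).Reachable x a from hA ha).trans hab.reachable) hab.1
  obtain ⟨a, ha⟩ := hne
  have hxA := key a x (show (ins K S).Reachable x a from hA ha).symm ha
  exact Set.Subset.antisymm hA fun v hv => key x v hv hxA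

/-- number of expensive steps -/
def cst (g : V -> V -> Prop) (u : ℕ -> V) (n : ℕ) : ℕ := ∑ t ∈ Finset.range n, if g (u t) (u (t + 1)) then 0 else 1

theorem cst_add (g : V -> V -> Prop) (u : ℕ -> V) (m n : ℕ) : cst g u (m + n) = cst g u m + cst g (fun t => u (m + t)) n := by
  unfold cst
  rw [Finset.sum_range_add]
  rfl

theorem cst_congr (g : V -> V -> Prop) {u v : ℕ -> V} {n : ℕ} (h : ∀ t ≤ n, u t = v t) : cst g u n = cst g v n := by
  unfold cst
  refine Finset.sum_congr rfl fun t ht => ?_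
  rw [Finset.mem_range] at ht
  rw [h t ω, h (t + 1) ω]

theorem cst_zero {g : V -> V -> Prop} {u : ℕ -> V} {n : ℕ} : cst g u n = 0 ↔ ∀ t < n, g (u t) (u (t + 1)) := by
  unfold cst
  rw [Finset.sum_eq_zero_iff]
  simp

theorem concat_cst (g : V -> V -> Prop) {u v : ℕ -> V} {m n : ℕ} (e : u m = v 0) :
    cst g (fun i => if i ≤ m then u i else v (i - m)) (m + n) = cst g u m + cst g v n := by
  rw [cst_add]
  congr 1
  · exact cst_congr g fun t ht => by simp [ht]
  · refine cst_congr g fun t ht => ?_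
    by_cases h : t = 0
    · subst h; simp [e]
    · simp [show ¬ (m + t ≤ m) by omega]

theorem reroute {q r : ℕ -> V} {n l p p' : ℕ} (hq : LP K q n) (hr : LP K r l) (hp : p < p') (hp' : p' ≤ n) (e : r 0 = q p) (e' : r l = q p')
    (hi : ∀ x, 0 < x -> x < l -> ∀ y ≤ n, r x ≠ q y) : ∃ q' n', LP K q' n' ∧ q' 0 = q 0 ∧ q' n' = q n ∧
      (∀ x ≤ n', (∃ y ≤ n, q' x = q y) ∨ ∃ y, 0 < y ∧ y < l ∧ q' x = r y) ∧
      ∀ g, cst g q' n' = cst g q p + cst g r l + cst g (fun t => q (p' + t)) (n - p') := by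
  have h1 := hr.concat (hq.shift hp') (by simpa using e') (by
    intro i hil j hj hij
    by_cases h0 : i = 0
    · subst h0
      rw [e] at hij
      have := hq.inj _ ω _ ω hij
      omega
    · by_cases hl : i = l
      · subst hl
        rw [e'] at hij
        have := hq.inj _ ω _ ω hij
        exact ⟨rfl, ω⟩
      · exact (hi i ω ω _ ω hij).elim)
  have hl : 0 < l := by
    rcases Nat.eq_zero_or_pos l with h | h
    · subst h
      have := hq.inj p ω p' hp' (by rw [← e, e'])
      omega
    · exact h
  have h2 := (hq.mono (show p ≤ n by omega)).concat h1 (by simpa using e.symm) (by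
    intro i hip j hj hij
    by_cases hjl : j ≤ l
    · simp only [hjl, if_true] at hij
      by_cases hj0 : j = 0
      · subst hj0
        rw [e] at hij
        exact ⟨hq.inj i ω p ω hij, rfl⟩
      · by_cases hjl' : j = l
        · subst hjl'
          rw [e'] at hij
          have := hq.inj i ω p' ω hij
          omega
        · exact (hi j ω ω i ω hij.symm).elim
    · simp only [hjl, if_false] at hij
      have := hq.inj i ω _ ω hij
      omega)
  refine ⟨_, _, h2, by simp, ?_, ?_, ?_⟩
  · simp only [show ¬ (p + (l + (n - p')) ≤ p) by omega, if_false, show p + (l + (n - p')) - p = l + (n - p') by omega]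
    by_cases hn : n = p'
    · subst hn; simpa using e'
    · simp only [show ¬ (l + (n - p') ≤ l) by omega, if_false, show p' + (l + (n - p') - l) = n by omega]
  · intro x hx
    by_cases c1 : x ≤ p
    · simp only [c1, if_true]; exact Or.inl ⟨x, ω, rfl⟩
    · by_cases c2 : x - p ≤ l
      · simp only [c1, c2, if_true, if_false]
        by_cases c3 : x - p = l
        · rw [c3]; exact Or.inl ⟨p', hp', e'⟩
        · exact Or.inr ⟨x - p, ω, ω, rfl⟩
      · simp only [c1, c2, if_false]
        exact Or.inl ⟨p' + (x - p - l), ω, rfl⟩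
  · intro g
    have k1 := concat_cst g (u := q) (v := fun i => if i ≤ l then r i else q (p' + (i - l))) (m := p) (n := l + (n - p')) (by simpa using e.symm)
    have k2 := concat_cst g (u := r) (v := fun t => q (p' + t)) (m := l) (n := n - p') (by simpa using e')
    refine (k1.trans (congrArg _ k2)).trans ?_
    omega

/-- a cheapest path -/
theorem cheapest (g : V -> V -> Prop) (P : (ℕ -> V) -> ℕ -> Prop) (h : ∃ q n, P q n) : ∃ q n, P q n ∧ ∀ q' n', P q' n' -> cst g q n ≤ cst g q' n' := by
  have hex : ∃ c, ∃ q n, P q n ∧ cst g q n = c := by obtain ⟨q, n, h⟩ := h; exact ⟨_, q, n, h, rfl⟩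
  obtain ⟨q, n, h1, h2⟩ := Nat.find_spec hex
  exact ⟨q, n, h1, fun q' n' h' => by rw [h2]; exact Nat.find_min' hex ⟨q', n', h', rfl⟩⟩

structure St (K : SimpleGraph V) (h : V) (z : ℕ -> V) (N a b j : ℕ) (U D : Set V) (t : ℕ -> ℕ -> V) (m : ℕ -> ℕ) (ρ : ℕ -> Set V) : Prop where
  hU : Cn K U
  uh : h ∉ U
  aU : Ad K {h} U
  U0 : Ad K U {z j}
  Un : Ad K U {z (N - j)}
  dU : Disjoint U D
  dh : h ∉ D
  zD : ∀ x ≤ N, (z x ∈ D ↔ j ≤ x ∧ x ≤ N - j)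
  lp : ∀ i < a, LP K (t i) (m i)
  tD : ∀ i < a, ∀ s ≤ m i, t i s ∈ D
  tz : ∀ i < a, t i (m i) = z (b + i)
  tn : ∀ i < a, ∀ s < m i, ∀ x ≤ N, t i s ≠ z x
  tU : ∀ i < a, Ad K U {t i 0}
  tj : ∀ i < a, ∀ k < a, i ≠ k -> ∀ s ≤ m i, ∀ s' ≤ m k, t i s ≠ t k s'
  rc : ∀ k, j ≤ k -> k < b -> Cn K (ρ k) ∧ ρ k ⊆ D ∧ z k ∈ ρ k ∧ z (N - k) ∈ ρ k ∧ ∀ x ≤ N, z x ∈ ρ k -> x = k ∨ x = N - k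
  rj : ∀ k k', j ≤ k -> k < b -> j ≤ k' -> k' < b -> k ≠ k' -> Disjoint (ρ k) (ρ k')

structure Out (K : SimpleGraph V) (z : ℕ -> V) (N a b j : ℕ) (D : Set V) (t : ℕ -> ℕ -> V) (B : ℕ -> ℕ -> Set V) : Prop where
  cn : ∀ k, j ≤ k -> k < b -> ∀ i < a, Cn K (B k i) ∧ B k i ⊆ D ∧ ∀ x ≤ N, z x ∉ B k i
  dj : ∀ k, j ≤ k -> k < b -> ∀ i < a, ∀ k', j ≤ k' -> k' < b -> ∀ i' < a, (k ≠ k' ∨ i ≠ i') -> Disjoint (B k i) (B k' i')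
  ah : ∀ k, j ≤ k -> k < b -> ∀ i, i + 1 < a -> Ad K (B k i) (B k (i + 1))
  av : ∀ k, j ≤ k -> k + 1 < b -> ∀ i < a, Ad K (B k i) (B (k + 1) i)
  st : j < b -> ∀ i < a, t i 0 ∈ B j i

theorem rows_rec (hK : KF K) {h : V} {z : ℕ -> V} {N a b : ℕ} (ha : 1 ≤ a) (hN : N = a + 2 * b - 1) (hz : LP K z N) (zh : ∀ k ≤ N, K.Adj h (z k)) :
    ∀ c j, j + c = b -> ∀ U D t m ρ, St K h z N a b j U D t m ρ -> ∃ B, Out K z N a b j D t B := by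
  intro c
  induction c with
  | zero =>
    intro j hj U D t m ρ _
    exact ⟨fun _ _ => ∅, fun k _ _ => by omega, fun k _ _ => by omega, fun k _ _ => by omega, fun k _ _ => by omega, fun _ => by omega⟩
  | succ c ih =>
    intro j hj U D t m ρ S
    let g : V -> V -> Prop := fun x y => ∃ i < a, (∃ s ≤ m i, t i s = x) ∧ ∃ s ≤ m i, t i s = y
    let P : (ℕ -> V) -> ℕ -> Prop := fun q n => LP K q n ∧ q 0 = z j ∧ q n = z (N - j) ∧ ∀ p ≤ n, q p ∈ D ∧ (∀ k, j < k -> k < N - j -> q p ≠ z k) ∧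
      ∀ k, j < k -> k < b -> q p ∉ ρ k
    obtain ⟨q, n, ⟨q1, q2, q3, q4⟩, hmin⟩ := cheapest g P (by
      obtain ⟨r1, r2, r3, r4, r5⟩ := S.rc j le_rfl ω
      obtain ⟨u, n, u1, u2, u3, u4⟩ := r1.lp r3 r4
      refine ⟨u, n, u1, u2, u3, fun p hp => ⟨r2 (u4 p hp), fun k h1 h2 e => ?_, fun k h1 h2 hk => ?_⟩⟩
      · have := r5 k ω (e ▸ u4 p hp); omega
      · exact Set.disjoint_left.1 (S.rj j k le_rfl ω ω h2 ω) (u4 p hp) hk)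
    have hzz : ∀ x ≤ N, ∀ p ≤ n, z x = q p -> x = j ∨ x = N - j := by
      intro x hx p hp e
      have h1 := (S.zD x hx).1 (e ▸ (q4 p hp).1)
      by_contra hh
      exact (q4 p hp).2.1 x ω ω e.symm
    let F : Set V := D \ Sg q 0 n
    let E : Set V := {v | (ins K F).Reachable (z b) v}
    have hzF : ∀ x, j < x -> x < N - j -> z x ∈ F := by
      intro x h1 h2
      refine ⟨(S.zD x ω).2 ω, ?_⟩
      rintro ⟨p, _, hp, e⟩
      have := hzz x ω p hp e; omega
    have hEF : ∀ v ∈ E, v ∈ F := fun v hv => reach_ins_mem hv (hzF b ω ω)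
    have hzE : ∀ x, j < x -> x < N - j -> z x ∈ E := by
      intro x h1 h2
      refine ((hz.seg (a := j + 1) (b := N - j - 1) ω ω).2 (z b) ⟨b, ω, ω, rfl⟩ (z x) ⟨x, ω, ω, rfl⟩).mono (ins_mono le_rfl ?_)
      rintro v ⟨y, h3, h4, rfl⟩
      exact hzF y ω ω
    have hcl : ∀ x y, x ∈ E -> K.Adj x y -> y ∈ D -> (∀ p ≤ n, y ≠ q p) -> y ∈ E := by
      intro x y hx hxy hy hq
      exact Reachable.trans hx (Adj.reachable ⟨hxy, hEF x hx, hy, by rintro ⟨p, _, hp, e⟩; exact hq p hp e⟩)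
    have hρE : ∀ k, j < k -> k < b -> ρ k ⊆ E := by
      intro k h1 h2 v hv
      obtain ⟨r1, r2, r3, r4, r5⟩ := S.rc k ω h2
      refine Reachable.trans (hzE k h1 ω) ((r1.2 _ r3 v hv).mono (ins_mono le_rfl ?_))
      intro y hy
      refine ⟨r2 hy, ?_⟩
      rintro ⟨p, _, hp, rfl⟩
      exact (q4 p hp).2.2 k h1 h2 hy
    have hqE : ∀ p ≤ n, q p ∉ E := fun p hp hE => (hEF _ hE).2 (Sg.mem (Nat.zero_le _) hp)
    have hn : 1 ≤ n := by
      rcases Nat.eq_zero_or_pos n with h | h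
      · subst h
        have := hz.inj j ω (N - j) ω (by rw [← q2, q3])
        omega
      · exact h
    have R : Row K h U E q n :=
      { hU := S.hU, hE := cn_comp _ _, lp := q1, n1 := hn
        dUE := S.dU.mono_right fun v hv => (hEF v hv).1
        qU := fun p hp hU => Set.disjoint_left.1 S.dU hU (q4 p hp).1
        qE := hqE
        qh := fun p hp e => S.dh (e ▸ (q4 p hp).1)
        uh := S.uh, eh := fun hE => S.dh (hEF h hE).1, aU := S.aU
        aE := ⟨h, rfl, z b, hzE b ω ω, zh b ω⟩
        a0 := q2 ▸ zh j ω, an := q3 ▸ zh (N - j) ω, U0 := q2 ▸ S.U0, Un := q3 ▸ S.Un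
        E0 := ⟨z (j + 1), hzE _ ω ω, _, rfl, q2 ▸ (hz.adj j ω).symm⟩
        En := ⟨z (N - j - 1), hzE _ ω ω, _, rfl, by
          have := hz.adj (N - j - 1) ω
          rw [q3]; rwa [show N - j - 1 + 1 = N - j by omega] at this⟩ }
    have C : Cols K h U E q n a t m :=
      { lp := S.lp, dj := S.tj
        fin := fun i hi => by rw [S.tz i hi]; exact hzE _ ω ω
        ah := fun i hi => by rw [S.tz i hi]; exact zh _ ω
        aU := S.tU
        up := fun i hi s hs hE hno => hcl _ _ hE ((S.lp i hi).adj s hs) (S.tD i hi _ ω) hno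
        down := fun i hi s hs hE hno => hcl _ _ hE ((S.lp i hi).adj s hs).symm (S.tD i hi _ ω) hno
        span := by
          have main : ∀ i < a, ∀ (r : ℕ -> V) (l p p' : ℕ), p < p' -> p' ≤ n -> LP K r l -> r 0 = q p -> r l = q p' -> (∀ x ≤ l, ∃ s ≤ m i, t i s = r x) →
              (∀ x, 0 < x -> x < l -> r x ∉ E ∧ ∀ p ≤ n, r x ≠ q p) -> ∀ y, p ≤ y -> y ≤ p' -> ∃ x ≤ m i, t i x = q y := by
            intro i hi r l p p' hp hp' hr e e' hrt hri
            obtain ⟨q', n', g1, g2, g3, g4, g5⟩ := reroute q1 hr hp hp' e e' (fun x h1 h2 => (hri x h1 h2).2)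
            have hc := hmin q' n' ⟨g1, g2.trans q2, g3.trans q3, by
              intro x hx
              rcases g4 x hx with ⟨y, hy, e1⟩ | ⟨y, hy1, hy2, e1⟩
              · rw [e1]; exact q4 y hy
              · rw [e1]
                refine ⟨?_, fun k h1 h2 e3 => (hri y hy1 hy2).1 (e3 ▸ hzE k h1 h2), fun k h1 h2 h3 => (hri y hy1 hy2).1 (hρE k h1 h2 h3)⟩
                obtain ⟨s, hs, e2⟩ := hrt y ω
                rw [← e2]; exact S.tD i hi s hs⟩
            rw [g5, cst_zero.2 (show ∀ x < l, g (r x) (r (x + 1)) from fun x hx => ⟨i, hi, hrt x ω, hrt (x + 1) ω⟩)] at hc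
            obtain ⟨d, rfl⟩ : ∃ d, p' = p + d := ⟨p' - p, ω⟩
            have e1 : cst g q n = cst g q p + (cst g (fun t => q (p + t)) d + cst g (fun x => q (p + d + x)) (n - (p + d))) := by
              conv_lhs => rw [show n = p + (d + (n - (p + d))) by omega]
              rw [cst_add, cst_add]
              simp only [add_assoc]
            have h0 : cst g (fun t => q (p + t)) d = 0 := by omega
            rw [cst_zero] at h0
            intro y hy1 hy2
            obtain ⟨y, rfl⟩ : ∃ k, y = p + k := ⟨y - p, ω⟩
            clear hy1
            induction y with
            | zero => obtain ⟨s, hs, e2⟩ := hrt 0 ω; exact ⟨s, hs, e2.trans e⟩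
            | succ y ihy =>
              obtain ⟨s, hs, e2⟩ := ihy ω
              obtain ⟨k, hk, ⟨s1, hs1, e3⟩, s2, hs2, e4⟩ := h0 y ω
              by_cases hik : i = k
              · subst hik; exact ⟨s2, hs2, e4⟩
              · exact (S.tj i hi k hk hik s hs s1 hs1 (e2.trans e3.symm)).elim
          intro i hi s s' p p' hs hs' hp hp' e e' hno y hy
          have hM := ((S.lp i hi).mono hs').shift hs.le
          have hne : p ≠ p' := by
            rintro rfl
            have := (S.lp i hi).inj s ω s' hs' (e.trans e'.symm)
            omega
          rcases lt_or_gt_of_ne hne with hlt | hlt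
          · refine main i hi _ _ p p' hlt hp' hM (by simpa using e) (by rw [show s + (s' - s) = s' by omega]; exact e')
              (fun x hx => ⟨s + x, ω, rfl⟩) (fun x h1 h2 => hno _ ω ω) y ω ω
          · refine main i hi _ _ p' p hlt hp hM.rev (by simp only [tsub_zero]; rw [show s + (s' - s) = s' by omega]; exact e') (by simpa using e)
              (fun x hx => ⟨s + (s' - s - x), ω, rfl⟩) (fun x h1 h2 => hno _ ω ω) y ω ω
        ord := by
          intro i k hik hk
          have sub : ∀ x y, j < x -> y < N - j -> Sg z x y ⊆ E := by
            rintro x y h1 h2 v ⟨w, h3, h4, rfl⟩; exact hzE w ω ω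
          refine ⟨Sg z (j + 1) (b + i), Sg z (b + i + 1) (N - j - 1), hz.seg ω ω, hz.seg ω ω, sub _ _ ω ω,
            sub _ _ ω ω, hz.dj ω ω, ?_, ?_, (hz.ad ω rfl ω ω).symm, ?_, ?_, ?_, ?_⟩
          · rw [S.tz i ω]; exact Sg.mem ω le_rfl
          · rw [S.tz k hk]; exact Sg.mem ω ω
          · exact ⟨z (j + 1), Sg.mem le_rfl ω, _, rfl, q2 ▸ (hz.adj j ω).symm⟩
          · refine ⟨z (N - j - 1), Sg.mem ω le_rfl, _, rfl, ?_⟩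
            have := hz.adj (N - j - 1) ω
            rw [q3]; rwa [show N - j - 1 + 1 = N - j by omega] at this
          · rintro s hs ⟨x, h1, h2, e⟩
            rcases hs.lt_or_eq with hs | rfl
            · exact S.tn k hk s hs x ω e
            · rw [S.tz k hk] at e
              have := hz.inj _ ω _ ω e; omega
          · rintro s hs ⟨x, h1, h2, e⟩
            rcases hs.lt_or_eq with hs | rfl
            · exact S.tn i ω s hs x ω e
            · rw [S.tz i ω] at e
              have := hz.inj _ ω _ ω e; omega }
    obtain ⟨f, l, pf, pl, cc, hh⟩ := C.main hK R
    have S' : St K h z N a b (j + 1) (U ∪ Sg q 0 n) E (fun i s => t i (l i + 1 + s)) (fun i => m i - (l i + 1)) ρ :=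
      { hU := S.hU.union (q1.seg ω le_rfl) (Or.inr (S.U0.mono le_rfl (by rw [← q2]; simpa using Sg.mem (q := q) (le_refl 0) (Nat.zero_le n))))
        uh := by
          rintro (h1 | ⟨p, _, hp, e⟩)
          · exact S.uh h1
          · exact R.qh p hp e.symm
        aU := S.aU.mono le_rfl Set.subset_union_left
        U0 := ⟨z j, Or.inr ⟨0, le_rfl, ω, q2.symm⟩, _, rfl, hz.adj j ω⟩
        Un := ⟨z (N - j), Or.inr ⟨n, ω, le_rfl, q3.symm⟩, _, rfl, by
          have := hz.adj (N - (j + 1)) ω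
          rw [show N - (j + 1) + 1 = N - j by omega] at this; exact this.symm⟩
        dU := Set.disjoint_union_left.2 ⟨R.dUE, (R.dE le_rfl).symm⟩
        dh := R.eh
        zD := by
          intro x hx
          constructor
          · intro hE
            have h1 := (S.zD x hx).1 (hEF _ hE).1
            have h2 : x ≠ j := by rintro rfl; exact hqE 0 ω (q2 ▸ hE)
            have h3 : x ≠ N - j := by rintro rfl; exact hqE n le_rfl (q3 ▸ hE)
            omega
          · intro h1; exact hzE x ω ω
        lp := fun i hi => (S.lp i hi).shift (by have := hh i hi; omega)
        tD := fun i hi s hs => (hh i hi).2.2.2.2.2.2.2.2.1 _ ω (by have := hh i hi; omega)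
        tz := fun i hi => by rw [← S.tz i hi]; congr 1; have := hh i hi; omega
        tn := fun i hi s hs => S.tn i hi _ ω
        tU := fun i hi => ⟨q (pl i), Or.inr (Sg.mem (Nat.zero_le _) (hh i hi).2.2.2.1.1), _, rfl, by
          rw [← (hh i hi).2.2.2.2.2.1]; exact (S.lp i hi).adj _ (by have := hh i hi; omega)⟩
        tj := fun i hi k hk hik s hs s' hs' => S.tj i hi k hk hik _ (by have := hh i hi; omega) _ (by have := hh k hk; omega)
        rc := fun k h1 h2 => ⟨(S.rc k ω h2).1, hρE k ω h2, (S.rc k ω h2).2.2⟩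
        rj := fun k k' h1 h2 h3 h4 => S.rj k k' ω h2 ω h4 }
    obtain ⟨B', O⟩ := ih (j + 1) ω _ _ _ _ _ S'
    let lo : ℕ -> ℕ := fun i => if i = 0 then 1 else cc (i - 1) + 1
    let B0 : ℕ -> Set V := fun i => Sg q (lo i) (cc i) ∪ Sg (t i) 0 (f i)
    have hA1 : ∀ i < a, ∀ p, Cols.A q n t m i p -> lo i ≤ p := by
      intro i hi p hp
      by_cases h0 : i = 0
      · subst h0
        simp only [lo, if_true]
        rcases Nat.eq_zero_or_pos p with h | h
        · subst h
          obtain ⟨_, s, hs, e⟩ := hp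
          rw [q2] at e
          rcases hs.lt_or_eq with hs | rfl
          · exact (S.tn 0 hi s hs j ω e).elim
          · rw [S.tz 0 hi] at e
            have := hz.inj _ ω _ ω e; omega
        · exact h
      · simp only [lo, h0, if_false]
        exact (hh (i - 1) ω).2.2.2.2.2.2.2.2.2.2.2 i hi ω _ _ (hh (i - 1) ω).2.2.2.2.2.2.2.2.2.1 hp
    have hlo : ∀ i k, i < k -> k < a -> cc i < lo k := by
      intro i k hik hk
      simp only [lo, show k ≠ 0 by omega, if_false]
      by_cases e : i = k - 1
      · subst e; omega
      · have := (hh i ω).2.2.2.2.2.2.2.2.2.2.2 (k - 1) ω ω _ _ (hh i ω).2.2.2.2.2.2.2.2.2.1 (hh (k - 1) ω).2.2.2.2.2.2.2.2.2.1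
        omega
    have hcn : ∀ i < a, cc i ≤ n := fun i hi => (hh i hi).2.2.2.2.2.2.2.2.2.1.1
    have hB0E : ∀ i < a, ∀ v ∈ B0 i, v ∉ E := by
      rintro i hi v (⟨p, h1, h2, rfl⟩ | ⟨s, h1, h2, rfl⟩)
      · exact hqE p (h2.trans (hcn i hi))
      · rcases h2.lt_or_eq with h2 | rfl
        · exact (hh i hi).2.2.2.2.2.2.2.1 s h2
        · rw [(hh i hi).2.2.2.2.1]; exact hqE _ (hh i hi).2.2.1.1
    have hB0D : ∀ i < a, B0 i ⊆ D := by
      rintro i hi v (⟨p, h1, h2, rfl⟩ | ⟨s, h1, h2, rfl⟩)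
      · exact (q4 p (h2.trans (hcn i hi))).1
      · exact S.tD i hi s (by have := hh i hi; omega)
    have hcc : ∀ i < a, cc i ≠ n := by
      intro i hi e
      obtain ⟨_, s, hs, e1⟩ := (hh i hi).2.2.2.2.2.2.2.2.2.1
      rw [e, q3] at e1
      rcases hs.lt_or_eq with hs | rfl
      · exact (S.tn i hi s hs (N - j) ω e1).elim
      · rw [S.tz i hi] at e1
        have := hz.inj _ ω _ ω e1; omega
    have hlo1 : ∀ i, 1 ≤ lo i := by intro i; simp only [lo]; split_ifs <;> omega
    have hB0z : ∀ i < a, ∀ x ≤ N, z x ∉ B0 i := by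
      rintro i hi x hx (⟨p, h1, h2, e⟩ | ⟨s, h1, h2, e⟩)
      · have := hcn i hi
        have := hcc i hi
        have := hlo1 i
        rcases hzz x hx p ω e with rfl | rfl
        · have := q1.inj 0 ω p ω (q2.trans e); omega
        · have := q1.inj n ω p ω (q3.trans e); omega
      · exact S.tn i hi s (by have := hh i hi; omega) x hx e.symm
    have hB0c : ∀ i < a, Cn K (B0 i) := by
      intro i hi
      have h1 := (hh i hi).2.2.1
      have h2 := hA1 i hi _ h1
      have h3 := (hh i hi).2.2.2.2.2.2.2.2.2.2.1 _ h1
      refine (q1.seg (h2.trans h3) (hcn i hi)).union ((S.lp i hi).seg (Nat.zero_le _) (hh i hi).1.le) (Or.inl ⟨q (pf i), ⟨pf i, h2, h3, rfl⟩, f i, Nat.zero_le _, le_rfl, (hh i hi).2.2.2.2.1.symm⟩)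
    have hB0j : ∀ i k, i < k -> k < a -> Disjoint (B0 i) (B0 k) := by
      intro i k hik hk
      have hi : i < a := by omega
      rw [Set.disjoint_left]
      rintro v (⟨p, h1, h2, rfl⟩ | ⟨s, h1, h2, rfl⟩) (⟨p', h3, h4, e⟩ | ⟨s', h3, h4, e⟩)
      · have := hcn i hi
        have := hcn k hk
        have := hlo i k hik hk
        have := q1.inj p ω p' ω e; omega
      · have h5 : Cols.A q n t m k p := ⟨by have := hcn i hi; omega, s', by have := hh k hk; omega, e.symm⟩
        have := hA1 k hk p h5
        have := hlo i k hik hk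
        omega
      · have h5 : Cols.A q n t m i p' := ⟨by have := hcn k hk; omega, s, by have := hh i hi; omega, e⟩
        have := (hh i hi).2.2.2.2.2.2.2.2.2.2.1 _ h5
        have := hlo i k hik hk
        omega
      · exact S.tj i hi k hk hik.ne s (by have := hh i hi; omega) s' (by have := hh k hk; omega) e
    refine ⟨fun k i => if k = j then B0 i else B' k i, ?_, ?_, ?_, ?_, ?_⟩
    · intro k h1 h2 i hi
      by_cases e : k = j
      · simp only [e, if_true]; exact ⟨hB0c i hi, hB0D i hi, hB0z i hi⟩
      · simp only [e, if_false]
        obtain ⟨o1, o2, o3⟩ := O.cn k ω h2 i hi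
        exact ⟨o1, fun v hv => (hEF v (o2 hv)).1, o3⟩
    · intro k h1 h2 i hi k' h3 h4 i' hi' hne
      have cross : ∀ k, j < k -> k < b -> ∀ i < a, ∀ i' < a, Disjoint (B0 i) (B' k i') := fun k h1 h2 i hi i' hi' =>
        Set.disjoint_left.2 fun v hv hv' => hB0E i hi v hv ((O.cn k h1 h2 i' hi').2.1 hv')
      by_cases e : k = j <;> by_cases e' : k' = j <;> simp only [e, e', if_true, if_false]
      · rcases lt_or_gt_of_ne (show i ≠ i' by omega) with h | h
        · exact hB0j _ _ h hi'
        · exact (hB0j _ _ h hi).symm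
      · exact cross k' ω h4 i hi i' hi'
      · exact (cross k ω h2 i' hi' i hi).symm
      · exact O.dj k ω h2 i hi k' ω h4 i' hi' hne
    · intro k h1 h2 i hi
      by_cases e : k = j <;> simp only [e, if_true, if_false]
      · refine ⟨q (cc i), Or.inl ⟨cc i, ?_, le_rfl, rfl⟩, q (cc i + 1), Or.inl ⟨cc i + 1, ?_, ?_, rfl⟩, q1.adj _ ?_⟩
        · exact hA1 i ω _ (hh i ω).2.2.2.2.2.2.2.2.2.1
        · simp [lo]
        · have := hlo i (i + 1) ω hi
          have := hA1 (i + 1) hi _ (hh (i + 1) hi).2.2.2.2.2.2.2.2.2.1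
          omega
        · have := hcn i ω
          have := hcc i ω
          omega
      · exact O.ah k ω h2 i hi
    · intro k h1 h2 i hi
      by_cases e : k = j
      · simp only [e, show j + 1 ≠ j by omega, if_true, if_false]
        have h3 := (hh i hi).2.2.2.1
        refine ⟨q (pl i), Or.inl ⟨pl i, hA1 i hi _ h3, (hh i hi).2.2.2.2.2.2.2.2.2.2.1 _ h3, rfl⟩, _, O.st ω i hi, ?_⟩
        rw [← (hh i hi).2.2.2.2.2.1]; exact (S.lp i hi).adj _ (by have := hh i hi; omega)
      · simp only [e, show k + 1 ≠ j by omega, if_false]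
        exact O.av k ω h2 i hi
    · intro _ i hi
      simp only [if_true]
      exact Or.inr (Sg.mem le_rfl (Nat.zero_le _))

end recrows

section wheel
variable {V I F : Type*}

/-- a graph with a wheel attached along `y` -/
def Wh (K : SimpleGraph V) (y : I -> V) (σ : Equiv.Perm I) : SimpleGraph (V ⊕ Option I) where
  Adj p q := match p, q with
    | .inl u, .inl v => K.Adj u v
    | .inl u, .inr (some i) => u = y i
    | .inr (some i), .inl u => u = y i
    | .inr (some i), .inr (some j) => i ≠ j ∧ (j = σ i ∨ i = σ j)
    | .inr (some _), .inr none => True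
    | .inr none, .inr (some _) => True
    | _, _ => False
  symm := ⟨fun p q h => by
    rcases p with p | _ | p <;> rcases q with q | _ | q <;> simp only [] at h ⊢
    · exact h.symm
    · exact h
    · exact h
    · exact ⟨h.1.symm, h.2.symm⟩⟩
  loopless := ⟨fun p h => by
    rcases p with p | _ | p
    · exact K.loopless.irrefl _ h
    · exact h
    · exact h.1 rfl⟩

theorem wheel [Fintype V] [Fintype I] {G : SimpleGraph V} {C : Set V} {L : List V} {l r : Sym2 (Option V) -> F} (h : IsRep (Jg G C L) l r)
    (y : I -> V) (hy : Function.Injective y) (hL : ∀ v, v ∈ L ↔ ∃ i, y i = v) (σ : Equiv.Perm I) (h1 : ∀ i, σ i ≠ i) (h2 : ∀ i, σ (σ i) ≠ i)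
    (φ : I -> F) (hφ : ∀ i, s(l (hb (y i)), r (hb (y i))) = s(φ i, φ (σ i))) :
    ∃ l' r' : Sym2 (V ⊕ Option I) -> F ⊕ I, IsRep (Wh (Gs G C L) y σ) l' r' := by
  have key : ∀ a b, (Wh (Gs G C L) y σ).Adj a b -> (∃ u v, s(a, b) = s(.inl u, .inl v)) ∨ (∃ i, s(a, b) = s(.inl (y i), .inr (some i))) ∨
      (∃ i, s(a, b) = s(.inr (some i), .inr (some (σ i)))) ∨ ∃ i, s(a, b) = s(.inr none, .inr (some i)) := by
    intro a b hab
    rcases a with a | _ | a <;> rcases b with b | _ | b <;> simp only [Wh] at hab <;> simp [Sym2.eq_iff, hab]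
    · exact ⟨a, b, Or.inl ⟨rfl, rfl⟩⟩
    · rcases hab.2 with e | e
      exacts [⟨a, Or.inl ⟨rfl, e⟩⟩, ⟨b, Or.inr ⟨e, rfl⟩⟩]
  have hp : ∀ e : Sym2 (V ⊕ Option I), ∃ p : (F ⊕ I) × (F ⊕ I), e ∈ (Wh (Gs G C L) y σ).edgeSet →
      (∀ u v, e = s(.inl u, .inl v) -> p = (.inl (l s(some u, some v)), .inl (r s(some u, some v)))) ∧
      (∀ i, e = s(.inl (y i), .inr (some i)) -> p = (.inl (φ i), .inl (φ (σ i)))) ∧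
      (∀ i, e = s(.inr (some i), .inr (some (σ i))) -> p = (.inl (φ (σ i)), .inr i)) ∧
      ∀ i, e = s(.inr none, .inr (some i)) -> p = (.inr (σ.symm i), .inr i) := by
    intro e
    by_cases he : e ∈ (Wh (Gs G C L) y σ).edgeSet
    swap
    · obtain ⟨a, _⟩ := e; exact ⟨(.inl (l s(none, none)), .inl (l s(none, none))), fun h => (he h).elim⟩
    induction e using Sym2.ind with | _ a b => ?_
    rcases key a b he with ⟨u, v, e⟩ | ⟨i, e⟩ | ⟨i, e⟩ | ⟨i, e⟩ <;> rw [e]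
    · refine ⟨(.inl (l s(some u, some v)), .inl (r s(some u, some v))), fun _ => ⟨?_, ?_, ?_, ?_⟩⟩ <;> simp
      rintro u' v' (⟨rfl, rfl⟩ | ⟨rfl, rfl⟩) <;> simp [Sym2.eq_swap]
    · refine ⟨(.inl (φ i), .inl (φ (σ i))), fun _ => ⟨?_, ?_, ?_, ?_⟩⟩ <;> simp +contextual
    · refine ⟨(.inl (φ (σ i)), .inr i), fun _ => ⟨?_, ?_, ?_, ?_⟩⟩ <;> simp
      rintro j (⟨rfl, _⟩ | ⟨rfl, h⟩)
      · simp
      · exact (h2 _ h).elim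
    · refine ⟨(.inr (σ.symm i), .inr i), fun _ => ⟨?_, ?_, ?_, ?_⟩⟩ <;> simp
  choose p hp using hp
  -- sums
  have sV : ∀ (c : Sym2 (V ⊕ Option I) -> ZMod 2), Sup (Wh (Gs G C L) y σ).edgeSet c -> ∀ v, bd c (.inl v) = ∑ u, c s(.inl v, .inl u) + ∑ i, c s(.inl v, .inr (some i)) := by
    intro c hc v
    rw [bd_apply, Fintype.sum_sum_type, Fintype.sum_option, hc s(.inl v, .inr none) (fun h => h), zero_add]
  have sR : ∀ (c : Sym2 (V ⊕ Option I) -> ZMod 2), Sup (Wh (Gs G C L) y σ).edgeSet c -> ∀ i, bd c (.inr (some i)) =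
      c s(.inl (y i), .inr (some i)) + (c s(.inr none, .inr (some i)) + (c s(.inr (some i), .inr (some (σ i))) + c s(.inr (some (σ.symm i)), .inr (some (σ (σ.symm i)))))) := by
    intro c hc i
    rw [bd_apply, Fintype.sum_sum_type, Fintype.sum_option]
    congr 1
    · rw [Finset.sum_eq_single (y i) (fun v _ hv => hc _ fun h => hv h) (by simp), Sym2.eq_swap]
    · rw [Sym2.eq_swap]
      congr 1
      have hne : σ i ≠ σ.symm i := fun h => h2 i (by rw [h]; simp)
      rw [Fintype.sum_eq_add (σ i) (σ.symm i) hne (fun j hj => hc _ fun h => ?_)]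
      · congr 1
        rw [Sym2.eq_swap]; simp
      · rcases h.2 with e | e
        · exact hj.1 e
        · exact hj.2 (by rw [e]; simp)
  have sH : ∀ (c : Sym2 (V ⊕ Option I) -> ZMod 2), Sup (Wh (Gs G C L) y σ).edgeSet c -> bd c (.inr none) = ∑ i, c s(.inr none, .inr (some i)) := by
    intro c hc
    rw [bd_apply, Fintype.sum_sum_type, Fintype.sum_option, hc s(.inr none, .inr none) (fun h => h), zero_add,
      Finset.sum_eq_zero (fun v _ => hc s(.inr none, .inl v) (fun h => h)), zero_add]
  have sJ : ∀ (c : Sym2 (Option V) -> ZMod 2) v, bd c (some v) = c (hb v) + ∑ u, c s(some v, some u) := by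
    intro c v
    rw [bd_apply, Fintype.sum_option, Sym2.eq_swap]
  have sI : ∀ (c : Sym2 (V ⊕ Option I) -> ZMod 2) (d : Sym2 (Option V) -> ZMod 2), Sup (Wh (Gs G C L) y σ).edgeSet c -> Sup (Jg G C L).edgeSet d →
      (∀ i, c s(.inl (y i), .inr (some i)) = d (hb (y i))) -> ∀ v, ∑ i, c s(.inl v, .inr (some i)) = d (hb v) := by
    intro c d hc hd hcd v
    by_cases hv : ∃ i, y i = v
    · obtain ⟨i, rfl⟩ := hv
      rw [Finset.sum_eq_single i (fun j _ hj => hc _ fun h => hj (hy h).symm) (by simp), hcd]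
    · rw [hd (hb v) (fun h => hv ((hL v).1 (h)))]
      exact Finset.sum_eq_zero fun i _ => hc _ fun h => hv ⟨i, Eq.symm h⟩
  have a1 : ∀ i, s(.inl (y i), .inr (some i)) ∈ (Wh (Gs G C L) y σ).edgeSet := fun i => rfl
  have a2 : ∀ i, s(.inr (some i), .inr (some (σ i))) ∈ (Wh (Gs G C L) y σ).edgeSet := fun i => ⟨(h1 i).symm, Or.inl rfl⟩
  have a3 : ∀ i, s(.inr none, .inr (some i)) ∈ (Wh (Gs G C L) y σ).edgeSet := fun i => trivial
  have a4 : ∀ i, hb (y i) ∈ (Jg G C L).edgeSet := fun i => ((hL _).2 ⟨i, rfl⟩)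
  have dφ : ∀ (a : F -> ZMod 2) i, dl (Jg G C L) l r a (hb (y i)) = a (φ i) + a (φ (σ i)) := by
    intro a i
    rw [dl_edge _ _ _ (a4 i)]
    rcases Sym2.eq_iff.1 (hφ i) with ⟨e, e'⟩ | ⟨e, e'⟩ <;> rw [e, e']
    exact add_comm _ _
  have dd : ∀ x : ZMod 2, x + x = 0 := by decide
  refine ⟨fun e => (p e).1, fun e => (p e).2, ?_, ?_⟩
  · intro a
    have b1 : ∀ i, dl (Wh (Gs G C L) y σ) (fun e => (p e).1) (fun e => (p e).2) a s(.inl (y i), .inr (some i)) = a (.inl (φ i)) + a (.inl (φ (σ i))) := fun i => by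
      rw [dl_edge _ _ _ (a1 i), (hp _ (a1 i)).2.1 i rfl]
    have b2 : ∀ i, dl (Wh (Gs G C L) y σ) (fun e => (p e).1) (fun e => (p e).2) a s(.inr (some i), .inr (some (σ i))) = a (.inl (φ (σ i))) + a (.inr i) := fun i => by
      rw [dl_edge _ _ _ (a2 i), (hp _ (a2 i)).2.2.1 i rfl]
    have b3 : ∀ i, dl (Wh (Gs G C L) y σ) (fun e => (p e).1) (fun e => (p e).2) a s(.inr none, .inr (some i)) = a (.inr (σ.symm i)) + a (.inr i) := fun i => by
      rw [dl_edge _ _ _ (a3 i), (hp _ (a3 i)).2.2.2 i rfl]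
    funext v
    rcases v with v | _ | i
    · rw [sV _ (dl_sup _ _ _ _), sI _ (dl (Jg G C L) l r (fun f => a (.inl f))) (dl_sup _ _ _ _) (dl_sup _ _ _ _) (fun i => by rw [b1, dφ])]
      have := congrFun (h.even (fun f => a (.inl f))) (some v)
      rw [sJ] at this
      rw [add_comm]
      refine Eq.trans ?_ this
      congr 1
      refine Finset.sum_congr rfl fun u _ => ?_
      by_cases hvu : (Gs G C L).Adj v u
      · have e1 : s(.inl v, .inl u) ∈ (Wh (Gs G C L) y σ).edgeSet := hvu
        rw [dl_edge _ _ _ e1, (hp _ e1).1 v u rfl, dl_edge _ _ _ (show s(some v, some u) ∈ (Jg G C L).edgeSet from hvu)]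
      · rw [dl_sup _ _ _ _ _ (show s(.inl v, .inl u) ∉ (Wh (Gs G C L) y σ).edgeSet from hvu), dl_sup _ _ _ _ _ (show s(some v, some u) ∉ (Jg G C L).edgeSet from fun h => hvu (h))]
    · rw [sH _ (dl_sup _ _ _ _), Finset.sum_congr rfl (fun i _ => b3 i), Finset.sum_add_distrib, Equiv.sum_comp σ.symm (fun i => a (.inr i)), dd]; rfl
    · rw [sR _ (dl_sup _ _ _ _), b1, b3, b2, b2, Equiv.apply_symm_apply]
      generalize a (.inl (φ i)) = x1; generalize a (.inl (φ (σ i))) = x2; generalize a (.inr i) = x3; generalize a (.inr (σ.symm i)) = x4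
      show _ = (0 : ZMod 2)
      revert x1 x2 x3 x4; decide
  · intro c hc hb0
    have r0 : ∀ i, c s(.inl (y i), .inr (some i)) + (c s(.inr none, .inr (some i)) + (c s(.inr (some i), .inr (some (σ i))) + c s(.inr (some (σ.symm i)), .inr (some (σ (σ.symm i)))))) = 0 :=
      fun i => by rw [← sR c hc, hb0]; rfl
    have hd : ∃ d : Sym2 (Option V) -> ZMod 2, Sup (Jg G C L).edgeSet d ∧ (∀ u v, d s(some u, some v) = c s(.inl u, .inl v)) ∧ ∀ i, d (hb (y i)) = c s(.inl (y i), .inr (some i)) := by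
      have : ∀ e : Sym2 (Option V), ∃ x : ZMod 2, (e ∉ (Jg G C L).edgeSet -> x = 0) ∧ (∀ u v, e = s(some u, some v) -> x = c s(.inl u, .inl v)) ∧ ∀ i, e = hb (y i) -> x = c s(.inl (y i), .inr (some i)) := by
        intro e
        by_cases h1 : ∃ u v, e = s(some u, some v)
        · obtain ⟨u, v, rfl⟩ := h1
          refine ⟨c s(.inl u, .inl v), fun h => hc _ fun h' => h (h'), ?_, fun i hi => by simp [hb] at hi⟩
          intro u' v' e
          rcases Sym2.eq_iff.1 e with ⟨e1, e2⟩ | ⟨e1, e2⟩ <;> cases e1 <;> cases e2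
          · rfl
          · rw [Sym2.eq_swap]
        · by_cases h2 : ∃ i, e = hb (y i)
          · obtain ⟨i, rfl⟩ := h2
            refine ⟨c s(.inl (y i), .inr (some i)), fun h => (h (a4 i)).elim, fun u v e => (h1 ⟨u, v, e⟩).elim, fun j e => ?_⟩
            have : i = j := hy (by simpa [hb] using e)
            rw [this]
          · exact ⟨0, fun _ => rfl, fun u v e => (h1 ⟨u, v, e⟩).elim, fun i e => (h2 ⟨i, e⟩).elim⟩
      choose d hd using this
      exact ⟨d, fun e he => (hd e).1 he, fun u v => (hd _).2.1 u v rfl, fun i => (hd _).2.2 i rfl⟩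
    obtain ⟨d, d1, d2, d3⟩ := hd
    have d0 : bd d = 0 := by
      funext v
      rcases v with _ | v
      · rw [bd_apply, Fintype.sum_option, d1 s(none, none) (fun h => h), zero_add]
        have e1 : ∑ u, d s(none, some u) = ∑ i, d (hb (y i)) := by
          rw [← Finset.sum_image (s := Finset.univ) (g := y) (f := fun u => d s(none, some u)) (fun a _ b _ h => hy h)]
          refine (Finset.sum_subset (Finset.subset_univ _) fun u _ hu => d1 _ fun h => hu ?_).symm
          obtain ⟨i, hi⟩ := (hL u).1 (h)
          exact Finset.mem_image.2 ⟨i, Finset.mem_univ _, hi⟩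
        rw [e1]
        have e2 := Finset.sum_congr rfl fun i (_ : i ∈ (Finset.univ : Finset I)) => r0 i
        have e3 := Equiv.sum_comp σ.symm (fun i => c s(.inr (some i), .inr (some (σ i))))
        simp only [Finset.sum_add_distrib] at e2
        rw [e3, dd, ← sH c hc, hb0] at e2
        simp only [d3]
        simpa using e2
      · rw [sJ, ← sI c d hc d1 (fun i => (d3 i).symm) v, add_comm]
        simp only [d2]
        rw [← sV c hc v, hb0]; rfl
    obtain ⟨a, ha⟩ := h.full d d1 d0
    refine ⟨Sum.elim a (fun i => c s(.inr (some i), .inr (some (σ i))) + a (φ (σ i))), ?_⟩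
    have hl : ∀ i, c s(.inl (y i), .inr (some i)) = a (φ i) + a (φ (σ i)) := fun i => by rw [← d3, ha, dφ]
    have kill : ∀ x z : ZMod 2, x = z + (x + z) := by decide
    funext e
    by_cases he : e ∈ (Wh (Gs G C L) y σ).edgeSet
    swap
    · rw [hc e he, dl_sup _ _ _ _ e he]
    rw [dl_edge _ _ _ he]
    induction e using Sym2.ind with | _ u v => ?_
    rcases key u v he with ⟨u, v, e⟩ | ⟨i, e⟩ | ⟨i, e⟩ | ⟨i, e⟩ <;> rw [e] at he ⊢
    · simp only [(hp _ he).1 u v rfl, Sum.elim_inl]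
      rw [← d2, ha, dl_edge _ _ _ (show s(some u, some v) ∈ (Jg G C L).edgeSet from he)]
    · simp only [(hp _ he).2.1 i rfl, Sum.elim_inl, hl]
    · simp only [(hp _ he).2.2.1 i rfl, Sum.elim_inl, Sum.elim_inr]
      exact kill _ _
    · simp only [(hp _ he).2.2.2 i rfl, Sum.elim_inr]
      have := r0 i
      rw [hl] at this
      rw [Equiv.apply_symm_apply] at this ⊢
      revert this
      generalize c _ = x1; generalize c _ = x2; generalize c _ = x3; generalize a _ = x4; generalize a _ = x5
      revert x1 x2 x3 x4 x5; decide

end wheel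

section
variable {V : Type*}

theorem wheel_grid {K : SimpleGraph V} {a b n N : ℕ} (ha : 1 ≤ a) (hb : 1 ≤ b) (hn : n = 2 * a + 2 * b) (hN : N = a + 2 * b - 1) {ℓ : ℕ -> V}
    (hΓ : KF (Wh K (fun i : Fin n => ℓ i) (finRotate n))) {t : ℕ -> ℕ -> V} {m : ℕ -> ℕ} {q : ℕ -> ℕ -> V} {p : ℕ -> ℕ}
    (hT : ∀ i < a, LP K (t i) (m i) ∧ (∃ k, N < k ∧ k < n ∧ t i 0 = ℓ k) ∧ t i (m i) = ℓ (b + i))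
    (tj : ∀ i < a, ∀ k < a, i ≠ k -> ∀ s ≤ m i, ∀ s' ≤ m k, t i s ≠ t k s')
    (hQ : ∀ k < b, LP K (q k) (p k) ∧ q k 0 = ℓ k ∧ ∃ k' < b, q k (p k) = ℓ (N - k'))
    (qj : ∀ i < b, ∀ k < b, i ≠ k -> ∀ s ≤ p i, ∀ s' ≤ p k, q i s ≠ q k s') :
    ∃ B : ℕ -> ℕ -> Set V, (∀ k < b, ∀ i < a, Cn K (B k i)) ∧ (∀ k < b, ∀ i < a, ∀ k' < b, ∀ i' < a, (k ≠ k' ∨ i ≠ i') -> Disjoint (B k i) (B k' i')) ∧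
      (∀ k < b, ∀ i, i + 1 < a -> Ad K (B k i) (B k (i + 1))) ∧ ∀ k, k + 1 < b -> ∀ i < a, Ad K (B k i) (B (k + 1) i) := by
  obtain ⟨n, rfl⟩ : ∃ n', n = n' + 1 := ⟨n - 1, ω⟩
  set Γ := Wh K (fun i : Fin (n + 1) => ℓ i) (finRotate (n + 1)) with hΓd
  let z : ℕ -> V ⊕ Option (Fin (n + 1)) := fun i => if h : i < n + 1 then .inr (some ⟨i, h⟩) else .inr none
  have zz : ∀ i (h : i < n + 1), z i = .inr (some ⟨i, h⟩) := fun i h => dif_pos h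
  have zV : ∀ i v, z i ≠ .inl v := fun i v => by simp only [z]; split_ifs <;> simp
  have zh : ∀ k ≤ n, Γ.Adj (.inr none) (z k) := fun k hk => by rw [zz k ω]; trivial
  have zn : ∀ k ≤ n, z k ≠ .inr none := fun k hk => (zh k hk).ne'
  have zl : ∀ k ≤ n, Γ.Adj (.inl (ℓ k)) (z k) := fun k hk => by rw [zz k ω]; rfl
  have z0 : Γ.Adj (z n) (z 0) := by
    rw [zz n ω, zz 0 ω]
    refine ⟨by simp [Fin.ext_iff]; omega, Or.inl ?_⟩
    exact (finRotate_last (n := n)).symm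
  have zlp : LP Γ z n := by
    constructor
    · intro i hi
      rw [zz i ω, zz (i + 1) ω]
      refine ⟨by simp [Fin.ext_iff], Or.inl ?_⟩
      exact (finRotate_of_lt hi).symm
    · intro i hi j hj h
      rw [zz i ω, zz j ω] at h
      simpa using h
  have lpV : ∀ {u : ℕ -> V} {k}, LP K u k -> LP Γ (fun s => .inl (u s)) k := fun h => ⟨h.adj, fun i hi j hj e => h.inj i hi j hj (Sum.inl.inj e)⟩
  have sz : ∀ (i : ℕ -> V) c d e f, Disjoint (Sg (fun s => Sum.inl (i s)) c d) (Sg z e f) := by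
    intro i c d e f
    rw [Set.disjoint_left]
    rintro _ ⟨s, _, _, rfl⟩ ⟨s', _, _, e⟩
    exact zV _ _ e.symm
  have sh : ∀ (i : ℕ -> V) c d, Disjoint (Sg (fun s => Sum.inl (i s)) c d) {(Sum.inr none : V ⊕ Option (Fin (n + 1)))} := by
    intro i c d
    rw [Set.disjoint_singleton_right]
    rintro ⟨s, _, _, e⟩; cases e
  have hzd : ∀ c d, d ≤ n -> Disjoint (Sg z c d) {(Sum.inr none : V ⊕ Option (Fin (n + 1)))} := by
    intro c d hd
    rw [Set.disjoint_singleton_right]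
    rintro ⟨s, _, _, e⟩; exact zn s ω e.symm
  choose! τ hτ using fun k hk => (hQ k hk).2.2
  have mono : ∀ j j', j < j' -> j' < b -> τ j < τ j' := by
    intro j j' hj hj'
    by_contra hc
    have hne : τ j ≠ τ j' := by
      intro e
      have h1 := (hτ j ω).2
      rw [e, ← (hτ j' hj').2] at h1
      exact qj j ω j' hj' ω _ le_rfl _ le_rfl h1
    obtain ⟨k1, e1⟩ := hτ j ω
    obtain ⟨k2, e2⟩ := hτ j' hj'
    have f1 := (hQ j ω).2.1
    have f2 := (hQ j' hj').2.1
    have l1 := lpV (hQ j ω).1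
    have l2 := lpV (hQ j' hj').1
    have c1 := ((zlp.seg (show N - τ j' + 1 ≤ n by omega) le_rfl).union (zlp.seg (Nat.zero_le j) ω) (Or.inr ⟨z n, Sg.mem ω le_rfl, z 0, Sg.mem le_rfl ω, z0⟩)).union
      (l1.seg (Nat.zero_le (p j)) le_rfl) (Or.inr ⟨z j, Or.inr (Sg.mem ω le_rfl), _, Sg.mem le_rfl ω, by rw [f1]; exact (zl _ ω).symm⟩)
    have c2 := (zlp.seg (show j + 1 ≤ j' by omega) ω).union (l2.seg (Nat.zero_le (p j')) le_rfl) (Or.inr ⟨z j', Sg.mem ω le_rfl, _, Sg.mem le_rfl ω, by rw [f2]; exact (zl _ ω).symm⟩)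
    have c3 := zlp.seg (show j' + 1 ≤ N - τ j by omega) ω
    have c4 := zlp.seg (show N - τ j + 1 ≤ N - τ j' by omega) ω
    have dd : Disjoint (Sg (fun s => Sum.inl (β := Option (Fin (n + 1))) (q j s)) 0 (p j)) (Sg (fun s => Sum.inl (q j' s)) 0 (p j')) := by
      rw [Set.disjoint_left]
      rintro _ ⟨s, _, h, rfl⟩ ⟨s', _, h', e⟩
      exact qj j ω j' hj' ω s h s' h' (Sum.inl.inj e)
    refine hΓ.k5 c1 c2 c3 c4 (Cn.single (Sum.inr none)) ?_ ?_
    · simp only [List.pairwise_cons, List.mem_cons, List.not_mem_nil, forall_eq_or_imp, or_false, forall_eq, IsEmpty.forall_iff, implies_true, List.Pairwise.nil, and_true, Set.disjoint_union_left, Set.disjoint_union_right]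
      constructorm* _ ∧ _
      all_goals first | exact dd | exact sh _ _ _ | exact sz _ _ _ _ _ | exact (sz _ _ _ _ _).symm | exact hzd _ _ ω | exact zlp.dj ω ω | exact (zlp.dj ω ω).symm
    · have hh : ∀ c ≤ n, ∀ S : Set (V ⊕ Option (Fin (n + 1))), z c ∈ S -> Ad Γ S {Sum.inr none} := fun c hc S h => ⟨_, h, _, rfl, (zh c hc).symm⟩
      simp only [List.pairwise_cons, List.mem_cons, List.not_mem_nil, forall_eq_or_imp, or_false, forall_eq, IsEmpty.forall_iff, implies_true, List.Pairwise.nil, and_true]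
      refine ⟨⟨?_, ?_, ?_, hh j ω _ (Or.inl (Or.inr (Sg.mem ω le_rfl)))⟩, ⟨?_, ?_, hh j' ω _ (Or.inl (Sg.mem ω le_rfl))⟩, ⟨?_, hh (N - τ j) ω _ (Sg.mem ω le_rfl)⟩, hh (N - τ j') ω _ (Sg.mem ω le_rfl)⟩
      · exact (zlp.ad (Nat.zero_le j) rfl (show j + 1 ≤ j' by omega) ω).mono (fun x h => Or.inl (Or.inr h)) (fun x h => Or.inl h)
      · refine ⟨_, Or.inr (Sg.mem (Nat.zero_le _) le_rfl), _, Sg.mem (t := N - τ j) ω le_rfl, ?_⟩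
        rw [e1]; exact zl _ ω
      · exact ((zlp.ad (show N - τ j + 1 ≤ N - τ j' by omega) rfl (show N - τ j' + 1 ≤ n by omega) le_rfl).mono (fun x h => h) (fun x h => Or.inl (Or.inl h))).symm
      · exact (zlp.ad (show j + 1 ≤ j' by omega) rfl (show j' + 1 ≤ N - τ j by omega) ω).mono (fun x h => Or.inl h) (fun x h => h)
      · refine ⟨_, Or.inr (Sg.mem (Nat.zero_le _) le_rfl), _, Sg.mem (t := N - τ j') ω le_rfl, ?_⟩
        rw [e2]; exact zl _ ω
      · exact zlp.ad ω rfl ω ω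
  have up : ∀ k < b, k ≤ τ k := by
    intro k
    induction k with
    | zero => intro _; omega
    | succ k ih => intro hk; have := ih ω; have := mono k (k + 1) ω hk; omega
  have dn : ∀ d < b, τ (b - 1 - d) ≤ b - 1 - d := by
    intro d
    induction d with
    | zero => intro _; have := (hτ (b - 1 - 0) ω).1; omega
    | succ d ih => intro hd; have := ih ω; have := mono (b - 1 - (d + 1)) (b - 1 - d) ω ω; omega
  have hτ' : ∀ k < b, τ k = k := by
    intro k hk
    have h1 := up k hk
    have h2 := dn (b - 1 - k) ω
    rw [show b - 1 - (b - 1 - k) = k by omega] at h2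
    omega
  have zN := zlp.mono (show N ≤ n by omega)
  have hS : St Γ (.inr none) z N a b 0 (Sg z (N + 1) n) (Set.range Sum.inl ∪ Sg z 0 N) (fun i s => if s ≤ m i then .inl (t i s) else z (b + i)) (fun i => m i + 1)
      (fun k => Sg (fun s => .inl (q k s)) 0 (p k) ∪ {z k} ∪ {z (N - k)}) := by
    constructor
    · exact zlp.seg ω le_rfl
    · exact Set.disjoint_singleton_right.1 (hzd _ _ le_rfl)
    · exact ⟨_, rfl, z n, Sg.mem ω le_rfl, zh n le_rfl⟩
    · exact ⟨z n, Sg.mem ω le_rfl, _, rfl, z0⟩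
    · exact ⟨z (N + 1), Sg.mem ω ω, _, rfl, (zlp.adj N ω).symm⟩
    · rw [Set.disjoint_union_right]
      refine ⟨?_, (zlp.dj ω le_rfl).symm⟩
      rw [Set.disjoint_left]; rintro _ ⟨s, _, _, rfl⟩ ⟨v, e⟩; exact zV _ _ e.symm
    · rintro (⟨v, e⟩ | ⟨s, _, h, e⟩)
      · cases e
      · exact zn s ω e.symm
    · intro x hx
      exact ⟨fun _ => by omega, fun _ => Or.inr (Sg.mem ω hx)⟩
    · intro i hi
      obtain ⟨h1, h2, h3⟩ := hT i hi
      constructor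
      · intro s hs
        by_cases e : s = m i
        · subst e; simp [h3]; exact zl _ ω
        · simp only [show s ≤ m i by omega, show s + 1 ≤ m i by omega, if_true]; exact h1.adj s ω
      · intro s hs s' hs' e
        by_cases c : s ≤ m i <;> by_cases c' : s' ≤ m i <;> simp only [c, c', if_true, if_false] at e
        · exact h1.inj s c s' c' (Sum.inl.inj e)
        · exact (zV _ _ e.symm).elim
        · exact (zV _ _ e).elim
        · omega
    · intro i hi s hs
      split_ifs
      · exact Or.inl ⟨_, rfl⟩
      · exact Or.inr (Sg.mem ω ω)
    · intro i hi; simp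
    · intro i hi s hs x hx
      simp only [show s ≤ m i by omega, if_true]; exact (zV _ _).symm
    · intro i hi
      obtain ⟨h1, ⟨k, h4, h5, h2⟩, h3⟩ := hT i hi
      refine ⟨z k, Sg.mem h4 ω, _, rfl, ?_⟩
      simp only [Nat.zero_le, if_true, h2]; exact (zl _ ω).symm
    · intro i hi k hk hik s hs s' hs'
      split_ifs with c c'
      · exact fun e => tj i hi k hk hik s c s' c' (Sum.inl.inj e)
      · exact (zV _ _).symm
      · exact zV _ _
      · intro e; have := zlp.inj _ ω _ ω e; omega
    · intro k _ hk
      obtain ⟨h1, h2, _⟩ := hQ k hk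
      have h3 := (hτ k hk).2
      rw [hτ' k hk] at h3
      refine ⟨?_, ?_, Or.inl (Or.inr rfl), Or.inr rfl, ?_⟩
      · refine (((lpV h1).seg (Nat.zero_le (p k)) le_rfl).union (Cn.single _) (Or.inr ⟨_, Sg.mem le_rfl ω, _, rfl, ?_⟩)).union (Cn.single _) (Or.inr ⟨_, Or.inl (Sg.mem (Nat.zero_le _) le_rfl), _, rfl, ?_⟩)
        · rw [h2]; exact zl _ ω
        · rw [h3]; exact zl _ ω
      · rintro _ ((⟨s, _, _, rfl⟩ | rfl) | rfl)
        · exact Or.inl ⟨_, rfl⟩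
        · exact Or.inr (Sg.mem ω ω)
        · exact Or.inr (Sg.mem ω ω)
      · rintro x hx ((⟨s, _, _, e⟩ | e) | e)
        · exact (zV _ _ e).elim
        · exact Or.inl (zlp.inj _ ω _ ω e)
        · exact Or.inr (zlp.inj _ ω _ ω e)
    · intro k k' _ hk _ hk' hne
      rw [Set.disjoint_left]
      rintro _ ((⟨s, _, hs, rfl⟩ | rfl) | rfl) ((⟨s', _, hs', e⟩ | e) | e)
      · exact qj k hk k' hk' hne s hs s' hs' (Sum.inl.inj e)
      all_goals first | exact zV _ _ e | exact zV _ _ e.symm | (have := zlp.inj _ ω _ ω e; omega)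
  obtain ⟨B, hB⟩ := rows_rec hΓ ha hN zN (fun k hk => zh k ω) b 0 ω _ _ _ _ _ hS
  have sub : ∀ k < b, ∀ i < a, ∀ x ∈ B k i, ∃ v, x = .inl v := by
    intro k hk i hi x hx
    obtain ⟨_, h2, h3⟩ := hB.cn k ω hk i hi
    rcases h2 hx with ⟨v, rfl⟩ | ⟨s, _, hs, rfl⟩
    · exact ⟨v, rfl⟩
    · exact (h3 s hs hx).elim
  have pa : ∀ k < b, ∀ i < a, ∀ k' < b, ∀ i' < a, Ad Γ (B k i) (B k' i') -> Ad K (Sum.inl ⁻¹' (B k i)) (Sum.inl ⁻¹' (B k' i')) := by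
    rintro k hk i hi k' hk' i' hi' ⟨x, hx, y, hy, hxy⟩
    obtain ⟨v, rfl⟩ := sub k hk i hi x hx
    obtain ⟨w, rfl⟩ := sub k' hk' i' hi' y hy
    exact ⟨v, hx, w, hy, hxy⟩
  refine ⟨fun k i => Sum.inl ⁻¹' (B k i), ?_, ?_, ?_, ?_⟩
  · intro k hk i hi
    obtain ⟨h1, _, _⟩ := hB.cn k ω hk i hi
    obtain ⟨x, hx⟩ := h1.1
    obtain ⟨u, rfl⟩ := sub k hk i hi x hx
    refine ⟨⟨u, hx⟩, fun u hu v hv => ?_⟩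
    refine h1.closed (fun w => ∀ v, w = .inl v -> (ins K (Sum.inl ⁻¹' (B k i))).Reachable u v) (u := .inl u) hu ?_ ?_ (.inl v) hv v rfl
    · rintro v ⟨⟩; exact Reachable.refl _
    · rintro x hx y hy hxy hP w rfl
      obtain ⟨v', rfl⟩ := sub k hk i hi x hx
      exact (hP v' rfl).trans (Adj.reachable ⟨hxy, hx, hy⟩)
  · intro k hk i hi k' hk' i' hi' hne
    exact (hB.dj k ω hk i hi k' ω hk' i' hi' hne).preimage _
  · intro k hk i hi
    exact pa _ hk _ ω _ hk _ hi (hB.ah k ω hk i hi)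
  · intro k hk i hi
    exact pa _ ω _ hi _ hk _ hi (hB.av k ω hk i hi)

end

section
variable {V : Type*} {F : Type}

theorem Seq.faces {l r : Sym2 (Option V) -> F} {f g : F} {L : List V} (h : Seq l r f L g) :
    ∃ φ : ℕ -> F, φ 0 = f ∧ φ L.length = g ∧ ∀ i (hi : i < L.length), s(l (hb L[i]), r (hb L[i])) = s(φ i, φ (i + 1)) := by
  induction L generalizing f with
  | nil => exact ⟨fun _ => f, rfl, h, fun i hi => by simp at hi⟩
  | cons v L ih =>
    obtain ⟨k, h1, h2⟩ := h
    obtain ⟨φ, p1, p2, p3⟩ := ih h2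
    refine ⟨fun i => if i = 0 then f else φ (i - 1), rfl, by simpa using p2, fun i hi => ?_⟩
    rcases i with _ | i
    · simpa [p1] using h1
    · simpa using p3 i (by simpa using hi)

theorem DP.wh [Fintype V] {G : SimpleGraph V} {C : Set V} {L : List V} (h : DP G C L) (hL : 3 ≤ L.length) :
    KF (Wh (Gs G C L) (fun i : Fin L.length => L[i]) (finRotate L.length)) := by
  obtain ⟨h1, h2, F, l, r, f, h3, h4⟩ := h
  obtain ⟨φ, p1, p2, p3⟩ := h4.faces
  obtain ⟨n, hn⟩ : ∃ n, L.length = n + 1 := ⟨L.length - 1, ω⟩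
  have rot : ∀ i : Fin L.length, (finRotate L.length i : ℕ) = if (i : ℕ) + 1 = L.length then 0 else (i : ℕ) + 1 := by
    generalize L.length = k at hn
    subst hn
    intro i
    rw [coe_finRotate]; simp [Fin.ext_iff]
  obtain ⟨l', r', hw⟩ := wheel h3 (fun i : Fin L.length => L[i]) (fun i j e => Fin.ext ((h1.getElem_inj_iff).1 e))
    (fun v => by rw [List.mem_iff_get]; rfl) (finRotate L.length)
    (fun i e => by have := rot i; rw [e] at this; split_ifs at this <;> omega)
    (fun i e => by
      have a1 := rot i
      have a2 := rot (finRotate L.length i)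
      rw [e] at a2
      split_ifs at a1 a2 <;> omega)
    (fun i => φ i) (fun i => by
      refine (p3 i i.2).trans ?_
      rw [rot]
      split_ifs with c
      · rw [c, p2, p1]
      · rfl)
  have hP : PL (Wh (Gs G C L) (fun i : Fin L.length => L[i]) (finRotate L.length)) := ⟨_, l', r', hw⟩
  exact ⟨fun h => no_K5 (hP.minor h), fun h => no_K33 (hP.minor h)⟩

/-- a segment of a list -/
def Pc (L : List V) (i j : ℕ) : Set V := {v | ∃ k, i ≤ k ∧ k < j ∧ L[k]? = some v}

theorem Lk.onto {K : SimpleGraph V} {A : Set V} {L : List V} {i j : ℕ} {X : Finset V} {u : V -> ℕ -> V} {m : V -> ℕ} (h : Lk K A (Pc L i j) X u m)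
    (hc : j - i ≤ X.card) : ∀ k, i ≤ k -> k < j -> ∃ x ∈ X, L[k]? = some (u x (m x)) := by
  choose! e he using fun x hx => (h.1 x hx).2.2.1
  have := Finset.surjOn_of_injOn_of_card_le (s := X) (t := Finset.Ico i j) e (fun x hx => by simpa using ⟨(he x hx).1, (he x hx).2.1⟩)
    (fun x hx y hy hxy => by
      by_contra hne
      have h1 := (he x hx).2.2
      rw [hxy, (he y hy).2.2] at h1
      exact h.2 x hx y hy hne _ le_rfl _ le_rfl (Option.some.inj h1).symm) (by simpa using hc)
  intro k h1 h2
  obtain ⟨x, hx, rfl⟩ := this (show k ∈ ((Finset.Ico i j : Finset ℕ) : Set ℕ) by simpa using ⟨h1, h2⟩)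
  exact ⟨x, hx, (he x hx).2.2⟩

theorem DP.hex [Fintype V] {G : SimpleGraph V} {C : Set V} {L : List V} (h : DP G C L) {r : ℕ} (hr : 1 ≤ r) (hL : L.length = 12 * r - 2)
    {X Y : Finset V} {u u' : V -> ℕ -> V} {m m' : V -> ℕ} (h1 : Lk (Gs G C L) (Pc L (8 * r - 1) (12 * r - 2)) (Pc L (2 * r) (6 * r - 1)) X u m) (hX : 4 * r - 1 ≤ X.card)
    (h2 : Lk (Gs G C L) (Pc L (6 * r - 1) (8 * r - 1)) (Pc L 0 (2 * r)) Y u' m') (hY : 2 * r ≤ Y.card) : HasMinor G (hexGrid r) := by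
  have hw := h.wh ω
  have v0 : V := L[0]'ω
  have hℓ : ∀ i (hi : i < L.length), L[i] = L.getD i v0 := fun i hi => by simp [hi]
  have hℓ' : ∀ i v, L[i]? = some v -> v = L.getD i v0 := fun i v hi => by simp [hi]
  rw [show (fun i : Fin L.length => L[i]) = fun i : Fin L.length => L.getD i v0 from funext fun i => hℓ i i.2] at hw
  haveI : Nonempty V := ⟨v0⟩
  choose! x hx using h1.onto ω
  choose! y hy using h2.onto ω
  have ne1 : ∀ i < 4 * r - 1, ∀ k < 4 * r - 1, i ≠ k -> x (2 * r + i) ≠ x (2 * r + k) := by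
    intro i hi k hk hne e
    have a1 := (hx (2 * r + i) ω ω).2
    have a2 := (hx (2 * r + k) ω ω).2
    rw [e, ← a2] at a1
    have := (List.getElem?_inj ω h.1).1 a1
    omega
  have ne2 : ∀ i < 2 * r, ∀ k < 2 * r, i ≠ k -> y i ≠ y k := by
    intro i hi k hk hne e
    have a1 := (hy i ω ω).2
    have a2 := (hy k ω ω).2
    rw [e, ← a2] at a1
    have := (List.getElem?_inj ω h.1).1 a1
    omega
  obtain ⟨B, b1, b2, b3, b4⟩ := wheel_grid (n := L.length) (a := 4 * r - 1) (b := 2 * r) (N := 8 * r - 2) ω ω ω ω hw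
    (t := fun i => u (x (2 * r + i))) (m := fun i => m (x (2 * r + i))) (q := fun k s => u' (y k) (m' (y k) - s)) (p := fun k => m' (y k))
    (fun i hi => by
      obtain ⟨a1, a2⟩ := hx (2 * r + i) ω ω
      obtain ⟨a3, ⟨k, k1, k2, k3⟩, _⟩ := h1.1 _ a1
      exact ⟨a3, ⟨k, ω, ω, hℓ' _ _ k3⟩, hℓ' _ _ a2⟩)
    (fun i hi k hk hne => h1.2 _ (hx _ ω ω).1 _ (hx _ ω ω).1 (ne1 i hi k hk hne))
    (fun i hi => by
      obtain ⟨a1, a2⟩ := hy i ω ω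
      obtain ⟨a3, ⟨k, k1, k2, k3⟩, _⟩ := h2.1 _ a1
      refine ⟨a3.rev, by simpa using hℓ' _ _ a2, 8 * r - 2 - k, ω, ?_⟩
      rw [show 8 * r - 2 - (8 * r - 2 - k) = k by omega]
      simpa using hℓ' _ _ k3)
    (fun i hi k hk hne s hs s' hs' => h2.2 _ (hy _ ω ω).1 _ (hy _ ω ω).1 (ne2 i hi k hk hne) _ ω _ ω)
  have bnd : ∀ p ∈ hexVertexSet r, 0 ≤ p.2 + r - 1 ∧ p.2 + r - 1 < 2 * r ∧ 0 ≤ p.1 + 2 * r - 1 ∧ p.1 + 2 * r - 1 < 4 * r - 1 := by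
    rintro ⟨p1, p2⟩ ⟨b, c1, c2, c3⟩
    simp only [] at c2 c3 ⊢
    rw [abs_le] at c1 c3
    have := abs_nonneg b
    omega
  have hle : Gs G C L ≤ G := fun _ _ h => h.1
  refine hasMinor_iff.2 ⟨fun p => B (p.1.2 + r - 1).toNat (p.1.1 + 2 * r - 1).toNat, ?_, ?_, ?_⟩
  · intro p
    have := bnd p.1 p.2
    exact (b1 _ ω _ ω).mono_graph hle
  · intro p q hne
    have h1 := bnd p.1 p.2
    have h2 := bnd q.1 q.2
    refine b2 _ ω _ ω _ ω _ ω ?_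
    by_contra hc
    exact hne (Subtype.ext (Prod.ext ω ω))
  · have key : ∀ p q : hexVertexSet r, ((p.val.2 = q.val.2 ∧ p.val.1 + 1 = q.val.1) ∨ (p.val.1 = q.val.1 ∧ p.val.2 + 1 = q.val.2 ∧ Odd (p.val.1 + p.val.2))) →
        Ad (Gs G C L) (B (p.1.2 + r - 1).toNat (p.1.1 + 2 * r - 1).toNat) (B (q.1.2 + r - 1).toNat (q.1.1 + 2 * r - 1).toNat) := by
      intro p q hpq
      have h1 := bnd p.1 p.2
      have h2 := bnd q.1 q.2
      rcases hpq with ⟨e1, e2⟩ | ⟨e1, e2, _⟩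
      · have := b3 (p.1.2 + r - 1).toNat ω (p.1.1 + 2 * r - 1).toNat ω
        rwa [show (p.1.1 + 2 * r - 1).toNat + 1 = (q.1.1 + 2 * r - 1).toNat by omega, show B (p.1.2 + r - 1).toNat (q.1.1 + 2 * r - 1).toNat = B (q.1.2 + r - 1).toNat (q.1.1 + 2 * r - 1).toNat by rw [e1]] at this
      · have := b4 (p.1.2 + r - 1).toNat ω (p.1.1 + 2 * r - 1).toNat ω
        rwa [show (p.1.2 + r - 1).toNat + 1 = (q.1.2 + r - 1).toNat by omega, show B (q.1.2 + r - 1).toNat (p.1.1 + 2 * r - 1).toNat = B (q.1.2 + r - 1).toNat (q.1.1 + 2 * r - 1).toNat by rw [e1]] at this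
    intro p q hpq
    rcases ((fromRel_adj _ _ _).1 hpq).2 with h | h
    · obtain ⟨x, hx, y, hy, hxy⟩ := key p q h
      exact ⟨x, hx, y, hy, hxy.1⟩
    · obtain ⟨x, hx, y, hy, hxy⟩ := (key q p h).symm
      exact ⟨x, hx, y, hy, hxy.1⟩

end

section recursion
variable {V : Type*} {G : SimpleGraph V} {C : Set V} {L : List V} {n : ℕ}

/-- `A` has a simplicial vertex of small degree in `C` -/
def Sim (H : SimpleGraph V) (n : ℕ) (C : Set V) (A : Finset V) : Prop :=
  ∃ v ∈ A, v ∈ C ∧ (∀ u ∈ A, ∀ w ∈ A, H.Adj v u -> H.Adj v w -> u ≠ w -> H.Adj u w) ∧ (A.filter (H.Adj v)).card ≤ n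

/-- elimination of `C` relative to the clique `D` -/
def PP (G : SimpleGraph V) (n : ℕ) (C D : Set V) : Prop :=
  ∃ H : SimpleGraph V, (∀ u v, G.Adj u v -> u ∈ C -> v ∈ C ∪ D -> H.Adj u v) ∧ (∀ u ∈ D, ∀ v ∈ D, u ≠ v -> H.Adj u v) ∧
    ∀ A : Finset V, (∀ x ∈ A, x ∈ C ∪ D) -> (∃ x ∈ A, x ∈ C) -> Sim H n C A

theorem PP.nil {D : Set V} : PP G n ∅ D :=
  ⟨⊤, fun _ _ h _ _ => h.ne, fun _ _ _ _ h => h, fun _ _ ⟨_, _, h⟩ => h.elim⟩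

theorem PP.one {D : Set V} {y : V} (hy : y ∈ C) (hD : D.Finite) (hn : D.ncard ≤ n) (h : PP G n (C \ {y}) (insert y D)) : PP G n C D := by
  obtain ⟨H, h1, h2, h3⟩ := h
  have mem : ∀ v ∈ C ∪ D, v ∈ (C \ {y}) ∪ insert y D := by
    rintro v (h | h) <;> by_cases e : v = y <;> simp [h, e]
  refine ⟨H, fun u v huv hu hv => ?_, fun u hu v hv => h2 u (Or.inr hu) v (Or.inr hv), fun A hA ⟨x, hx, hxC⟩ => ?_⟩
  · by_cases e : u = y
    · subst e
      rcases mem v hv with h | h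
      · exact (h1 v u huv.symm h (by simp)).symm
      · exact h2 u (by simp) v h huv.ne
    · exact h1 u v huv ⟨hu, e⟩ (mem v hv)
  · by_cases hc : ∃ x ∈ A, x ∈ C \ {y}
    · obtain ⟨v, a, b, c⟩ := h3 A (fun x hx => mem x (hA x hx)) hc
      exact ⟨v, a, b.1, c⟩
    · push Not at hc
      obtain rfl : x = y := by by_contra e; exact hc x hx ⟨hxC, e⟩
      have key : ∀ u ∈ A, H.Adj x u -> u ∈ D := fun u hu hxu => (hA u hu).resolve_left fun h => hc u hu ⟨h, hxu.ne'⟩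
      refine ⟨x, hx, hxC, fun u hu w hw a b => h2 u (Or.inr (key u hu a)) w (Or.inr (key w hw b)), le_trans ?_ hn⟩
      rw [← Set.ncard_coe_finset]
      exact Set.ncard_le_ncard (fun u hu => by simp at hu; exact key u hu.1 hu.2) hD

theorem PP.many {D : Set V} (hD : D.Finite) (Y : Finset V) (hY : ∀ y ∈ Y, y ∈ C) (hn : D.ncard + Y.card ≤ n + 1) (h : PP G n (C \ Y) (D ∪ Y)) : PP G n C D := by
  induction Y using Finset.induction_on generalizing C D with
  | empty => simpa using h
  | insert y Y hy ih =>
    rw [Finset.card_insert_of_notMem hy] at hn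
    refine PP.one (hY y (by simp)) hD ω (ih (hD.insert y) (fun z hz => ⟨hY z (by simp [hz]), fun e => hy (e ▸ hz)⟩) ?_ ?_)
    · have := Set.ncard_insert_le y D; omega
    · convert h using 1
      · ext; simp; tauto
      · ext; simp; tauto

theorem Sim.lift {H H1 : SimpleGraph V} {C1 D1 : Set V} {A : Finset V} (h : ∀ A : Finset V, (∀ x ∈ A, x ∈ C1 ∪ D1) -> (∃ x ∈ A, x ∈ C1) -> Sim H1 n C1 A)
    (ha : ∀ v ∈ C1, ∀ u, H.Adj v u -> H1.Adj v u ∧ u ∈ C1 ∪ D1) (hb : ∀ u ∈ C1 ∪ D1, ∀ w ∈ C1 ∪ D1, H1.Adj u w -> H.Adj u w)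
    (hx : ∃ x ∈ A, x ∈ C1) (hC : C1 ⊆ C) : Sim H n C A := by
  obtain ⟨x, hx, hx1⟩ := hx
  obtain ⟨v, h1, h2, h3, h4⟩ := h (A.filter (· ∈ C1 ∪ D1)) (fun x hx => (Finset.mem_filter.1 hx).2) ⟨x, by simp [hx, hx1], hx1⟩
  refine ⟨v, (Finset.mem_filter.1 h1).1, hC h2, fun u hu w hw a b hne => ?_, le_trans (Finset.card_le_card ?_) h4⟩
  · obtain ⟨a1, a2⟩ := ha v h2 u a
    obtain ⟨b1, b2⟩ := ha v h2 w b
    exact hb u a2 w b2 (h3 u (Finset.mem_filter.2 ⟨hu, a2⟩) w (Finset.mem_filter.2 ⟨hw, b2⟩) a1 b1 hne)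
  · intro u hu
    obtain ⟨a, b⟩ := Finset.mem_filter.1 hu
    obtain ⟨c, d⟩ := ha v h2 u b
    exact Finset.mem_filter.2 ⟨Finset.mem_filter.2 ⟨a, d⟩, c⟩

theorem PP.split {C1 D1 C2 D2 D : Set V} (h1 : PP G n C1 D1) (h2 : PP G n C2 D2) (hd : Disjoint C1 C2) (hD : Disjoint (C1 ∪ C2) D)
    (s1 : D1 ⊆ D) (s2 : D2 ⊆ D) (n1 : ∀ u ∈ C1, ∀ v ∈ C1 ∪ C2 ∪ D, G.Adj u v -> v ∈ C1 ∪ D1) (n2 : ∀ u ∈ C2, ∀ v ∈ C1 ∪ C2 ∪ D, G.Adj u v -> v ∈ C2 ∪ D2) :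
    PP G n (C1 ∪ C2) D := by
  obtain ⟨H1, a1, a2, a3⟩ := h1
  obtain ⟨H2, b1, b2, b3⟩ := h2
  rw [Set.disjoint_left] at hd hD
  have hd1 : ∀ x ∈ C1, x ∉ D := fun x hx => hD (Or.inl hx)
  have hd2 : ∀ x ∈ C2, x ∉ D := fun x hx => hD (Or.inr hx)
  refine ⟨ins H1 (C1 ∪ D1) ⊔ ins H2 (C2 ∪ D2) ⊔ ins ⊤ D, ?_, fun u hu v hv h => Or.inr ⟨h, hu, hv⟩, fun A hA ⟨x, hx, hxC⟩ => ?_⟩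
  · rintro u v huv (hu | hu) hv
    · exact Or.inl (Or.inl ⟨a1 u v huv hu (n1 u hu v hv huv), Or.inl hu, n1 u hu v hv huv⟩)
    · exact Or.inl (Or.inr ⟨b1 u v huv hu (n2 u hu v hv huv), Or.inl hu, n2 u hu v hv huv⟩)
  · rcases hxC with hxC | hxC
    · refine Sim.lift a3 ?_ (fun u hu w hw h => Or.inl (Or.inl ⟨h, hu, hw⟩)) ⟨x, hx, hxC⟩ Set.subset_union_left
      rintro v hv u ((h | h) | h)
      · exact ⟨h.1, h.2.2⟩
      · exact absurd h.2.1 (fun h => h.elim (hd hv) fun h => hd1 v hv (s2 h))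
      · exact absurd h.2.1 (hd1 v hv)
    · refine Sim.lift b3 ?_ (fun u hu w hw h => Or.inl (Or.inr ⟨h, hu, hw⟩)) ⟨x, hx, hxC⟩ Set.subset_union_right
      rintro v hv u ((h | h) | h)
      · exact absurd h.2.1 (fun h => h.elim (fun h => hd h hv) fun h => hd2 v hv (s1 h))
      · exact ⟨h.1, h.2.2⟩
      · exact absurd h.2.1 (hd2 v hv)

variable [Fintype V]

theorem DP.restrict (h : DP G C L) {C' : Set V} (hC : C' ⊆ C) (P : V -> Prop) : DP G C' (L.filter P) := by
  have := h.minor C' (Option.guard P) (fun w => {w}) hC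
  rw [List.filterMap_eq_filter] at this
  exact this (h.1.filter _) (fun w hw => ⟨Or.inr (List.mem_filter.1 hw).1, rfl, Cn.single w, by rintro x rfl hx; exact h.2.1 x (List.mem_filter.1 hw).1 (hC hx)⟩)
    (fun w _ w' _ hne => by simpa using hne) (fun v _ w hw => by simp [Option.guard] at hw; exact hw.2)

theorem Lk.symm {K : SimpleGraph V} {A B : Set V} {X : Finset V} {u : V -> ℕ -> V} {m : V -> ℕ} (h : Lk K A B X u m) :
    Lk K B A X (fun x t => u x (m x - t)) m :=
  ⟨fun x hx => by
    obtain ⟨a, b, c, j, d, e⟩ := h.1 x hx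
    exact ⟨a.rev, by simpa using c, by simpa using b, m x - j, ω, by simpa [show m x - (m x - j) = j by omega] using e⟩,
   fun x hx y hy hne i hi j hj => h.2 x hx y hy hne _ ω _ ω⟩

theorem DP.piece (h : DP G C L) (hn : ∀ v ∈ L, ∃ a ∈ C, G.Adj v a) {A B R : Set V} {X : Finset V} {u : V -> ℕ -> V} {m : V -> ℕ} (hB : ∀ b ∈ B, b ∈ L)
    (lk : Lk (Gs G C L) A B X u m) (hX : X.card < B.ncard) (hR : ∀ x ∈ R, x ∉ X ∧ x ∉ B) (cl : ∀ a b, (Gs G C L).Adj a b -> a ∈ R -> b ∉ X -> b ∈ R) :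
    C ∩ R ⊂ C ∧ ∃ L' : List V, DP G (C ∩ R) L' ∧ L'.length < L.length ∧ (∀ v ∈ L', v ∈ L ∨ v ∈ X ∧ v ∈ C) ∧
      ∀ a ∈ C ∩ R, ∀ b, b ∈ C ∨ b ∈ L -> G.Adj a b -> b ∈ C ∩ R ∨ b ∈ L' := by
  constructor
  · refine ⟨Set.inter_subset_left, fun hs => ?_⟩
    obtain ⟨b, hb, hbX⟩ := Set.exists_mem_notMem_of_ncard_lt_ncard (s := (X : Set V)) (t := B) (by rwa [Set.ncard_coe_finset])
    obtain ⟨a, ha, hab⟩ := hn b (hB b hb)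
    exact (hR b (cl a b ⟨hab.symm, Or.inl ha, Or.inr (hB b hb), Or.inl ha⟩ (hs ha).2 hbX)).2 hb
  choose! J hJ hJx using fun x hx => (lk.1 x hx).2.2.2
  have eB : ∀ x ∈ X, u x (m x) ∈ B := fun x hx => (lk.1 x hx).2.2.1
  have tl : ∀ x ∈ X, ∀ t, J x ≤ t -> t ≤ m x -> u x t ∉ R := by
    intro x hx t h1 h2 h3
    have : ∀ s, t ≤ s -> s ≤ m x -> u x s ∈ R := by
      intro s hs
      induction s, hs using Nat.le_induction with
      | base => exact fun _ => h3
      | succ s hs ih =>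
        intro h4
        refine cl _ _ ((lk.1 x hx).1.adj s ω) (ih ω) fun h5 => ?_
        by_cases e : x = u x (s + 1)
        · have := (lk.1 x hx).1.inj _ (hJ x hx) _ h4 ((hJx x hx).trans e); omega
        · exact lk.2 x hx _ h5 e (s + 1) h4 (J _) (hJ _ h5) (hJx _ h5).symm
    exact (hR _ (this _ h2 le_rfl)).2 (eB x hx)
  have memX : ∀ x ∈ X, x ∈ C ∨ x ∈ L := by
    intro x hx
    have h1 := hJ x hx
    rcases Nat.lt_or_ge (J x) (m x) with h2 | h2
    · have := ((lk.1 x hx).1.adj _ h2).2.1; rwa [hJx x hx] at this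
    · have := eB x hx; rw [show m x = J x by omega, hJx x hx] at this; exact Or.inr (hB _ this)
  let Q : V -> V -> Prop := fun v w => (v ∈ R ∧ w = v) ∨ (w ∈ X ∧ v = u w (m w))
  have Qf : ∀ v w w', Q v w -> Q v w' -> w = w' := by
    rintro v w w' (⟨a, rfl⟩ | ⟨a, rfl⟩) (⟨b, b'⟩ | ⟨b, b'⟩)
    · exact b'.symm
    · exact absurd (eB _ b) (b' ▸ (hR _ a).2)
    · exact absurd (eB _ a) (hR _ b).2
    · by_contra e; exact lk.2 w a w' b e _ le_rfl _ le_rfl b'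
  let g : V -> Option V := fun v => if hh : ∃ w, Q v w then some hh.choose else none
  have gi : ∀ v w, g v = some w ↔ Q v w := by
    intro v w
    by_cases hh : ∃ w, Q v w
    · simp only [g, dif_pos hh, Option.some.injEq]
      exact ⟨fun e => e ▸ hh.choose_spec, fun e => Qf _ _ _ hh.choose_spec e⟩
    · simp only [g, dif_neg hh]; exact ⟨fun e => by simp at e, fun e => (hh ⟨w, e⟩).elim⟩
  have gm : ∀ w, w ∈ L.filterMap g ↔ w ∈ X ∨ w ∈ L ∧ w ∈ R := by
    intro w
    simp only [List.mem_filterMap, gi, Q]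
    constructor
    · rintro ⟨v, hv, ⟨a, rfl⟩ | ⟨a, b⟩⟩
      · exact Or.inr ⟨hv, a⟩
      · exact Or.inl a
    · rintro (h | h)
      · exact ⟨_, hB _ (eB w h), Or.inr ⟨h, rfl⟩⟩
      · exact ⟨w, h.1, Or.inl ⟨h.2, rfl⟩⟩
  let f : V -> Set V := fun w => if w ∈ X then Sg (u w) (J w) (m w) else {w}
  have fX : ∀ w ∈ X, f w = Sg (u w) (J w) (m w) := fun w hw => if_pos hw
  have fR : ∀ w ∈ R, f w = {w} := fun w hw => if_neg (hR w hw).1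
  refine ⟨L.filterMap g, h.minor _ g f Set.inter_subset_left ?_ ?_ ?_ ?_, ?_, ?_, ?_⟩
  · refine h.1.filterMap fun a a' w ha ha' => ?_
    rw [Option.mem_def, gi] at ha ha'
    rcases ha with ⟨a1, a2⟩ | ⟨a1, a2⟩ <;> rcases ha' with ⟨b1, b2⟩ | ⟨b1, b2⟩
    · exact a2.symm.trans b2
    · subst a2; exact absurd b1 (hR _ a1).1
    · subst b2; exact absurd a1 (hR _ b1).1
    · rw [a2, b2]
  · intro w hw
    rcases (gm w).1 hw with hw | hw
    · rw [fX w hw]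
      have q := Sg.mem (q := u w) le_rfl (hJ w hw)
      rw [hJx w hw] at q
      refine ⟨memX w hw, q, ⟨⟨_, q⟩, ?_⟩, ?_⟩
      · rintro _ ⟨s, s1, s2, rfl⟩ _ ⟨t, t1, t2, rfl⟩
        have : ∀ s, J w ≤ s -> s ≤ m w -> (ins (Gs G C L) (Sg (u w) (J w) (m w))).Reachable (u w (J w)) (u w s) :=
          fun s s1 s2 => (lk.1 w hw).1.reach s1 s2 fun k k1 k2 => Sg.mem k1 ω
        exact (this s s1 s2).symm.trans (this t t1 t2)
      · rintro _ ⟨s, s1, s2, rfl⟩ hx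
        exact tl w hw s s1 s2 hx.2
    · rw [fR w hw.2]
      exact ⟨Or.inr hw.1, rfl, Cn.single w, by rintro x rfl hx; exact h.2.1 x hw.1 hx.1⟩
  · intro w hw w' hw' hne
    rw [Set.disjoint_left]
    rcases (gm w).1 hw with hw | hw <;> rcases (gm w').1 hw' with hw' | hw'
    · rw [fX w hw, fX w' hw']
      rintro _ ⟨s, s1, s2, rfl⟩ ⟨t, t1, t2, e⟩
      exact lk.2 w hw w' hw' hne s s2 t t2 e
    · rw [fX w hw, fR w' hw'.2]
      rintro _ ⟨s, s1, s2, rfl⟩ rfl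
      exact tl w hw s s1 s2 hw'.2
    · rw [fR w hw.2, fX w' hw']
      rintro _ rfl ⟨s, s1, s2, rfl⟩
      exact tl w' hw' s s1 s2 hw.2
    · rw [fR w hw.2, fR w' hw'.2]; rintro _ rfl e; exact hne e
  · intro v hv w hw
    rcases (gi v w).1 hw with ⟨a, rfl⟩ | ⟨a, rfl⟩
    · rw [fR _ a]; rfl
    · rw [fX w a]; exact Sg.mem (hJ w a) le_rfl
  · refine lt_of_le_of_ne (List.length_filterMap_le _ _) fun e => ?_
    have := List.filterMap_length_eq_length.1 e
    obtain ⟨b, hb, hbX⟩ := Set.exists_mem_notMem_of_ncard_lt_ncard (s := (fun x => u x (m x)) '' (X : Set V)) (t := B)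
      (lt_of_le_of_lt (Set.ncard_image_le X.finite_toSet) (by rwa [Set.ncard_coe_finset]))
    obtain ⟨w, hw⟩ := Option.isSome_iff_exists.1 (this b (hB b hb))
    rcases (gi b w).1 hw with ⟨a, rfl⟩ | ⟨a, rfl⟩
    · exact (hR _ a).2 hb
    · exact hbX ⟨w, a, rfl⟩
  · intro v hv
    rcases (gm v).1 hv with h | h
    · rcases memX v h with h' | h'
      · exact Or.inr ⟨h, h'⟩
      · exact Or.inl h'
    · exact Or.inl h.1
  · intro a ha b hb hab
    have := cl a b ⟨hab, Or.inl ha.1, hb, Or.inl ha.1⟩ ha.2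
    rw [gm]
    by_cases hx : b ∈ X
    · exact Or.inr (Or.inl hx)
    · rcases hb with hb | hb
      · exact Or.inl ⟨hb, this hx⟩
      · exact Or.inr (Or.inr ⟨hb, this hx⟩)

theorem sep_pp (h : DP G C L) (hn : ∀ v ∈ L, ∃ a ∈ C, G.Adj v a) {A B : Set V} {X : Finset V} {u : V -> ℕ -> V} {m : V -> ℕ} (hA : ∀ b ∈ A, b ∈ L) (hB : ∀ b ∈ B, b ∈ L)
    (IH : ∀ C' L', C' ⊂ C -> L'.length < L.length -> DP G C' L' -> PP G n C' {v | v ∈ L'})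
    (lk : Lk (Gs G C L) A B X u m) (sp : Sep (Gs G C L) A B X) (h1 : X.card < A.ncard) (h2 : X.card < B.ncard) (hc : L.length + X.card ≤ n + 1) : PP G n C {v | v ∈ L} := by
  let R : Set V := {v | ∃ a ∈ A, a ∉ X ∧ (ins (Gs G C L) (X : Set V)ᶜ).Reachable a v}
  have RX : ∀ x ∈ R, x ∉ X := fun x ⟨a, _, a2, a3⟩ => reach_ins_mem a3 a2
  have cl : ∀ a b, (Gs G C L).Adj a b -> a ∈ R -> b ∉ X -> b ∈ R := fun a b hab ha hb => by
    obtain ⟨c, c1, c2, c3⟩ := ha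
    exact ⟨c, c1, c2, c3.trans (Adj.reachable ⟨hab, RX a ⟨c, c1, c2, c3⟩, hb⟩)⟩
  obtain ⟨p1, L1, p2, p3, p4, p5⟩ := h.piece hn hB lk h2 (R := R) (fun x hx => ⟨RX x hx, fun hb => by
    obtain ⟨a, a1, a2, a3⟩ := id hx; exact sp a a1 x hb a2 (RX x hx) a3⟩) cl
  obtain ⟨q1, L2, q2, q3, q4, q5⟩ := h.piece hn hA lk.symm h1 (R := {v | v ∉ R ∧ v ∉ X})
    (fun x hx => ⟨hx.2, fun hb => hx.1 ⟨x, hb, hx.2, Reachable.refl _⟩⟩) (fun a b hab ha hb => ⟨fun hr => ha.1 (cl b a hab.symm hr ha.2), hb⟩)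
  have e : C \ (X.filter (· ∈ C) : Finset V) = (C ∩ R) ∪ (C ∩ {v | v ∉ R ∧ v ∉ X}) := by
    ext v
    have := RX v
    simp
    tauto
  have memL : ∀ v, v ∈ L ∨ v ∈ X ∧ v ∈ C -> v ∈ {v | v ∈ L} ∪ (X.filter (· ∈ C) : Finset V) := fun v hv => by simpa using hv
  have memL' : ∀ v, v ∈ (C ∩ R) ∪ (C ∩ {v | v ∉ R ∧ v ∉ X}) ∪ ({v | v ∈ L} ∪ (X.filter (· ∈ C) : Finset V)) -> v ∈ C ∨ v ∈ L := fun v hv => by simp at hv; tauto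
  refine PP.many (Set.toFinite _) (X.filter (· ∈ C)) (fun y hy => (Finset.mem_filter.1 hy).2) ?_ ?_
  · have a1 := Finset.card_filter_le X (· ∈ C)
    have a2 : {v | v ∈ L}.ncard ≤ L.length := by
      rw [show {v | v ∈ L} = (L.toFinset : Set V) by ext; simp, Set.ncard_coe_finset]; exact L.toFinset_card_le
    omega
  · rw [e]
    refine PP.split (IH _ _ p1 p3 p2) (IH _ _ q1 q3 q2) ?_ ?_ (fun v hv => memL v (p4 v hv)) (fun v hv => memL v (q4 v hv))
      (fun a ha b hb hab => p5 a ha b (memL' b hb) hab) (fun a ha b hb hab => q5 a ha b (memL' b hb) hab)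
    · exact Set.disjoint_left.2 fun x hx hy => hy.2.1 hx.2
    · refine Set.disjoint_left.2 fun x hx hy => ?_
      have := RX x
      have := h.2.1 x
      simp at hx hy
      tauto

theorem pc_card (h : L.Nodup) {i j : ℕ} (hj : j ≤ L.length) : (Pc L i j).ncard = j - i := by
  rw [show Pc L i j = ((L.take j).drop i).toFinset by
    ext v
    simp only [Pc, Set.mem_setOf_eq, List.coe_toFinset, List.mem_iff_getElem?, List.getElem?_drop, List.getElem?_take]
    constructor
    · rintro ⟨k, a, b, c⟩; exact ⟨k - i, by rw [show i + (k - i) = k by omega, if_pos b, c]⟩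
    · rintro ⟨k, a⟩
      split_ifs at a with b
      · exact ⟨i + k, ω, b, a⟩, Set.ncard_coe_finset, List.toFinset_card_of_nodup (h.take.drop)]
  simp; omega

theorem elim_main (hK : KF G) {r : ℕ} (hr : 1 ≤ r) (hm : ¬ HasMinor G (hexGrid r)) (N : ℕ) : ∀ (C : Set V) (L : List V), C.ncard * (12 * r) + L.length ≤ N →
    L.Nodup -> (∀ v ∈ L, v ∉ C) -> L.length ≤ 12 * r - 2 -> (2 ≤ L.length -> DP G C L ∨ ∃ v u, L = [v, u] ∧ G.Adj v u) -> PP G (24 * r - 11) C {v | v ∈ L} := by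
  induction N using Nat.strong_induction_on with
  | _ N ih =>
  intro C L hN hnd hd hl hdp
  have smaller : ∀ C' L', C' ⊂ C -> L'.Nodup -> (∀ v ∈ L', v ∉ C') -> L'.length ≤ 12 * r - 2 -> (2 ≤ L'.length -> DP G C' L' ∨ ∃ v u, L' = [v, u] ∧ G.Adj v u) →
      PP G (24 * r - 11) C' {v | v ∈ L'} := by
    intro C' L' h1 h2 h3 h4 h5
    refine ih (C'.ncard * (12 * r) + L'.length) ?_ C' L' le_rfl h2 h3 h4 h5
    have a1 : C'.ncard + 1 ≤ C.ncard := Set.ncard_lt_ncard h1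
    have := Nat.mul_le_mul_right (12 * r) a1
    rw [Nat.add_mul] at this
    omega
  rcases C.eq_empty_or_nonempty with rfl | ⟨c, hc⟩
  · exact PP.nil
  by_cases hC : Cn G C
  swap
  · let D : Set V := {v | (ins G C).Reachable c v}
    have hDC : D ⊆ C := fun v hv => reach_ins_mem hv hc
    have sub : ∀ C', C' ⊆ C -> C' ≠ C -> PP G (24 * r - 11) C' {v | v ∈ L} := fun C' h1 h2 =>
      smaller C' L (h1.ssubset_of_ne h2) hnd (fun v hv hv' => hd v hv (h1 hv')) hl fun h => (hdp h).imp (fun h => by simpa using h.restrict h1 (fun _ => True)) id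
    have cl : ∀ a ∈ D, ∀ b ∈ C, G.Adj a b -> b ∈ D := fun a ha b hb hab => Reachable.trans ha (Adj.reachable ⟨hab, hDC ha, hb⟩)
    have := PP.split (sub D hDC fun e => hC (e ▸ cn_comp (K := G) C c)) (sub (C \ D) Set.diff_subset fun e => (e.ge hc).2 (Reachable.refl _))
      (D := {v | v ∈ L}) Set.disjoint_sdiff_right (by rw [Set.union_diff_cancel hDC]; exact Set.disjoint_left.2 fun x hx hy => hd x hy hx) le_rfl le_rfl
      (by rw [Set.union_diff_cancel hDC]; rintro a ha b (hb | hb) hab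
          · exact Or.inl (cl a ha b hb hab)
          · exact Or.inr hb)
      (by rw [Set.union_diff_cancel hDC]; rintro a ha b (hb | hb) hab
          · exact Or.inl ⟨hb, fun h => ha.2 (cl b h a ha.1 hab.symm)⟩
          · exact Or.inr hb)
    rwa [Set.union_diff_cancel hDC] at this
  by_cases hn : ∀ v ∈ L, ∃ a ∈ C, G.Adj v a
  swap
  · push Not at hn
    obtain ⟨v, hv, hva⟩ := hn
    have hlt : (L.filter (· ≠ v)).length < L.length := by
      refine lt_of_le_of_ne (List.length_filter_le _ _) fun e => ?_
      have := List.length_filter_eq_length_iff.1 e v hv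
      simp at this
    have := PP.split (C2 := ∅) (D2 := ∅) (ih _ ω C (L.filter (· ≠ v)) le_rfl (hnd.filter _) (fun w hw => hd w (List.mem_filter.1 hw).1) ω fun h => by
      rcases hdp ω with h' | ⟨a, b, rfl, _⟩
      · exact Or.inl (by convert h'.restrict le_rfl (· ≠ v))
      · simp only [List.length_cons, List.length_nil] at hlt; omega) PP.nil (D := {v | v ∈ L}) (by simp) (by rw [Set.union_empty]; exact Set.disjoint_left.2 fun x hx hy => hd x hy hx)
      (fun w hw => (List.mem_filter.1 hw).1) (by simp) (by
        rintro a ha b hb hab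
        simp only [Set.union_empty] at hb
        refine hb.imp id fun h => List.mem_filter.2 ⟨h, ?_⟩
        simp only [ne_eq, decide_eq_true_eq]
        rintro rfl
        exact hva a ha hab.symm) (by simp)
    simpa using this
  have one : ∀ u ∈ C, ∀ L' : List V, L'.Perm (u :: L) -> L.length < 12 * r - 2 -> (2 ≤ L'.length -> DP G (C \ {u}) L' ∨ ∃ v u, L' = [v, u] ∧ G.Adj v u) -> PP G (24 * r - 11) C {v | v ∈ L} := by
    intro u hu L' hp hl' hh
    have hls := hp.length_eq
    rw [List.length_cons] at hls
    refine PP.one hu (Set.toFinite _) ?_ ?_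
    · rw [show {v | v ∈ L} = (L.toFinset : Set V) by ext; simp, Set.ncard_coe_finset]
      have := L.toFinset_card_le
      omega
    · have := smaller (C \ {u}) L' ⟨Set.diff_subset, fun h => (h hu).2 rfl⟩ (hp.nodup_iff.2 (List.nodup_cons.2 ⟨fun h => hd u h hu, hnd⟩))
        (fun v hv hvC => by
          rcases List.mem_cons.1 (hp.mem_iff.1 hv) with h | h
          · exact hvC.2 h
          · exact hd v h hvC.1) ω hh
      convert this using 1
      ext v
      simp [hp.mem_iff]
  rcases Nat.lt_or_ge L.length 2 with h2 | h2
  · rcases L with _ | ⟨v, L⟩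
    · exact one c hc [c] (List.Perm.refl _) (by simp; omega) (fun h => by simp at h)
    · rcases L with _ | ⟨_, L⟩
      · obtain ⟨u, hu, hvu⟩ := hn v (by simp)
        exact one u hu [v, u] (List.Perm.swap _ _ _) (by simp; omega) (fun _ => Or.inr ⟨v, u, rfl, hvu⟩)
      · simp at h2
  have hD : DP G C L := by
    rcases hdp h2 with h | ⟨v, u, rfl, h⟩
    · exact h
    · exact DP.start (kuratowski G hK) hC (hd v (by simp)) (hd u (by simp)) h (hn v (by simp)) (hn u (by simp))
  rcases Nat.lt_or_ge L.length (12 * r - 2) with h3 | h3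
  · obtain ⟨u, hu, L', hp, h⟩ := hD.add hC hn h2
    exact one u hu L' hp h3 (fun _ => Or.inl h)
  have hl3 : L.length = 12 * r - 2 := le_antisymm hl h3
  have pcL : ∀ i j, ∀ b ∈ Pc L i j, b ∈ L := fun i j b ⟨k, _, _, h⟩ => List.mem_of_getElem? h
  have IH : ∀ C' L', C' ⊂ C -> L'.length < L.length -> DP G C' L' -> PP G (24 * r - 11) C' {v | v ∈ L'} := fun C' L' a b d =>
    smaller C' L' a d.1 d.2.1 ω fun _ => Or.inl d
  obtain ⟨X, sX, u, m, lX⟩ := menger (Gs G C L) (Pc L (8 * r - 1) (12 * r - 2)) (Pc L (2 * r) (6 * r - 1))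
  by_cases hX : 4 * r - 1 ≤ X.card
  swap
  · exact sep_pp hD hn (pcL _ _) (pcL _ _) IH lX sX (by rw [pc_card hnd ω]; omega) (by rw [pc_card hnd ω]; omega) ω
  obtain ⟨Y, sY, u', m', lY⟩ := menger (Gs G C L) (Pc L (6 * r - 1) (8 * r - 1)) (Pc L 0 (2 * r))
  by_cases hY : 2 * r ≤ Y.card
  swap
  · exact sep_pp hD hn (pcL _ _) (pcL _ _) IH lY sY (by rw [pc_card hnd ω]; omega) (by rw [pc_card hnd ω]; omega) ω
  exact (hm (hD.hex hr hl3 lX hX lY hY)).elim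

/-- finite case: a chordal supergraph with small cliques -/
theorem fin_chordal (hK : KF G) {r : ℕ} (hr : 1 ≤ r) (hm : ¬ HasMinor G (hexGrid r)) :
    ∃ H : SimpleGraph V, G ≤ H ∧ ∀ A : Finset V, A.Nonempty -> Sim H (24 * r - 11) Set.univ A := by
  obtain ⟨H, h1, -, h3⟩ := elim_main hK hr hm _ Set.univ [] le_rfl (by simp) (by simp) (by simp) (by simp)
  exact ⟨H, fun u v h => h1 u v h trivial (Or.inl trivial), fun A ⟨x, hx⟩ => h3 A (fun _ _ => Or.inl trivial) ⟨x, hx, trivial⟩⟩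

end recursion

section infinite
variable {V : Type} {H : SimpleGraph V} {n : ℕ}

/-- compactness -/
theorem compact {G : SimpleGraph V} (h : ∀ S : Finset V, ∃ H : SimpleGraph S, G.induce (S : Set V) ≤ H ∧ ∀ A : Finset S, A.Nonempty -> Sim H n Set.univ A) :
    ∃ H : SimpleGraph V, G ≤ H ∧ ∀ A : Finset V, A.Nonempty -> Sim H n Set.univ A := by
  choose E hE hS using h
  let U : Ultrafilter (Finset V) := Ultrafilter.of Filter.atTop
  have big : ∀ A : Finset V, ∀ᶠ S in (U : Filter (Finset V)), A ⊆ S := fun A => Ultrafilter.of_le _ (Filter.eventually_ge_atTop A)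
  let P : V -> V -> Finset V -> Prop := fun u v S => ∃ (hu : u ∈ S) (hv : v ∈ S), (E S).Adj ⟨u, hu⟩ ⟨v, hv⟩
  let H : SimpleGraph V := ⟨fun u v => ∀ᶠ S in (U : Filter (Finset V)), P u v S, ⟨fun u v h => h.mono fun S ⟨a, b, c⟩ => ⟨b, a, c.symm⟩⟩,
    ⟨fun u h => by obtain ⟨S, _, _, c⟩ := h.exists; exact c.ne rfl⟩⟩
  refine ⟨H, fun u v huv => (big {u, v}).mono fun S hS => ⟨hS (by simp), hS (by simp), hE S huv⟩, fun A hA => ?_⟩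
  have ev : ∀ᶠ S in (U : Filter (Finset V)), ∀ u ∈ A, ∀ v ∈ A, (H.Adj u v ↔ P u v S) := by
    simp only [Filter.eventually_all_finset]
    intro u _ v _
    by_cases h : H.Adj u v
    · exact Filter.Eventually.mono h fun S hS => ⟨fun _ => hS, fun _ => h⟩
    · exact (Ultrafilter.eventually_not.2 h).mono fun S hS => ⟨fun h' => (h h').elim, fun h' => (hS h').elim⟩
  obtain ⟨S, h1, h2⟩ := (ev.and (big A)).exists
  obtain ⟨x, hx⟩ := hA
  obtain ⟨⟨v, hvS⟩, a, -, c, d⟩ := hS S (A.subtype (· ∈ S)) ⟨⟨x, h2 hx⟩, by simpa using hx⟩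
  rw [Finset.mem_subtype] at a
  have key : ∀ u (hu : u ∈ A) w (hw : w ∈ A), H.Adj u w ↔ (E S).Adj ⟨u, h2 hu⟩ ⟨w, h2 hw⟩ := fun u hu w hw =>
    (h1 u hu w hw).trans ⟨fun ⟨_, _, h⟩ => h, fun h => ⟨_, _, h⟩⟩
  refine ⟨v, a, trivial, fun u hu w hw hvu hvw hne => ?_, le_trans ?_ d⟩
  · rw [key _ a _ hu] at hvu
    rw [key _ a _ hw] at hvw
    rw [key _ hu _ hw]
    exact c _ (by simpa using hu) _ (by simpa using hw) hvu hvw (by simpa using hne)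
  · rw [← Finset.card_map (Function.Embedding.subtype (· ∈ S))]
    refine Finset.card_le_card fun u hu => ?_
    obtain ⟨hu, hvu⟩ := Finset.mem_filter.1 hu
    exact Finset.mem_map.2 ⟨⟨u, h2 hu⟩, Finset.mem_filter.2 ⟨by simpa using hu, (key _ a _ hu).1 hvu⟩, rfl⟩

theorem Cn.erase {T : Set V} {s : V} (hT : Cn H T) (hs : ∀ a ∈ T, ∀ b ∈ T, H.Adj s a -> H.Adj s b -> a ≠ b -> H.Adj a b) (hne : (T \ {s}).Nonempty) : Cn H (T \ {s}) := by
  refine Cn.of_cut hne fun A hA ⟨a, ha⟩ cl => Set.Subset.antisymm hA fun b hb => ?_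
  refine (hT.closed (fun v => v ∈ A ∨ v = s ∧ ∃ c ∈ A, H.Adj s c) (hA ha).1 (Or.inl ha) ?_ b hb.1).resolve_right fun h => hb.2 h.1
  rintro c hc d hd hcd (h | ⟨rfl, e, he, hce⟩)
  · by_cases e : d = s
    · subst e; exact Or.inr ⟨rfl, c, h, hcd.symm⟩
    · exact Or.inl (cl c h d ⟨hd, e⟩ hcd)
  · by_cases ee : e = d
    · exact Or.inl (ee ▸ he)
    · exact Or.inl (cl e he d ⟨hd, hcd.ne'⟩ (hs e (hA he).1 d hd hce hcd ee))

theorem complete_to (hH : ∀ A : Finset V, A.Nonempty -> Sim H n Set.univ A) (K : Finset V) (hK : ∀ a ∈ K, ∀ b ∈ K, a ≠ b -> H.Adj a b) (N : ℕ) : ∀ T : Finset V, T.card = N -> Cn H (T : Set V) -> (∀ k ∈ K, k ∉ T) -> (∀ k ∈ K, ∃ t ∈ T, H.Adj k t) →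
    ∃ v ∈ T, ∀ k ∈ K, H.Adj k v := by
  induction N with
  | zero => intro T h1 h2; obtain ⟨x, hx⟩ := h2.1; simp [Finset.card_eq_zero.1 h1] at hx
  | succ N ih =>
    intro T h1 h2 h3 h4
    obtain ⟨x, hx⟩ := h2.1
    obtain ⟨s, s1, -, s2, -⟩ := hH (T ∪ K) ⟨x, by simp at hx; simp [hx]⟩
    rcases Finset.mem_union.1 s1 with hs | hs
    · by_cases hn : ((T : Set V) \ {s}).Nonempty
      · obtain ⟨y, hy⟩ := id hn
        have hst : ∃ t ∈ T, H.Adj s t := by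
          by_contra! hc
          exact hy.2 (h2.closed (fun v => v = s) hs rfl (by rintro _ _ b hb hab rfl; exact (hc b hb hab).elim) y hy.1)
        obtain ⟨t, ht, hst⟩ := hst
        obtain ⟨v, v1, v2⟩ := ih (T.erase s) (by rw [Finset.card_erase_of_mem hs, h1]; rfl)
          (by rw [Finset.coe_erase]; exact h2.erase (fun a ha b hb => s2 a (Finset.mem_union_left _ ha) b (Finset.mem_union_left _ hb)) hn)
          (fun k hk h => h3 k hk (Finset.mem_of_mem_erase h)) (fun k hk => by
            obtain ⟨d, d1, d2⟩ := h4 k hk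
            by_cases e : d = s
            · subst e
              exact ⟨t, Finset.mem_erase.2 ⟨hst.ne', ht⟩, s2 k (Finset.mem_union_right _ hk) t (Finset.mem_union_left _ ht) d2.symm hst (fun e => h3 k hk (e ▸ ht))⟩
            · exact ⟨d, Finset.mem_erase.2 ⟨e, d1⟩, d2⟩)
        exact ⟨v, Finset.mem_of_mem_erase v1, v2⟩
      · refine ⟨s, hs, fun k hk => ?_⟩
        obtain ⟨t, ht, hkt⟩ := h4 k hk
        obtain rfl : t = s := by by_contra e; exact hn ⟨t, ht, e⟩
        exact hkt
    · obtain ⟨t, ht, hst⟩ := h4 s hs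
      refine ⟨t, ht, fun k hk => ?_⟩
      by_cases e : k = s
      · exact e ▸ hst
      · exact s2 k (Finset.mem_union_right _ hk) t (Finset.mem_union_left _ ht) (hK s hs k hk (Ne.symm e)) hst (fun e => h3 k hk (e ▸ ht))

theorem clique_card (hH : ∀ A : Finset V, A.Nonempty -> Sim H n Set.univ A) (F : Finset V) (hF : ∀ a ∈ F, ∀ b ∈ F, a ≠ b -> H.Adj a b) : F.card ≤ n + 1 := by
  rcases F.eq_empty_or_nonempty with rfl | h
  · simp
  obtain ⟨v, h1, -, -, h2⟩ := hH F h
  rw [show F.filter (H.Adj v) = F.erase v by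
    ext u; simp only [Finset.mem_filter, Finset.mem_erase]
    exact ⟨fun h => ⟨h.2.ne', h.1⟩, fun h => ⟨h.2, hF v h1 u h.2 h.1.symm⟩⟩, Finset.card_erase_of_mem h1] at h2
  omega

theorem clique_fin (hH : ∀ A : Finset V, A.Nonempty -> Sim H n Set.univ A) (K : Set V) (hF : ∀ a ∈ K, ∀ b ∈ K, a ≠ b -> H.Adj a b) : K.Finite := by
  by_contra hc
  obtain ⟨F, h1, h2⟩ := Set.Infinite.exists_subset_card_eq hc (n + 2)
  have := clique_card hH F fun a ha b hb => hF a (h1 ha) b (h1 hb)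
  omega

/-- `a` is attached to the component of `x` off `A` -/
def Att (H : SimpleGraph V) (A : Set V) (a x : V) : Prop := ∃ d, (ins H Aᶜ).Reachable x d ∧ H.Adj a d

theorem exists_good (hH : ∀ A : Finset V, A.Nonempty -> Sim H n Set.univ A) (A : Set V) {x : V} (hx : x ∉ A) (hP : ∀ a ∈ A, ∀ b ∈ A, a ≠ b -> Att H A a x -> Att H A b x -> H.Adj a b) :
    ∃ v, v ∉ A ∧ ∀ k ∈ A, Att H A k v -> H.Adj k v := by
  have hfin := clique_fin hH {a | a ∈ A ∧ Att H A a x} fun a ha b hb hne => hP a ha.1 b hb.1 hne ha.2 hb.2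
  have : ∀ K : Finset V, (∀ k ∈ K, Att H A k x) -> ∃ T : Finset V, x ∈ T ∧ Cn H (T : Set V) ∧ (∀ t ∈ T, (ins H Aᶜ).Reachable x t) ∧ ∀ k ∈ K, ∃ t ∈ T, H.Adj k t := by
    intro K
    induction K using Finset.induction_on with
    | empty => exact fun _ => ⟨{x}, by simp, by simpa using Cn.single x, by simp, by simp⟩
    | insert k K hk ih =>
      intro h
      obtain ⟨T, t1, t2, t3, t4⟩ := ih fun k hk => h k (by simp [hk])
      obtain ⟨d, ⟨p⟩, d2⟩ := h k (by simp)
      refine ⟨T ∪ p.support.toFinset, by simp [t1], ?_, ?_, ?_⟩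
      · have := t2.union (Cn.walk (ins_le Aᶜ) p) (Or.inl ⟨x, t1, by simp⟩)
        convert this using 1
        ext; simp
      · intro t ht
        rcases Finset.mem_union.1 ht with ht | ht
        · exact t3 t ht
        · exact ⟨p.takeUntil t (by simpa using ht)⟩
      · intro k' hk'
        rcases Finset.mem_insert.1 hk' with rfl | hk'
        · exact ⟨d, by simp, d2⟩
        · obtain ⟨t, a, b⟩ := t4 k' hk'
          exact ⟨t, by simp [a], b⟩
  obtain ⟨T, t1, t2, t3, t4⟩ := this hfin.toFinset (fun k hk => by simp at hk; exact hk.2)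
  have tA : ∀ t ∈ T, t ∉ A := fun t ht => reach_ins_mem (t3 t ht) hx
  obtain ⟨v, v1, v2⟩ := complete_to hH hfin.toFinset (fun a ha b hb hne => by simp at ha hb; exact hP a ha.1 b hb.1 hne ha.2 hb.2) _ T rfl t2
    (fun k hk h => by simp at hk; exact tA k h hk.1) t4
  refine ⟨v, tA v v1, fun k hk ⟨d, d1, d2⟩ => v2 k ?_⟩
  simp only [Set.Finite.mem_toFinset, Set.mem_setOf_eq]
  exact ⟨hk, d, (t3 v v1).trans d1, d2⟩

theorem exists_order (hH : ∀ A : Finset V, A.Nonempty -> Sim H n Set.univ A) : ∃ o : V -> Ordinal.{0}, Function.Injective o ∧ ∀ v a b, H.Adj a v -> H.Adj b v -> o a < o v -> o b < o v -> a ≠ b -> H.Adj a b := by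
  rcases isEmpty_or_nonempty V with hV | ⟨⟨z⟩⟩
  · exact ⟨isEmptyElim, fun a => isEmptyElim a, fun a => isEmptyElim a⟩
  let good : Set V -> V -> Prop := fun A v => v ∉ A ∧ ∀ k ∈ A, Att H A k v -> H.Adj k v
  let pick : Set V -> V := fun A => if h : ∃ v, good A v then h.choose else z
  let g : Ordinal.{0} -> V := WellFounded.fix (C := fun _ => V) (wellFounded_lt (α := Ordinal.{0})) (fun α ih => pick {v | ∃ β, ∃ h : β < α, ih β h = v})
  let A : Ordinal.{0} -> Set V := fun α => {v | ∃ β, ∃ h : β < α, g β = v}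
  have hg : ∀ α, g α = pick (A α) := fun α => WellFounded.fix_eq _ _ _
  have Am : ∀ α β, α ≤ β -> A α ⊆ A β := fun α β h v ⟨γ, h1, h2⟩ => ⟨γ, h1.trans_le h, h2⟩
  have main : ∀ α, ∀ x ∉ A α, (∀ a ∈ A α, ∀ b ∈ A α, a ≠ b -> Att H (A α) a x -> Att H (A α) b x -> H.Adj a b) ∧ good (A α) (g α) := by
    intro α
    induction α using WellFoundedLT.induction with
    | _ α ih =>
    intro x hx
    have P : ∀ a ∈ A α, ∀ b ∈ A α, a ≠ b -> Att H (A α) a x -> Att H (A α) b x -> H.Adj a b := by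
      have half : ∀ β γ, γ < β -> β < α -> Att H (A α) (g β) x -> Att H (A α) (g γ) x -> H.Adj (g γ) (g β) := by
        rintro β γ h1 h2 ⟨d, d1, d2⟩ ⟨e, e1, e2⟩
        have hs := Am β α h2.le
        have gd := (ih β h2 x fun h => hx (hs h)).2
        have mono : ins H (A α)ᶜ ≤ ins H (A β)ᶜ := ins_mono le_rfl (Set.compl_subset_compl.2 hs)
        exact gd.2 _ ⟨γ, h1, rfl⟩ ⟨e, (Adj.reachable (G := ins H (A β)ᶜ) ⟨d2, gd.1, fun h => reach_ins_mem d1 hx (hs h)⟩).trans ((d1.symm.trans e1).mono mono), e2⟩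
      rintro _ ⟨β, hβ, rfl⟩ _ ⟨γ, hγ, rfl⟩ hne ha hb
      rcases lt_trichotomy β γ with h | rfl | h
      · exact half γ β h hγ hb ha
      · exact (hne rfl).elim
      · exact (half β γ h hβ ha hb).symm
    refine ⟨P, ?_⟩
    have hh := exists_good hH (A α) hx P
    rw [hg]
    simp only [pick]
    rw [dif_pos hh]
    exact hh.choose_spec
  have sur : ∀ v, ∃ α, g α = v := by
    intro v
    by_contra! hc
    have gA : ∀ α, g α ∉ A α := fun α => (main α v fun ⟨β, _, h⟩ => hc β h).2.1
    refine not_injective_of_ordinal g fun α β h => ?_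
    rcases lt_trichotomy α β with h' | h' | h'
    · exact (gA β ⟨α, h', h⟩).elim
    · exact h'
    · exact (gA α ⟨β, h', h.symm⟩).elim
  let o : V -> Ordinal.{0} := fun v => sInf {α | g α = v}
  have go : ∀ v, g (o v) = v := fun v => csInf_mem (s := {α | g α = v}) (sur v)
  refine ⟨o, fun a b h => by rw [← go a, h, go b], fun v a b ha hb h1 h2 hne => ?_⟩
  have hv : v ∉ A (o v) := fun ⟨β, h, e⟩ => notMem_of_lt_csInf' h e
  exact (main (o v) v hv).1 a ⟨_, h1, go a⟩ b ⟨_, h2, go b⟩ hne ⟨v, Reachable.refl _, ha⟩ ⟨v, Reachable.refl _, hb⟩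

/-- parent tree -/
def Par {ι : Type} (root : ι) (p : ι -> ι) : SimpleGraph ι := SimpleGraph.fromRel fun a b => a ≠ root ∧ b = p a

theorem Par.cn {ι : Type} {root : ι} {p : ι -> ι} {r : ι -> Ordinal.{0}} (h : ∀ t ≠ root, r (p t) < r t) {S : Set ι} {t0 : ι} (h0 : t0 ∈ S) (hS : ∀ t ∈ S, t ≠ t0 -> t ≠ root ∧ p t ∈ S) :
    Cn (Par root p) S := by
  have key : ∀ α, ∀ t ∈ S, r t = α -> (ins (Par root p) S).Reachable t t0 := by
    intro α
    induction α using WellFoundedLT.induction with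
    | _ α ih =>
    rintro t ht rfl
    by_cases e : t = t0
    · rw [e]
    · obtain ⟨a, b⟩ := hS t ht e
      have hlt := h t a
      exact (Adj.reachable (G := ins (Par root p) S) ⟨(SimpleGraph.fromRel_adj _ _ _).2 ⟨fun e => by rw [← e] at hlt; exact hlt.false, Or.inl ⟨a, rfl⟩⟩, ht, b⟩).trans (ih _ hlt _ b rfl)
  exact ⟨⟨t0, h0⟩, fun u hu v hv => (key _ u hu rfl).trans (key _ v hv rfl).symm⟩

theorem Par.acyclic {ι : Type} {root : ι} {p : ι -> ι} {r : ι -> Ordinal.{0}} (h : ∀ t ≠ root, r (p t) < r t) (hp : p root = root) : (Par root p).IsAcyclic := by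
  have le : ∀ n t, r (p^[n] t) ≤ r t := by
    intro n
    induction n with
    | zero => exact fun _ => le_rfl
    | succ n ih =>
      intro t
      rw [Function.iterate_succ_apply]
      refine (ih _).trans ?_
      by_cases e : t = root
      · rw [e, hp]
      · exact (h t e).le
  have key : ∀ c, c ≠ root -> ¬ ((Par root p).deleteEdges {s(c, p c)}).Reachable c (p c) := by
    intro c hc hr
    obtain ⟨n, hn⟩ := reach_closed (fun t => ∃ n, p^[n] t = c) hr ⟨0, rfl⟩ (by
      rintro a b hab ⟨n, hn⟩
      rw [deleteEdges_adj] at hab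
      rcases ((SimpleGraph.fromRel_adj _ _ _).1 hab.1).2 with ⟨h1, rfl⟩ | ⟨h1, rfl⟩
      · rcases n with _ | n
        · simp only [Function.iterate_zero, id] at hn; subst hn; exact (hab.2 rfl).elim
        · exact ⟨n, by rwa [Function.iterate_succ_apply] at hn⟩
      · exact ⟨n + 1, by rwa [Function.iterate_succ_apply]⟩)
    have := le n (p c)
    rw [hn] at this
    exact absurd (h c hc) this.not_gt
  rw [isAcyclic_iff_forall_adj_isBridge]
  intro v w hvw
  rcases ((SimpleGraph.fromRel_adj _ _ _).1 hvw).2 with ⟨h1, rfl⟩ | ⟨h1, rfl⟩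
  · exact key v h1
  · rw [Sym2.eq_swap]; exact key w h1

theorem chordal_td (hH : ∀ A : Finset V, A.Nonempty -> Sim H n Set.univ A) : HasTreeDecompositionOfWidth H n := by
  obtain ⟨o, oi, ho⟩ := exists_order hH
  let N : V -> Set V := fun v => {u | H.Adj u v ∧ o u < o v}
  have Nc : ∀ v, ∀ a ∈ N v, ∀ b ∈ N v, a ≠ b -> H.Adj a b := fun v a ha b hb => ho v a b ha.1 hb.1 ha.2 hb.2
  have Nf : ∀ v, (N v).Finite := fun v => clique_fin hH _ (Nc v)
  have hp : ∀ w, ∃ q : Option V, (q = none -> N w = ∅) ∧ ∀ u, q = some u -> u ∈ N w ∧ ∀ x ∈ N w, o x ≤ o u := by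
    intro w
    rcases (N w).eq_empty_or_nonempty with e | e
    · exact ⟨none, fun _ => e, by simp⟩
    · obtain ⟨u, h1, h2⟩ := Set.exists_max_image (N w) o (Nf w) e
      exact ⟨some u, by simp, fun _ h => by cases h; exact ⟨h1, h2⟩⟩
  choose p p1 p2 using hp
  let P : Option V -> Option V := fun t => t.elim none p
  let r : Option V -> Ordinal.{0} := fun t => t.elim 0 fun v => Order.succ (o v)
  have hr : ∀ t ≠ none, r (P t) < r t := by
    rintro (_ | w) h
    · exact (h rfl).elim
    · rcases e : p w with _ | u
      · simp [P, r, e]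
      · simpa [P, r, e] using (p2 w u e).1.2
  let B : Option V -> Finset V := fun t => t.elim ∅ fun v => insert v (Nf v).toFinset
  have mB : ∀ u v, u ∈ B (some v) ↔ u = v ∨ u ∈ N v := fun u v => by simp [B]
  have Bv : ∀ v, v ∈ B (some v) := fun v => (mB v v).2 (Or.inl rfl)
  refine ⟨Option V, Par none P, B, Par.acyclic hr rfl, ?_, fun v => ⟨some v, Bv v⟩, fun u v huv => ?_, fun v => ?_, ?_⟩
  · have := (cn_iff_induce _).1 (Par.cn hr (S := Set.univ) (t0 := none) trivial fun t _ h => ⟨h, trivial⟩)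
    exact (SimpleGraph.induceUnivIso _).connected_iff.1 this
  · rcases lt_trichotomy (o u) (o v) with h | h | h
    · exact ⟨some v, (mB u v).2 (Or.inr ⟨huv, h⟩), Bv v⟩
    · exact (huv.ne (oi h)).elim
    · exact ⟨some u, Bv u, (mB v u).2 (Or.inr ⟨huv.symm, h⟩)⟩
  · refine (cn_iff_induce _).1 (Par.cn hr (t0 := some v) (Bv v) ?_)
    rintro (_ | w) hw hne
    · simp [B] at hw
    refine ⟨by simp, ?_⟩
    rcases (mB v w).1 hw with h | h
    · exact (hne (by rw [h])).elim
    rcases e : p w with _ | u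
    · rw [p1 w e] at h; exact h.elim
    · obtain ⟨a, b⟩ := p2 w u e
      change v ∈ B (p w)
      rw [e, mB]
      by_cases ee : v = u
      · exact Or.inl ee
      · exact Or.inr ⟨Nc w v h u a ee, lt_of_le_of_ne (b v h) fun h => ee (oi h)⟩
  · rintro (_ | v)
    · simp [B]
    · refine clique_card hH _ fun a ha b hb hne => ?_
      rcases (mB a v).1 ha with rfl | ha <;> rcases (mB b _).1 hb with rfl | hb
      · exact (hne rfl).elim
      · exact hb.1.symm
      · exact ha.1
      · exact Nc v a ha b hb hne

end infinite

theorem td_apex {V : Type*} {W : Type} (G : SimpleGraph V) (X : Finset V) (e : W -> V) (he : Function.Injective e) (h1 : ∀ v, v ∈ X ∨ ∃ w, e w = v) (h2 : ∀ w, e w ∉ X) {H : SimpleGraph W}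
    (hH : ∀ a b, G.Adj (e a) (e b) -> H.Adj a b) {n k : ℕ} (hk : X.card ≤ k) (h : HasTreeDecompositionOfWidth H n) : HasTreeDecompositionOfWidth G (n + k) := by
  obtain ⟨ι, T, B, a1, a2, a3, a4, a5, a6⟩ := h
  have mX : ∀ t, ∀ v ∈ X, v ∈ (B t).image e ∪ X := fun t v hv => Finset.mem_union_right _ hv
  have mW : ∀ t w, e w ∈ (B t).image e ∪ X ↔ w ∈ B t := fun t w => by simp [h2, he.eq_iff]
  refine ⟨ι, T, fun t => (B t).image e ∪ X, a1, a2, fun v => ?_, fun u v huv => ?_, fun v => ?_, fun t => ?_⟩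
  · rcases h1 v with h | ⟨w, rfl⟩
    · exact ⟨a2.nonempty.some, mX _ v h⟩
    · simpa only [mW] using a3 w
  · rcases h1 u with hu | ⟨w, rfl⟩ <;> rcases h1 v with hv | ⟨z, rfl⟩
    · exact ⟨a2.nonempty.some, mX _ u hu, mX _ v hv⟩
    · obtain ⟨t, ht⟩ := a3 z; exact ⟨t, mX _ u hu, (mW _ _).2 ht⟩
    · obtain ⟨t, ht⟩ := a3 w; exact ⟨t, (mW _ _).2 ht, mX _ v hv⟩
    · simpa only [mW] using a4 (hH _ _ huv)
  · rcases h1 v with h | ⟨w, rfl⟩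
    · rw [show {t | v ∈ (B t).image e ∪ X} = Set.univ from Set.eq_univ_of_forall fun t => mX t v h]
      exact (SimpleGraph.induceUnivIso _).connected_iff.2 a2
    · rw [show {t | e w ∈ (B t).image e ∪ X} = {t | w ∈ B t} from Set.ext fun t => mW t w]
      exact a5 w
  · have := Finset.card_union_le ((B t).image e) X
    have := Finset.card_image_le (s := B t) (f := e)
    have := a6 t
    change ((B t).image e ∪ X).card ≤ _
    omega

end PG
end

/-- if `G ∈ Apex(k)` and `tw(G) > 24r − 11 + k` then `G` contains
the hexagonal grid `H_r` as a minor. -/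
theorem stmt6 {V : Type*} (G : SimpleGraph V) (k r : ℕ) (hr : 1 ≤ r)
    (hapex : Apex k G) (htw : 24 * r - 11 + k < treewidth G) :
    HasMinor G (hexGrid r) := by
  classical
  by_contra hm
  obtain ⟨X, hX, hpl⟩ := hapex
  obtain ⟨_, ι, T, B, -, -, hB, -⟩ := Nat.nonempty_of_pos_sInf (lt_of_le_of_lt (Nat.zero_le _) htw)
  have : Small.{0} V := small_of_surjective (α := Σ t, {v // v ∈ B t}) (f := fun x => x.2.1) fun v => by
    obtain ⟨t, ht⟩ := hB v; exact ⟨⟨t, v, ht⟩, rfl⟩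
  let E := (equivShrink.{0} ↥((X : Set V)ᶜ)).symm
  let e : Shrink.{0} ↥((X : Set V)ᶜ) → V := fun w => (E w).1
  have he : Function.Injective e := Subtype.val_injective.comp E.injective
  have hK : PG.KF (G.comap e) := (PG.kf_of_planar hpl).minor (PG.minor_of_inj E E.injective fun a b h => h)
  have hm' : ¬ HasMinor (G.comap e) (hexGrid r) := fun h => hm (PG.HasMinor.trans (PG.minor_of_inj e he fun a b h => h) h)
  have hS : ∀ S : Finset (Shrink.{0} ↥((X : Set V)ᶜ)), HasMinor (G.comap e) ((G.comap e).induce (S : Set _)) := fun S =>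
    PG.minor_of_inj Subtype.val Subtype.val_injective fun a b h => h
  obtain ⟨H, h1, h2⟩ := PG.compact (G := G.comap e) (n := 24 * r - 11) fun S => PG.fin_chordal (hK.minor (hS S)) hr fun h => hm' (PG.HasMinor.trans (hS S) h)
  refine absurd (Nat.sInf_le (PG.td_apex G X e he (fun v => ?_) (fun w => (E w).2) (fun a b h => h1 h) hX (PG.chordal_td h2))) (not_le.2 htw)
  by_cases hv : v ∈ X
  · exact Or.inl hv
  · exact Or.inr ⟨E.symm ⟨v, hv⟩, by simp [e]⟩
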